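/- Assume hypothesis (H) and that there is a point x₀ ∈ ∂𝔻 with h(x₀) > √(−K(x₀)). Then there exist a sequence ε_n → 0 with ε_n > 0 for all n, and functions u_n ∈ C²(closed 𝔻) such that u_n solves (P_{ε_n}) and ind(u_n) ≤ 1 for every n. -/

import Mathlib

open MeasureTheory Real Filter

noncomputable section

/-- The open unit disk in ℝ² ≅ ℂ. -/
def unitDisk : Set ℂ := Metric.ball 0 1

/-- The unit circle ∂𝔻. -/
def unitCircle : Set ℂ := Metric.sphere 0 1

/-- The closed unit disk. -/
def closedUnitDisk : Set ℂ := Metric.closedBall 0 1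

/-- Directional derivative of `u` at `x` in direction `v`. -/
def pd (u : ℂ → ℝ) (v x : ℂ) : ℝ := fderiv ℝ u x v

/-- Laplacian of `u` at `x`. -/
def lap (u : ℂ → ℝ) (x : ℂ) : ℝ :=
  fderiv ℝ (fun y => pd u 1 y) x 1 + fderiv ℝ (fun y => pd u Complex.I y) x Complex.I

/-- Squared norm of the gradient, |∇u|². -/
def gradSq (u : ℂ → ℝ) (x : ℂ) : ℝ := pd u 1 x ^ 2 + pd u Complex.I x ^ 2

/-- Outward normal derivative ∂_ν u(x) = ∇u(x)·x at a boundary point. -/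
def nderiv (u : ℂ → ℝ) (x : ℂ) : ℝ := x.re * pd u 1 x + x.im * pd u Complex.I x

/-- Tangential derivative ∂_τ u(x) = ∇u(x)·(−x₂,x₁) at a boundary point. -/
def tderiv (u : ℂ → ℝ) (x : ℂ) : ℝ := -x.im * pd u 1 x + x.re * pd u Complex.I x

/-- Unit-speed parametrization of the unit circle. -/
def bpt (θ : ℝ) : ℂ := Complex.exp ((θ : ℂ) * Complex.I)

/-- Integral over ∂𝔻 with respect to arclength. -/
def bint (f : ℂ → ℝ) : ℝ := ∫ θ in (0:ℝ)..(2 * π), f (bpt θ)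

/-- A solution of the prescribed curvature problem for `(K, h)`. -/
def IsSolution (K h u : ℂ → ℝ) : Prop :=
  ContDiff ℝ 2 u ∧
  (∀ x ∈ unitDisk, -lap u x = 2 * K x * Real.exp (u x)) ∧
  (∀ x ∈ unitCircle, nderiv u x + 2 = 2 * h x * Real.exp (u x / 2))

/-- The auxiliary function Φ = H + √(H² + K). -/
def Phi (K H : ℂ → ℝ) (x : ℂ) : ℝ := H x + Real.sqrt (H x ^ 2 + K x)

/-- `H` is the harmonic extension of `h`, C¹ up to the boundary. -/
def IsHarmExt (h H : ℂ → ℝ) : Prop :=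
  ContDiff ℝ 1 H ∧ ContDiffOn ℝ 2 H unitDisk ∧
  (∀ x ∈ unitDisk, lap H x = 0) ∧ ∀ x ∈ unitCircle, H x = h x

/-- K_ε. -/
def Keps (K : ℂ → ℝ) (ε : ℝ) (x : ℂ) : ℝ := (K x - ε / 2) / (1 + ε)

/-- h_ε. -/
def heps (h : ℂ → ℝ) (ε : ℝ) (x : ℂ) : ℝ := h x / (1 + ε)

/-- K̃_ε. -/
def Ktil (ε : ℝ) : ℝ := -ε / (2 * (1 + ε))

/-- h̃_ε. -/
def htil (ε : ℝ) : ℝ := 1 / (1 + ε)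

/-- A solution of the perturbed problem (P_ε). -/
def IsPerturbedSolution (K h : ℂ → ℝ) (ε : ℝ) (u : ℂ → ℝ) : Prop :=
  ContDiff ℝ 2 u ∧
  (∀ x ∈ unitDisk, -lap u x + 2 * Ktil ε = 2 * Keps K ε x * Real.exp (u x)) ∧
  (∀ x ∈ unitCircle, nderiv u x + 2 * htil ε = 2 * heps h ε x * Real.exp (u x / 2))

/-- The energy functional I. -/
def Ifun (K h u : ℂ → ℝ) : ℝ :=
  (∫ x in unitDisk, ((1/2) * gradSq u x - 2 * K x * Real.exp (u x))) +
  bint (fun x => 2 * u x - 4 * h x * Real.exp (u x / 2))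

/-- The perturbation term T. -/
def Tfun (u : ℂ → ℝ) : ℝ :=
  ∫ x in unitDisk, ((1/2) * gradSq u x + Real.exp (u x) - u x)

/-- The perturbed functional I_ε. -/
def Ieps (K h : ℂ → ℝ) (ε : ℝ) (u : ℂ → ℝ) : ℝ := (Ifun K h u + ε * Tfun u) / (1 + ε)

/-- The quadratic form associated with the second variation of I_ε at `u`. -/
def Qform (K h : ℂ → ℝ) (ε : ℝ) (u v : ℂ → ℝ) : ℝ :=
  (∫ x in unitDisk, gradSq v x)
  - 2 * (∫ x in unitDisk, Keps K ε x * Real.exp (u x) * (v x) ^ 2)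
  - bint (fun x => heps h ε x * Real.exp (u x / 2) * (v x) ^ 2)

/-- The Morse index of the solution `u` of (P_ε) is at most `m`: every
finite-dimensional subspace of C¹ functions on which `Qform` is negative
definite has dimension at most `m`. -/
def IndexLe (K h : ℂ → ℝ) (ε : ℝ) (u : ℂ → ℝ) (m : ℕ) : Prop :=
  ∀ E : Submodule ℝ (ℂ → ℝ), FiniteDimensional ℝ E →
    (∀ v ∈ E, ContDiff ℝ 1 v) →
    (∀ v ∈ E, v ≠ 0 → Qform K h ε u v < 0) →
    Module.finrank ℝ E ≤ m

section PartA
open Set Topology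
variable {V : Type*} [NormedAddCommGroup V] [NormedSpace ℝ V]
structure LineC2 (j : V → ℝ) (A Q : V → V → ℝ) : Prop where
  cj : Continuous j
  cA : Continuous (fun z : V × V => A z.1 z.2)
  cQ : Continuous (fun z : V × V => Q z.1 z.2)
  dj : ∀ (x v : V) (t : ℝ), HasDerivAt (fun t : ℝ => j (x + t • v)) (A (x + t • v) v) t
  dA : ∀ (x v : V) (t : ℝ), HasDerivAt (fun t : ℝ => A (x + t • v) v) (Q (x + t • v) v) t
  neg : ∀ x v, A x (-v) = -A x v
lemma joined_ball_shift {j : V → ℝ} {c ρ : ℝ} {p w x : V}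
    (h : ∀ y ∈ Metric.ball p ρ, j (y + w) < c) (hx : x ∈ Metric.ball p ρ) (hρ : 0 < ρ) :
    JoinedIn {y | j y < c} (x + w) (p + w) := by
  apply JoinedIn.of_segment_subset
  intro z hz
  have h1 : segment ℝ x p ⊆ Metric.ball p ρ :=
    (convex_ball p ρ).segment_subset hx (Metric.mem_ball_self hρ)
  have h2 : z - w ∈ segment ℝ x p := by
    obtain ⟨a, b, ha, hb, hab, rfl⟩ := hz
    refine ⟨a, b, ha, hb, hab, ?_⟩
    have : w = a • w + b • w := by rw [← add_smul, hab, one_smul]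
    nth_rewrite 3 [this]
    simp only [smul_add]; abel
  have := h _ (h1 h2)
  simpa using this
lemma joined_ray {j : V → ℝ} {c t0 : ℝ} {w x : V} (ht : 0 ≤ t0)
    (h : ∀ t ∈ Icc 0 t0, j (x + t • w) < c) :
    JoinedIn {y | j y < c} x (x + t0 • w) := by
  refine JoinedIn.ofLine (f := fun s : ℝ => x + (s*t0) • w) (by fun_prop) (by simp) (by simp) ?_
  rintro _ ⟨s, hs, rfl⟩
  exact h _ ⟨by have := hs.1; positivity, by nlinarith [hs.1, hs.2]⟩
lemma lemB_local_reg {j : V → ℝ} {A Q : V → V → ℝ} (H : LineC2 j A Q) {c : ℝ} {p v : V}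
    (hp : j p = c) (hv : A p v < 0) :
    ∃ ρ > 0, (∀ x ∈ Metric.ball p ρ, ∀ y ∈ Metric.ball p ρ, j x < c → j y < c →
      JoinedIn {y | j y < c} x y) ∧ p ∈ closure {y | j y < c} := by
  have hc : Continuous (fun z : ℝ × V => A (z.2 + z.1 • v) v) :=
    H.cA.comp (by fun_prop : Continuous fun z : ℝ × V => (z.2 + z.1 • v, v))
  have h1 : ∀ᶠ z : ℝ × V in 𝓝 (0, p), A (z.2 + z.1 • v) v < 0 :=
    hc.continuousAt.eventually_lt continuousAt_const (by simpa using hv)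
  rw [Metric.eventually_nhds_iff_ball] at h1
  obtain ⟨r, hr, h1⟩ := h1
  have h2 : ∀ x ∈ Metric.ball p r, ∀ t ∈ Ico 0 r, A (x + t • v) v < 0 := by
    intro x hx t ht
    refine h1 (t, x) ?_
    rw [← ball_prod_same]
    exact ⟨by simp [abs_of_nonneg ht.1, ht.2], hx⟩
  have h3 : ∀ x ∈ Metric.ball p r, StrictAntiOn (fun t : ℝ => j (x + t • v)) (Icc 0 (r/2)) := by
    intro x hx
    apply strictAntiOn_of_deriv_neg (convex_Icc _ _)
    · exact fun t _ => (H.dj x v t).continuousAt.continuousWithinAt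
    · intro t ht
      rw [interior_Icc] at ht
      rw [(H.dj x v t).deriv]
      exact h2 x hx t ⟨ht.1.le, by linarith [ht.2]⟩
  have h4 : ∀ t ∈ Ioc 0 (r/2), j (p + t • v) < c := by
    intro t ht
    have := h3 p (Metric.mem_ball_self hr) (left_mem_Icc.2 (by linarith)) ⟨ht.1.le, ht.2⟩ ht.1
    simpa [hp] using this
  have h5 : ∀ᶠ y in 𝓝 p, j (y + (r/2) • v) < c :=
    (H.cj.comp (by fun_prop : Continuous fun y => y + (r/2) • v)).continuousAt.eventually_lt
      continuousAt_const (h4 _ ⟨by linarith, le_rfl⟩)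
  rw [Metric.eventually_nhds_iff_ball] at h5
  obtain ⟨r', hr', h5⟩ := h5
  have key : ∀ x ∈ Metric.ball p (min r r'), j x < c →
      JoinedIn {y | j y < c} x (p + (r/2) • v) := by
    intro x hx hxc
    refine (joined_ray (t0 := r/2) (w := v) (by linarith) ?_).trans
      (joined_ball_shift h5 (Metric.ball_subset_ball (min_le_right _ _) hx) hr')
    intro t ht
    refine lt_of_le_of_lt ?_ hxc
    have := (h3 x (Metric.ball_subset_ball (min_le_left _ _) hx)).antitoneOn
      (left_mem_Icc.2 (by linarith)) ht ht.1
    simpa using this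
  refine ⟨min r r', lt_min hr hr', fun x hx y hy hxc hyc =>
    (key x hx hxc).trans (key y hy hyc).symm, ?_⟩
  have ht : Tendsto (fun t : ℝ => p + t • v) (𝓝[>] 0) (𝓝 p) := by
    have : Continuous (fun t : ℝ => p + t • v) := by fun_prop
    simpa using (this.tendsto 0).mono_left nhdsWithin_le_nhds
  refine mem_closure_of_tendsto ht ?_
  filter_upwards [Ioc_mem_nhdsGT (by linarith : (0:ℝ) < r/2)] with t ht using h4 t ht
lemma lemB_local_conc {j : V → ℝ} {A Q : V → V → ℝ} (H : LineC2 j A Q) {c : ℝ} {p p1 p2 : V}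
    (hp : j p = c) (hA : ∀ v, A p v = 0)
    (hQ : ∀ x y : ℝ, (x, y) ≠ 0 → Q p (x • p1 + y • p2) < 0) :
    ∃ ρ > 0, (∀ x ∈ Metric.ball p ρ, ∀ y ∈ Metric.ball p ρ, j x < c → j y < c →
      JoinedIn {y | j y < c} x y) ∧ p ∈ closure {y | j y < c} := by
  let w : ℝ → V := fun θ => cos θ • p1 + sin θ • p2
  have hw : Continuous w := by fun_prop
  have w0 : w 0 = p1 := by simp [w]
  have wpi : w π = -p1 := by simp [w]
  have hc : Continuous (fun z : ℝ × (ℝ × V) => Q (z.2.2 + z.2.1 • w z.1) (w z.1)) :=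
    H.cQ.comp (by fun_prop :
      Continuous fun z : ℝ × (ℝ × V) => (z.2.2 + z.2.1 • w z.1, w z.1))
  have h1 : ∀ᶠ z : ℝ × V in 𝓝 (0, p), ∀ θ ∈ Icc 0 π, Q (z.2 + z.1 • w θ) (w θ) < 0 := by
    apply isCompact_Icc.eventually_forall_of_forall_eventually
    intro θ hθ
    have : ContinuousAt (fun z : (ℝ × V) × ℝ => Q (z.1.2 + z.1.1 • w z.2) (w z.2)) ((0, p), θ) :=
      (hc.comp (by fun_prop : Continuous fun z : (ℝ × V) × ℝ => (z.2, z.1))).continuousAt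
    refine this.eventually_lt continuousAt_const ?_
    simp only [zero_smul, add_zero]
    apply hQ
    intro h
    simp only [Prod.mk_eq_zero] at h
    have := sin_sq_add_cos_sq θ
    rw [h.1, h.2] at this; norm_num at this
  rw [Metric.eventually_nhds_iff_ball] at h1
  obtain ⟨r, hr, h1⟩ := h1
  have h2 : ∀ x ∈ Metric.ball p r, ∀ t ∈ Ico 0 r, ∀ θ ∈ Icc 0 π, Q (x + t • w θ) (w θ) < 0 := by
    intro x hx t ht
    refine h1 (t, x) ?_
    rw [← ball_prod_same]
    exact ⟨by simp [abs_of_nonneg ht.1, ht.2], hx⟩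
  have h3 : ∀ x ∈ Metric.ball p r, ∀ θ ∈ Icc 0 π, A x (w θ) ≤ 0 →
      StrictAntiOn (fun t : ℝ => j (x + t • w θ)) (Icc 0 (r/2)) := by
    intro x hx θ hθ hA0
    have ha : StrictAntiOn (fun t : ℝ => A (x + t • w θ) (w θ)) (Icc 0 (r/2)) := by
      apply strictAntiOn_of_deriv_neg (convex_Icc _ _)
      · exact fun t _ => (H.dA x (w θ) t).continuousAt.continuousWithinAt
      · intro t ht
        rw [interior_Icc] at ht
        rw [(H.dA x (w θ) t).deriv]
        exact h2 x hx t ⟨ht.1.le, by linarith [ht.2]⟩ θ hθ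
    apply strictAntiOn_of_deriv_neg (convex_Icc _ _)
    · exact fun t _ => (H.dj x (w θ) t).continuousAt.continuousWithinAt
    · intro t ht
      rw [interior_Icc] at ht
      rw [(H.dj x (w θ) t).deriv]
      have := ha (left_mem_Icc.2 (by linarith)) ⟨ht.1.le, ht.2.le⟩ ht.1
      simp only [zero_smul, add_zero] at this
      linarith
  have h4 : ∀ θ ∈ Icc 0 π, ∀ t ∈ Ioc 0 (r/2), j (p + t • w θ) < c := by
    intro θ hθ t ht
    have := h3 p (Metric.mem_ball_self hr) θ hθ (hA _).le (left_mem_Icc.2 (by linarith))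
      ⟨ht.1.le, ht.2⟩ ht.1
    simpa [hp] using this
  have hpi0 : (0:ℝ) ∈ Icc 0 π := ⟨le_rfl, pi_pos.le⟩
  have hpip : π ∈ Icc 0 π := ⟨pi_pos.le, le_rfl⟩
  have h5 : ∀ θ ∈ Icc 0 π, ∀ᶠ y in 𝓝 p, j (y + (r/2) • w θ) < c := fun θ hθ =>
    (H.cj.comp (by fun_prop : Continuous fun y => y + (r/2) • w θ)).continuousAt.eventually_lt
      continuousAt_const (h4 θ hθ _ ⟨by linarith, le_rfl⟩)
  have h6 := (h5 0 hpi0).and (h5 π hpip)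
  rw [Metric.eventually_nhds_iff_ball] at h6
  obtain ⟨r', hr', h6⟩ := h6
  have arc : JoinedIn {y | j y < c} (p + (r/2) • w 0) (p + (r/2) • w π) := by
    refine JoinedIn.ofLine (f := fun s : ℝ => p + (r/2) • w (s*π)) (by fun_prop) (by simp)
      (by simp) ?_
    rintro _ ⟨s, hs, rfl⟩
    exact h4 _ ⟨by have := hs.1; positivity, by nlinarith [hs.1, hs.2, pi_pos]⟩ _
      ⟨by linarith, le_rfl⟩
  have key : ∀ x ∈ Metric.ball p (min r r'), j x < c →
      JoinedIn {y | j y < c} x (p + (r/2) • w 0) := by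
    intro x hx hxc
    have gen : ∀ θ ∈ Icc 0 π, A x (w θ) ≤ 0 → (∀ y ∈ Metric.ball p r', j (y + (r/2) • w θ) < c) →
        JoinedIn {y | j y < c} x (p + (r/2) • w θ) := by
      intro θ hθ hle h7
      refine (joined_ray (t0 := r/2) (w := w θ) (by linarith) ?_).trans
        (joined_ball_shift h7 (Metric.ball_subset_ball (min_le_right _ _) hx) hr')
      intro t ht
      refine lt_of_le_of_lt ?_ hxc
      have := (h3 x (Metric.ball_subset_ball (min_le_left _ _) hx) θ hθ hle).antitoneOn
        (left_mem_Icc.2 (by linarith)) ht ht.1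
      simpa using this
    rcases le_total (A x (w 0)) 0 with h | h
    · exact gen 0 hpi0 h fun y hy => (h6 y hy).1
    · refine (gen π hpip ?_ fun y hy => (h6 y hy).2).trans arc.symm
      rw [wpi, H.neg, ← w0]; linarith
  refine ⟨min r r', lt_min hr hr', fun x hx y hy hxc hyc =>
    (key x hx hxc).trans (key y hy hyc).symm, ?_⟩
  have ht : Tendsto (fun t : ℝ => p + t • w 0) (𝓝[>] 0) (𝓝 p) := by
    have : Continuous (fun t : ℝ => p + t • w 0) := by fun_prop
    simpa using (this.tendsto 0).mono_left nhdsWithin_le_nhds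
  refine mem_closure_of_tendsto ht ?_
  filter_upwards [Ioc_mem_nhdsGT (by linarith : (0:ℝ) < r/2)] with t ht using h4 0 hpi0 t ht
lemma lemB_global {j T : V → ℝ} (hj : Continuous j) {c M : ℝ} {a b : V}
    (hcpt : IsCompact {x | T x ≤ M}) (hab : ¬ JoinedIn {y | j y < c} a b)
    (ha : j a < c) (hb : j b < c)
    (hpath : ∀ δ > 0, JoinedIn {x | c ≤ j x → (T x ≤ M ∧ j x < c + δ)} a b)
    (hloc : ∀ p, T p ≤ M → j p = c → ∃ ρ > 0, (∀ x ∈ Metric.ball p ρ, ∀ y ∈ Metric.ball p ρ,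
      j x < c → j y < c → JoinedIn {y | j y < c} x y) ∧ p ∈ closure {y | j y < c}) : False := by
  set X : Set V := {p | T p ≤ M ∧ j p = c} with hX
  have hXc : IsCompact X := hcpt.inter_right (isClosed_singleton.preimage hj)
  choose! ρ hρ hρ2 using fun p (hp : p ∈ X) => hloc p hp.1 hp.2
  obtain ⟨r, hr, hr2⟩ := lebesgue_number_lemma_of_metric (s := X)
    (c := fun p : X => Metric.ball (p : V) (ρ p)) hXc (fun _ => Metric.isOpen_ball)
    (fun p hp => mem_iUnion.2 ⟨⟨p, hp⟩, Metric.mem_ball_self (hρ p hp)⟩)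
  have hball : ∀ p ∈ X, ∀ x ∈ Metric.ball p r, ∀ y ∈ Metric.ball p r, j x < c → j y < c →
      JoinedIn {y | j y < c} x y := by
    intro p hp x hx y hy
    obtain ⟨⟨i, hi⟩, hi2⟩ := hr2 p hp
    exact (hρ2 i hi).1 x (hi2 hx) y (hi2 hy)
  have hdelta : ∃ δ > 0, ∀ x, T x ≤ M → c ≤ j x → j x < c + δ →
      ∃ p ∈ X, dist x p < r / 3 := by
    set Z : Set V := {x | T x ≤ M ∧ c ≤ j x} \ Metric.thickening (r/3) X with hZ
    have hZc : IsCompact Z := by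
      have : Z = {x | T x ≤ M} ∩ ({x | c ≤ j x} ∩ (Metric.thickening (r/3) X)ᶜ) := by
        ext x; simp [hZ, and_assoc]
      rw [this]
      exact hcpt.inter_right ((isClosed_le continuous_const hj).inter
        Metric.isOpen_thickening.isClosed_compl)
    have : ∃ δ > 0, ∀ x ∈ Z, c + δ ≤ j x := by
      rcases Z.eq_empty_or_nonempty with h | h
      · exact ⟨1, one_pos, by simp [h]⟩
      obtain ⟨z, hz, hz2⟩ := hZc.exists_isMinOn h hj.continuousOn
      have hzc : c < j z := by
        refine lt_of_le_of_ne hz.1.2 fun he => hz.2 ?_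
        exact Metric.self_subset_thickening (by linarith) _ ⟨hz.1.1, he.symm⟩
      exact ⟨j z - c, by linarith, fun x hx => by have : j z ≤ j x := hz2 hx; linarith⟩
    obtain ⟨δ, hδ, h⟩ := this
    refine ⟨δ, hδ, fun x h1 h2 h3 => ?_⟩
    by_contra h4
    have := h x ⟨⟨h1, h2⟩, fun h5 => h4 (Metric.mem_thickening_iff.1 h5)⟩
    linarith
  obtain ⟨δ, hδ, hd⟩ := hdelta
  obtain ⟨γ, hγ⟩ := hpath δ hδ
  let G : V → Set V := fun z => {y | j y < c ∧ (y = z ∨ ∃ p ∈ X, dist z p < r/3 ∧ dist y p < r)}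
  have hG : ∀ z ∈ range γ, (G z).Nonempty := by
    rintro _ ⟨t, rfl⟩
    by_cases h : j (γ t) < c
    · exact ⟨γ t, h, Or.inl rfl⟩
    · push Not at h
      obtain ⟨p, hp, hp2⟩ := hd _ (hγ t h).1 h (hγ t h).2
      obtain ⟨y, hy, hy2⟩ := Metric.mem_closure_iff.1 (hρ2 p hp).2 r hr
      exact ⟨y, hy, Or.inr ⟨p, hp, hp2, by rwa [dist_comm]⟩⟩
  have hR := (isPreconnected_range γ.continuous).induction₂
    (fun z z' => ∀ y ∈ G z, ∀ y' ∈ G z', JoinedIn {y | j y < c} y y') ?_ ?_ ?_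
    (x := a) (y := b) ⟨0, γ.source⟩ ⟨1, γ.target⟩
  · exact hab (hR a ⟨ha, Or.inl rfl⟩ b ⟨hb, Or.inl rfl⟩)
  · intro z hz
    have e1 : ∀ᶠ z' in 𝓝 z, dist z' z < r/3 := Metric.ball_mem_nhds z (by linarith)
    have e2 : j z < c → ∀ᶠ z' in 𝓝 z, JoinedIn {y | j y < c} z z' := by
      intro h
      obtain ⟨s, hs, hs2⟩ := Metric.isOpen_iff.1 (isOpen_lt hj continuous_const) z h
      filter_upwards [Metric.ball_mem_nhds z hs] with z' hz'
      exact (JoinedIn.of_segment_subset ((convex_ball z s).segment_subset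
        (Metric.mem_ball_self hs) hz')).mono hs2
    have e3 : ∀ᶠ z' in 𝓝 z, j z < c → JoinedIn {y | j y < c} z z' := by
      by_cases h : j z < c
      · filter_upwards [e2 h] with z' hz' using fun _ => hz'
      · exact Eventually.of_forall fun _ h' => absurd h' h
    refine nhdsWithin_le_nhds ?_
    filter_upwards [e1, e3] with z' h1 h3
    rintro y ⟨hy, hyz⟩ y' ⟨hy', hyz'⟩
    rcases hyz with rfl | ⟨p, hp, hp1, hp2⟩
    · refine (h3 hy).trans ?_
      rcases hyz' with rfl | ⟨p', hp', hp1', hp2'⟩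
      · exact JoinedIn.refl hy'
      · exact hball p' hp' z' (Metric.mem_ball.2 (by linarith)) y' hp2' (h3 hy).target_mem hy'
    · rcases hyz' with rfl | ⟨p', hp', hp1', hp2'⟩
      · exact hball p hp y hp2 _
          (Metric.mem_ball.2 (by linarith [dist_triangle y' z p])) hy hy'
      · have hpp : dist p' p < r := by
          have e1 := dist_triangle p' z' p
          have e2 := dist_triangle z' z p
          rw [dist_comm p' z'] at e1
          linarith
        obtain ⟨w, hw, hw2⟩ := Metric.mem_closure_iff.1 (hρ2 p' hp').2 (r - dist p' p) (by linarith)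
        have hwp : dist w p < r := by
          have := dist_triangle w p' p
          rw [dist_comm w p'] at this
          linarith
        have hwp' : dist w p' < r := by rw [dist_comm]; linarith [dist_nonneg (x := p') (y := p)]
        exact (hball p hp y hp2 w hwp hy hw).trans (hball p' hp' w hwp' y' hp2' hw hy')
  · intro x y z _ hy _ h1 h2 u hu v hv
    obtain ⟨w, hw⟩ := hG y hy
    exact (h1 u hu w hw).trans (h2 w hw v hv)
  · intro x y _ _ h u hu v hv
    exact (h v hv u hu).symm
lemma lemB {j T : V → ℝ} {A Q : V → V → ℝ} (H : LineC2 j A Q) {c M : ℝ}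
    {a b : V} (hcpt : IsCompact {x | T x ≤ M}) (hab : ¬ JoinedIn {y | j y < c} a b)
    (ha : j a < c) (hb : j b < c)
    (hpath : ∀ δ > 0, JoinedIn {x | c ≤ j x → (T x ≤ M ∧ j x < c + δ)} a b) :
    ∃ p, T p ≤ M ∧ (∀ v, A p v = 0) ∧
      ¬ ∃ p1 p2 : V, ∀ x y : ℝ, (x, y) ≠ 0 → Q p (x • p1 + y • p2) < 0 := by
  by_contra hcon
  push Not at hcon
  refine lemB_global H.cj hcpt hab ha hb hpath fun p hp hpc => ?_
  by_cases hA : ∀ v, A p v = 0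
  · obtain ⟨p1, p2, hQ⟩ := hcon p hp hA
    exact lemB_local_conc H hpc hA hQ
  · push Not at hA
    obtain ⟨v, hv⟩ := hA
    rcases lt_or_gt_of_ne hv with h | h
    · exact lemB_local_reg H hpc h
    · exact lemB_local_reg H hpc (v := -v) (by rw [H.neg]; linarith)
lemma struwe_select {c : ℝ → ℝ} {α β M0 : ℝ} (hαβ : α < β)
    (hmono : MonotoneOn c (Icc α β)) (hlt : c β - c α < M0*(β - α)) :
    ∃ ε ∈ Ico α β, ∀ η > 0, ∃ ε' ∈ Ioo ε (ε + η), ε' ≤ β ∧ c ε' - c ε ≤ M0*(ε' - ε) := by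
  by_contra hcon
  push Not at hcon
  set S := {t | t ∈ Icc α β ∧ c α + M0*(t - α) ≤ c t} with hS
  have hαS : α ∈ S := ⟨⟨le_rfl, hαβ.le⟩, by simp⟩
  have hbd : BddAbove S := ⟨β, fun t ht => ht.1.2⟩
  set s := sSup S
  have hs1 : s ∈ Icc α β := ⟨le_csSup hbd hαS, csSup_le ⟨α, hαS⟩ fun t ht => ht.1.2⟩
  have hs2 : c α + M0*(s - α) ≤ c s := by
    have hcl : s ∈ closure S := csSup_mem_closure ⟨α, hαS⟩ hbd
    have hsub : S ⊆ {t | c α + M0*(t - α) ≤ c s} := fun t ht =>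
      ht.2.trans (hmono ht.1 hs1 (le_csSup hbd ht))
    exact closure_minimal hsub (isClosed_le (by fun_prop) continuous_const) hcl
  rcases hs1.2.eq_or_lt with h | h
  · rw [h] at hs2; linarith
  · obtain ⟨η, hη, h2⟩ := hcon s ⟨hs1.1, h⟩
    set ε' := min (s + η / 2) β
    have h3 : s < ε' := lt_min (by linarith) h
    have h4 := h2 ε' ⟨h3, (min_le_left _ _).trans_lt (by linarith)⟩ (min_le_right _ _)
    have : ε' ∈ S := ⟨⟨hs1.1.trans h3.le, min_le_right _ _⟩, by linarith⟩
    exact absurd (le_csSup hbd this) (not_le.2 h3)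
lemma struwe {j0 T : V → ℝ} {A Q : ℝ → V → V → ℝ} {α β m C : ℝ} {a b : V}
    (hαβ : α < β) (hα : 0 ≤ α)
    (H : ∀ ε ∈ Icc α β, LineC2 (fun x => j0 x + ε*T x) (A ε) (Q ε))
    (hT0 : ∀ x, 0 ≤ T x)
    (hcpt : IsCompact {x | T x ≤ (C - m + 1) / (β - α) + 1})
    (hsep : ¬ JoinedIn {x | j0 x < m} a b)
    (ha : j0 a + β*T a < m) (hb : j0 b + β*T b < m)
    (hup : JoinedIn {x | j0 x + β*T x ≤ C} a b) :
    ∃ ε ∈ Icc α β, ∃ p, T p ≤ (C - m + 1) / (β - α) + 1 ∧ (∀ v, A ε p v = 0) ∧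
      ¬ ∃ p1 p2 : V, ∀ x y : ℝ, (x, y) ≠ 0 → Q ε p (x • p1 + y • p2) < 0 := by
  set M0 := (C - m + 1) / (β - α) with hM0
  let L : ℝ → Set ℝ := fun ε => {l | JoinedIn {x | j0 x + ε*T x ≤ l} a b}
  have hLmono : ∀ ε ε', ε ≤ ε' → L ε' ⊆ L ε := fun ε ε' h l hl =>
    hl.mono fun x hx => le_trans (add_le_add_right (mul_le_mul_of_nonneg_right h (hT0 x)) _ :
      j0 x + ε*T x ≤ j0 x + ε'*T x) hx
  have hC : ∀ ε ∈ Icc α β, C ∈ L ε := fun ε hε => hLmono ε β hε.2 hup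
  have hlow : ∀ ε ∈ Icc α β, ∀ l ∈ L ε, m ≤ l := by
    intro ε hε l hl
    by_contra h
    push Not at h
    refine hsep (hl.mono fun x hx => ?_)
    have h1 : j0 x + ε*T x ≤ l := hx
    have h2 := mul_nonneg (hα.trans hε.1) (hT0 x)
    change j0 x < m; linarith
  have hbdd : ∀ ε ∈ Icc α β, BddBelow (L ε) := fun ε hε => ⟨m, hlow ε hε⟩
  let c : ℝ → ℝ := fun ε => sInf (L ε)
  have hmc : ∀ ε ∈ Icc α β, m ≤ c ε := fun ε hε => le_csInf ⟨C, hC ε hε⟩ (hlow ε hε)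
  have hcC : ∀ ε ∈ Icc α β, c ε ≤ C := fun ε hε => csInf_le (hbdd ε hε) (hC ε hε)
  have hmono : MonotoneOn c (Icc α β) := fun ε hε ε' hε' h =>
    csInf_le_csInf (hbdd ε hε) ⟨C, hC ε' hε'⟩ (hLmono ε ε' h)
  have hba : 0 < β - α := by linarith
  have hlt : c β - c α < M0*(β - α) := by
    rw [hM0, div_mul_cancel₀ _ hba.ne']
    linarith [hcC β ⟨hαβ.le, le_rfl⟩, hmc α ⟨le_rfl, hαβ.le⟩]
  obtain ⟨ε, hε, hsel⟩ := struwe_select hαβ hmono hlt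
  have hεI : ε ∈ Icc α β := ⟨hε.1, hε.2.le⟩
  have hle : ∀ x, j0 x + ε*T x ≤ j0 x + β*T x := fun x => by
    have := mul_le_mul_of_nonneg_right hεI.2 (hT0 x); linarith
  have hM1 : 0 ≤ M0 := by
    rw [hM0]; refine div_nonneg ?_ hba.le
    linarith [hcC ε hεI, hmc ε hεI]
  refine ⟨ε, hεI, lemB (H ε hεI) (c := c ε) (a := a) (b := b) hcpt ?_ ?_ ?_ ?_⟩
  · rintro ⟨γ, hγ⟩
    obtain ⟨t, -, ht⟩ := isCompact_univ.exists_isMaxOn (univ_nonempty (α := unitInterval))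
      (((H ε hεI).cj.comp γ.continuous).continuousOn)
    have : j0 (γ t) + ε*T (γ t) ∈ L ε := ⟨γ, fun s => ht (mem_univ s)⟩
    exact absurd (csInf_le (hbdd ε hεI) this) (not_le.2 (hγ t))
  · linarith [hle a, hmc ε hεI]
  · linarith [hle b, hmc ε hεI]
  · intro δ hδ
    obtain ⟨ε', h1, h2, h3⟩ := hsel (δ / (M0 + 1)) (by positivity)
    have hd : 0 < ε' - ε := by linarith [h1.1]
    have hε' : ε' ∈ Icc α β := ⟨hε.1.trans h1.1.le, h2⟩
    obtain ⟨l, hl, hl2⟩ := exists_lt_of_csInf_lt ⟨C, hC ε' hε'⟩ (show c ε' < c ε' + (ε' - ε) by linarith)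
    have hδ2 : (M0 + 1)*(ε' - ε) < δ := by
      have := h1.2
      rw [← sub_lt_iff_lt_add', lt_div_iff₀ (by positivity)] at this
      linarith
    refine JoinedIn.mono hl fun x hx hcx => ?_
    have hx' : j0 x + ε'*T x ≤ l := hx
    have e1 : T x*(ε' - ε) ≤ (M0 + 1)*(ε' - ε) := by linarith
    exact ⟨le_of_mul_le_mul_right e1 hd, by nlinarith [mul_nonneg (hT0 x) hd.le]⟩
end PartA
section PartS
open Set Topology
abbrev BB : Type := Metric.closedBall (0:ℂ) 1
instance : CompactSpace BB := isCompact_iff_compactSpace.1 (isCompact_closedBall (0:ℂ) 1)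
def retr (x : ℂ) : BB := ⟨((max 1 ‖x‖)⁻¹ : ℝ) • x, by
  have h : (0:ℝ) < max 1 ‖x‖ := lt_max_of_lt_left one_pos
  simp only [Metric.mem_closedBall, dist_zero_right, norm_smul, norm_inv, Real.norm_eq_abs,
    abs_of_pos h]
  rw [inv_mul_le_iff₀ h]; simp⟩
lemma retr_cont : Continuous retr := by
  have : ∀ x : ℂ, max 1 ‖x‖ ≠ 0 := fun x => (lt_max_of_lt_left one_pos).ne'
  refine Continuous.subtype_mk ?_ _
  exact ((continuous_const.max continuous_norm).inv₀ this).smul continuous_id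
lemma retr_of_le {x : ℂ} (hx : ‖x‖ ≤ 1) : retr x = ⟨x, by simpa using hx⟩ := by
  simp [retr, max_eq_left hx]
lemma retr_val {x : ℂ} (hx : ‖x‖ ≤ 1) : ((retr x : BB) : ℂ) = x := by rw [retr_of_le hx]
lemma bpt_norm (θ : ℝ) : ‖bpt θ‖ = 1 := Complex.norm_exp_ofReal_mul_I θ
lemma bpt_cont : Continuous bpt := by unfold bpt; fun_prop
def bptB (θ : ℝ) : BB := ⟨bpt θ, by simp [bpt_norm]⟩
lemma bptB_cont : Continuous bptB := bpt_cont.subtype_mk _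
def νD : Measure BB := (volume.restrict unitDisk).map retr
def νS : Measure BB := (volume.restrict (Ioc 0 (2*π))).map bptB
instance : IsFiniteMeasure (volume.restrict unitDisk) :=
  ⟨by simp [unitDisk]⟩
instance : IsFiniteMeasure νD := by unfold νD; infer_instance
instance : IsFiniteMeasure νS := by unfold νS; infer_instance
lemma integral_νD {E : Type*} [NormedAddCommGroup E] [NormedSpace ℝ E] (F : BB → E)
    (hF : AEStronglyMeasurable F νD) :
    ∫ x, F x ∂νD = ∫ x in unitDisk, F (retr x) := by
  rw [νD] at hF ⊢
  rw [integral_map retr_cont.aemeasurable hF]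
lemma integral_νD' (G : ℂ → ℝ) (hG : Continuous (fun x : BB => G x)) :
    ∫ x, G (x:ℂ) ∂νD = ∫ x in unitDisk, G x := by
  rw [integral_νD _ hG.aestronglyMeasurable]
  refine setIntegral_congr_fun measurableSet_ball fun x hx => ?_
  simp only [unitDisk, Metric.mem_ball, dist_zero_right] at hx
  simp only [retr_val hx.le]
lemma integral_νS {E : Type*} [NormedAddCommGroup E] [NormedSpace ℝ E] (F : BB → E)
    (hF : AEStronglyMeasurable F νS) :
    ∫ x, F x ∂νS = ∫ θ in (0:ℝ)..(2*π), F (bptB θ) := by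
  rw [νS] at hF ⊢
  rw [integral_map bptB_cont.aemeasurable hF, intervalIntegral.integral_of_le (by positivity)]
lemma integral_νS' (G : ℂ → ℝ) (hG : Continuous (fun x : BB => G x)) :
    ∫ x, G (x:ℂ) ∂νS = bint G := by
  rw [integral_νS _ hG.aestronglyMeasurable]; rfl
lemma νD_univ : νD.real univ = π := by
  rw [νD, measureReal_def, Measure.map_apply retr_cont.measurable MeasurableSet.univ]
  simp [unitDisk]
lemma νS_univ : νS.real univ = 2*π := by
  rw [νS, measureReal_def, Measure.map_apply bptB_cont.measurable MeasurableSet.univ]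
  simp [pi_pos.le]
abbrev HH : Type := WithLp 2 (Lp ℝ 2 νD × Lp ℝ 2 νS)
abbrev CB : Type := C(BB, ℝ)
def JD : CB →L[ℝ] HH :=
  (WithLp.prodContinuousLinearEquiv 2 ℝ (Lp ℝ 2 νD) (Lp ℝ 2 νS)).symm.toContinuousLinearMap.comp
    ((ContinuousLinearMap.inl ℝ _ _).comp (ContinuousMap.toLp 2 νD ℝ))
def JS : CB →L[ℝ] HH :=
  (WithLp.prodContinuousLinearEquiv 2 ℝ (Lp ℝ 2 νD) (Lp ℝ 2 νS)).symm.toContinuousLinearMap.comp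
    ((ContinuousLinearMap.inr ℝ _ _).comp (ContinuousMap.toLp 2 νS ℝ))
def iot : CB →L[ℝ] HH := JD + JS
lemma inner_JD (q : HH) (f : CB) : inner ℝ q (JD f) = ∫ x, q.ofLp.1 x*f x ∂νD := by
  rw [WithLp.prod_inner_apply]
  have h2 : (JD f).ofLp.2 = 0 := rfl
  have h1 : (JD f).ofLp.1 = ContinuousMap.toLp 2 νD ℝ f := rfl
  rw [h1, h2, inner_zero_right, add_zero, L2.inner_def]
  refine integral_congr_ae ?_
  filter_upwards [ContinuousMap.coeFn_toLp (p := 2) (𝕜 := ℝ) νD f] with x hx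
  rw [hx, RCLike.inner_apply, mul_comm]; rfl
lemma inner_JS (q : HH) (f : CB) : inner ℝ q (JS f) = ∫ x, q.ofLp.2 x*f x ∂νS := by
  rw [WithLp.prod_inner_apply]
  have h2 : (JS f).ofLp.1 = 0 := rfl
  have h1 : (JS f).ofLp.2 = ContinuousMap.toLp 2 νS ℝ f := rfl
  rw [h1, h2, inner_zero_right, zero_add, L2.inner_def]
  refine integral_congr_ae ?_
  filter_upwards [ContinuousMap.coeFn_toLp (p := 2) (𝕜 := ℝ) νS f] with x hx
  rw [hx, RCLike.inner_apply, mul_comm]; rfl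
lemma inner_JD_JD (f g : CB) : inner ℝ (JD f) (JD g) = ∫ x, f x*g x ∂νD := by
  rw [inner_JD]
  refine integral_congr_ae ?_
  have h1 : (JD f).ofLp.1 = ContinuousMap.toLp 2 νD ℝ f := rfl
  filter_upwards [ContinuousMap.coeFn_toLp (p := 2) (𝕜 := ℝ) νD f] with x hx
  simp only [h1, hx]
lemma inner_JS_JS (f g : CB) : inner ℝ (JS f) (JS g) = ∫ x, f x*g x ∂νS := by
  rw [inner_JS]
  refine integral_congr_ae ?_
  have h1 : (JS f).ofLp.2 = ContinuousMap.toLp 2 νS ℝ f := rfl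
  filter_upwards [ContinuousMap.coeFn_toLp (p := 2) (𝕜 := ℝ) νS f] with x hx
  simp only [h1, hx]
lemma inner_JD_JS (f g : CB) : inner ℝ (JD f) (JS g) = 0 := by
  rw [WithLp.prod_inner_apply]
  have h2 : (JS g).ofLp.1 = 0 := rfl
  have h1 : (JD f).ofLp.2 = 0 := rfl
  rw [h1, h2]; simp
lemma inner_JS_JD (f g : CB) : inner ℝ (JS f) (JD g) = 0 := by
  rw [real_inner_comm, inner_JD_JS]
lemma dense_J : DenseRange (fun z : CB × CB => JD z.1 + JS z.2) := by
  have h1 := (ContinuousMap.toLp_denseRange ℝ (p := 2) (μ := νD) (𝕜 := ℝ) (by simp))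
  have h2 := (ContinuousMap.toLp_denseRange ℝ (p := 2) (μ := νS) (𝕜 := ℝ) (by simp))
  have h3 := (WithLp.prodContinuousLinearEquiv 2 ℝ (Lp ℝ 2 νD) (Lp ℝ 2 νS)).symm.surjective.denseRange.comp
    (h1.prodMap h2) (ContinuousLinearEquiv.continuous _)
  convert h3 using 1
  ext1 z
  apply (WithLp.prodContinuousLinearEquiv 2 ℝ (Lp ℝ 2 νD) (Lp ℝ 2 νS)).injective
  ext1 <;> simp [JD, JS]
  
end PartS
section PartH1
open Set Topology
variable {V : Type*} [NormedAddCommGroup V] [NormedSpace ℝ V]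
lemma LineC2.add {j j' : V → ℝ} {A Q A' Q' : V → V → ℝ} (h : LineC2 j A Q) (h' : LineC2 j' A' Q') :
    LineC2 (fun x => j x + j' x) (fun x v => A x v + A' x v) (fun x v => Q x v + Q' x v) where
  cj := h.cj.add h'.cj
  cA := h.cA.add h'.cA
  cQ := h.cQ.add h'.cQ
  dj x v t := (h.dj x v t).add (h'.dj x v t)
  dA x v t := (h.dA x v t).add (h'.dA x v t)
  neg x v := by simp only [h.neg, h'.neg]; ring
lemma LineC2.cmul {j : V → ℝ} {A Q : V → V → ℝ} (c : ℝ) (h : LineC2 j A Q) :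
    LineC2 (fun x => c*j x) (fun x v => c*A x v) (fun x v => c*Q x v) where
  cj := continuous_const.mul h.cj
  cA := continuous_const.mul h.cA
  cQ := continuous_const.mul h.cQ
  dj x v t := (h.dj x v t).const_mul c
  dA x v t := (h.dA x v t).const_mul c
  neg x v := by simp only [h.neg]; ring
lemma LineC2.comp {W : Type*} [NormedAddCommGroup W] [NormedSpace ℝ W] (L : W →L[ℝ] V)
    {j : V → ℝ} {A Q : V → V → ℝ} (h : LineC2 j A Q) :
    LineC2 (fun x => j (L x)) (fun x v => A (L x) (L v)) (fun x v => Q (L x) (L v)) where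
  cj := h.cj.comp L.continuous
  cA := h.cA.comp (by fun_prop : Continuous fun z : W × W => (L z.1, L z.2))
  cQ := h.cQ.comp (by fun_prop : Continuous fun z : W × W => (L z.1, L z.2))
  dj x v t := by simpa using h.dj (L x) (L v) t
  dA x v t := by simpa using h.dA (L x) (L v) t
  neg x v := by simp only [map_neg, h.neg]
lemma hasDerivAt_line (x v : V) (t : ℝ) : HasDerivAt (fun t : ℝ => x + t • v) v t := by
  simpa using ((hasDerivAt_id t).smul_const v).const_add x
lemma LineC2.lin (L : V →L[ℝ] ℝ) : LineC2 (fun x => L x) (fun _ v => L v) (fun _ _ => 0) where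
  cj := L.continuous
  cA := by fun_prop
  cQ := continuous_const
  dj x v t := L.hasFDerivAt.comp_hasDerivAt t (hasDerivAt_line x v t)
  dA x v t := hasDerivAt_const _ _
  neg x v := by simp
lemma LineC2.quad (B : V →L[ℝ] V →L[ℝ] ℝ) (hB : ∀ x y, B x y = B y x) :
    LineC2 (fun x => B x x / 2) (fun x v => B x v) (fun _ v => B v v) where
  cj := by fun_prop
  cA := by fun_prop
  cQ := by fun_prop
  dj x v t := by
    have h1 := B.hasFDerivAt.comp_hasDerivAt t (hasDerivAt_line x v t)
    have h2 := (h1.clm_apply (hasDerivAt_line x v t)).div_const 2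
    have e : (B v (x + t • v) + B (x + t • v) v) / 2 = B (x + t • v) v := by rw [hB v]; ring
    exact e ▸ h2
  dA x v t := by
    have h1 := B.hasFDerivAt.comp_hasDerivAt t (hasDerivAt_line x v t)
    simpa using h1.clm_apply (hasDerivAt_const t v)
  neg x v := by simp
def EE (u : CB) : CB := NormedSpace.exp u
lemma EE_apply (u : CB) (x : BB) : EE u x = Real.exp (u x) := by
  have := NormedSpace.map_exp (ContinuousMap.evalAlgHom ℝ ℝ x : CB →ₐ[ℝ] ℝ)
    (continuous_eval_const x) u
  simpa [EE, Real.exp_eq_exp_ℝ] using this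
lemma EE_cont : Continuous EE := NormedSpace.exp_continuous
lemma EE_deriv (u w : CB) (t : ℝ) : HasDerivAt (fun t : ℝ => EE (u + t • w)) (EE (u + t • w)*w) t := by
  have h := (hasDerivAt_exp_smul_const (𝕂 := ℝ) w t).const_mul (NormedSpace.exp u)
  have e : ∀ s : ℝ, EE (u + s • w) = NormedSpace.exp u*NormedSpace.exp (s • w) := fun s => by
    rw [EE, NormedSpace.exp_add]
  rw [e, mul_assoc]
  exact h.congr_of_eventuallyEq (Eventually.of_forall e)
lemma LineC2.expt (l : CB →L[ℝ] ℝ) (φ : CB) (c : ℝ) (G : V →L[ℝ] CB) :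
    LineC2 (fun q => l (φ*EE (c • G q))) (fun q v => l (φ*(EE (c • G q)*(c • G v))))
      (fun q v => l (φ*(EE (c • G q)*(c • G v)*(c • G v)))) where
  cj := by
    have := EE_cont
    fun_prop
  cA := by
    have := EE_cont
    fun_prop
  cQ := by
    have := EE_cont
    fun_prop
  dj x v t := by
    have h := (EE_deriv (c • G x) (c • G v) t).const_mul φ
    have := l.hasFDerivAt.comp_hasDerivAt t h
    simpa [Function.comp_def, smul_add, smul_comm c] using this
  dA x v t := by
    have h := ((EE_deriv (c • G x) (c • G v) t).mul_const (c • G v)).const_mul φ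
    have := l.hasFDerivAt.comp_hasDerivAt t h
    simpa [Function.comp_def, smul_add, smul_comm c] using this
  neg x v := by simp
def lD : CB →L[ℝ] ℝ := (innerSL ℝ (JD 1)).comp JD
def lS : CB →L[ℝ] ℝ := (innerSL ℝ (JS 1)).comp JS
lemma lD_apply (f : CB) : lD f = ∫ x, f x ∂νD := by
  change inner ℝ (JD 1) (JD f) = _
  rw [inner_JD_JD]; simp
lemma lS_apply (f : CB) : lS f = ∫ x, f x ∂νS := by
  change inner ℝ (JS 1) (JS f) = _
  rw [inner_JS_JS]; simp
lemma cb_int (f : CB) (μ : Measure BB) [IsFiniteMeasure μ] : Integrable (fun x => f x) μ :=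
  f.continuous.integrable_of_hasCompactSupport (HasCompactSupport.of_compactSpace _)
lemma lD_mono {f g : CB} (h : ∀ x, f x ≤ g x) : lD f ≤ lD g := by
  rw [lD_apply, lD_apply]; exact integral_mono (cb_int f _) (cb_int g _) h
lemma lS_mono {f g : CB} (h : ∀ x, f x ≤ g x) : lS f ≤ lS g := by
  rw [lS_apply, lS_apply]; exact integral_mono (cb_int f _) (cb_int g _) h
lemma inner_JD' (f g : CB) : inner ℝ (JD f) (JD g) = lD (f*g) := by
  rw [inner_JD_JD, lD_apply]; rfl
lemma inner_JS' (f g : CB) : inner ℝ (JS f) (JS g) = lS (f*g) := by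
  rw [inner_JS_JS, lS_apply]; rfl
lemma inner_JD_iot (f g : CB) : inner ℝ (JD f) (iot g) = lD (f*g) := by
  rw [← inner_JD']; rw [iot, add_apply, inner_add_right, inner_JD_JS, add_zero]
lemma inner_JS_iot (f g : CB) : inner ℝ (JS f) (iot g) = lS (f*g) := by
  rw [← inner_JS']; rw [iot, add_apply, inner_add_right, inner_JS_JD, zero_add]
lemma norm_JD_sq (w : CB) : ‖JD w‖^2 = lD (w*w) := by
  rw [← inner_JD', real_inner_self_eq_norm_sq]
lemma norm_JS_sq (w : CB) : ‖JS w‖^2 = lS (w*w) := by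
  rw [← inner_JS', real_inner_self_eq_norm_sq]
lemma cb_abs_le (f : CB) (x : BB) : |f x| ≤ ‖f‖ := f.norm_coe_le_norm x
lemma norm_JD_mul (φ w : CB) : ‖JD (φ*w)‖ ≤ ‖φ‖*‖JD w‖ := by
  refine abs_le_of_sq_le_sq' ?_ (by positivity) |>.2
  rw [mul_pow, norm_JD_sq, norm_JD_sq, ← smul_eq_mul (‖φ‖^2), ← map_smul]
  refine lD_mono fun x => ?_
  have h1 := sq_le_sq' (neg_le_of_abs_le (cb_abs_le φ x)) (le_of_abs_le (cb_abs_le φ x))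
  simp only [ContinuousMap.mul_apply, ContinuousMap.smul_apply, smul_eq_mul]
  nlinarith [mul_le_mul_of_nonneg_right h1 (mul_self_nonneg (w x))]
lemma norm_JS_mul (φ w : CB) : ‖JS (φ*w)‖ ≤ ‖φ‖*‖JS w‖ := by
  refine abs_le_of_sq_le_sq' ?_ (by positivity) |>.2
  rw [mul_pow, norm_JS_sq, norm_JS_sq, ← smul_eq_mul (‖φ‖^2), ← map_smul]
  refine lS_mono fun x => ?_
  have h1 := sq_le_sq' (neg_le_of_abs_le (cb_abs_le φ x)) (le_of_abs_le (cb_abs_le φ x))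
  simp only [ContinuousMap.mul_apply, ContinuousMap.smul_apply, smul_eq_mul]
  nlinarith [mul_le_mul_of_nonneg_right h1 (mul_self_nonneg (w x))]
lemma norm_iot_sq (w : CB) : ‖iot w‖^2 = ‖JD w‖^2 + ‖JS w‖^2 := by
  rw [← real_inner_self_eq_norm_sq, iot, add_apply, inner_add_left, inner_add_right,
    inner_add_right, inner_JD_JS, inner_JS_JD, real_inner_self_eq_norm_sq,
    real_inner_self_eq_norm_sq]; ring
lemma norm_JD_le (w : CB) : ‖JD w‖ ≤ ‖iot w‖ :=
  abs_le_of_sq_le_sq' (by rw [norm_iot_sq]; nlinarith [sq_nonneg ‖JS w‖]) (by positivity) |>.2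
lemma norm_JS_le (w : CB) : ‖JS w‖ ≤ ‖iot w‖ :=
  abs_le_of_sq_le_sq' (by rw [norm_iot_sq]; nlinarith [sq_nonneg ‖JD w‖]) (by positivity) |>.2
lemma tendsto_lD_sq {ι : Type*} {F : Filter ι} {φ w : ι → CB} {φ0 w0 : CB}
    (h1 : Tendsto φ F (𝓝 φ0)) (h2 : Tendsto (fun i => iot (w i)) F (𝓝 (iot w0))) :
    Tendsto (fun i => lD (φ i*(w i*w i))) F (𝓝 (lD (φ0*(w0*w0)))) ∧
    Tendsto (fun i => lS (φ i*(w i*w i))) F (𝓝 (lS (φ0*(w0*w0)))) := by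
  have h3 : Tendsto (fun i => ‖iot (w i - w0)‖) F (𝓝 0) := by
    simpa [map_sub] using tendsto_iff_norm_sub_tendsto_zero.1 h2
  have hφ : Tendsto (fun i => ‖φ i - φ0‖) F (𝓝 0) := tendsto_iff_norm_sub_tendsto_zero.1 h1
  have gen : ∀ (J : CB →L[ℝ] HH), (∀ w, ‖J w‖ ≤ ‖iot w‖) → (∀ φ w, ‖J (φ*w)‖ ≤ ‖φ‖*‖J w‖) →
      Tendsto (fun i => inner ℝ (J (φ i*w i)) (J (w i))) F (𝓝 (inner ℝ (J (φ0*w0)) (J w0))) := by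
    intro J hJ1 hJ2
    have hw : Tendsto (fun i => J (w i)) F (𝓝 (J w0)) := by
      rw [tendsto_iff_norm_sub_tendsto_zero]
      refine squeeze_zero (fun _ => norm_nonneg _) (fun i => ?_) h3
      rw [← map_sub]; exact hJ1 _
    refine Tendsto.inner ?_ hw
    rw [tendsto_iff_norm_sub_tendsto_zero]
    have hb : Tendsto (fun i => ‖φ i - φ0‖*‖J (w i)‖ + ‖φ0‖*‖iot (w i - w0)‖) F (𝓝 0) := by
      simpa using (hφ.mul hw.norm).add (h3.const_mul ‖φ0‖)
    refine squeeze_zero (fun _ => norm_nonneg _) (fun i => ?_) hb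
    have e : J (φ i*w i) - J (φ0*w0) = J ((φ i - φ0)*w i) + J (φ0*(w i - w0)) := by
      rw [← map_sub, ← map_add]; congr 1; ring
    rw [e]
    refine (norm_add_le _ _).trans (add_le_add (hJ2 _ _) ((hJ2 _ _).trans ?_))
    gcongr; exact hJ1 _
  constructor
  · simpa only [inner_JD', mul_assoc] using gen JD norm_JD_le norm_JD_mul
  · simpa only [inner_JS', mul_assoc] using gen JS norm_JS_le norm_JS_mul
end PartH1
section PartH2
open Set Topology
def cbR (v : ℂ → ℝ) (hv : Continuous v) : CB := ⟨fun x => v x, hv.comp continuous_subtype_val⟩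
lemma cbR_apply (v : ℂ → ℝ) (hv : Continuous v) (x : BB) : cbR v hv x = v x := rfl
def tot (q : HH) : ℝ := inner ℝ q (iot 1)
def Den (G : HH →L[ℝ] CB) (q : HH) : ℝ := inner ℝ q (iot (G q)) - tot q^2
structure IsGreen (G : HH →L[ℝ] CB) : Prop where
  cpt : IsCompactOperator G
  symm : ∀ p q, inner ℝ (iot (G p)) q = inner ℝ p (iot (G q))
  pos : ∀ q, q ≠ 0 → 0 < inner ℝ q (iot (G q))
  mean : ∀ q, lS (G q) = 2*π*tot q
  Dnn : ∀ q, 0 ≤ Den G q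
  LM : ∀ q, lS (EE (G q)) ≤ 2*π*exp (tot q + Den G q / (4*π))
  MT : ∃ C > 0, ∀ q, lD (EE ((2:ℝ) • G q)) ≤ C*exp (C*Den G q + 2*tot q)
  C5 : ∀ v (hv : ContDiff ℝ 1 v) q, inner ℝ q (iot (cbR v hv.continuous))^2 ≤
    inner ℝ q (iot (G q))*((∫ x in unitDisk, gradSq v x) + (bint v / (2*π))^2)
def BD (G : HH →L[ℝ] CB) : HH →L[ℝ] HH →L[ℝ] ℝ :=
  (isBoundedBilinearMap_inner (𝕜 := ℝ) (E := HH)).toContinuousLinearMap.comp (iot.comp G) - (innerSL ℝ (iot 1)).smulRight (innerSL ℝ (iot 1))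
lemma BD_apply (G : HH →L[ℝ] CB) (p q : HH) :
    BD G p q = inner ℝ (iot (G p)) q - tot p*tot q := by
  change inner ℝ (iot (G p)) q - inner ℝ (iot 1) p*inner ℝ (iot 1) q = _
  rw [tot, tot, real_inner_comm p (iot 1), real_inner_comm q (iot 1)]
lemma BD_self (G : HH →L[ℝ] CB) (q : HH) : BD G q q = Den G q := by
  rw [BD_apply, Den, real_inner_comm]; ring
lemma BD_symm {G : HH →L[ℝ] CB} (hG : IsGreen G) (p q : HH) : BD G p q = BD G q p := by
  rw [BD_apply, BD_apply, hG.symm, real_inner_comm]; ring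
def j0 (K h : CB) (G : HH →L[ℝ] CB) (q : HH) : ℝ :=
  Den G q / 2 + 2*lS (G q) + lD ((-2:ℝ) • K*EE (G q)) + (-4)*lS (h*EE ((1/2:ℝ) • G q))
def TT (G : HH →L[ℝ] CB) (q : HH) : ℝ := Den G q / 2 + lD (EE (G q)) - lD (G q)
def cK (K : CB) (ε : ℝ) : CB := ε • 1 - (2:ℝ) • K
def AA (K h : CB) (G : HH →L[ℝ] CB) (ε : ℝ) (q v : HH) : ℝ :=
  (1 + ε)*BD G q v + 2*lS (G v) - ε*lD (G v) + lD (cK K ε*EE (G q)*G v)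
    - 2*lS (h*EE ((1/2:ℝ) • G q)*G v)
def QQ (K h : CB) (G : HH →L[ℝ] CB) (ε : ℝ) (q v : HH) : ℝ :=
  (1 + ε)*Den G v + lD (cK K ε*EE (G q)*(G v*G v))
    - lS (h*EE ((1/2:ℝ) • G q)*(G v*G v))
lemma line_j (K h : CB) {G : HH →L[ℝ] CB} (hG : IsGreen G) (ε : ℝ) :
    LineC2 (fun q => j0 K h G q + ε*TT G q) (AA K h G ε) (QQ K h G ε) := by
  have h1 := (((LineC2.quad (BD G) (BD_symm hG)).cmul (1 + ε)).add (((LineC2.lin (lS.comp G)).cmul 2).add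
    ((LineC2.lin (lD.comp G)).cmul (-ε)))).add ((LineC2.expt lD (cK K ε) 1 G).add
    ((LineC2.expt lS h (1/2) G).cmul (-4)))
  convert h1 using 1
  · funext q
    have : cK K ε*EE (G q) = (-2:ℝ) • K*EE (G q) + ε • EE (G q) := by
      rw [cK, sub_mul, smul_mul_assoc, one_mul, smul_mul_assoc, smul_mul_assoc, neg_smul]; abel
    simp only [j0, TT, BD_self, ContinuousLinearMap.comp_apply, one_smul, this, map_add, map_smul,
      smul_eq_mul]
    ring
  · funext q v
    simp only [AA, ContinuousLinearMap.comp_apply, one_smul, mul_smul_comm, map_smul, smul_eq_mul,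
      mul_assoc]
    ring
  · funext q v
    simp only [QQ, one_smul, mul_smul_comm, smul_mul_assoc, map_smul, smul_eq_mul, mul_assoc, BD_self]
    ring
def FF (K h : CB) (ε : ℝ) (u : CB) : HH :=
  JD ((1 + ε)⁻¹ • (ε • 1 - cK K ε*EE u)) +
  JS ((1 + ε)⁻¹ • ((2:ℝ) • (h*EE ((1/2:ℝ) • u)) - (2:ℝ) • 1) + (lS u / (4*π^2)) • 1)
lemma AA_eq (K h : CB) {G : HH →L[ℝ] CB} (hG : IsGreen G) {ε : ℝ} (hε : 0 < ε) (q v : HH) :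
    AA K h G ε q v = (1 + ε)*inner ℝ (q - FF K h ε (G q)) (iot (G v)) := by
  have h1 : (1 + ε) ≠ 0 := by positivity
  have hpi := pi_ne_zero
  rw [inner_sub_left, FF, inner_add_left, inner_JD_iot, inner_JS_iot]
  simp only [smul_mul_assoc, map_smul, smul_eq_mul, sub_mul, one_mul, map_sub, add_mul, map_add]
  rw [AA, BD_apply, hG.symm, hG.mean, hG.mean, mul_assoc (cK K ε), mul_assoc h]
  field_simp
  ring
/-! ### finite-dimensional invariant subspaces -/
def Ev (G : HH →L[ℝ] CB) : Set HH := {v | ∃ l : ℝ, 0 < l ∧ iot (G v) = l • v}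
def VV (G : HH →L[ℝ] CB) (t : Finset (Ev G)) : Submodule ℝ HH :=
  Submodule.span ℝ (Subtype.val '' (t : Set (Ev G)))
instance (G : HH →L[ℝ] CB) (t : Finset (Ev G)) : FiniteDimensional ℝ (VV G t) :=
  FiniteDimensional.span_of_finite ℝ (t.finite_toSet.image _)
lemma VV_mono (G : HH →L[ℝ] CB) : Monotone (VV G) := fun _ _ h =>
  Submodule.span_mono (image_mono (by exact_mod_cast h))
lemma VV_surj (G : HH →L[ℝ] CB) (t : Finset (Ev G)) : ∀ w ∈ VV G t, ∃ p ∈ VV G t, iot (G p) = w := by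
  intro w hw
  induction hw using Submodule.span_induction with
  | mem x hx =>
    obtain ⟨v, hv, rfl⟩ := hx
    obtain ⟨l, hl, h⟩ := v.2
    refine ⟨l⁻¹ • v, Submodule.smul_mem _ _ (Submodule.subset_span ⟨v, hv, rfl⟩), ?_⟩
    rw [map_smul, map_smul, h, smul_smul, inv_mul_cancel₀ hl.ne', one_smul]
  | zero => exact ⟨0, Submodule.zero_mem _, by simp⟩
  | add x y _ _ h1 h2 =>
    obtain ⟨p, hp, rfl⟩ := h1
    obtain ⟨p', hp', rfl⟩ := h2
    exact ⟨p + p', Submodule.add_mem _ hp hp', by simp⟩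
  | smul c x _ h1 =>
    obtain ⟨p, hp, rfl⟩ := h1
    exact ⟨c • p, Submodule.smul_mem _ _ hp, by simp⟩
lemma VV_dense {G : HH →L[ℝ] CB} (hG : IsGreen G) : ⊤ ≤ (⨆ t, VV G t).topologicalClosure := by
  have h1 : IsCompactOperator (iot.comp G) := hG.cpt.clm_comp iot
  have h2 : (iot.comp G).IsSymmetric := fun p q => hG.symm p q
  have h3 := ContinuousLinearMap.orthogonalComplement_iSup_eigenspaces_eq_bot h1 h2
  rw [← Submodule.topologicalClosure_eq_top_iff] at h3
  rw [← h3]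
  apply Submodule.topologicalClosure_mono
  refine iSup_le fun μ v hv => ?_
  by_cases hv0 : v = 0
  · rw [hv0]; exact Submodule.zero_mem _
  have hv' : iot (G v) = μ • v := Module.End.mem_eigenspace_iff.1 hv
  have hμ : 0 < μ := by
    have := hG.pos v hv0
    rw [hv', real_inner_smul_right, real_inner_self_eq_norm_sq] at this
    have h5 : 0 < ‖v‖^2 := by positivity
    exact pos_of_mul_pos_left this h5.le
  let e : Ev G := ⟨v, μ, hμ, hv'⟩
  exact Submodule.mem_iSup_of_mem {e} (Submodule.subset_span ⟨e, by simp, rfl⟩)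
lemma VV_proj {G : HH →L[ℝ] CB} (hG : IsGreen G) (x : HH) :
    Tendsto (fun t => (VV G t).starProjection x) atTop (𝓝 x) :=
  Submodule.starProjection_tendsto_self _ (VV_mono G) x (VV_dense hG)
lemma crit_eq (K h : CB) {G : HH →L[ℝ] CB} (hG : IsGreen G) {ε : ℝ} (hε : 0 < ε)
    {t : Finset (Ev G)} {q : HH} (hq : q ∈ VV G t) (hA : ∀ v ∈ VV G t, AA K h G ε q v = 0) :
    q = (VV G t).starProjection (FF K h ε (G q)) := by
  refine (Submodule.eq_starProjection_of_mem_of_inner_eq_zero hq fun w hw => ?_).symm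
  obtain ⟨p, hp, rfl⟩ := VV_surj G t w hw
  have := hA p hp
  rw [AA_eq K h hG hε, mul_eq_zero] at this
  rcases this with h | h
  · linarith
  · rw [inner_sub_left] at h ⊢; linarith
end PartH2
section PartH3
open Set Topology
lemma EE_mul_self (u : CB) : EE u*EE u = EE ((2:ℝ) • u) := by
  ext x; simp only [ContinuousMap.mul_apply, EE_apply, ContinuousMap.smul_apply, smul_eq_mul,
    ← Real.exp_add]; ring_nf
lemma EE_half_mul (u : CB) : EE ((1/2:ℝ) • u)*EE ((1/2:ℝ) • u) = EE u := by
  rw [EE_mul_self, smul_smul]; norm_num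
lemma abs_le_exp_sub (x : ℝ) : |x| ≤ Real.exp x - x := by
  rw [abs_le]
  constructor
  · linarith [Real.exp_pos x]
  · rcases le_or_gt x 0 with h | h
    · linarith [Real.exp_pos x]
    · have h1 := Real.add_one_le_exp (x / 2)
      have h2 : Real.exp x = Real.exp (x/2)*Real.exp (x/2) := by rw [← Real.exp_add]; ring_nf
      nlinarith [sq_nonneg (x/2 - 1)]
lemma TT_bd {G : HH →L[ℝ] CB} (q : HH) : Den G q / 2 + |lD (G q)| ≤ TT G q := by
  have h1 : |lD (G q)| ≤ lD (EE (G q) - G q) := by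
    rw [abs_le]
    constructor
    · have : lD (-(EE (G q) - G q)) ≤ lD (G q) := lD_mono fun x => by
        have := (abs_le.1 (abs_le_exp_sub (G q x))).1
        simp only [ContinuousMap.neg_apply, ContinuousMap.sub_apply, EE_apply]; linarith
      simpa using this
    · exact lD_mono fun x => by
        have := (abs_le.1 (abs_le_exp_sub (G q x))).2
        simpa only [ContinuousMap.sub_apply, EE_apply] using this
  rw [TT]; rw [map_sub] at h1; linarith
lemma TT_nonneg {G : HH →L[ℝ] CB} (hG : IsGreen G) (q : HH) : 0 ≤ TT G q := by
  have := TT_bd (G := G) q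
  have := hG.Dnn q
  have := abs_nonneg (lD (G q))
  linarith
lemma tot_JD1 : tot (JD 1) = π := by
  rw [tot, inner_JD_iot, one_mul, lD_apply]; simp [νD_univ]
lemma tot_bd {G : HH →L[ℝ] CB} (hG : IsGreen G) (M : ℝ) :
    ∃ R, ∀ q, TT G q ≤ M → |tot q| ≤ R := by
  refine ⟨(M + (Den G (JD 1) + 2*M) / 2) / π, fun q hq => ?_⟩
  have h0 := TT_bd (G := G) q
  have hD := hG.Dnn q
  have h1 : BD G (JD 1) q = lD (G q) - π*tot q := by
    rw [BD_apply, hG.symm, inner_JD_iot, one_mul, tot_JD1]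
  have e1 := hG.Dnn (JD 1 + q)
  have e2 := hG.Dnn (JD 1 - q)
  rw [← BD_self] at e1 e2
  simp only [map_add, map_sub, add_apply, sub_apply, BD_self, BD_symm hG q (JD 1)] at e1 e2
  have h2 := neg_abs_le (lD (G q))
  have h3 := le_abs_self (lD (G q))
  have h5 : |tot q| * π = |tot q*π| := by rw [abs_mul, abs_of_pos pi_pos]
  rw [le_div_iff₀ pi_pos, h5, abs_le]
  have h4 := abs_nonneg (lD (G q))
  constructor <;> linarith
lemma TT_cont {G : HH →L[ℝ] CB} : Continuous (TT G) := by
  have h1 : Continuous (Den G) := by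
    have : Continuous (fun q => BD G q q) := by fun_prop
    simpa only [BD_self] using this
  have := EE_cont
  unfold TT; fun_prop
lemma VV_compact {G : HH →L[ℝ] CB} (hG : IsGreen G) (t : Finset (Ev G)) (M : ℝ) :
    IsCompact {x : VV G t | TT G x ≤ M} := by
  have hcl : IsClosed {x : VV G t | TT G x ≤ M} :=
    isClosed_le (TT_cont.comp continuous_subtype_val) continuous_const
  obtain ⟨R, hR⟩ := tot_bd hG M
  have hl : ∃ l > 0, ∀ x : VV G t, l*‖x‖^2 ≤ inner ℝ (x:HH) (iot (G x)) := by
    have hc : Continuous (fun x : VV G t => inner ℝ (x:HH) (iot (G x))) := by fun_prop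
    rcases (Metric.sphere (0 : VV G t) 1).eq_empty_or_nonempty with h | h
    · refine ⟨1, one_pos, fun x => ?_⟩
      by_cases hx : x = 0
      · simp [hx]
      · have : (‖x‖⁻¹ • x) ∈ Metric.sphere (0 : VV G t) 1 := by
          rw [mem_sphere_zero_iff_norm, norm_smul, norm_inv, norm_norm,
            inv_mul_cancel₀ (norm_ne_zero_iff.2 hx)]
        rw [h] at this; exact this.elim
    · obtain ⟨z, hz, hz2⟩ := (isCompact_sphere (0 : VV G t) 1).exists_isMinOn h hc.continuousOn
      have hz0 : (z : HH) ≠ 0 := by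
        intro h0
        have : z = 0 := by ext1; exact h0
        simp [this] at hz
      refine ⟨_, hG.pos z hz0, fun x => ?_⟩
      by_cases hx : x = 0
      · simp [hx]
      · have hx' : ‖x‖ ≠ 0 := norm_ne_zero_iff.2 hx
        have := hz2 (show (‖x‖⁻¹ • x) ∈ Metric.sphere (0 : VV G t) 1 by
          rw [mem_sphere_zero_iff_norm, norm_smul, norm_inv, norm_norm, inv_mul_cancel₀ hx'])
        simp only [mem_ofPred_eq, Submodule.coe_smul, map_smul, real_inner_smul_left,
          real_inner_smul_right] at this
        have h2 : 0 < ‖x‖ := norm_pos_iff.2 hx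
        calc _ ≤ (‖x‖⁻¹*(‖x‖⁻¹*inner ℝ (x:HH) (iot (G x))))*‖x‖^2 := by gcongr
          _ = _ := by field_simp
  obtain ⟨l, hl, hl2⟩ := hl
  refine (Metric.isCompact_of_isClosed_isBounded hcl ?_)
  refine (Metric.isBounded_closedBall (x := (0 : VV G t)) (r := √((2*M + R^2) / l))).subset ?_
  intro x hx
  have hx : TT G x ≤ M := hx
  have h1 := TT_bd (G := G) (x : HH)
  have h2 := abs_nonneg (lD (G x))
  have h3 := sq_le_sq' (neg_le_of_abs_le (hR x hx)) (le_of_abs_le (hR x hx))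
  have h4 := hl2 x
  have h5 : inner ℝ (x:HH) (iot (G x)) = Den G x + tot (x:HH)^2 := by rw [Den]; ring
  simp only [Metric.mem_closedBall, dist_zero_right]
  apply Real.le_sqrt_of_sq_le
  rw [le_div_iff₀ hl]; linarith
lemma expbd {G : HH →L[ℝ] CB} (hG : IsGreen G) (M R : ℝ) :
    ∃ B, ∀ q, Den G q ≤ M → |tot q| ≤ R →
      ‖JD (EE (G q))‖ ≤ B ∧ ‖JS (EE ((1/2:ℝ) • G q))‖ ≤ B := by
  obtain ⟨C, hC, hMT⟩ := hG.MT
  refine ⟨max √(C*exp (C*M + 2*R)) √(2*π*exp (R + M / (4*π))), fun q h1 h2 => ⟨?_, ?_⟩⟩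
  · refine le_max_of_le_left (Real.le_sqrt_of_sq_le ?_)
    rw [norm_JD_sq, EE_mul_self]
    have := le_of_abs_le h2
    exact (hMT q).trans (by gcongr)
  · refine le_max_of_le_right (Real.le_sqrt_of_sq_le ?_)
    rw [norm_JS_sq, EE_half_mul]
    have := le_of_abs_le h2
    exact (hG.LM q).trans (by gcongr)
lemma FF_bd (K h : CB) {G : HH →L[ℝ] CB} (hG : IsGreen G) (M β : ℝ) :
    ∃ B, ∀ ε q, 0 < ε → ε ≤ β → TT G q ≤ M → ‖FF K h ε (G q)‖ ≤ B := by
  obtain ⟨R, hR⟩ := tot_bd hG M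
  obtain ⟨B, hB⟩ := expbd hG (2*M) R
  refine ⟨(β*‖JD 1‖ + (β*‖(1:CB)‖ + 2*‖K‖)*B) +
    (2*(‖h‖*B) + 2*‖JS 1‖ + R / (2*π)*‖JS 1‖), fun ε q hε hεβ hq => ?_⟩
  have hD : Den G q ≤ 2*M := by
    have := TT_bd (G := G) q
    have := abs_nonneg (lD (G q))
    linarith
  have ht := hR q hq
  obtain ⟨b1, b2⟩ := hB q hD ht
  have hB0 : 0 ≤ B := (norm_nonneg _).trans b1
  have hinv : ‖(1 + ε)⁻¹‖ ≤ 1 := by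
    rw [norm_inv, Real.norm_of_nonneg (by linarith)]; exact inv_le_one_of_one_le₀ (by linarith)
  have gen : ∀ x : HH, ‖(1 + ε)⁻¹ • x‖ ≤ ‖x‖ := fun x => by
    rw [norm_smul]; exact mul_le_of_le_one_left (norm_nonneg _) hinv
  have hε' : ‖ε‖ ≤ β := by rw [Real.norm_of_nonneg hε.le]; exact hεβ
  rw [FF]
  refine (norm_add_le _ _).trans (add_le_add ?_ ?_)
  · rw [map_smul]
    refine (gen _).trans ?_
    rw [map_sub, map_smul]
    refine (norm_sub_le _ _).trans (add_le_add ?_ ?_)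
    · rw [norm_smul]; gcongr
    · refine (norm_JD_mul _ _).trans ?_
      have : ‖cK K ε‖ ≤ β*‖(1:CB)‖ + 2*‖K‖ := by
        rw [cK]
        refine (norm_sub_le _ _).trans ?_
        rw [norm_smul, norm_smul, Real.norm_ofNat]; gcongr
      have h0 := (norm_nonneg _).trans this
      gcongr
  · rw [map_add, map_smul, map_smul]
    refine (norm_add_le _ _).trans (add_le_add ?_ ?_)
    · refine (gen _).trans ?_
      rw [map_sub, map_smul, map_smul]
      refine (norm_sub_le _ _).trans ?_
      rw [norm_smul, norm_smul, Real.norm_ofNat]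
      have := norm_JS_mul h (EE ((1/2:ℝ) • G q))
      gcongr
      exact this.trans (by gcongr)
    · rw [norm_smul, hG.mean]
      have : ‖2*π*tot q / (4*π^2)‖ ≤ R / (2*π) := by
        have e : 2*π*tot q / (4*π^2) = tot q / (2*π) := by
          field_simp; ring
        rw [e, norm_div, Real.norm_eq_abs, Real.norm_of_nonneg (by positivity : 0 ≤ 2*π)]
        gcongr
      gcongr
lemma exp_est (J : CB →L[ℝ] HH) (l : CB →L[ℝ] ℝ) (hJ : ∀ f g, inner ℝ (J f) (J g) = l (f*g))
    (hl : ∀ f g : CB, (∀ x, f x ≤ g x) → l f ≤ l g)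
    (hJ2 : ∀ φ w, ‖J (φ*w)‖ ≤ ‖φ‖*‖J w‖) (φ u v : CB) :
    |l (φ*EE u) - l (φ*EE v)| ≤ ‖φ‖*‖J (u - v)‖*(‖J (EE u)‖ + ‖J (EE v)‖) := by
  have hpt : ∀ x, |(φ*(EE u - EE v)) x| ≤ (|φ*(u - v)| * (EE u + EE v)) x := fun x => by
    simp only [ContinuousMap.mul_apply, ContinuousMap.sub_apply, ContinuousMap.add_apply, EE_apply,
      ContinuousMap.abs_apply, abs_mul, mul_assoc]
    gcongr
    set a := u x
    set b := v x
    have key : ∀ a b : ℝ, Real.exp a - Real.exp b ≤ |a - b| * (Real.exp a + Real.exp b) := by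
      intro a b
      have h1 := Real.add_one_le_exp (b - a)
      have h2 : Real.exp b = Real.exp a*Real.exp (b - a) := by rw [← Real.exp_add]; ring_nf
      nlinarith [Real.exp_pos a, Real.exp_pos b, le_abs_self (a - b), abs_nonneg (a - b)]
    rw [abs_le]
    have := key a b
    have := key b a
    rw [abs_sub_comm b a] at this
    constructor <;> nlinarith
  have h1 : |l (φ*(EE u - EE v))| ≤ l (|φ*(u - v)| * (EE u + EE v)) := by
    rw [abs_le]
    constructor
    · rw [← map_neg]
      exact hl _ _ fun x => (abs_le.1 (hpt x)).1
    · exact hl _ _ fun x => (abs_le.1 (hpt x)).2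
  have h2 : ‖J |φ*(u - v)|‖ = ‖J (φ*(u - v))‖ := by
    rw [← sq_eq_sq₀ (norm_nonneg _) (norm_nonneg _), ← real_inner_self_eq_norm_sq,
      ← real_inner_self_eq_norm_sq, hJ, hJ]
    congr 1; ext x
    simp only [ContinuousMap.mul_apply, ContinuousMap.abs_apply, abs_mul_abs_self]
  rw [← map_sub, ← mul_sub]
  refine h1.trans ?_
  rw [← hJ]
  refine (real_inner_le_norm _ _).trans ?_
  rw [h2, map_add]
  gcongr
  · exact hJ2 _ _
  · exact norm_add_le _ _
end PartH3
section PartH4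
open Set Topology
lemma lS_cbR (v : ℂ → ℝ) (hv : Continuous v) : lS (cbR v hv) = bint v := by
  rw [lS_apply, ← integral_νS' v (hv.comp continuous_subtype_val)]; rfl
lemma lS_eq_inner (u : CB) : lS u = inner ℝ (iot u) (JS 1) := by
  rw [real_inner_comm, inner_JS_iot, one_mul]
lemma lD_eq_inner (u : CB) : lD u = inner ℝ (iot u) (JD 1) := by
  rw [real_inner_comm, inner_JD_iot, one_mul]
lemma appr_bd {G : HH →L[ℝ] CB} (hG : IsGreen G) (v : ℂ → ℝ) (hv : ContDiff ℝ 1 v) {t : Finset (Ev G)}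
    {p : HH} (hp : p ∈ VV G t) (hp2 : iot (G p) = (VV G t).starProjection (iot (cbR v hv.continuous))) :
    Den G p ≤ (∫ x in unitDisk, gradSq v x) + (bint v / (2*π))^2 - tot p^2 := by
  have h1 : inner ℝ p (iot (G p)) = inner ℝ p (iot (cbR v hv.continuous)) := by
    rw [hp2, ← Submodule.inner_starProjection_left_eq_right,
      Submodule.starProjection_eq_self_iff.2 hp]
  have h2 := hG.C5 v hv p
  rw [← h1] at h2
  rw [Den]
  set I := inner ℝ p (iot (G p)) with hI
  have h3 : 0 ≤ I := by
    have := hG.Dnn p; rw [Den, ← hI] at this; nlinarith [sq_nonneg (tot p)]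
  have h4 : I ≤ (∫ x in unitDisk, gradSq v x) + (bint v / (2*π))^2 := by
    rcases h3.eq_or_lt with h | h
    · rw [← h]
      have : 0 ≤ ∫ x in unitDisk, gradSq v x := integral_nonneg fun x => by
        unfold gradSq; positivity
      positivity
    · nlinarith
  linarith
lemma appr {G : HH →L[ℝ] CB} (hG : IsGreen G) (v : ℂ → ℝ) (hv : ContDiff ℝ 1 v) :
    ∃ p : Finset (Ev G) → HH, (∀ t, p t ∈ VV G t) ∧
      Tendsto (fun t => iot (G (p t))) atTop (𝓝 (iot (cbR v hv.continuous))) ∧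
      (∀ t, Den G (p t) ≤ (∫ x in unitDisk, gradSq v x) + (bint v / (2*π))^2 - tot (p t)^2) ∧
      ∀ t, iot (G (p t)) = (VV G t).starProjection (iot (cbR v hv.continuous)) := by
  choose p hp hp2 using fun t => VV_surj G t ((VV G t).starProjection (iot (cbR v hv.continuous)))
    (Submodule.starProjection_apply_mem _ _)
  refine ⟨p, hp, ?_, fun t => appr_bd hG v hv (hp t) (hp2 t), hp2⟩
  simp only [hp2]; exact VV_proj hG _
lemma tendsto_tot {ι : Type*} {F : Filter ι} {G : HH →L[ℝ] CB} (hG : IsGreen G) {p : ι → HH} {w : CB}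
    (h : Tendsto (fun t => iot (G (p t))) F (𝓝 (iot w))) :
    Tendsto (fun t => tot (p t)) F (𝓝 (lS w / (2*π))) := by
  have h1 : ∀ t, tot (p t) = inner ℝ (iot (G (p t))) (JS 1) / (2*π) := fun t => by
    rw [← lS_eq_inner, hG.mean]; field_simp
  simp only [h1, lS_eq_inner w]
  exact (h.inner tendsto_const_nhds).div_const _
lemma tendsto_exp {ι : Type*} {F : Filter ι} (J : CB →L[ℝ] HH) (l : CB →L[ℝ] ℝ)
    (hJ : ∀ f g, inner ℝ (J f) (J g) = l (f*g))
    (hl : ∀ f g : CB, (∀ x, f x ≤ g x) → l f ≤ l g)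
    (hJ2 : ∀ φ w, ‖J (φ*w)‖ ≤ ‖φ‖*‖J w‖) (hJ3 : ∀ w, ‖J w‖ ≤ ‖iot w‖) (φ : CB)
    {u : ι → CB} {w : CB} (h : Tendsto (fun t => iot (u t)) F (𝓝 (iot w))) (B : ℝ)
    (hB : ∀ t, ‖J (EE (u t))‖ ≤ B) :
    Tendsto (fun t => l (φ*EE (u t))) F (𝓝 (l (φ*EE w))) := by
  rw [tendsto_iff_dist_tendsto_zero]
  have h1 : Tendsto (fun t => ‖φ‖*‖iot (u t) - iot w‖*(B + ‖J (EE w)‖)) F (𝓝 0) := by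
    have := ((tendsto_iff_norm_sub_tendsto_zero.1 h).const_mul ‖φ‖).mul_const (B + ‖J (EE w)‖)
    simpa using this
  refine squeeze_zero (fun _ => dist_nonneg) (fun t => ?_) h1
  rw [Real.dist_eq]
  refine (exp_est J l hJ hl hJ2 φ (u t) w).trans ?_
  have := hJ3 (u t - w)
  rw [map_sub iot] at this
  have := hB t
  gcongr
def Jv (K h : CB) (β : ℝ) (v : ℂ → ℝ) (w : CB) : ℝ :=
  (1 + β) / 2*(∫ x in unitDisk, gradSq v x) + 2*lS w - β*lD w + lD (cK K β*EE w)
    - 4*lS (h*EE ((1/2:ℝ) • w))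
lemma jb_eq (K h : CB) (G : HH →L[ℝ] CB) (β : ℝ) (q : HH) :
    j0 K h G q + β*TT G q = (1 + β) / 2*Den G q + 2*lS (G q) - β*lD (G q)
      + lD (cK K β*EE (G q)) - 4*lS (h*EE ((1/2:ℝ) • G q)) := by
  have : cK K β*EE (G q) = (-2:ℝ) • K*EE (G q) + β • EE (G q) := by
    rw [cK, sub_mul, smul_mul_assoc, one_mul, smul_mul_assoc, smul_mul_assoc, neg_smul]; abel
  rw [j0, TT, this, map_add, map_smul, smul_eq_mul]; ring
lemma endpt (K h : CB) {G : HH →L[ℝ] CB} (hG : IsGreen G) {β m : ℝ} (hβ : 0 < β)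
    (v : ℂ → ℝ) (hv : ContDiff ℝ 1 v) (hm : Jv K h β v (cbR v hv.continuous) < m) :
    ∃ p : Finset (Ev G) → HH, (∀ t, p t ∈ VV G t) ∧ (∀ᶠ t in atTop, j0 K h G (p t) + β*TT G (p t) < m) ∧
      Tendsto (fun t => lS (EE ((1/2:ℝ) • G (p t)))) atTop
        (𝓝 (lS (EE ((1/2:ℝ) • cbR v hv.continuous)))) := by
  obtain ⟨p, hp, ht, hD, -⟩ := appr hG v hv
  set w := cbR v hv.continuous with hw
  set D := ∫ x in unitDisk, gradSq v x
  set a := D + (bint v / (2*π))^2 with ha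
  have htot := tendsto_tot hG ht
  obtain ⟨B, hB⟩ := expbd hG a √a
  have hb : ∀ t, ‖JD (EE (G (p t)))‖ ≤ B ∧ ‖JS (EE ((1/2:ℝ) • G (p t)))‖ ≤ B := fun t => by
    refine hB _ ?_ (Real.abs_le_sqrt ?_)
    · nlinarith [hD t, sq_nonneg (tot (p t))]
    · nlinarith [hD t, hG.Dnn (p t)]
  have e1 := fun φ => tendsto_exp JD lD inner_JD' (fun _ _ h => lD_mono h) norm_JD_mul norm_JD_le φ ht B
    (fun t => (hb t).1)
  have ht2 : Tendsto (fun t => iot ((1/2:ℝ) • G (p t))) atTop (𝓝 (iot ((1/2:ℝ) • w))) := by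
    simp only [map_smul]; exact ht.const_smul _
  have e2 := fun φ => tendsto_exp JS lS inner_JS' (fun _ _ h => lS_mono h) norm_JS_mul norm_JS_le φ ht2 B
    (fun t => (hb t).2)
  refine ⟨p, hp, ?_, ?_⟩
  · have k1 : Tendsto (fun t => lS (G (p t))) atTop (𝓝 (lS w)) := by
      simp only [lS_eq_inner]; exact ht.inner tendsto_const_nhds
    have k2 : Tendsto (fun t => lD (G (p t))) atTop (𝓝 (lD w)) := by
      simp only [lD_eq_inner]; exact ht.inner tendsto_const_nhds
    have k3 : Tendsto (fun t => a - tot (p t)^2) atTop (𝓝 D) := by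
      have := (htot.pow 2).const_sub a
      rw [hw, lS_cbR, ha, add_sub_cancel_right] at this
      exact this
    have k4 := ((((k3.const_mul ((1 + β) / 2)).add (k1.const_mul 2)).sub (k2.const_mul β)).add
      (e1 (cK K β))).sub ((e2 h).const_mul 4)
    filter_upwards [k4.eventually_lt_const hm] with t h1
    refine lt_of_le_of_lt ?_ h1
    rw [jb_eq]
    have := hD t
    gcongr
  · simpa only [one_mul] using e2 1
lemma lD_nonneg {f : CB} (h : ∀ x, 0 ≤ f x) : 0 ≤ lD f := by
  rw [← map_zero lD]; exact lD_mono h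
lemma sep_low (K h : CB) {G : HH →L[ℝ] CB} (hG : IsGreen G) (hK : ∀ x, K x ≤ 0) {q : HH}
    (hq : lS (EE ((1/2:ℝ) • G q)) = 2*π) : -(8*π*‖h‖) ≤ j0 K h G q := by
  have h1 := hG.LM ((1/2:ℝ) • q)
  have h2 : Den G ((1/2:ℝ) • q) = Den G q / 4 := by
    rw [← BD_self, ← BD_self, map_smul, map_smul, smul_apply, smul_eq_mul, smul_eq_mul]; ring
  have h3 : tot ((1/2:ℝ) • q) = tot q / 2 := by rw [tot, tot, real_inner_smul_left]; ring
  rw [map_smul, hq, h2, h3] at h1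
  have h4 : 1 ≤ exp (tot q / 2 + Den G q / 4 / (4*π)) := by
    by_contra hc
    push Not at hc
    nlinarith [pi_pos]
  rw [Real.one_le_exp_iff] at h4
  have h5 : 0 ≤ 4*π*tot q + Den G q / 2 := by
    have : 4*π*tot q + Den G q / 2 = (tot q / 2 + Den G q / 4 / (4*π))*(8*π) := by
      field_simp; ring
    rw [this]; positivity
  have h6 : 0 ≤ lD ((-2:ℝ) • K*EE (G q)) := lD_nonneg fun x => by
    simp only [ContinuousMap.mul_apply, ContinuousMap.smul_apply, smul_eq_mul, EE_apply]
    have := hK x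
    have : 0 ≤ -2*K x := by linarith
    positivity
  have h7 : lS (h*EE ((1/2:ℝ) • G q)) ≤ lS (‖h‖ • EE ((1/2:ℝ) • G q)) := lS_mono fun x => by
    simp only [ContinuousMap.mul_apply, ContinuousMap.smul_apply, smul_eq_mul, EE_apply]
    have := le_of_abs_le (cb_abs_le h x)
    gcongr
  rw [map_smul, hq, smul_eq_mul] at h7
  rw [j0, hG.mean]
  linarith
lemma sep_join (K h : CB) {G : HH →L[ℝ] CB} (hG : IsGreen G) (hK : ∀ x, K x ≤ 0)
    (V : Submodule ℝ HH) {a b : V}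
    (ha : lS (EE ((1/2:ℝ) • G a)) < 2*π) (hb : 2*π < lS (EE ((1/2:ℝ) • G b))) :
    ¬ JoinedIn {x : V | j0 K h G x < -(8*π*‖h‖)} a b := by
  rintro ⟨γ, hγ⟩
  have hc : Continuous (fun s => lS (EE ((1/2:ℝ) • G (γ s)))) := by
    have := EE_cont
    fun_prop
  obtain ⟨s, hs⟩ := intermediate_value_univ (0 : unitInterval) 1 hc (show 2*π ∈ _ from
    ⟨by rw [γ.source]; exact ha.le, by rw [γ.target]; exact hb.le⟩)
  exact absurd (hγ s) (not_lt.2 (sep_low K h hG hK hs))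
lemma line_sub (K h : CB) {G : HH →L[ℝ] CB} (hG : IsGreen G) (ε : ℝ) (V : Submodule ℝ HH) :
    LineC2 (fun q : V => j0 K h G q + ε*TT G q) (fun q v => AA K h G ε q v) (fun q v => QQ K h G ε q v) := 
  (line_j K h hG ε).comp V.subtypeL
lemma galerkin (K h : CB) {G : HH →L[ℝ] CB} (hG : IsGreen G) (hK : ∀ x, K x ≤ 0) {α β : ℝ} (hα : 0 < α)
    (hαβ : α < β) (va vb : ℂ → ℝ) (hva : ContDiff ℝ 1 va) (hvb : ContDiff ℝ 1 vb)
    (ja : Jv K h β va (cbR va hva.continuous) < -(8*π*‖h‖))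
    (jb : Jv K h β vb (cbR vb hvb.continuous) < -(8*π*‖h‖))
    (la : lS (EE ((1/2:ℝ) • cbR va hva.continuous)) < 2*π)
    (lb : 2*π < lS (EE ((1/2:ℝ) • cbR vb hvb.continuous))) :
    ∃ M, ∃ t0, ∀ t ≥ t0, ∃ ε ∈ Icc α β, ∃ q : HH, q ∈ VV G t ∧ TT G q ≤ M ∧
      (∀ v ∈ VV G t, AA K h G ε q v = 0) ∧ ∀ p1 ∈ VV G t, ∀ p2 ∈ VV G t,
        ∃ x y : ℝ, x^2 + y^2 = 1 ∧ 0 ≤ QQ K h G ε q (x • p1 + y • p2) := by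
  obtain ⟨pa, pa1, pa2, pa3⟩ := endpt K h hG (hα.trans hαβ) va hva ja
  obtain ⟨pb, pb1, pb2, pb3⟩ := endpt K h hG (hα.trans hαβ) vb hvb jb
  obtain ⟨t0, ha, hb, ha', hb'⟩ := (pa2.and (pb2.and ((pa3.eventually_lt_const la).and
    (pb3.eventually_const_lt lb)))).exists
  have hcj : Continuous (fun q => j0 K h G q + β*TT G q) := (line_j K h hG β).cj
  have hsc : IsCompact (segment ℝ (pa t0) (pb t0)) := by
    rw [segment_eq_image]; exact isCompact_Icc.image (by fun_prop)
  obtain ⟨C, hC⟩ := hsc.bddAbove_image hcj.continuousOn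
  refine ⟨(C - -(8*π*‖h‖) + 1) / (β - α) + 1, t0, fun t ht => ?_⟩
  let A : VV G t := ⟨pa t0, VV_mono G ht (pa1 t0)⟩
  let B : VV G t := ⟨pb t0, VV_mono G ht (pb1 t0)⟩
  have hup : JoinedIn {x : VV G t | j0 K h G x + β*TT G x ≤ C} A B := by
    have hs : JoinedIn (segment ℝ A B) A B := (convex_segment A B).isPathConnected
      ⟨A, left_mem_segment ℝ A B⟩ |>.joinedIn _ (left_mem_segment ℝ A B) _ (right_mem_segment ℝ A B)
    refine hs.mono fun z hz => hC ⟨z, ?_, rfl⟩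
    obtain ⟨x, y, hx, hy, hxy, rfl⟩ := hz
    exact ⟨x, y, hx, hy, hxy, rfl⟩
  obtain ⟨ε, hε, p, hT, hA, hQ⟩ := struwe (V := VV G t) (j0 := fun q => j0 K h G q) (T := fun q => TT G q)
    (A := fun ε q v => AA K h G ε q v) (Q := fun ε q v => QQ K h G ε q v) (m := -(8*π*‖h‖)) (C := C)
    (a := A) (b := B) hαβ hα.le (fun ε _ => line_sub K h hG ε (VV G t)) (fun x => TT_nonneg hG _)
    (VV_compact hG t _) (sep_join K h hG hK _ ha' hb') ha hb hup
  refine ⟨ε, hε, p, p.2, hT, fun v hv => hA ⟨v, hv⟩, fun p1 h1 p2 h2 => ?_⟩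
  push Not at hQ
  obtain ⟨x, y, hxy, hq⟩ := hQ ⟨p1, h1⟩ ⟨p2, h2⟩
  have hn : 0 < x^2 + y^2 := by
    rcases eq_or_ne x 0 with h0 | h0
    · have : y ≠ 0 := fun h' => hxy (by rw [h0, h']; rfl)
      positivity
    · positivity
  set r := √(x^2 + y^2) with hr
  have hr0 : 0 < r := Real.sqrt_pos.2 hn
  have hr2 : r^2 = x^2 + y^2 := Real.sq_sqrt hn.le
  refine ⟨r⁻¹*x, r⁻¹*y, ?_, ?_⟩
  · rw [mul_pow, mul_pow, ← mul_add, ← hr2]; field_simp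
  · have e : QQ K h G ε p ((r⁻¹*x) • p1 + (r⁻¹*y) • p2) = r⁻¹^2*QQ K h G ε p (x • p1 + y • p2) := by
      rw [mul_smul, mul_smul, ← smul_add]
      generalize x • p1 + y • p2 = w
      rw [QQ, QQ, ← BD_self, ← BD_self]
      simp only [map_smul, smul_apply, smul_eq_mul, smul_mul_assoc, mul_smul_comm]
      ring
    rw [e]
    exact mul_nonneg (by positivity) hq
end PartH4
section PartH5
open Set Topology
lemma FF_tendsto {ι : Type*} {F : Filter ι} (K h : CB) {e : ι → ℝ} {u : ι → CB} {ε : ℝ} {u0 : CB} (hε : 0 < ε)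
    (h1 : Tendsto e F (𝓝 ε)) (h2 : Tendsto u F (𝓝 u0)) :
    Tendsto (fun i => FF K h (e i) (u i)) F (𝓝 (FF K h ε u0)) := by
  have hE : Tendsto (fun i => EE (u i)) F (𝓝 (EE u0)) := (EE_cont.tendsto _).comp h2
  have hE2 : Tendsto (fun i => EE ((1/2:ℝ) • u i)) F (𝓝 (EE ((1/2:ℝ) • u0))) :=
    (EE_cont.tendsto _).comp (h2.const_smul _)
  have hi : Tendsto (fun i => (1 + e i)⁻¹) F (𝓝 (1 + ε)⁻¹) :=
    (h1.const_add 1).inv₀ (by positivity)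
  have hS : Tendsto (fun i => lS (u i)) F (𝓝 (lS u0)) := (lS.continuous.tendsto _).comp h2
  have hc : Tendsto (fun i => cK K (e i)) F (𝓝 (cK K ε)) := (h1.smul_const _).sub tendsto_const_nhds
  unfold FF
  refine Tendsto.add ((JD.continuous.tendsto _).comp ?_) ((JS.continuous.tendsto _).comp ?_)
  · exact hi.smul ((h1.smul_const _).sub (hc.mul hE))
  · exact (hi.smul (((tendsto_const_nhds.mul hE2).const_smul _).sub tendsto_const_nhds)).add
      ((hS.div_const _).smul_const _)
theorem abstract_main (K h : CB) {G : HH →L[ℝ] CB} (hG : IsGreen G) (hK : ∀ x, K x ≤ 0) {α β : ℝ}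
    (hα : 0 < α)
    (hαβ : α < β) (va vb : ℂ → ℝ) (hva : ContDiff ℝ 1 va) (hvb : ContDiff ℝ 1 vb)
    (ja : Jv K h β va (cbR va hva.continuous) < -(8*π*‖h‖))
    (jb : Jv K h β vb (cbR vb hvb.continuous) < -(8*π*‖h‖))
    (la : lS (EE ((1/2:ℝ) • cbR va hva.continuous)) < 2*π)
    (lb : 2*π < lS (EE ((1/2:ℝ) • cbR vb hvb.continuous))) :
    ∃ ε ∈ Icc α β, ∃ u : CB, u = G (FF K h ε u) ∧ ∀ v1 v2 : ℂ → ℝ, ContDiff ℝ 1 v1 → ContDiff ℝ 1 v2 →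
      ∃ x y : ℝ, x^2 + y^2 = 1 ∧ ∀ w : CB, (∀ z : BB, w z = x*v1 z + y*v2 z) →
        0 ≤ (1 + ε)*(∫ z in unitDisk, gradSq (fun z => x*v1 z + y*v2 z) z)
          + lD (cK K ε*EE u*(w*w)) - lS (h*EE ((1/2:ℝ) • u)*(w*w)) := by
  obtain ⟨M, t0, H⟩ := galerkin K h hG hK hα hαβ va vb hva hvb ja jb la lb
  choose! e he q hqV hqT hqA hqQ using H
  let U : Ultrafilter (Finset (Ev G)) := Ultrafilter.of atTop
  have hU : (U : Filter (Finset (Ev G))) ≤ atTop := Ultrafilter.of_le _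
  have hge : ∀ᶠ t in (U : Filter (Finset (Ev G))), t0 ≤ t := hU (eventually_ge_atTop t0)
  obtain ⟨ε, hε, hεl⟩ := isCompact_Icc.ultrafilter_le_nhds (U.map e) (s := Icc α β)
    (by rw [Filter.le_principal_iff]; exact hge.mono fun t ht => he t ht)
  have hεl : Tendsto e U (𝓝 ε) := hεl
  have hε0 : 0 < ε := hα.trans_le hε.1
  obtain ⟨B, hB⟩ := FF_bd K h hG M β
  have hqF : ∀ᶠ t in (U : Filter (Finset (Ev G))), q t = (VV G t).starProjection (FF K h (e t) (G (q t))) :=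
    hge.mono fun t ht => crit_eq K h hG (hα.trans_le (he t ht).1) (hqV t ht) (hqA t ht)
  have hqB : ∀ᶠ t in (U : Filter (Finset (Ev G))), G (q t) ∈ closure (G '' Metric.closedBall 0 B) := by
    filter_upwards [hge, hqF] with t ht h1
    refine subset_closure ⟨q t, ?_, rfl⟩
    rw [mem_closedBall_zero_iff, h1]
    exact (Submodule.norm_starProjection_apply_le _ _).trans
      (hB _ _ (hα.trans_le (he t ht).1) (he t ht).2 (hqT t ht))
  obtain ⟨u, -, hu⟩ := (hG.cpt.isCompact_closure_image_closedBall B).ultrafilter_le_nhds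
    (U.map (fun t => G (q t))) (by rw [Filter.le_principal_iff]; exact hqB)
  have hu : Tendsto (fun t => G (q t)) U (𝓝 u) := hu
  have hF := FF_tendsto K h hε0 hεl hu
  have hq : Tendsto q U (𝓝 (FF K h ε u)) := by
    rw [tendsto_iff_norm_sub_tendsto_zero]
    have l1 := tendsto_iff_norm_sub_tendsto_zero.1 hF
    have l2 := tendsto_iff_norm_sub_tendsto_zero.1 ((VV_proj hG (FF K h ε u)).mono_left hU)
    have l3 := l1.add l2
    rw [add_zero] at l3
    refine squeeze_zero' (Eventually.of_forall fun _ => norm_nonneg _) (hqF.mono fun t ht => ?_) l3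
    refine (norm_sub_le_norm_sub_add_norm_sub _ ((VV G t).starProjection (FF K h ε u)) _).trans ?_
    gcongr
    conv_lhs => rw [ht, ← map_sub]
    exact Submodule.norm_starProjection_apply_le _ _
  refine ⟨ε, hε, u, tendsto_nhds_unique hu ((G.continuous.tendsto _).comp hq), fun v1 v2 hv1 hv2 => ?_⟩
  obtain ⟨p1, m1, l1, d1, s1⟩ := appr hG v1 hv1
  obtain ⟨p2, m2, l2, d2, s2⟩ := appr hG v2 hv2
  choose! x y hxy hQ using fun t ht => hqQ t ht (p1 t) (m1 t) (p2 t) (m2 t)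
  have hlim : ∀ f : Finset (Ev G) → ℝ, (∃ B, ∀ᶠ t in (U : Filter (Finset (Ev G))), |f t| ≤ B) →
      ∃ x, Tendsto f U (𝓝 x) := by
    rintro f ⟨B, hB⟩
    obtain ⟨x, -, hx⟩ := isCompact_Icc.ultrafilter_le_nhds (U.map f) (s := Icc (-B) B)
      (by rw [Filter.le_principal_iff]; exact hB.mono fun i h => abs_le.1 h)
    exact ⟨x, hx⟩
  obtain ⟨X, hX⟩ := hlim x ⟨1, hge.mono fun t ht => abs_le_of_sq_le_sq (by nlinarith [hxy t ht, sq_nonneg (y t)]) one_pos.le⟩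
  obtain ⟨Y, hY⟩ := hlim y ⟨1, hge.mono fun t ht => abs_le_of_sq_le_sq (by nlinarith [hxy t ht, sq_nonneg (x t)]) one_pos.le⟩
  have b1 : ∃ B, ∀ t, |Den G (p1 t)| ≤ B := ⟨_, fun t => by
    rw [abs_of_nonneg (hG.Dnn _)]; exact (d1 t).trans (sub_le_self _ (sq_nonneg _))⟩
  have b2 : ∃ B, ∀ t, |Den G (p2 t)| ≤ B := ⟨_, fun t => by
    rw [abs_of_nonneg (hG.Dnn _)]; exact (d2 t).trans (sub_le_self _ (sq_nonneg _))⟩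
  obtain ⟨B1, b1⟩ := b1
  obtain ⟨B2, b2⟩ := b2
  have b3 : ∀ t, |BD G (p1 t) (p2 t)| ≤ B1 + B2 := fun t => by
    have e1 := hG.Dnn (p1 t + p2 t)
    have e2 := hG.Dnn (p1 t - p2 t)
    have e3 := le_of_abs_le (b1 t)
    have e4 := le_of_abs_le (b2 t)
    have e5 := hG.Dnn (p1 t)
    have e6 := hG.Dnn (p2 t)
    rw [← BD_self] at e1 e2
    simp only [map_add, map_sub, add_apply, sub_apply, BD_self, BD_symm hG (p2 t) (p1 t)] at e1 e2
    rw [abs_le]; constructor <;> linarith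
  obtain ⟨D1, hD1⟩ := hlim _ ⟨B1, Eventually.of_forall b1⟩
  obtain ⟨D2, hD2⟩ := hlim _ ⟨B2, Eventually.of_forall b2⟩
  obtain ⟨D3, hD3⟩ := hlim _ ⟨B1 + B2, Eventually.of_forall b3⟩
  have hDen : ∀ (a b : ℝ) t, Den G (a • p1 t + b • p2 t) =
      a^2*Den G (p1 t) + 2*(a*b)*BD G (p1 t) (p2 t) + b^2*Den G (p2 t) := fun a b t => by
    rw [← BD_self]
    simp only [map_add, map_smul, add_apply, smul_apply, smul_eq_mul, BD_self, BD_symm hG (p2 t) (p1 t)]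
    ring
  have hXY : X^2 + Y^2 = 1 :=
    tendsto_nhds_unique ((hX.pow 2).add (hY.pow 2)) (Tendsto.congr' (hge.mono fun t ht => (hxy t ht).symm)
      tendsto_const_nhds)
  refine ⟨X, Y, hXY, fun w hw => ?_⟩
  have hv : ContDiff ℝ 1 (fun z => X*v1 z + Y*v2 z) := by fun_prop
  have hw' : w = cbR _ hv.continuous := by ext z; rw [hw]; rfl
  have hw2 : w = X • cbR v1 hv1.continuous + Y • cbR v2 hv2.continuous := by ext z; rw [hw]; rfl
  have hwl : ∀ a b : Finset (Ev G) → ℝ, Tendsto a U (𝓝 X) → Tendsto b U (𝓝 Y) →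
      Tendsto (fun t => iot (G (a t • p1 t + b t • p2 t))) U (𝓝 (iot w)) := fun a b ha hb => by
    rw [hw2]
    simp only [map_add, map_smul]
    exact (ha.smul (l1.mono_left hU)).add (hb.smul (l2.mono_left hU))
  have hbound : X^2*D1 + 2*(X*Y)*D3 + Y^2*D2 ≤
      ∫ z in unitDisk, gradSq (fun z => X*v1 z + Y*v2 z) z := by
    have g1 : Tendsto (fun t => Den G (X • p1 t + Y • p2 t)) U (𝓝 (X^2*D1 + 2*(X*Y)*D3 + Y^2*D2)) := by
      simp only [hDen]
      exact ((hD1.const_mul _).add (hD3.const_mul _)).add (hD2.const_mul _)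
    have g2 := ((tendsto_tot hG (hwl _ _ tendsto_const_nhds tendsto_const_nhds)).pow 2).const_sub
      ((∫ z in unitDisk, gradSq (fun z => X*v1 z + Y*v2 z) z) + (bint (fun z => X*v1 z + Y*v2 z) / (2*π))^2)
    rw [hw', lS_cbR, add_sub_cancel_right] at g2
    refine le_of_tendsto_of_tendsto' g1 g2 fun t => appr_bd hG _ hv
      (Submodule.add_mem _ (Submodule.smul_mem _ _ (m1 t)) (Submodule.smul_mem _ _ (m2 t))) ?_
    rw [← hw', hw2]
    simp only [map_add, map_smul, s1, s2]
  have hφ1 : Tendsto (fun t => cK K (e t)*EE (G (q t))) U (𝓝 (cK K ε*EE u)) :=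
    Tendsto.mul ((hεl.smul_const _).sub tendsto_const_nhds) ((EE_cont.tendsto _).comp hu)
  have hφ2 : Tendsto (fun t => h*EE ((1/2:ℝ) • G (q t))) U (𝓝 (h*EE ((1/2:ℝ) • u))) :=
    tendsto_const_nhds.mul ((EE_cont.tendsto _).comp (hu.const_smul _))
  have t1 := (tendsto_lD_sq hφ1 (hwl x y hX hY)).1
  have t2 := (tendsto_lD_sq hφ2 (hwl x y hX hY)).2
  have t3 : Tendsto (fun t => Den G (x t • p1 t + y t • p2 t)) U (𝓝 (X^2*D1 + 2*(X*Y)*D3 + Y^2*D2)) := by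
    simp only [hDen]
    exact (((hX.pow 2).mul hD1).add (((hX.mul hY).const_mul 2).mul hD3)).add ((hY.pow 2).mul hD2)
  have t4 := (((hεl.const_add 1).mul t3).add t1).sub t2
  have t5 := ge_of_tendsto t4 (hge.mono fun t ht => hQ t ht)
  refine t5.trans ?_
  gcongr
end PartH5
section PartB
open Set Topology
lemma bpt_per (θ : ℝ) : bpt (θ + 2*π) = bpt θ := by
  simp only [bpt]; push_cast; rw [add_mul, Complex.exp_add, Complex.exp_two_pi_mul_I, mul_one]
lemma bpt_hasDerivAt (θ : ℝ) : HasDerivAt bpt (Complex.I*bpt θ) θ := by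
  have h : HasDerivAt (fun θ : ℝ => (θ : ℂ)*Complex.I) Complex.I θ := by
    simpa using (Complex.ofRealCLM.hasDerivAt (x := θ)).mul_const Complex.I
  have := h.cexp
  rw [mul_comm] at this
  exact this
lemma bpt_eq (θ : ℝ) : bpt θ = Real.cos θ + Real.sin θ*Complex.I := by
  rw [bpt, Complex.exp_mul_I]; push_cast; rfl
lemma polar {F : ℂ → ℝ} (hF : Continuous F) :
    ∫ x in unitDisk, F x = ∫ r in (0:ℝ)..1, r*bint (fun x => F (r*x)) := by
  have hmd : MeasurableSet unitDisk := measurableSet_ball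
  rw [← integral_indicator hmd, ← Complex.integral_comp_polarCoord_symm]
  have hc : Continuous (fun p : ℝ × ℝ => p.1*F (p.1*bpt p.2)) := by
    have := bpt_cont; fun_prop
  have h1 : ∫ p in polarCoord.target, p.1 • (unitDisk.indicator F (Complex.polarCoord.symm p)) =
      ∫ p in Ioo (0:ℝ) 1 ×ˢ Ioo (-π) π, p.1*F (p.1*bpt p.2) := by
    rw [← integral_indicator (measurableSet_Ioo.prod measurableSet_Ioo),
      ← integral_indicator polarCoord.open_target.measurableSet]
    congr 1; ext p
    have e : (Complex.polarCoord.symm p : ℂ) = p.1*bpt p.2 := by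
      rw [Complex.polarCoord_symm_apply, bpt_eq]
    have hm : ((p.1 : ℂ)*bpt p.2) ∈ unitDisk ↔ |p.1| < 1 := by
      simp [unitDisk, bpt_norm]
    by_cases h0 : p ∈ polarCoord.target
    · rw [indicator_of_mem h0, e]
      obtain ⟨h01, h02⟩ := h0
      have h01 : 0 < p.1 := h01
      by_cases h1 : p.1 < 1
      · rw [indicator_of_mem (hm.2 (by rw [abs_of_pos h01]; exact h1)), indicator_of_mem (show p ∈ Ioo (0:ℝ) 1 ×ˢ Ioo (-π) π from ⟨⟨h01, h1⟩, h02⟩)]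
        rfl
      · rw [indicator_of_notMem (fun h => h1 (by have := hm.1 h; rwa [abs_of_pos h01] at this)),
          indicator_of_notMem (fun h => h1 h.1.2)]; simp
    · rw [indicator_of_notMem h0, indicator_of_notMem]
      exact fun h => h0 ⟨h.1.1, h.2⟩
  rw [h1, Measure.volume_eq_prod, setIntegral_prod]
  · rw [intervalIntegral.integral_of_le zero_le_one, integral_Ioc_eq_integral_Ioo]
    refine setIntegral_congr_fun measurableSet_Ioo fun r _ => ?_
    have hp : Function.Periodic (fun θ => F (r*bpt θ)) (2*π) := fun θ => by simp only [bpt_per]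
    have := hp.intervalIntegral_add_eq (-π) 0
    simp only [bint]
    rw [zero_add] at this
    rw [← this, ← intervalIntegral.integral_const_mul,
      intervalIntegral.integral_of_le (by linarith [pi_pos]), integral_Ioc_eq_integral_Ioo]
    congr 2; ring_nf
  · refine IntegrableOn.mono_set (t := Icc (0:ℝ) 1 ×ˢ Icc (-π) π)
      (hc.continuousOn.integrableOn_compact (isCompact_Icc.prod isCompact_Icc))
      (prod_mono Ioo_subset_Icc_self Ioo_subset_Icc_self)
lemma bint_cont {F : ℂ → ℝ} (hF : Continuous F) : Continuous (fun r : ℝ => bint (fun x => F (r*x))) := by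
  have := bpt_cont
  exact intervalIntegral.continuous_parametric_intervalIntegral_of_continuous' (by fun_prop) _ _
lemma divthm {f : ℂ → ℝ} (hf : ContDiff ℝ 1 f) (w : ℂ) :
    ∫ x in unitDisk, pd f w x = bint (fun x => (w.re*x.re + w.im*x.im)*f x) := by
  have hpd : Continuous (fun x => pd f w x) := (hf.continuous_fderiv one_ne_zero).clm_apply continuous_const
  rw [polar hpd]
  set a : ℝ → ℝ := fun θ => w.re*(bpt θ).re + w.im*(bpt θ).im with ha
  set b : ℝ → ℝ := fun θ => w.re*(Complex.I*bpt θ).re + w.im*(Complex.I*bpt θ).im with hb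
  have hbpt : ContDiff ℝ 1 bpt := by
    have : bpt = fun θ : ℝ => Complex.exp (Complex.ofRealCLM θ*Complex.I) := rfl
    rw [this]; fun_prop
  have hre : ContDiff ℝ 1 Complex.re := Complex.reCLM.contDiff
  have him : ContDiff ℝ 1 Complex.im := Complex.imCLM.contDiff
  have hof : ContDiff ℝ 1 (fun r : ℝ => (r : ℂ)) := Complex.ofRealCLM.contDiff
  have hac : ContDiff ℝ 1 a := by fun_prop
  have hbc : ContDiff ℝ 1 b := by fun_prop
  let A : ℝ × ℝ → ℝ := fun p => p.1*a p.2*f (p.1*bpt p.2)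
  let B : ℝ × ℝ → ℝ := fun p => b p.2*f (p.1*bpt p.2)
  have hA : ContDiff ℝ 1 A := by fun_prop
  have hB : ContDiff ℝ 1 B := by fun_prop
  have key : ∀ r θ : ℝ, fderiv ℝ A (r, θ) (1, 0) + fderiv ℝ B (r, θ) (0, 1) = r*pd f w (r*bpt θ) := by
    intro r θ
    have dA : HasDerivAt (fun s : ℝ => A (s, θ)) (fderiv ℝ A (r, θ) (1, 0)) r := by
      have hl : HasDerivAt (fun s : ℝ => (s, θ)) ((1 : ℝ), (0 : ℝ)) r :=
        (hasDerivAt_id' r).prodMk (hasDerivAt_const r θ)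
      have hfA : HasFDerivAt A (fderiv ℝ A (r, θ)) ((fun s : ℝ => (s, θ)) r) :=
        (hA.differentiable one_ne_zero (r, θ)).hasFDerivAt
      exact hfA.comp_hasDerivAt r hl
    have dB : HasDerivAt (fun s : ℝ => B (r, s)) (fderiv ℝ B (r, θ) (0, 1)) θ := by
      have hl : HasDerivAt (fun s : ℝ => (r, s)) ((0 : ℝ), (1 : ℝ)) θ :=
        (hasDerivAt_const θ r).prodMk (hasDerivAt_id' θ)
      have hfB : HasFDerivAt B (fderiv ℝ B (r, θ)) ((fun s : ℝ => (r, s)) θ) :=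
        (hB.differentiable one_ne_zero (r, θ)).hasFDerivAt
      exact hfB.comp_hasDerivAt θ hl
    have hfd := (hf.differentiable one_ne_zero (r*bpt θ)).hasFDerivAt
    have hr : HasDerivAt (fun s : ℝ => (s : ℂ)*bpt θ) (bpt θ) r := by
      simpa using (Complex.ofRealCLM.hasDerivAt (x := r)).mul_const (bpt θ)
    have ht : HasDerivAt (fun s : ℝ => (r : ℂ)*bpt s) (r*(Complex.I*bpt θ)) θ :=
      (bpt_hasDerivAt θ).const_mul _
    have dA' := ((hasDerivAt_id r).mul_const (a θ)).mul (hfd.comp_hasDerivAt r hr)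
    have hbd : HasDerivAt b (- a θ) θ := by
      have h1 := (bpt_hasDerivAt θ).const_mul Complex.I
      have h2 := (Complex.reCLM.hasFDerivAt.comp_hasDerivAt θ h1).const_mul w.re
      have h3 := (Complex.imCLM.hasFDerivAt.comp_hasDerivAt θ h1).const_mul w.im
      refine (h2.add h3).congr_deriv ?_
      simp only [Complex.reCLM_apply, Complex.imCLM_apply, ha, ← mul_assoc, Complex.I_mul_I]
      simp; ring
    have dB' := hbd.mul (hfd.comp_hasDerivAt θ ht)
    rw [dA.unique dA', dB.unique dB']
    have hw : w = (a θ : ℂ)*bpt θ + (b θ : ℂ)*(Complex.I*bpt θ) := by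
      have h1 : (bpt θ).re^2 + (bpt θ).im^2 = 1 := by
        have := bpt_norm θ
        rw [← Complex.sq_norm_sub_sq_re, this]; ring
      apply Complex.ext
      · simp [ha, hb]; linear_combination (-w.re)*h1
      · simp [ha, hb]; linear_combination (-w.im)*h1
    have e2 : ∀ (c : ℝ) (z : ℂ), fderiv ℝ f (r*bpt θ) (c*z) = c*fderiv ℝ f (r*bpt θ) z := by
      intro c z
      rw [show (c : ℂ)*z = c • z from (Complex.real_smul).symm, map_smul, smul_eq_mul]
    have e1 : pd f w (r*bpt θ) = a θ*fderiv ℝ f (r*bpt θ) (bpt θ) +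
        b θ*fderiv ℝ f (r*bpt θ) (Complex.I*bpt θ) := by
      rw [pd]; nth_rewrite 1 [hw]; rw [map_add, e2, e2]
    rw [e1, e2]
    simp only [id, Function.comp]
    ring
  have hdiv := integral2_divergence_prod_of_hasFDerivAt_off_countable A B (fderiv ℝ A) (fderiv ℝ B) 0 0 1 (2*π)
    ∅ countable_empty hA.continuous.continuousOn hB.continuous.continuousOn
    (fun x _ => (hA.differentiable one_ne_zero x).hasFDerivAt)
    (fun x _ => (hB.differentiable one_ne_zero x).hasFDerivAt)
    (ContinuousOn.integrableOn_compact (isCompact_uIcc.prod isCompact_uIcc) (by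
      have h1 := hA.continuous_fderiv one_ne_zero
      have h2 := hB.continuous_fderiv one_ne_zero
      fun_prop))
  simp only [key] at hdiv
  have e0 : bpt (2*π) = bpt 0 := by have := bpt_per 0; rwa [zero_add] at this
  have e1 : ∀ x : ℝ, B (x, 2*π) = B (x, 0) := fun x => by simp only [B, hb, e0]
  simp only [e1, sub_self, zero_add, A, zero_mul, intervalIntegral.integral_zero, sub_zero, one_mul,
    Complex.ofReal_one] at hdiv
  simp only [bint, ← intervalIntegral.integral_const_mul]
  exact hdiv
lemma disk_int {F : ℂ → ℝ} (hF : Continuous F) : IntegrableOn F unitDisk :=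
  (hF.continuousOn.integrableOn_compact (isCompact_closedBall 0 1)).mono_set Metric.ball_subset_closedBall
def gdot (U v : ℂ → ℝ) (x : ℂ) : ℝ := pd U 1 x*pd v 1 x + pd U Complex.I x*pd v Complex.I x
lemma pd_cont {f : ℂ → ℝ} (hf : ContDiff ℝ 1 f) (w : ℂ) : Continuous (pd f w) :=
  (hf.continuous_fderiv one_ne_zero).clm_apply continuous_const
lemma pd_C1 {f : ℂ → ℝ} (hf : ContDiff ℝ 2 f) (w : ℂ) : ContDiff ℝ 1 (pd f w) :=
  (hf.fderiv_right (m := 1) (by norm_num)).clm_apply contDiff_const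
lemma lap_cont {f : ℂ → ℝ} (hf : ContDiff ℝ 2 f) : Continuous (lap f) :=
  (pd_cont (pd_C1 hf 1) 1).add (pd_cont (pd_C1 hf Complex.I) Complex.I)
lemma gdot_cont {U v : ℂ → ℝ} (hU : ContDiff ℝ 1 U) (hv : ContDiff ℝ 1 v) : Continuous (gdot U v) :=
  ((pd_cont hU _).mul (pd_cont hv _)).add ((pd_cont hU _).mul (pd_cont hv _))
lemma nderiv_cont {U : ℂ → ℝ} (hU : ContDiff ℝ 1 U) : Continuous (nderiv U) :=
  (Complex.continuous_re.mul (pd_cont hU _)).add (Complex.continuous_im.mul (pd_cont hU _))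
lemma pd_mul {f g : ℂ → ℝ} (hf : ContDiff ℝ 1 f) (hg : ContDiff ℝ 1 g) (w x : ℂ) :
    pd (fun y => f y*g y) w x = f x*pd g w x + g x*pd f w x := by
  have := ((hf.differentiable one_ne_zero x).hasFDerivAt.mul (hg.differentiable one_ne_zero x).hasFDerivAt).fderiv
  simp only [pd]
  erw [this]; simp
lemma bint_add {f g : ℂ → ℝ} (hf : Continuous f) (hg : Continuous g) :
    bint (fun x => f x + g x) = bint f + bint g :=
  intervalIntegral.integral_add ((hf.comp bpt_cont).intervalIntegrable _ _) ((hg.comp bpt_cont).intervalIntegrable _ _)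
lemma bint_const_mul (c : ℝ) (f : ℂ → ℝ) : bint (fun x => c*f x) = c*bint f :=
  intervalIntegral.integral_const_mul _ _
lemma bint_congr {f g : ℂ → ℝ} (h : ∀ θ, f (bpt θ) = g (bpt θ)) : bint f = bint g := by
  simp only [bint, h]
lemma green {U v : ℂ → ℝ} (hU : ContDiff ℝ 2 U) (hv : ContDiff ℝ 1 v) :
    ∫ x in unitDisk, gdot U v x = (∫ x in unitDisk, -lap U x*v x) + bint (fun x => nderiv U x*v x) := by
  have hU1 : ContDiff ℝ 1 U := hU.of_le (by norm_num)
  have h1 := divthm (hv.mul (pd_C1 hU 1)) 1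
  have h2 := divthm (hv.mul (pd_C1 hU Complex.I)) Complex.I
  have c1 := disk_int (pd_cont (hv.mul (pd_C1 hU 1)) 1)
  have c2 := disk_int (pd_cont (hv.mul (pd_C1 hU Complex.I)) Complex.I)
  have c3 := disk_int ((lap_cont hU).neg.mul hv.continuous)
  have e : ∀ x, gdot U v x = pd (fun y => v y*pd U 1 y) 1 x + pd (fun y => v y*pd U Complex.I y) Complex.I x
      + -lap U x*v x := by
    intro x
    rw [pd_mul hv (pd_C1 hU 1), pd_mul hv (pd_C1 hU _)]
    have l : lap U x = pd (pd U 1) 1 x + pd (pd U Complex.I) Complex.I x := rfl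
    rw [l, gdot]; ring
  simp only [e]
  have i1 := integral_add (c1.add c2) c3
  have i2 := integral_add c1 c2
  simp only [Pi.add_apply, Pi.mul_apply, Pi.neg_apply] at i1 i2
  rw [i1, i2, h1, h2, add_comm]
  congr 1
  rw [← bint_add]
  · congr 1; ext x; simp [nderiv]; ring
  · have := hv.continuous; have := pd_cont hU1 1; fun_prop
  · have := hv.continuous; have := pd_cont hU1 Complex.I; fun_prop
end PartB
section PartG1
open Set Topology
def opk (κ : C(BB, HH)) : HH →L[ℝ] CB :=
  LinearMap.mkContinuous
    { toFun := fun q => ⟨fun x => inner ℝ (κ x) q, by fun_prop⟩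
      map_add' := fun p q => by ext x; exact inner_add_right (𝕜 := ℝ) (κ x) p q
      map_smul' := fun c q => by ext x; exact inner_smul_right (𝕜 := ℝ) (κ x) q c } ‖κ‖ (fun q => by
      refine (ContinuousMap.norm_le _ (by positivity)).2 fun x => ?_
      refine (norm_inner_le_norm (𝕜 := ℝ) (κ x) q).trans ?_
      gcongr; exact κ.norm_coe_le_norm x)
lemma opk_cpt (κ : C(BB, HH)) : IsCompactOperator (opk κ) := by
  refine (isCompactOperator_iff_image_closedBall_subset_compact (opk κ : HH →ₗ[ℝ] CB) one_pos).2 ?_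
  let e := (ContinuousMap.isometryEquivBoundedOfCompact BB ℝ)
  have h := BoundedContinuousFunction.arzela_ascoli (Metric.closedBall (0:ℝ) ‖κ‖) (isCompact_closedBall _ _)
    (e '' (opk κ '' Metric.closedBall 0 1)) (by
      rintro f x ⟨g, ⟨q, hq, rfl⟩, rfl⟩
      rw [mem_closedBall_zero_iff] at hq ⊢
      change ‖inner ℝ (κ x) q‖ ≤ _
      refine (norm_inner_le_norm _ _).trans ?_
      calc _ ≤ ‖κ‖*1 := by gcongr; exact κ.norm_coe_le_norm x
        _ = _ := mul_one _) (by
      intro x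
      rw [Metric.equicontinuousAt_iff_right]
      intro ε hε
      filter_upwards [Metric.tendsto_nhds.1 (κ.continuous.tendsto x) ε hε] with y hy
      rintro ⟨f, ⟨g, ⟨q, hq, rfl⟩, rfl⟩⟩
      rw [mem_closedBall_zero_iff] at hq
      change dist (inner ℝ (κ x) q) (inner ℝ (κ y) q) < ε
      rw [dist_eq_norm, ← inner_sub_left]
      refine (norm_inner_le_norm _ _).trans_lt ?_
      rw [dist_comm, dist_eq_norm] at hy
      calc _ ≤ ‖κ x - κ y‖*1 := by gcongr
        _ < _ := by rwa [mul_one])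
  refine ⟨e.symm '' closure _, h.image e.symm.continuous, ?_⟩
  intro g hg
  exact ⟨e g, subset_closure ⟨g, hg, rfl⟩, e.symm_apply_apply g⟩
lemma riesz {a : ℝ} (ha0 : 0 ≤ a) (ha : a < 2) (R : ℝ) : ∃ C > 0, ∀ x : ℂ,
    IntegrableOn (fun y : ℂ => ‖x - y‖^(-a)) (Metric.ball 0 R) ∧
    ∫ y in Metric.ball (0:ℂ) R, ‖x - y‖^(-a) ≤ C := by
  let g : ℂ → ℝ := (Metric.ball (0:ℂ) 1).indicator fun z => ‖z‖^(-a)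
  have hmeas : Measurable (fun z : ℂ => ‖z‖^(-a)) := by fun_prop
  have hg : Integrable g := by
    rw [integrable_indicator_iff measurableSet_ball]
    refine integrableOn_ball_of_norm_le_rpow (C := 1) (α := a) (by simp) (by simpa using ha)
      (Eventually.of_forall fun x => ?_) hmeas.aestronglyMeasurable
    rw [one_mul, Real.norm_of_nonneg (by positivity)]
  have hg0 : ∀ z, 0 ≤ g z := fun z => indicator_nonneg (fun _ _ => by positivity) z
  have h1 : IntegrableOn (fun _ : ℂ => (1:ℝ)) (Metric.ball 0 R) :=
    integrableOn_const measure_ball_lt_top.ne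
  have hb : ∀ z : ℂ, ‖z‖^(-a) ≤ 1 + g z := by
    intro z
    by_cases hz : z ∈ Metric.ball (0:ℂ) 1
    · simp only [g, indicator_of_mem hz]; linarith
    · simp only [g, indicator_of_notMem hz, add_zero]
      rw [mem_ball_zero_iff, not_lt] at hz
      exact Real.rpow_le_one_of_one_le_of_nonpos hz (by linarith)
  refine ⟨(∫ y in Metric.ball (0:ℂ) R, (1:ℝ)) + (∫ z, g z) + 1, ?_, fun x => ?_⟩
  · have := integral_nonneg (μ := volume) (f := g) hg0
    have : 0 ≤ ∫ y in Metric.ball (0:ℂ) R, (1:ℝ) := integral_nonneg fun _ => zero_le_one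
    positivity
  have hgx : Integrable fun y => g (x - y) := hg.comp_sub_left x
  have hi : IntegrableOn (fun y => 1 + g (x - y)) (Metric.ball 0 R) := h1.add hgx.integrableOn
  have hI : IntegrableOn (fun y : ℂ => ‖x - y‖^(-a)) (Metric.ball 0 R) := by
    refine hi.mono' (hmeas.comp (measurable_const.sub measurable_id)).aestronglyMeasurable
      (Eventually.of_forall fun y => ?_)
    rw [Real.norm_of_nonneg (by positivity)]; exact hb _
  refine ⟨hI, ?_⟩
  calc _ ≤ ∫ y in Metric.ball (0:ℂ) R, (1 + g (x - y)) := integral_mono hI hi fun y => hb _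
    _ = (∫ y in Metric.ball (0:ℂ) R, (1:ℝ)) + ∫ y in Metric.ball (0:ℂ) R, g (x - y) :=
      integral_add h1 hgx.integrableOn
    _ ≤ (∫ y in Metric.ball (0:ℂ) R, (1:ℝ)) + ∫ y, g (x - y) := by
      have := setIntegral_le_integral (s := Metric.ball (0:ℂ) R) hgx (Eventually.of_forall fun y => hg0 _)
      linarith
    _ ≤ _ := by rw [integral_sub_left_eq_self g volume x]; linarith
lemma dist_bpt {x : ℂ} {s : ℝ} (hs : |s| ≤ π) :
    |s| / π ≤ ‖x - bpt (x.arg + s)‖ := by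
  have e : bpt (x.arg + s) = bpt x.arg*bpt s := by
    simp only [bpt]; push_cast; rw [add_mul, Complex.exp_add]
  have e2 : x = bpt x.arg*‖x‖ := by
    rw [mul_comm]; exact (Complex.norm_mul_exp_arg_mul_I x).symm
  have e3 : ‖x - bpt (x.arg + s)‖ = ‖(‖x‖:ℂ) - bpt s‖ := by
    rw [e]; nth_rewrite 1 [e2]; rw [← mul_sub, norm_mul, bpt_norm, one_mul]
  rw [e3]
  have hpi := pi_pos
  refine abs_le_of_sq_le_sq' ?_ (norm_nonneg _) |>.2
  rw [Complex.sq_norm, Complex.normSq_apply, bpt_eq]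
  simp only [Complex.sub_re, Complex.sub_im, Complex.ofReal_re, Complex.ofReal_im, Complex.add_re, Complex.add_im,
    Complex.mul_re, Complex.mul_im, Complex.I_re, Complex.I_im]
  ring_nf
  have h1 := Real.sin_sq_add_cos_sq s
  have hr := norm_nonneg x
  have hsp : |s| ^ 2*π⁻¹^2 = (|s| / π)^2 := by ring
  rw [hsp]
  have hle : |s| / π ≤ 1 := (div_le_one hpi).2 hs
  have h0 : 0 ≤ |s| / π := by positivity
  by_cases hc : 0 ≤ Real.cos s
  · have : |s| ≤ π / 2 := by
      by_contra hh
      push Not at hh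
      have := Real.cos_neg_of_pi_div_two_lt_of_lt hh (by linarith)
      rw [Real.cos_abs] at this; linarith
    have h2 := Real.mul_le_sin (abs_nonneg s) this
    have h3 : Real.sin |s| ^ 2 = Real.sin s^2 := by
      rcases abs_choice s with h | h <;> rw [h]; rw [Real.sin_neg]; ring
    have h4 : |s| / π ≤ 2 / π * |s| := by rw [div_mul_eq_mul_div]; gcongr; linarith [abs_nonneg s]
    have h5 : (|s| / π)^2 ≤ Real.sin s^2 := by rw [← h3]; gcongr; linarith
    nlinarith [sq_nonneg (‖x‖ - Real.cos s)]
  · push Not at hc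
    nlinarith
lemma rieszS : ∃ C > 0, ∀ x : BB,
    Integrable (fun y : BB => ‖(x:ℂ) - y‖^(-(1/2):ℝ)) νS ∧
    ∫ y, ‖(x:ℂ) - y‖^(-(1/2):ℝ) ∂νS ≤ C := by
  let g : ℝ → ℝ := fun s => (|s| / π)^(-(1/2):ℝ)
  have hgi0 : IntervalIntegrable g volume 0 π := by
    have : IntervalIntegrable (fun s : ℝ => s^(-(1/2):ℝ)*(π⁻¹)^(-(1/2):ℝ)) volume 0 π :=
      (intervalIntegral.intervalIntegrable_rpow' (by norm_num)).mul_const _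
    refine this.congr fun s hs => ?_
    rw [uIoc_of_le pi_pos.le] at hs
    simp only [g, abs_of_pos hs.1, div_eq_mul_inv]
    rw [Real.mul_rpow hs.1.le (by positivity)]
  have hgi1 : IntervalIntegrable g volume (-π) 0 := by
    have := (hgi0.comp_sub_left 0).symm
    simp only [zero_sub, g, abs_neg, sub_self] at this
    exact this
  have hgi : IntervalIntegrable g volume (-π) π := hgi1.trans hgi0
  have hg0 : ∀ s, 0 ≤ g s := fun s => by positivity
  refine ⟨(∫ s in (-π)..π, g s) + 1, ?_, fun x => ?_⟩
  · have : 0 ≤ ∫ s in (-π)..π, g s := intervalIntegral.integral_nonneg (by linarith [pi_pos]) fun s _ => hg0 s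
    positivity
  have hms : Measurable (fun y : BB => ‖(x:ℂ) - y‖^(-(1/2):ℝ)) := by fun_prop
  let f : ℝ → ℝ := fun θ => ‖(x:ℂ) - bpt θ‖^(-(1/2):ℝ)
  have hper : Function.Periodic f (2*π) := fun θ => by simp only [f, bpt_per]
  have hle : ∀ s, |s| ≤ π → s ≠ 0 → f ((x:ℂ).arg + s) ≤ g s := fun s hs h0 =>
    Real.rpow_le_rpow_of_nonpos (by positivity) (dist_bpt hs) (by norm_num)
  have hmf : Measurable f := by have := bpt_cont; fun_prop
  have hfi' : IntervalIntegrable (fun s => f ((x:ℂ).arg + s)) volume (-π) π := by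
    refine hgi.mono_fun' (hmf.comp (measurable_const.add measurable_id)).aestronglyMeasurable ?_
    rw [uIoc_of_le (by linarith [pi_pos])]
    have h0 : ∀ᵐ s : ℝ ∂(volume.restrict (Ioc (-π) π)), s ≠ 0 := Measure.ae_ne _ 0
    filter_upwards [h0, ae_restrict_mem measurableSet_Ioc] with s h0 hs
    rw [Real.norm_of_nonneg (by positivity)]
    exact hle s (abs_le.2 ⟨hs.1.le, hs.2⟩) h0
  have hfi2 : IntervalIntegrable f volume (-π + (x:ℂ).arg) (π + (x:ℂ).arg) := by
    have := hfi'.comp_sub_right ((x:ℂ).arg)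
    simpa using this
  have hfi : IntervalIntegrable f volume 0 (2*π) := by
    refine hper.intervalIntegrable (t := -π + (x:ℂ).arg) (by positivity) ?_ _ _
    convert hfi2 using 1; ring
  have hint : ∫ y, ‖(x:ℂ) - y‖^(-(1/2):ℝ) ∂νS = ∫ θ in (0:ℝ)..(2*π), f θ :=
    integral_νS _ hms.aestronglyMeasurable
  constructor
  · rw [νS, integrable_map_measure hms.aestronglyMeasurable bptB_cont.aemeasurable]
    have := (intervalIntegrable_iff_integrableOn_Ioc_of_le (by positivity)).1 hfi
    exact this
  · rw [hint]
    have h1 := hper.intervalIntegral_add_eq 0 (-π + (x:ℂ).arg)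
    rw [zero_add] at h1
    rw [h1]
    have h2 := intervalIntegral.integral_comp_add_right (a := -π) (b := π) f ((x:ℂ).arg)
    rw [show -π + (x:ℂ).arg + 2*π = π + (x:ℂ).arg by ring, ← h2]
    have h3 : ∫ s in (-π)..π, f (s + (x:ℂ).arg) ≤ ∫ s in (-π)..π, g s := by
      simp only [add_comm _ (x:ℂ).arg]
      refine intervalIntegral.integral_mono_ae_restrict (by linarith [pi_pos]) hfi' hgi ?_
      have h0 : ∀ᵐ s : ℝ ∂(volume.restrict (Icc (-π) π)), s ≠ 0 := Measure.ae_ne _ 0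
      filter_upwards [h0, ae_restrict_mem measurableSet_Icc] with s h0 hs
      exact hle s (abs_le.2 ⟨hs.1, hs.2⟩) h0
    linarith
end PartG1
section PartG2
open Set Topology
def Nf (e : ℝ) (x y : ℂ) : ℝ :=
  -(1 / (4*π))*(log (Complex.normSq (x - y) + e) + log (Complex.normSq (1 - starRingEnd ℂ x*y) + e))
def en (n : ℕ) : ℝ := 1 / ((n:ℝ) + 1)
lemma en_pos (n : ℕ) : 0 < en n := by unfold en; positivity
lemma en_tendsto : Tendsto en atTop (𝓝 0) := tendsto_one_div_add_atTop_nhds_zero_nat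
lemma en_anti {n m : ℕ} (h : n ≤ m) : en m ≤ en n := by unfold en; gcongr
lemma Nf_cont {e : ℝ} (he : 0 < e) : Continuous fun p : ℂ × ℂ => Nf e p.1 p.2 := by
  have h : ∀ z, Complex.normSq z + e ≠ 0 := fun z => by have := Complex.normSq_nonneg z; positivity
  have := Complex.continuous_normSq
  have h1 : Continuous fun p : ℂ × ℂ => log (Complex.normSq (p.1 - p.2) + e) :=
    Continuous.log (by fun_prop) fun p => h _
  have h2 : Continuous fun p : ℂ × ℂ => log (Complex.normSq (1 - starRingEnd ℂ p.1*p.2) + e) :=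
    Continuous.log (by fun_prop) fun p => h _
  unfold Nf; fun_prop
def Nk (n : ℕ) : C(BB × BB, ℝ) := ⟨fun p => Nf (en n) p.1 p.2,
  (Nf_cont (en_pos n)).comp (by fun_prop : Continuous fun p : BB × BB => ((p.1:ℂ), (p.2:ℂ)))⟩
def κn (n : ℕ) : C(BB, HH) := (⟨iot, iot.continuous⟩ : C(CB, HH)).comp (Nk n).curry
lemma logdiff {s e e' E : ℝ} (hs : 0 < s) (he : 0 < e) (he' : 0 < e') (h1 : e ≤ E) (h2 : e' ≤ E) :
    |log (s + e) - log (s + e')| ≤ 8*(E / s)^(1/8:ℝ) := by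
  wlog h : e' ≤ e generalizing e e'
  · rw [abs_sub_comm]; exact this he' he h2 h1 (by linarith)
  have hE : 0 < E := by linarith
  rw [abs_of_nonneg (sub_nonneg.2 (log_le_log (by positivity) (by linarith)))]
  have a1 : log (s + e) - log (s + e') ≤ log (1 + E / s) := by
    rw [← log_div (by positivity) (by positivity)]
    refine log_le_log (by positivity) ?_
    rw [div_le_iff₀ (by positivity)]
    have : E / s*s = E := by field_simp
    nlinarith [div_pos hE hs]
  have a2 : log (1 + E / s) = 8*log ((1 + E / s)^(1/8:ℝ)) := by
    rw [log_rpow (by positivity)]; ring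
  have a3 : (1 + E / s)^(1/8:ℝ) ≤ 1 + (E / s)^(1/8:ℝ) := by
    simpa using Real.rpow_add_le_add_rpow (a := 1) (b := E / s) (p := 1/8) (by norm_num) (by positivity) (by norm_num) (by norm_num)
  have a4 := log_le_log (by positivity) a3
  have a5 := log_le_sub_one_of_pos (x := 1 + (E / s)^(1/8:ℝ)) (by positivity)
  linarith
lemma normSq_ge (x y : BB) : Complex.normSq ((x:ℂ) - y) ≤ Complex.normSq (1 - starRingEnd ℂ (x:ℂ)*y) := by
  have hx := x.2; have hy := y.2
  rw [mem_closedBall_zero_iff] at hx hy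
  have h1 : Complex.normSq (x:ℂ) ≤ 1 := by rw [Complex.normSq_eq_norm_sq]; nlinarith [norm_nonneg (x:ℂ)]
  have h2 : Complex.normSq (y:ℂ) ≤ 1 := by rw [Complex.normSq_eq_norm_sq]; nlinarith [norm_nonneg (y:ℂ)]
  rw [Complex.normSq_apply] at *
  simp only [Complex.sub_re, Complex.sub_im, Complex.mul_re, Complex.mul_im, Complex.conj_re, Complex.conj_im,
    Complex.one_re, Complex.one_im, Complex.normSq_apply]
  nlinarith [mul_nonneg (sub_nonneg.2 h1) (sub_nonneg.2 h2)]
lemma Nf_diff {e e' E : ℝ} (he : 0 < e) (he' : 0 < e') (h1 : e ≤ E) (h2 : e' ≤ E) {x y : BB} (hxy : x ≠ y) :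
    (Nf e x y - Nf e' x y)^2 ≤ 2*E^(1/4:ℝ)*‖(x:ℂ) - y‖^(-(1/2):ℝ) := by
  have hE : 0 < E := by linarith
  have hn : 0 < ‖(x:ℂ) - y‖ := norm_pos_iff.2 (sub_ne_zero.2 fun h => hxy (Subtype.ext h))
  set s := Complex.normSq ((x:ℂ) - y) with hs
  have hs0 : 0 < s := by rw [hs, Complex.normSq_eq_norm_sq]; positivity
  have hge := normSq_ge x y
  set s' := Complex.normSq (1 - starRingEnd ℂ (x:ℂ)*y)
  have d1 := logdiff hs0 he he' h1 h2
  have d2 := logdiff (hs0.trans_le hge) he he' h1 h2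
  have d3 : (E / s')^(1/8:ℝ) ≤ (E / s)^(1/8:ℝ) :=
    Real.rpow_le_rpow (div_nonneg hE.le (hs0.le.trans hge)) (div_le_div_of_nonneg_left hE.le hs0 hge) (by norm_num)
  set t := (E / s)^(1/8:ℝ) with ht
  have ht0 : 0 ≤ t := by positivity
  have ht2 : t^2 = E^(1/4:ℝ)*‖(x:ℂ) - y‖^(-(1/2):ℝ) := by
    rw [ht, ← Real.rpow_natCast, ← Real.rpow_mul (by positivity), Real.div_rpow hE.le hs0.le, hs,
      Complex.normSq_eq_norm_sq, ← Real.rpow_natCast ‖_‖, ← Real.rpow_mul hn.le, div_eq_mul_inv, ← Real.rpow_neg hn.le]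
    norm_num
  rw [mul_assoc, ← ht2]
  have e1 : Nf e x y - Nf e' x y = -(1 / (4*π))*((log (s + e) - log (s + e')) + (log (s' + e) - log (s' + e'))) := by
    simp only [Nf]; ring
  have hpi := pi_gt_three
  have e2 : |Nf e x y - Nf e' x y| ≤ 1 / 12*(16*t) := by
    rw [e1, abs_mul, abs_neg, abs_of_pos (by positivity)]
    gcongr
    · linarith
    · exact (abs_add_le _ _).trans (by linarith)
  rw [← sq_abs]
  calc _ ≤ (1 / 12*(16*t))^2 := by gcongr
    _ ≤ _ := by nlinarith
lemma κn_cauchy : CauchySeq κn := by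
  obtain ⟨C, hC, hD⟩ := riesz (a := 1/2) (by norm_num) (by norm_num) 1
  obtain ⟨C', hC', hS⟩ := rieszS
  refine cauchySeq_of_le_tendsto_0 (fun n => √(2*en n^(1/4:ℝ)*(C + C'))) ?_ ?_
  · intro n m N hn hm
    rw [dist_eq_norm]
    refine (ContinuousMap.norm_le _ (by positivity)).2 fun x => ?_
    refine Real.le_sqrt_of_sq_le ?_
    let w : CB := (Nk n).curry x - (Nk m).curry x
    have hw : (κn n - κn m) x = iot w := by simp only [w, map_sub]; rfl
    have hbd : ∀ y, x ≠ y → (w*w) y ≤ 2*en N^(1/4:ℝ)*‖(x:ℂ) - y‖^(-(1/2):ℝ) := by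
      intro y hy
      have := Nf_diff (en_pos n) (en_pos m) (en_anti hn) (en_anti hm) hy
      rw [sq] at this; exact this
    have hen := en_pos N
    rw [hw, norm_iot_sq, norm_JD_sq, norm_JS_sq, mul_add]
    have hm' : Measurable (fun y : BB => ‖(x:ℂ) - y‖^(-(1/2):ℝ)) := by fun_prop
    have nn : ∀ y, 0 ≤ (w*w) y := fun y => mul_self_nonneg _
    refine add_le_add ?_ ?_
    · rw [lD_apply, integral_νD _ (w*w).continuous.aestronglyMeasurable]
      refine le_trans ?_ (mul_le_mul_of_nonneg_left (hD x).2 (by positivity))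
      rw [← integral_const_mul]
      refine integral_mono_of_nonneg (Eventually.of_forall fun y => nn _) ((hD x).1.const_mul _) ?_
      have h0 : ∀ᵐ y : ℂ ∂(volume.restrict unitDisk), y ≠ x := Measure.ae_ne _ _
      have hmd : MeasurableSet unitDisk := measurableSet_ball
      filter_upwards [h0, ae_restrict_mem hmd] with y h0 hy
      rw [unitDisk, mem_ball_zero_iff] at hy
      have := hbd (retr y) (fun h => h0 (by rw [h, retr_val hy.le]))
      rwa [retr_val hy.le] at this
    · rw [lS_apply]
      refine le_trans ?_ (mul_le_mul_of_nonneg_left (hS x).2 (by positivity))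
      rw [← integral_const_mul]
      refine integral_mono_of_nonneg (Eventually.of_forall nn) ((hS x).1.const_mul _) ?_
      have h0 : ∀ᵐ y ∂νS, x ≠ y := by
        have hms : MeasurableSet {a : BB | x = a} := measurableSet_eq_fun measurable_const measurable_id
        rw [ae_iff]
        simp only [ne_eq, not_not]
        rw [νS, Measure.map_apply bptB_cont.measurable hms]
        have : (bptB ⁻¹' {a | x = a} ∩ Ioc 0 (2*π)).Subsingleton := by
          rintro a ⟨ha, ha1⟩ b ⟨hb, hb1⟩
          have ha : x = bptB a := ha
          have hb : x = bptB b := hb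
          have hab : bpt a = bpt b := by
            have := congrArg Subtype.val (ha.symm.trans hb); exact this
          obtain ⟨n, hn⟩ := Complex.exp_eq_exp_iff_exists_int.1 hab
          have hn' : a = b + n*(2*π) := by
            have : (a:ℂ)*Complex.I = (b + n*(2*π))*Complex.I := by rw [hn]; ring
            have := mul_right_cancel₀ Complex.I_ne_zero this
            exact_mod_cast this
          have p := two_pi_pos
          have n1 : (n:ℝ) < 1 := by by_contra h; push Not at h; nlinarith [ha1.1, ha1.2, hb1.1, hb1.2]
          have n2 : (-1:ℝ) < n := by by_contra h; push Not at h; nlinarith [ha1.1, ha1.2, hb1.1, hb1.2]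
          have : n = 0 := by
            have n1 : n < 1 := by exact_mod_cast n1
            have n2 : -1 < n := by exact_mod_cast n2
            omega
          rw [hn', this]; simp
        rw [Measure.restrict_apply' measurableSet_Ioc]
        exact this.measure_zero _
      filter_upwards [h0] with y hy using hbd y hy
  · have h1 : Tendsto (fun n => en n^(1/4:ℝ)) atTop (𝓝 0) := by
      have := en_tendsto.rpow_const (p := 1/4) (Or.inr (by norm_num))
      rwa [Real.zero_rpow (by norm_num)] at this
    have := ((h1.const_mul 2).mul_const (C + C')).sqrt
    simpa using this
lemma exists_κ : ∃ κ : C(BB, HH), Tendsto κn atTop (𝓝 κ) := cauchySeq_tendsto_of_complete κn_cauchy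
def κ0 : C(BB, HH) := exists_κ.choose
lemma κ0_lim (x : BB) : Tendsto (fun n => κn n x) atTop (𝓝 (κ0 x)) :=
  ((continuous_eval_const (F := C(BB, HH)) x).tendsto _).comp exists_κ.choose_spec
lemma T_lim (q : HH) (x : BB) : Tendsto (fun n => inner ℝ (κn n x) q) atTop (𝓝 (opk κ0 q x)) :=
  (κ0_lim x).inner tendsto_const_nhds
def GG : HH →L[ℝ] CB := opk κ0 + (innerSL ℝ (iot 1)).smulRight ((1 : CB) - (2*π)⁻¹ • opk κ0 (JS 1))
lemma GG_apply (q : HH) : GG q = opk κ0 q + tot q • ((1 : CB) - (2*π)⁻¹ • opk κ0 (JS 1)) := by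
  rw [tot, real_inner_comm]; rfl
lemma lS_one : lS 1 = 2*π := by
  rw [lS_apply]; simp [νS_univ]
lemma GG_cpt : IsCompactOperator GG := by
  refine (opk_cpt κ0).add ?_
  refine ⟨(fun c : ℝ => c • ((1 : CB) - (2*π)⁻¹ • opk κ0 (JS 1))) '' Metric.closedBall 0 1,
    (isCompact_closedBall _ _).image (by fun_prop), ?_⟩
  have : Continuous fun q : HH => innerSL ℝ (iot 1) q := ContinuousLinearMap.continuous _
  have h := this.tendsto 0
  rw [map_zero] at h
  filter_upwards [h (Metric.closedBall_mem_nhds 0 one_pos)] with q hq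
  exact ⟨_, hq, rfl⟩
end PartG2
section PartG3
open Set Topology
lemma pd_of_line {f : ℂ → ℝ} {x v : ℂ} {d : ℝ} (hf : DifferentiableAt ℝ f x)
    (h : HasDerivAt (fun t : ℝ => f (x + t*v)) d 0) : pd f v x = d := by
  have := (hf.hasFDerivAt.hasLineDerivAt v)
  rw [HasLineDerivAt] at this
  exact this.unique (by simpa only [Complex.real_smul] using h)
def nl (e : ℝ) (a b y : ℂ) : ℝ := log (Complex.normSq (a + b*y) + e)
lemma nl_pos {e : ℝ} (he : 0 < e) (z : ℂ) : 0 < Complex.normSq z + e := by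
  have := Complex.normSq_nonneg z; positivity
lemma normSq_C : ContDiff ℝ ⊤ (fun z : ℂ => Complex.normSq z) := by
  simp only [Complex.normSq_apply]
  exact (Complex.reCLM.contDiff.mul Complex.reCLM.contDiff).add (Complex.imCLM.contDiff.mul Complex.imCLM.contDiff)
lemma nl_C {e : ℝ} (he : 0 < e) (a b : ℂ) : ContDiff ℝ 2 (nl e a b) :=
  ContDiff.log (((normSq_C.of_le le_top).comp (by fun_prop)).add contDiff_const) fun y => (nl_pos he _).ne'
lemma normSq_line (a b y v : ℂ) (t : ℝ) : Complex.normSq (a + b*(y + t*v)) =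
    Complex.normSq (a + b*y) + 2*t*(starRingEnd ℂ (a + b*y)*(b*v)).re + t^2*Complex.normSq (b*v) := by
  simp [Complex.normSq_apply]; ring
lemma nl_pd {e : ℝ} (he : 0 < e) (a b y v : ℂ) : pd (nl e a b) v y =
    2*(starRingEnd ℂ (a + b*y)*(b*v)).re / (Complex.normSq (a + b*y) + e) := by
  refine pd_of_line ((nl_C he a b).differentiable (by norm_num) _) ?_
  simp only [nl, normSq_line]
  set A := Complex.normSq (a + b*y)
  set B := (starRingEnd ℂ (a + b*y)*(b*v)).re
  set D := Complex.normSq (b*v)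
  have hp : A + 2*0*B + 0^2*D + e ≠ 0 := by have := nl_pos he (a + b*y); simp; exact this.ne'
  have h : HasDerivAt (fun t : ℝ => A + 2*t*B + t^2*D + e) (2*B) 0 := by
    have h1 := ((((hasDerivAt_id (0:ℝ)).const_mul 2).mul_const B).const_add A).add (((hasDerivAt_id (0:ℝ)).pow 2).mul_const D)
    refine (h1.add_const e).congr_deriv ?_
    simp
  refine (h.log hp).congr_deriv ?_
  simp
lemma lap_eq (f : ℂ → ℝ) (y : ℂ) : lap f y = pd (pd f 1) 1 y + pd (pd f Complex.I) Complex.I y := rfl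
lemma nl_lap {e : ℝ} (he : 0 < e) (a b y : ℂ) : lap (nl e a b) y =
    4*Complex.normSq b*e / (Complex.normSq (a + b*y) + e)^2 := by
  have key : ∀ v : ℂ, pd (pd (nl e a b) v) v y = 2*Complex.normSq (b*v) / (Complex.normSq (a + b*y) + e)
      - (2*(starRingEnd ℂ (a + b*y)*(b*v)).re)^2 / (Complex.normSq (a + b*y) + e)^2 := by
    intro v
    refine pd_of_line ((pd_C1 (nl_C he a b) v).differentiable (by norm_num) _) ?_
    simp only [nl_pd he, normSq_line]
    have e2 : ∀ t : ℝ, (starRingEnd ℂ (a + b*(y + t*v))*(b*v)).re =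
      (starRingEnd ℂ (a + b*y)*(b*v)).re + t*Complex.normSq (b*v) := by
        intro t; simp [Complex.normSq_apply]; ring
    simp only [e2]
    have hq := nl_pos he (a + b*y)
    set A := Complex.normSq (a + b*y)
    set B := (starRingEnd ℂ (a + b*y)*(b*v)).re
    set D := Complex.normSq (b*v)
    have hp : A + 2*0*B + 0^2*D + e ≠ 0 := by simp; exact hq.ne'
    have h : HasDerivAt (fun t : ℝ => A + 2*t*B + t^2*D + e) (2*B) 0 := by
      have h1 := ((((hasDerivAt_id (0:ℝ)).const_mul 2).mul_const B).const_add A).add (((hasDerivAt_id (0:ℝ)).pow 2).mul_const D)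
      refine (h1.add_const e).congr_deriv ?_
      simp
    have h2 : HasDerivAt (fun t : ℝ => 2*(B + t*D)) (2*D) 0 := by
      simpa using ((((hasDerivAt_id (0:ℝ))).mul_const D).const_add B).const_mul 2
    refine (h2.div h hp).congr_deriv ?_
    have hq' := hq.ne'
    simp
    field_simp
  have h1 := key 1
  have h2 := key Complex.I
  rw [lap_eq, h1, h2]
  have hq := (nl_pos he (a + b*y)).ne'
  have e1 : Complex.normSq (b*1) = Complex.normSq b := by simp
  have e2 : Complex.normSq (b*Complex.I) = Complex.normSq b := by simp
  have e3 : (starRingEnd ℂ (a + b*y)*(b*1)).re^2 + (starRingEnd ℂ (a + b*y)*(b*Complex.I)).re^2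
    = Complex.normSq (a + b*y)*Complex.normSq b := by
      simp [Complex.normSq_apply]; ring
  rw [e1, e2]
  generalize (starRingEnd ℂ (a + b*y)*(b*1)).re = p at e3 ⊢
  generalize (starRingEnd ℂ (a + b*y)*(b*Complex.I)).re = p' at e3 ⊢
  field_simp
  linear_combination (-4)*e3
lemma Nf_eq (e : ℝ) (x y : ℂ) : Nf e x y = -(1 / (4*π))*(nl e x (-1) y + nl e 1 (-(starRingEnd ℂ x)) y) := by
  simp only [Nf, nl, sub_eq_add_neg, neg_mul, one_mul]
lemma Nf_C {e : ℝ} (he : 0 < e) (x : ℂ) : ContDiff ℝ 2 (Nf e x) := by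
  have := nl_C he x (-1)
  have := nl_C he 1 (-(starRingEnd ℂ x))
  have h : Nf e x = fun y => -(1 / (4*π))*(nl e x (-1) y + nl e 1 (-(starRingEnd ℂ x)) y) := funext (Nf_eq e x)
  rw [h]; fun_prop
lemma pd_lin {f g : ℂ → ℝ} (hf : ContDiff ℝ 1 f) (hg : ContDiff ℝ 1 g) (c d : ℝ) (w : ℂ) :
    pd (fun y => c*f y + d*g y) w = fun y => c*pd f w y + d*pd g w y := by
  funext y
  have := (((hf.differentiable one_ne_zero y).hasFDerivAt.const_mul c).add
    ((hg.differentiable one_ne_zero y).hasFDerivAt.const_mul d)).fderiv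
  simp only [pd]
  erw [this]; simp
lemma lap_lin {f g : ℂ → ℝ} (hf : ContDiff ℝ 2 f) (hg : ContDiff ℝ 2 g) (c d : ℝ) (y : ℂ) :
    lap (fun y => c*f y + d*g y) y = c*lap f y + d*lap g y := by
  have hf1 := hf.of_le (m := 1) (by norm_num)
  have hg1 := hg.of_le (m := 1) (by norm_num)
  have a1 := congrFun (pd_lin (pd_C1 hf 1) (pd_C1 hg 1) c d 1) y
  have a2 := congrFun (pd_lin (pd_C1 hf Complex.I) (pd_C1 hg Complex.I) c d Complex.I) y
  rw [lap_eq, lap_eq, lap_eq, pd_lin hf1 hg1, pd_lin hf1 hg1, a1, a2]; ring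
lemma Nf_lap {e : ℝ} (he : 0 < e) (x y : ℂ) : -lap (Nf e x) y =
    (1 / π)*(e / (Complex.normSq (x - y) + e)^2) +
    (1 / π)*(Complex.normSq x*e / (Complex.normSq (1 - starRingEnd ℂ x*y) + e)^2) := by
  have h : Nf e x = fun y => -(1 / (4*π))*nl e x (-1) y + -(1 / (4*π))*nl e 1 (-(starRingEnd ℂ x)) y :=
    funext fun y => by rw [Nf_eq]; ring
  rw [h, lap_lin (nl_C he _ _) (nl_C he _ _), nl_lap he, nl_lap he]
  simp only [Complex.normSq_neg, Complex.normSq_conj, neg_mul, one_mul, map_one, ← sub_eq_add_neg]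
  have := pi_ne_zero
  field_simp
  ring
lemma Nf_nderiv {e : ℝ} (he : 0 < e) (x : ℂ) (θ : ℝ) : nderiv (Nf e x) (bpt θ) =
    -(1 / (2*π))*(Complex.normSq (x - bpt θ) / (Complex.normSq (x - bpt θ) + e)) := by
  have h : Nf e x = fun y => -(1 / (4*π))*nl e x (-1) y + -(1 / (4*π))*nl e 1 (-(starRingEnd ℂ x)) y :=
    funext fun y => by rw [Nf_eq]; ring
  have hn : Complex.normSq (bpt θ) = 1 := by rw [Complex.normSq_eq_norm_sq, bpt_norm]; norm_num
  have hs : Complex.normSq (1 + -(starRingEnd ℂ x)*bpt θ) = Complex.normSq (x + -1*bpt θ) := by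
    simp only [Complex.normSq_apply] at *
    simp
    linear_combination (x.re^2 + x.im^2 - 1)*hn
  have hs0 : Complex.normSq (x - bpt θ) = Complex.normSq (x + -1*bpt θ) := by rw [neg_one_mul, sub_eq_add_neg]
  rw [nderiv, h, pd_lin ((nl_C he _ _).of_le (by norm_num)) ((nl_C he _ _).of_le (by norm_num)), 
    pd_lin ((nl_C he _ _).of_le (by norm_num)) ((nl_C he _ _).of_le (by norm_num))]
  simp only [nl_pd he, hs, hs0]
  have hq := (nl_pos he (x + -1*bpt θ)).ne'
  have hpi := pi_ne_zero
  have e4 : (bpt θ).re*((starRingEnd ℂ (x + -1*bpt θ)*(-1*1)).re +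
      (starRingEnd ℂ (1 + -(starRingEnd ℂ x)*bpt θ)*(-(starRingEnd ℂ x)*1)).re) +
      (bpt θ).im*((starRingEnd ℂ (x + -1*bpt θ)*(-1*Complex.I)).re +
      (starRingEnd ℂ (1 + -(starRingEnd ℂ x)*bpt θ)*(-(starRingEnd ℂ x)*Complex.I)).re) =
      Complex.normSq (x + -1*bpt θ) := by
    simp only [Complex.normSq_apply] at *
    simp
    linear_combination (x.re^2 + x.im^2)*hn
  rw [← e4] at hq ⊢
  field_simp
  ring
end PartG3
section PartG4
open Set Topology
def φ0 (z : ℂ) : ℝ := (1 / π)*(1 / (‖z‖^2 + 1)^2)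
lemma φ0_int : ∫ z, φ0 z = 1 := by
  have h := integral_fun_norm_addHaar (volume : Measure ℂ) (fun r : ℝ => (1 / π)*(1 / (r^2 + 1)^2))
  change ∫ z, φ0 z = _ at h
  rw [h, Complex.finrank_real_complex]
  have h2 : ∫ y in Ioi (0:ℝ), y^(2 - 1) • ((1 / π)*(1 / (y^2 + 1)^2)) = 1 / (2*π) := by
    have hd : ∀ y ∈ Ici (0:ℝ), HasDerivAt (fun y : ℝ => -(1 / (2*π))*(y^2 + 1)⁻¹)
        (y^(2 - 1) • ((1 / π)*(1 / (y^2 + 1)^2))) y := by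
      intro y _
      have h0 : y^2 + 1 ≠ 0 := by positivity
      refine ((((hasDerivAt_id y).pow 2).add_const 1).inv h0 |>.const_mul _).congr_deriv ?_
      have := pi_ne_zero
      simp
      field_simp
    have ht : Tendsto (fun y : ℝ => -(1 / (2*π))*(y^2 + 1)⁻¹) atTop (𝓝 (-(1 / (2*π))*0)) := by
      refine Tendsto.const_mul _ (Tendsto.inv_tendsto_atTop ?_)
      exact tendsto_atTop_add_const_right _ _ (tendsto_pow_atTop two_ne_zero)
    have hpos : ∀ y ∈ Ioi (0:ℝ), 0 ≤ y^(2 - 1) • ((1 / π)*(1 / (y^2 + 1)^2)) := by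
      intro y hy; have : 0 < y := hy; rw [smul_eq_mul]; positivity
    rw [integral_Ioi_of_hasDerivAt_of_nonneg' hd hpos ht]
    simp
  rw [h2]
  have hb : volume.real (Metric.ball (0:ℂ) 1) = π := by
    rw [measureReal_def]; simp
  rw [hb]
  have := pi_ne_zero
  simp
lemma approx {g : ℂ → ℝ} {x : ℂ} (hg : Integrable g) (hx : ContinuousAt g x) :
    Tendsto (fun n => ∫ y, (1 / π)*(en n / (Complex.normSq (x - y) + en n)^2)*g y) atTop (𝓝 (g x)) := by
  have h := tendsto_integral_comp_smul_smul_of_integrable' (μ := volume) (φ := φ0)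
    (fun z => by unfold φ0; positivity) φ0_int ?_ hg hx
  · have hc : Tendsto (fun n : ℕ => √((n:ℝ) + 1)) atTop atTop :=
      tendsto_sqrt_atTop.comp (tendsto_atTop_add_const_right _ _ tendsto_natCast_atTop_atTop)
    refine (h.comp hc).congr fun n => ?_
    simp only [Function.comp]
    refine integral_congr_ae (Eventually.of_forall fun y => ?_)
    have hn : (0:ℝ) < n + 1 := by positivity
    have hs : √((n:ℝ) + 1)^2 = n + 1 := sq_sqrt hn.le
    simp only [φ0, Complex.finrank_real_complex, norm_smul, mul_pow, norm_eq_abs, sq_abs, hs, en,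
      ← Complex.normSq_eq_norm_sq, smul_eq_mul]
    have := Complex.normSq_nonneg (x - y)
    have hpi := pi_pos
    field_simp
  · rw [Complex.finrank_real_complex]
    have h1 : Tendsto (fun x : ℂ => (1 / π)*(‖x‖^2 + 1)⁻¹) (Bornology.cobounded ℂ) (𝓝 0) := by
      rw [← mul_zero (1 / π)]
      refine Tendsto.const_mul _ (Tendsto.inv_tendsto_atTop ?_)
      exact tendsto_atTop_add_const_right _ _ ((tendsto_pow_atTop two_ne_zero).comp tendsto_norm_cobounded_atTop)
    refine squeeze_zero (fun z => by unfold φ0; positivity) (fun z => ?_) h1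
    unfold φ0
    have hpi := pi_pos
    field_simp
    nlinarith [sq_nonneg ‖z‖]
def qU (U : ℂ → ℝ) (hU : ContDiff ℝ 2 U) : HH :=
  JD (cbR (fun x => -lap U x) (lap_cont hU).neg) +
  JS (cbR (nderiv U) (nderiv_cont (hU.of_le (by norm_num)))) + (bint U / (4*π^2)) • JS 1
lemma inner_JD_iot_cbR {f g : ℂ → ℝ} (hf : Continuous f) (hg : Continuous g) :
    inner ℝ (JD (cbR f hf)) (iot (cbR g hg)) = ∫ x in unitDisk, f x*g x := by
  rw [inner_JD_iot, lD_apply]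
  exact integral_νD' (fun x => f x*g x) ((hf.mul hg).comp continuous_subtype_val)
lemma inner_JS_iot_cbR {f g : ℂ → ℝ} (hf : Continuous f) (hg : Continuous g) :
    inner ℝ (JS (cbR f hf)) (iot (cbR g hg)) = bint (fun x => f x*g x) := by
  rw [inner_JS_iot, lS_apply]
  exact integral_νS' (fun x => f x*g x) ((hf.mul hg).comp continuous_subtype_val)
lemma lS_cbR' {f : ℂ → ℝ} (hf : Continuous f) : lS (cbR f hf) = bint f := by
  rw [lS_apply]; exact integral_νS' f (hf.comp continuous_subtype_val)
lemma qU_inner {U v : ℂ → ℝ} (hU : ContDiff ℝ 2 U) (hv : ContDiff ℝ 1 v) :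
    inner ℝ (qU U hU) (iot (cbR v hv.continuous)) =
      (∫ x in unitDisk, gdot U v x) + bint U*bint v / (4*π^2) := by
  rw [qU, inner_add_left, inner_add_left, inner_JD_iot_cbR, inner_JS_iot_cbR, real_inner_smul_left, inner_JS_iot,
    one_mul, green hU hv, lS_cbR']
  ring
lemma κn_eq (n : ℕ) (x : BB) : κn n x = iot (cbR (Nf (en n) x) (Nf_C (en_pos n) x).continuous) := rfl
lemma gdot_comm (U v : ℂ → ℝ) : gdot U v = gdot v U := by funext x; simp only [gdot]; ring
lemma rep_in {U : ℂ → ℝ} (hU : ContDiff ℝ 2 U) {x : BB} (hx : ‖(x:ℂ)‖ < 1) :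
    opk κ0 (qU U hU - (bint U / (4*π^2)) • JS 1) x = U x - bint U / (2*π) := by
  refine tendsto_nhds_unique (T_lim _ x) ?_
  have hU1 := hU.of_le (m := 1) (by norm_num)
  have hc := hU.continuous
  have hmd : MeasurableSet unitDisk := measurableSet_ball
  have e1 : ∀ n, inner ℝ (κn n x) (qU U hU - (bint U / (4*π^2)) • JS 1) =
      (∫ y, (1 / π)*(en n / (Complex.normSq (x - y) + en n)^2)*unitDisk.indicator U y) +
      (∫ y in unitDisk, (1 / π)*(Complex.normSq x*en n / (Complex.normSq (1 - starRingEnd ℂ (x:ℂ)*y) + en n)^2)*U y) +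
      ∫ θ in 0..(2*π), -(1 / (2*π))*(Complex.normSq (x - bpt θ) / (Complex.normSq (x - bpt θ) + en n))*U (bpt θ) := by
    intro n
    have hN := Nf_C (en_pos n) x
    have hN1 := hN.of_le (m := 1) (by norm_num)
    have hen := en_pos n
    have hcs := Complex.continuous_normSq
    have c1 : Continuous fun y : ℂ => (1 / π)*(en n / (Complex.normSq (x - y) + en n)^2)*U y := by
      refine (continuous_const.mul (continuous_const.div (by fun_prop) fun y => ?_)).mul hc
      have := Complex.normSq_nonneg ((x:ℂ) - y); positivity
    have c2 : Continuous fun y : ℂ => (1 / π)*(Complex.normSq x*en n / (Complex.normSq (1 - starRingEnd ℂ (x:ℂ)*y) + en n)^2)*U y := by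
      refine (continuous_const.mul (continuous_const.div (by fun_prop) fun y => ?_)).mul hc
      have := Complex.normSq_nonneg (1 - starRingEnd ℂ (x:ℂ)*y); positivity
    rw [qU, add_sub_cancel_right, κn_eq, real_inner_comm, inner_add_left, inner_JD_iot_cbR, inner_JS_iot_cbR,
      ← green hU hN1, gdot_comm, green hN hU1]
    congr 1
    · have : (fun y => (1 / π)*(en n / (Complex.normSq (x - y) + en n)^2)*unitDisk.indicator U y) =
        unitDisk.indicator fun y => (1 / π)*(en n / (Complex.normSq (x - y) + en n)^2)*U y := by
          funext y; by_cases hy : y ∈ unitDisk <;> simp [hy]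
      rw [this, integral_indicator hmd, ← integral_add (disk_int c1) (disk_int c2)]
      congr 1; funext y; rw [Nf_lap (en_pos n)]; ring
    · simp only [bint, Nf_nderiv (en_pos n)]
  simp only [e1]
  have hn : 0 < 1 - ‖(x:ℂ)‖ := by linarith
  have t1 := approx (g := unitDisk.indicator U) (x := x) ((integrable_indicator_iff hmd).2 (disk_int hc)) (by
    refine hc.continuousAt.congr ?_
    have : unitDisk ∈ 𝓝 (x:ℂ) := Metric.isOpen_ball.mem_nhds (mem_ball_zero_iff.2 hx)
    filter_upwards [this] with y hy; simp [hy])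
  have hxi : unitDisk.indicator U x = U x := indicator_of_mem (mem_ball_zero_iff.2 hx) U
  rw [hxi] at t1
  have en1 : ∀ n, en n ≤ 1 := fun n => by unfold en; rw [div_le_one (by positivity)]; linarith [(Nat.cast_nonneg n : (0:ℝ) ≤ n)]
  have t2 : Tendsto (fun n => ∫ y in unitDisk, (1 / π)*(Complex.normSq x*en n / (Complex.normSq (1 - starRingEnd ℂ (x:ℂ)*y) + en n)^2)*U y)
      atTop (𝓝 (∫ y in unitDisk, 0)) := by
    refine tendsto_integral_filter_of_dominated_convergence (fun y => (1 / π)*(1 / ((1 - ‖(x:ℂ)‖)^2)^2) * |U y|) ?_ ?_ ?_ ?_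
    · refine Eventually.of_forall fun n => Measurable.aestronglyMeasurable ?_
      have := hc.measurable; have := Complex.continuous_normSq.measurable
      fun_prop
    · refine Eventually.of_forall fun n => ?_
      filter_upwards [ae_restrict_mem hmd] with y hy
      rw [unitDisk, mem_ball_zero_iff] at hy
      rw [norm_mul, norm_mul, norm_eq_abs, norm_eq_abs, norm_eq_abs, abs_of_pos (by positivity), abs_of_nonneg]
      · have l1 : 1 - ‖(x:ℂ)‖ ≤ ‖1 - starRingEnd ℂ (x:ℂ)*y‖ := by
          have := norm_sub_norm_le (1:ℂ) (starRingEnd ℂ (x:ℂ)*y)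
          rw [norm_one, norm_mul, RCLike.norm_conj] at this
          nlinarith [norm_nonneg (x:ℂ)]
        have l2 : Complex.normSq (x:ℂ)*en n ≤ 1 := by
          rw [Complex.normSq_eq_norm_sq]
          have a1 : ‖(x:ℂ)‖^2 ≤ 1 := by nlinarith [norm_nonneg (x:ℂ)]
          nlinarith [en_pos n, en1 n]
        rw [Complex.normSq_eq_norm_sq (1 - _)]
        have := en_pos n
        gcongr
        nlinarith
      · have := en_pos n; have := Complex.normSq_nonneg (x:ℂ); positivity
    · exact (disk_int (by fun_prop : Continuous fun y => (1 / π)*(1 / ((1 - ‖(x:ℂ)‖)^2)^2) * |U y|))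
    · filter_upwards [ae_restrict_mem hmd] with y hy
      rw [unitDisk, mem_ball_zero_iff] at hy
      have hne : Complex.normSq (1 - starRingEnd ℂ (x:ℂ)*y) ≠ 0 := by
        intro h0
        rw [Complex.normSq_eq_zero] at h0
        have := norm_sub_norm_le (1:ℂ) (starRingEnd ℂ (x:ℂ)*y)
        rw [h0, norm_one, norm_mul, RCLike.norm_conj, norm_zero] at this
        nlinarith [norm_nonneg (x:ℂ)]
      have := (((en_tendsto.const_mul (Complex.normSq (x:ℂ))).div ((en_tendsto.const_add (Complex.normSq (1 - starRingEnd ℂ (x:ℂ)*y))).pow 2)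
        (by simpa using hne)).const_mul (1 / π)).mul_const (U y)
      simpa using this
  have t3 : Tendsto (fun n => ∫ θ in 0..(2*π), -(1 / (2*π))*(Complex.normSq (x - bpt θ) / (Complex.normSq (x - bpt θ) + en n))*U (bpt θ))
      atTop (𝓝 (∫ θ in 0..(2*π), -(1 / (2*π))*U (bpt θ))) := by
    have hb := bpt_cont
    refine intervalIntegral.tendsto_integral_filter_of_dominated_convergence (fun θ => (1 / (2*π)) * |U (bpt θ)|) ?_ ?_ ?_ ?_
    · refine Eventually.of_forall fun n => Measurable.aestronglyMeasurable ?_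
      have := (hc.comp hb).measurable; have := Complex.continuous_normSq.measurable; have := hb.measurable
      simp only [Function.comp_def] at *
      fun_prop
    · refine Eventually.of_forall fun n => Eventually.of_forall fun θ _ => ?_
      have p1 := en_pos n; have p2 := Complex.normSq_nonneg ((x:ℂ) - bpt θ)
      rw [norm_mul, norm_mul, norm_neg, norm_eq_abs, norm_eq_abs, norm_eq_abs, abs_of_pos (by positivity), abs_of_nonneg (by positivity)]
      gcongr
      refine mul_le_of_le_one_right (by positivity) ?_
      rw [div_le_one (by positivity)]; linarith
    · exact (by fun_prop : Continuous fun θ => (1 / (2*π)) * |U (bpt θ)|).intervalIntegrable _ _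
    · refine Eventually.of_forall fun θ _ => ?_
      have hne : Complex.normSq ((x:ℂ) - bpt θ) ≠ 0 := by
        intro h0
        rw [Complex.normSq_eq_zero, sub_eq_zero] at h0
        rw [h0, bpt_norm] at hx; exact lt_irrefl _ hx
      have := (((en_tendsto.const_add (Complex.normSq ((x:ℂ) - bpt θ))).inv₀ (by simpa using hne)).const_mul (Complex.normSq ((x:ℂ) - bpt θ))).const_mul (-(1 / (2*π))) |>.mul_const (U (bpt θ))
      simp only [div_eq_mul_inv (Complex.normSq ((x:ℂ) - bpt θ))]
      simpa [hne] using this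
  have := (t1.add t2).add t3
  convert this using 2
  rw [intervalIntegral.integral_const_mul, bint]; simp; ring
lemma tot_qU {U : ℂ → ℝ} (hU : ContDiff ℝ 2 U) : tot (qU U hU) = bint U / (2*π) := by
  have h := qU_inner hU (contDiff_const (c := (1:ℝ)))
  have h1 : cbR (fun _ => (1:ℝ)) continuous_const = 1 := rfl
  rw [tot, ← h1]
  refine h.trans ?_
  have : ∀ x, gdot U (fun _ => (1:ℝ)) x = 0 := fun x => by simp [gdot, pd]
  have hpi := pi_ne_zero
  simp [this, bint]
  field_simp; ring
lemma BB_dense : Dense {x : BB | ‖(x:ℂ)‖ < 1} := by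
  intro x
  refine mem_closure_of_tendsto (f := fun n : ℕ => retr (((1 - en n : ℝ) : ℂ)*x)) (b := atTop) ?_ ?_
  · have : Tendsto (fun n : ℕ => retr (((1 - en n : ℝ) : ℂ)*x)) atTop (𝓝 (retr (((1 - 0 : ℝ) : ℂ)*x))) :=
      (retr_cont.tendsto _).comp (((Complex.continuous_ofReal.tendsto _).comp (en_tendsto.const_sub 1)).mul_const _)
    have hr : retr (((1 - 0 : ℝ) : ℂ)*x) = x := by
      have := x.2; rw [mem_closedBall_zero_iff] at this
      apply Subtype.ext; rw [sub_zero, Complex.ofReal_one, one_mul, retr_val this]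
    rwa [hr] at this
  · refine Eventually.of_forall fun n => ?_
    have hx := x.2; rw [mem_closedBall_zero_iff] at hx
    have e1 := en_pos n
    have e2 : en n ≤ 1 := by unfold en; rw [div_le_one (by positivity)]; linarith [(Nat.cast_nonneg n : (0:ℝ) ≤ n)]
    have : ‖((1 - en n : ℝ) : ℂ)*x‖ < 1 := by
      rw [norm_mul, Complex.norm_real, norm_eq_abs, abs_of_nonneg (by linarith)]
      nlinarith [norm_nonneg (x:ℂ)]
    change ‖((retr _ : BB) : ℂ)‖ < 1
    rwa [retr_val this.le]
lemma GG_rep {U : ℂ → ℝ} (hU : ContDiff ℝ 2 U) : GG (qU U hU) = cbR U hU.continuous := by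
  rw [GG_apply, tot_qU]
  have h1 : opk κ0 (qU U hU - (bint U / (4*π^2)) • JS 1) = cbR U hU.continuous - (bint U / (2*π)) • 1 := by
    refine DFunLike.coe_injective (Continuous.ext_on BB_dense (map_continuous _) (map_continuous _) fun x hx => ?_)
    rw [rep_in hU hx]
    simp [cbR_apply]
  rw [map_sub, map_smul, sub_eq_iff_eq_add] at h1
  rw [h1]
  have hpi := pi_ne_zero
  ext x
  simp
  field_simp; ring
end PartG4
section PartG5
open Set Topology
def Mo (c : ℂ) (a b : ℕ) (z : ℂ) : ℝ := (c*z^a*(starRingEnd ℂ z)^b).re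
lemma Mo_C (c : ℂ) (a b : ℕ) : ContDiff ℝ 2 (Mo c a b) := by
  have h : ContDiff ℝ 2 fun z : ℂ => starRingEnd ℂ z := Complex.conjCLE.contDiff
  exact Complex.reCLM.contDiff.comp (by fun_prop : ContDiff ℝ 2 fun z : ℂ => c*z^a*(starRingEnd ℂ z)^b)
lemma Mo_pd (c : ℂ) (a b : ℕ) (v : ℂ) : pd (Mo c a b) v =
    fun z => 1*Mo (c*a*v) (a - 1) b z + 1*Mo (c*b*starRingEnd ℂ v) a (b - 1) z := by
  funext z
  refine pd_of_line ((Mo_C c a b).differentiable (by norm_num) z) ?_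
  have h1 : HasDerivAt (fun t : ℝ => z + t*v) v 0 := by
    simpa using ((Complex.ofRealCLM.hasDerivAt (x := (0:ℝ))).mul_const v).const_add z
  have h2 : HasDerivAt (fun t : ℝ => starRingEnd ℂ (z + t*v)) (starRingEnd ℂ v) 0 :=
    h1.star
  have h3 := (((h1.pow a).const_mul c).mul (h2.pow b))
  have h4 := Complex.reCLM.hasFDerivAt.comp_hasDerivAt (0:ℝ) h3
  refine h4.congr_deriv ?_
  simp only [Complex.reCLM_apply, Mo, one_mul, Complex.ofReal_zero, zero_mul, add_zero, ← Complex.add_re, Pi.pow_apply]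
  congr 1; ring
lemma Mo_lap (c : ℂ) (a b : ℕ) (z : ℂ) : lap (Mo c a b) z = Mo (4*c*a*b) (a - 1) (b - 1) z := by
  have C1 := fun c a b => (Mo_C c a b).of_le (m := 1) (by norm_num)
  rw [lap_eq, Mo_pd, Mo_pd, pd_lin (C1 _ _ _) (C1 _ _ _), pd_lin (C1 _ _ _) (C1 _ _ _)]
  simp only [Mo_pd, Mo, one_mul, ← Complex.add_re]
  congr 1
  simp only [map_one, Complex.conj_I]
  linear_combination (c*a*((a - 1 : ℕ):ℂ)*z^(a-1-1)*(starRingEnd ℂ z)^b + c*b*((b - 1 : ℕ):ℂ)*z^a*(starRingEnd ℂ z)^(b-1-1)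
    - 2*c*a*b*z^(a-1)*(starRingEnd ℂ z)^(b-1))*Complex.I_mul_I
lemma nderiv_eq (U : ℂ → ℝ) (x : ℂ) : nderiv U x = pd U x x := by
  simp only [nderiv, pd]
  conv_rhs => rw [← Complex.re_add_im x]
  have e1 : (x.re : ℂ) = x.re • (1:ℂ) := by simp
  have e2 : (x.im : ℂ)*Complex.I = x.im • Complex.I := by simp
  rw [e1, e2, map_add, map_smul, map_smul]
  simp only [smul_eq_mul]
  rw [← e1, ← e2, Complex.re_add_im]
lemma Mo_nderiv (c : ℂ) (a b : ℕ) (z : ℂ) : nderiv (Mo c a b) z = (a + b)*Mo c a b z := by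
  rw [nderiv_eq, Mo_pd]
  have e : ((a:ℝ) + b)*Mo c a b z = ((((a:ℝ) + b : ℝ) : ℂ)*(c*z^a*(starRingEnd ℂ z)^b)).re := by
    rw [Complex.re_ofReal_mul, Mo]
  rw [e]
  simp only [Mo, one_mul, ← Complex.add_re]
  congr 1
  push_cast
  have h1 : (a:ℂ)*(z*z^(a - 1)) = a*z^a := by
    rcases a with _ | a
    · simp
    · simp [pow_succ']
  have h2 : (b:ℂ)*(starRingEnd ℂ z*(starRingEnd ℂ z)^(b - 1)) = b*(starRingEnd ℂ z)^b := by
    rcases b with _ | b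
    · simp
    · simp [pow_succ']
  linear_combination c*(starRingEnd ℂ z)^b*h1 + c*z^a*h2
lemma sw_zero (l : CB →L[ℝ] ℝ) (h : ∀ c a b, l (cbR (Mo c a b) (Mo_C c a b).continuous) = 0) (f : CB) : l f = 0 := by
  let Λ : C(BB, ℂ) →L[ℝ] ℝ := l.comp (ContinuousLinearMap.compLeftContinuous ℝ BB Complex.reCLM)
  let V : Submodule ℂ C(BB, ℂ) :=
    { carrier := {F | ∀ c : ℂ, Λ (c • F) = 0}
      add_mem' := fun {F F'} h1 h2 c => by rw [smul_add, map_add, h1, h2, add_zero]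
      zero_mem' := fun c => by rw [smul_zero, map_zero]
      smul_mem' := fun d F h1 c => by rw [smul_smul]; exact h1 _ }
  have hcl : IsClosed (V : Set C(BB, ℂ)) := by
    have : (V : Set C(BB, ℂ)) = ⋂ c : ℂ, {F | Λ (c • F) = 0} := by ext F; simp only [mem_iInter]; rfl
    rw [this]
    exact isClosed_iInter fun c => isClosed_eq (Λ.continuous.comp (continuous_const_smul c)) continuous_const
  let idc : C(BB, ℂ) := (ContinuousMap.id ℂ).restrict (Metric.closedBall (0:ℂ) 1)
  have hadj : (StarAlgebra.adjoin ℂ {idc} : Set C(BB, ℂ)) ⊆ V := by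
    intro F hF
    have hF' : F ∈ (Subalgebra.toSubmodule (Algebra.adjoin ℂ ({idc} ∪ star {idc}))) := by
      rw [← StarAlgebra.adjoin_toSubalgebra]; exact hF
    rw [Algebra.adjoin_eq_span] at hF'
    refine Submodule.span_le.2 ?_ hF'
    intro g hg
    have e : ({idc} ∪ star {idc} : Set C(BB, ℂ)) = {idc, star idc} := by
      rw [Set.star_singleton]; rfl
    rw [e, SetLike.mem_coe, Submonoid.mem_closure_pair] at hg
    obtain ⟨m, n, rfl⟩ := hg
    intro c
    rw [← h c m n]
    change l _ = l _
    congr 1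
    ext z
    change (c*((z:ℂ)^m*(starRingEnd ℂ (z:ℂ))^n)).re = _
    rw [cbR_apply, Mo, mul_assoc]
  have htop := ContinuousMap.elemental_id_eq_top (𝕜 := ℂ) (Metric.closedBall (0:ℂ) 1)
  let F : C(BB, ℂ) := ⟨fun x => (f x : ℂ), by fun_prop⟩
  have hF : F ∈ StarAlgebra.elemental ℂ idc := by rw [htop]; trivial
  have hFV : F ∈ V := by
    have : F ∈ closure (StarAlgebra.adjoin ℂ {idc} : Set C(BB, ℂ)) := hF
    exact closure_minimal hadj hcl this
  have := hFV 1
  rw [one_smul] at this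
  have e : ContinuousLinearMap.compLeftContinuous ℝ BB Complex.reCLM F = f := by ext x; rfl
  rw [← e]; exact this
lemma qU_lin {U V : ℂ → ℝ} (hU : ContDiff ℝ 2 U) (hV : ContDiff ℝ 2 V) (c d : ℝ)
    (h : ContDiff ℝ 2 fun z => c*U z + d*V z) :
    qU (fun z => c*U z + d*V z) h = c • qU U hU + d • qU V hV := by
  have e1 : cbR (fun x => -lap (fun z => c*U z + d*V z) x) (lap_cont h).neg =
      c • cbR (fun x => -lap U x) (lap_cont hU).neg + d • cbR (fun x => -lap V x) (lap_cont hV).neg := by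
    ext x
    change -lap _ _ = c*(-lap _ _) + d*(-lap _ _)
    rw [lap_lin hU hV]; ring
  have hU1 := hU.of_le (m := 1) (by norm_num)
  have hV1 := hV.of_le (m := 1) (by norm_num)
  have e2 : cbR (nderiv fun z => c*U z + d*V z) (nderiv_cont (h.of_le (by norm_num))) =
      c • cbR (nderiv U) (nderiv_cont hU1) + d • cbR (nderiv V) (nderiv_cont hV1) := by
    ext x
    change nderiv _ _ = c*nderiv _ _ + d*nderiv _ _
    rw [nderiv_eq, pd_lin hU1 hV1, nderiv_eq, nderiv_eq]
  have e3 : bint (fun z => c*U z + d*V z) = c*bint U + d*bint V := by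
    rw [bint_add (hU.continuous.const_mul c) (hV.continuous.const_mul d), bint_const_mul, bint_const_mul]
  rw [qU, e1, e2, e3, qU, qU, map_add, map_add, map_smul, map_smul, map_smul, map_smul]
  module
def Good : Submodule ℝ HH where
  carrier := {q | ∃ (U : ℂ → ℝ) (hU : ContDiff ℝ 2 U) (p : Polynomial ℂ),
    (∀ θ, U (bpt θ) = (p.eval (bpt θ)).re) ∧ q = qU U hU}
  add_mem' := by
    rintro _ _ ⟨U, hU, p, hp, rfl⟩ ⟨V, hV, p', hp', rfl⟩
    have h : ContDiff ℝ 2 fun z => 1*U z + 1*V z := by fun_prop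
    exact ⟨_, h, p + p', fun θ => by simp [hp, hp'], by rw [qU_lin hU hV, one_smul, one_smul]⟩
  zero_mem' := by
    have h : ContDiff ℝ 2 fun _ : ℂ => (0:ℝ) := contDiff_const
    have h' : ContDiff ℝ 2 fun _ : ℂ => 0*(0:ℝ) + 0*0 := contDiff_const
    exact ⟨_, h', 0, by simp, by rw [qU_lin h h 0 0 h']; simp only [zero_smul, add_zero]⟩
  smul_mem' := by
    rintro c _ ⟨U, hU, p, hp, rfl⟩
    have h : ContDiff ℝ 2 fun z => c*U z + 0*U z := by fun_prop
    exact ⟨_, h, Polynomial.C (c:ℂ)*p, fun θ => by simp [hp], by rw [qU_lin hU hU, zero_smul, add_zero]⟩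
lemma bpt_conj (θ : ℝ) : bpt θ*starRingEnd ℂ (bpt θ) = 1 := by
  rw [Complex.mul_conj, Complex.normSq_eq_norm_sq, bpt_norm]; norm_num
lemma Mo_bpt (c : ℂ) (a b : ℕ) : ∃ (d : ℂ) (k : ℕ), ∀ θ, Mo c a b (bpt θ) = Mo d k 0 (bpt θ) := by
  rcases le_total b a with h | h
  · refine ⟨c, a - b, fun θ => ?_⟩
    obtain ⟨k, rfl⟩ := Nat.exists_eq_add_of_le h
    have h2 := congrArg (·^b) (bpt_conj θ)
    simp only [mul_pow, one_pow] at h2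
    simp only [Mo, Nat.add_sub_cancel_left, pow_zero, mul_one]
    congr 1
    rw [pow_add]; linear_combination c*(bpt θ)^k*h2
  · refine ⟨starRingEnd ℂ c, b - a, fun θ => ?_⟩
    obtain ⟨k, rfl⟩ := Nat.exists_eq_add_of_le h
    have h2 := congrArg (·^a) (bpt_conj θ)
    simp only [mul_pow, one_pow] at h2
    simp only [Mo, Nat.add_sub_cancel_left, pow_zero, mul_one]
    rw [← Complex.conj_re]
    congr 1
    simp only [map_mul, map_pow, Complex.conj_conj]
    have h3 := congrArg (starRingEnd ℂ) h2
    simp only [map_mul, map_pow, Complex.conj_conj, map_one] at h3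
    rw [pow_add]; linear_combination (starRingEnd ℂ c)*(bpt θ)^k*h3
lemma qMo_mem (c : ℂ) (a b : ℕ) : qU (Mo c a b) (Mo_C c a b) ∈ Good := by
  obtain ⟨d, k, h⟩ := Mo_bpt c a b
  refine ⟨_, _, Polynomial.C d*Polynomial.X^k, fun θ => ?_, rfl⟩
  rw [h]; simp [Mo]
lemma JS_congr {f g : CB} (h : ∀ θ, f (bptB θ) = g (bptB θ)) : JS f = JS g := by
  rw [← sub_eq_zero, ← map_sub, ← norm_eq_zero, ← sq_eq_zero_iff, norm_JS_sq, lS_apply,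
    integral_νS _ (map_continuous _).aestronglyMeasurable]
  simp [h]
lemma bint_Mo (c : ℂ) (k : ℕ) : bint (Mo c (k + 1) 0) = 0 := by
  have h := green (Mo_C c (k+1) 0) (contDiff_const (c := (1:ℝ)))
  have e : ∀ x, gdot (Mo c (k+1) 0) (fun _ => (1:ℝ)) x = 0 := fun x => by simp [gdot, pd]
  have e2 : ∀ x, lap (Mo c (k+1) 0) x = 0 := fun x => by rw [Mo_lap]; simp [Mo]
  simp only [e, e2, Mo_nderiv] at h
  rw [bint_congr (g := fun x => ((k:ℝ) + 1)*Mo c (k+1) 0 x) (fun θ => by push_cast; ring), bint_const_mul] at h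
  simp at h
  rcases h with h | h
  · have : (k:ℝ) + 1 ≠ 0 := by positivity
    exact absurd h this
  · exact h
lemma qMo_harm (c : ℂ) (k : ℕ) : qU (Mo c (k+1) 0) (Mo_C c (k+1) 0) =
    ((k:ℝ) + 1) • JS (cbR (Mo c (k+1) 0) (Mo_C c (k+1) 0).continuous) := by
  have e1 : cbR (fun x => -lap (Mo c (k+1) 0) x) (lap_cont (Mo_C c (k+1) 0)).neg = 0 := by
    ext x; change -lap _ _ = 0; rw [Mo_lap]; simp [Mo]
  have e2 : cbR (nderiv (Mo c (k+1) 0)) (nderiv_cont ((Mo_C c (k+1) 0).of_le (by norm_num))) =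
      ((k:ℝ) + 1) • cbR (Mo c (k+1) 0) (Mo_C c (k+1) 0).continuous := by
    ext x; change nderiv _ _ = ((k:ℝ) + 1)*_; rw [Mo_nderiv, cbR_apply]; push_cast; ring
  rw [qU, e1, e2, bint_Mo, map_zero, map_smul]; simp only [zero_div, zero_smul, zero_add, add_zero]
lemma Good_dense : Dense (Good : Set HH) := by
  rw [Submodule.dense_iff_topologicalClosure_eq_top, Submodule.topologicalClosure_eq_top_iff, Submodule.eq_bot_iff]
  intro r hr
  have hr : ∀ q ∈ Good, inner ℝ q r = 0 := fun q hq => (Submodule.mem_orthogonal _ _).1 hr q hq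
  have h0 : ∀ c k, inner ℝ (JS (cbR (Mo c k 0) (Mo_C c k 0).continuous)) r = 0 := by
    intro c k
    rcases k with _ | k
    · have h := hr _ (qMo_mem 1 0 0)
      have e1 : cbR (fun x => -lap (Mo 1 0 0) x) (lap_cont (Mo_C 1 0 0)).neg = 0 := by
        ext x; change -lap _ _ = 0; rw [Mo_lap]; simp [Mo]
      have e2 : cbR (nderiv (Mo 1 0 0)) (nderiv_cont ((Mo_C 1 0 0).of_le (by norm_num))) = 0 := by
        ext x; change nderiv _ _ = 0; rw [Mo_nderiv]; simp
      have e3 : bint (Mo 1 0 0) = 2*π := by simp [bint, Mo]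
      have e4 : cbR (Mo c 0 0) (Mo_C c 0 0).continuous = c.re • 1 := by
        ext x; change Mo c 0 0 x = c.re*1; simp [Mo]
      rw [qU, e1, e2, e3, map_zero, map_zero, zero_add, zero_add, real_inner_smul_left] at h
      have : inner ℝ (JS 1) r = 0 := by
        rcases mul_eq_zero.1 h with h | h
        · have := pi_pos
          have : 2*π / (4*π^2) ≠ 0 := by positivity
          exact absurd h this
        · exact h
      rw [e4, map_smul, real_inner_smul_left, this, mul_zero]
    · have h := hr _ (qMo_mem c (k+1) 0)
      rw [qMo_harm, real_inner_smul_left] at h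
      rcases mul_eq_zero.1 h with h | h
      · have : (k:ℝ) + 1 ≠ 0 := by positivity
        exact absurd h this
      · exact h
  have h1 : ∀ g, inner ℝ (JS g) r = 0 := by
    refine fun g => sw_zero ((innerSL ℝ r).comp JS) (fun c a b => ?_) g |> fun h => by rw [real_inner_comm]; exact h
    change inner ℝ r (JS _) = 0
    obtain ⟨d, k, h⟩ := Mo_bpt c a b
    rw [JS_congr (g := cbR (Mo d k 0) (Mo_C d k 0).continuous) h, real_inner_comm, h0]
  have h2 : ∀ g, inner ℝ (JD g) r = 0 := by
    refine fun g => sw_zero ((innerSL ℝ r).comp JD) (fun c a b => ?_) g |> fun h => by rw [real_inner_comm]; exact h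
    change inner ℝ r (JD _) = 0
    set d : ℂ := -c / (4*(a + 1)*(b + 1))
    have h := hr _ (qMo_mem d (a+1) (b+1))
    rw [qU, inner_add_left, inner_add_left, real_inner_smul_left, h1, h1, mul_zero, add_zero, add_zero] at h
    rw [real_inner_comm, ← h]
    congr 2
    ext x
    change Mo c a b x = -lap _ _
    rw [Mo_lap]
    have ha : (a:ℂ) + 1 ≠ 0 := by exact_mod_cast (Nat.succ_ne_zero a)
    have hb : (b:ℂ) + 1 ≠ 0 := by exact_mod_cast (Nat.succ_ne_zero b)
    have : 4*d*((a+1:ℕ):ℂ)*((b+1:ℕ):ℂ) = -c := by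
      simp only [d]; push_cast; field_simp
    rw [this]; simp [Mo]
  have h3 : (fun q : HH => inner ℝ q r) = fun _ => (0:ℝ) := by
    refine Continuous.ext_on dense_J (by fun_prop) continuous_const ?_
    rintro _ ⟨z, rfl⟩
    simp only
    rw [inner_add_left, h1, h2, add_zero]
  have := congrFun h3 r
  exact inner_self_eq_zero.1 this
end PartG5
section PartG6
open Set Topology
lemma LM_seq (x y : ℕ → ℝ) (hx : ∀ n, 0 ≤ x n) (hy : ∀ n, 0 ≤ y n)
    (h : ∀ n : ℕ, ((n:ℝ) + 1)*y (n + 1) ≤ ∑ i ∈ Finset.range (n + 1), ((i:ℝ) + 1)^2*x (i + 1)*y (n - i)) (N : ℕ) :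
    ∑ n ∈ Finset.range (N + 1), y n ≤ y 0*exp (∑ i ∈ Finset.range N, ((i:ℝ) + 1)*x (i + 1)) := by
  set f : ℝ → ℝ := fun r => ∑ n ∈ Finset.range (N + 1), y n*r^n with hf
  set A : ℝ → ℝ := fun r => ∑ i ∈ Finset.range N, ((i:ℝ) + 1)*x (i + 1)*r^(i + 1) with hA
  set f' : ℝ → ℝ := fun r => ∑ n ∈ Finset.range (N + 1), y n*(n*r^(n - 1)) with hf'
  set A' : ℝ → ℝ := fun r => ∑ i ∈ Finset.range N, ((i:ℝ) + 1)*x (i + 1)*(((i:ℝ) + 1)*r^i) with hA'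
  have df : ∀ r, HasDerivAt f (f' r) r := fun r => by
    simpa using HasDerivAt.fun_sum fun n (_ : n ∈ Finset.range (N + 1)) => (hasDerivAt_pow n r).const_mul (y n)
  have dA : ∀ r, HasDerivAt A (A' r) r := fun r => by
    simpa using HasDerivAt.fun_sum fun i (_ : i ∈ Finset.range N) => (hasDerivAt_pow (i + 1) r).const_mul (((i:ℝ) + 1)*x (i + 1))
  have key : ∀ r, 0 ≤ r → f' r ≤ A' r*f r := by
    intro r hr
    have e1 : f' r = ∑ j ∈ Finset.range N, ((j:ℝ) + 1)*y (j + 1)*r^j := by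
      simp only [hf']
      rw [Finset.sum_range_succ']
      simp only [Nat.cast_zero, zero_mul, mul_zero, add_zero, Nat.add_sub_cancel]
      refine Finset.sum_congr rfl fun j _ => by push_cast; ring
    have e2 : ∀ j : ℕ, ((j:ℝ) + 1)*y (j + 1)*r^j ≤ ∑ i ∈ Finset.range (j + 1),
        (((i:ℝ) + 1)^2*x (i + 1)*r^i)*(y (j - i)*r^(j - i)) := by
      intro j
      refine (mul_le_mul_of_nonneg_right (h j) (by positivity)).trans (le_of_eq ?_)
      rw [Finset.sum_mul]
      refine Finset.sum_congr rfl fun i hi => ?_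
      have : r^j = r^i*r^(j - i) := by
        rw [← pow_add]; congr 1; have := Finset.mem_range.1 hi; omega
      rw [this]; ring
    rw [e1]
    refine (Finset.sum_le_sum fun j _ => e2 j).trans ?_
    rw [Finset.sum_range_diag_flip N (fun i m => (((i:ℝ) + 1)^2*x (i + 1)*r^i)*(y m*r^m))]
    simp only [hA', hf]
    rw [Finset.sum_mul]
    refine Finset.sum_le_sum fun i _ => ?_
    rw [← Finset.mul_sum]
    have : ((i:ℝ) + 1)*x (i + 1)*(((i:ℝ) + 1)*r^i) = ((i:ℝ) + 1)^2*x (i + 1)*r^i := by ring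
    rw [this]
    have := hx (i + 1)
    refine mul_le_mul_of_nonneg_left ?_ (by positivity)
    exact Finset.sum_le_sum_of_subset_of_nonneg (Finset.range_mono (by omega)) fun m _ _ => mul_nonneg (hy m) (by positivity)
  have hd : ∀ r, HasDerivAt (fun r => f r*exp (-A r)) (f' r*exp (-A r) + f r*(exp (-A r)*-A' r)) r :=
    fun r => (df r).mul ((dA r).neg.exp)
  have hanti : AntitoneOn (fun r => f r*exp (-A r)) (Icc 0 1) := by
    refine antitoneOn_of_deriv_nonpos (convex_Icc 0 1) (fun r _ => (hd r).continuousAt.continuousWithinAt)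
      (fun r _ => (hd r).differentiableAt.differentiableWithinAt) fun r hr => ?_
    rw [interior_Icc] at hr
    rw [(hd r).deriv]
    have := key r hr.1.le
    have := exp_pos (-A r)
    nlinarith
  have h01 := hanti (left_mem_Icc.2 zero_le_one) (right_mem_Icc.2 zero_le_one) zero_le_one
  have A0 : A 0 = 0 := by simp [hA]
  have f0 : f 0 = y 0 := by
    simp only [hf]; rw [Finset.sum_range_succ']; simp
  have f1 : f 1 = ∑ n ∈ Finset.range (N + 1), y n := by simp [hf]
  have A1 : A 1 = ∑ i ∈ Finset.range N, ((i:ℝ) + 1)*x (i + 1) := by simp [hA]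
  simp only [A0, f0, neg_zero, exp_zero, mul_one] at h01
  rw [← f1, ← A1]
  rw [exp_neg, ← div_eq_mul_inv, div_le_iff₀ (exp_pos _)] at h01
  exact h01
lemma orth (n m : ℕ) : ∫ θ in 0..(2*π), bpt θ^n*(starRingEnd ℂ (bpt θ))^m = if n = m then (2*π : ℂ) else 0 := by
  split_ifs with h
  · subst h
    have : ∀ θ, bpt θ^n*(starRingEnd ℂ (bpt θ))^n = 1 := fun θ => by rw [← mul_pow, bpt_conj, one_pow]
    simp [this]
  · have e : ∀ θ : ℝ, bpt θ^n*(starRingEnd ℂ (bpt θ))^m = Complex.exp ((((n:ℂ) - m)*Complex.I)*θ) := by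
      intro θ
      rw [bpt, ← Complex.exp_conj, ← Complex.exp_nat_mul, ← Complex.exp_nat_mul, ← Complex.exp_add]
      congr 1
      simp; ring
    simp only [e]
    have hne : ((n:ℂ) - m)*Complex.I ≠ 0 := by
      refine mul_ne_zero (sub_ne_zero.2 ?_) Complex.I_ne_zero
      exact_mod_cast h
    rw [integral_exp_mul_complex hne]
    have : Complex.exp (((n:ℂ) - m)*Complex.I*((2*π : ℝ) : ℂ)) = 1 := by
      rw [Complex.exp_eq_one_iff]
      exact ⟨(n:ℤ) - m, by push_cast; ring⟩
    rw [this]; simp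
def Sm (a : ℕ → ℂ) (N : ℕ) (z : ℂ) : ℂ := ∑ n ∈ Finset.range N, a n*z^n
lemma orth_Sm (a b : ℕ → ℂ) (N : ℕ) :
    ∫ θ in 0..(2*π), Sm a N (bpt θ)*starRingEnd ℂ (Sm b N (bpt θ)) =
      2*π*∑ n ∈ Finset.range N, a n*starRingEnd ℂ (b n) := by
  have hb := bpt_cont
  have hb2 : Continuous fun θ => starRingEnd ℂ (bpt θ) := Complex.continuous_conj.comp hb
  have e : ∀ θ, Sm a N (bpt θ)*starRingEnd ℂ (Sm b N (bpt θ)) = ∑ n ∈ Finset.range N, ∑ m ∈ Finset.range N,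
      (a n*starRingEnd ℂ (b m))*(bpt θ^n*(starRingEnd ℂ (bpt θ))^m) := by
    intro θ
    simp only [Sm, map_sum, Finset.sum_mul_sum, map_mul, map_pow]
    refine Finset.sum_congr rfl fun n _ => Finset.sum_congr rfl fun m _ => by ring
  simp only [e]
  rw [intervalIntegral.integral_finsetSum]
  · rw [Finset.mul_sum]
    refine Finset.sum_congr rfl fun n hn => ?_
    rw [intervalIntegral.integral_finsetSum]
    · simp only [intervalIntegral.integral_const_mul, orth, mul_ite, mul_zero]
      rw [Finset.sum_ite_eq, if_pos hn]; ring
    · intro m _; exact (by fun_prop : Continuous _).intervalIntegrable _ _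
  · intro n _; exact (by fun_prop : Continuous _).intervalIntegrable _ _
lemma orth_Sm' (a b : ℕ → ℂ) (N : ℕ) (ha : a 0 = 0) :
    ∫ θ in 0..(2*π), Sm a N (bpt θ)*Sm b N (bpt θ) = 0 := by
  have hb := bpt_cont
  have e : ∀ θ, Sm a N (bpt θ)*Sm b N (bpt θ) = ∑ n ∈ Finset.range N, ∑ m ∈ Finset.range N,
      (a n*b m)*(bpt θ^(n + m)*(starRingEnd ℂ (bpt θ))^0) := by
    intro θ
    simp only [Sm, Finset.sum_mul_sum]
    refine Finset.sum_congr rfl fun n _ => Finset.sum_congr rfl fun m _ => by ring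
  simp only [e]
  have hb2 : Continuous fun θ => starRingEnd ℂ (bpt θ) := Complex.continuous_conj.comp hb
  rw [intervalIntegral.integral_finsetSum]
  · refine Finset.sum_eq_zero fun n hn => ?_
    rw [intervalIntegral.integral_finsetSum]
    · refine Finset.sum_eq_zero fun m hm => ?_
      rw [intervalIntegral.integral_const_mul, orth]
      rcases n with _ | n
      · simp [ha]
      · simp
    · intro m _; exact (by fun_prop : Continuous _).intervalIntegrable _ _
  · intro n _; exact (by fun_prop : Continuous _).intervalIntegrable _ _
lemma reInt {F : ℝ → ℂ} (hF : Continuous F) : ∫ θ in 0..(2*π), (F θ).re = (∫ θ in 0..(2*π), F θ).re :=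
  Complex.reCLM.intervalIntegral_comp_comm (hF.intervalIntegrable _ _)
def PP (p : Polynomial ℂ) (z : ℂ) : ℝ := (p.eval z).re
lemma PP_C (p : Polynomial ℂ) : ContDiff ℝ 2 (PP p) :=
  Complex.reCLM.contDiff.comp ((Polynomial.contDiff_aeval p 2 : ContDiff ℂ 2 fun z : ℂ => Polynomial.aeval z p).restrict_scalars ℝ)
lemma PP_pd (p : Polynomial ℂ) (v : ℂ) : pd (PP p) v = PP (Polynomial.C v*p.derivative) := by
  funext z
  refine pd_of_line ((PP_C p).differentiable (by norm_num) z) ?_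
  have h1 : HasDerivAt (fun t : ℝ => z + t*v) v 0 := by
    simpa using ((Complex.ofRealCLM.hasDerivAt (x := (0:ℝ))).mul_const v).const_add z
  have h2 : HasDerivAt (fun t : ℝ => p.eval (z + t*v)) (p.derivative.eval (z + ((0:ℝ):ℂ)*v)*v) 0 :=
    (p.hasDerivAt (z + ((0:ℝ):ℂ)*v)).comp_of_eq (𝕜 := ℝ) (0:ℝ) h1 rfl
  refine (Complex.reCLM.hasFDerivAt.comp_hasDerivAt (0:ℝ) h2).congr_deriv ?_
  simp [PP, mul_comm]
lemma PP_lap (p : Polynomial ℂ) (z : ℂ) : lap (PP p) z = 0 := by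
  rw [lap_eq, PP_pd, PP_pd, PP_pd, PP_pd]
  simp [PP]
lemma sm_eval (p : Polynomial ℂ) (z : ℂ) : p.eval z = Sm p.coeff (p.natDegree + 1) z :=
  Polynomial.eval_eq_sum_range z
lemma PP_energy (p : Polynomial ℂ) : ∫ x in unitDisk, gdot (PP p) (PP p) x =
    π*∑ i ∈ Finset.range p.natDegree, ((i:ℝ) + 1)*‖p.coeff (i + 1)‖^2 := by
  rw [green (PP_C p) ((PP_C p).of_le (by norm_num))]
  simp only [PP_lap, neg_zero, zero_mul, integral_zero, zero_add]
  set a : ℕ → ℂ := fun n => n*p.coeff n with ha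
  have e1 : ∀ z, nderiv (PP p) z = (Sm a (p.natDegree + 1) z).re := by
    intro z
    rw [nderiv_eq, PP_pd, PP]
    congr 1
    rw [Polynomial.eval_mul, Polynomial.eval_C, Polynomial.derivative_eval, p.sum_over_range' (by simp) (p.natDegree + 1) (by omega), Sm, Finset.mul_sum]
    refine Finset.sum_congr rfl fun n _ => ?_
    rcases n with _ | n
    · simp [ha]
    · simp [ha]; ring
  have hb := bpt_cont
  have cS : ∀ (a : ℕ → ℂ) N, Continuous fun θ => Sm a N (bpt θ) := fun a N => by unfold Sm; fun_prop
  set N := p.natDegree + 1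
  have e2 : ∀ θ, nderiv (PP p) (bpt θ)*PP p (bpt θ) = (1/2)*((Sm a N (bpt θ)*starRingEnd ℂ (Sm p.coeff N (bpt θ))).re +
      (Sm a N (bpt θ)*Sm p.coeff N (bpt θ)).re) := by
    intro θ
    rw [e1, PP, sm_eval]
    simp; ring
  have c1 : Continuous fun θ => Sm a N (bpt θ)*starRingEnd ℂ (Sm p.coeff N (bpt θ)) :=
    (cS _ _).mul (Complex.continuous_conj.comp (cS _ _))
  have c2 : Continuous fun θ => Sm a N (bpt θ)*Sm p.coeff N (bpt θ) := (cS _ _).mul (cS _ _)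
  have c1' : Continuous fun θ => (Sm a N (bpt θ)*starRingEnd ℂ (Sm p.coeff N (bpt θ))).re := Complex.continuous_re.comp c1
  have c2' : Continuous fun θ => (Sm a N (bpt θ)*Sm p.coeff N (bpt θ)).re := Complex.continuous_re.comp c2
  simp only [bint, e2]
  rw [intervalIntegral.integral_const_mul, intervalIntegral.integral_add
    (c1'.intervalIntegrable _ _) (c2'.intervalIntegrable _ _),
    reInt c1, reInt c2, orth_Sm, orth_Sm' _ _ _ (by simp [ha])]
  have e3 : (2*π*∑ n ∈ Finset.range N, a n*starRingEnd ℂ (p.coeff n) : ℂ) =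
      ((2*π*∑ n ∈ Finset.range N, (n:ℝ)*‖p.coeff n‖^2 : ℝ) : ℂ) := by
    push_cast
    congr 1
    refine Finset.sum_congr rfl fun n _ => ?_
    simp only [ha]
    rw [mul_assoc, Complex.mul_conj, Complex.normSq_eq_norm_sq]; push_cast; rfl
  rw [e3, Complex.ofReal_re, Finset.sum_range_succ']
  simp
  ring
lemma iterD (p : Polynomial ℂ) (k : ℕ) : iteratedDeriv k (fun z => p.eval z) 0 = (k.factorial : ℂ)*p.coeff k := by
  have h : ∀ k, iteratedDeriv k (fun z => p.eval z) = fun z => (Polynomial.derivative^[k] p).eval z := by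
    intro k
    induction k with
    | zero => simp
    | succ k ih => rw [iteratedDeriv_succ, ih, Function.iterate_succ_apply']; funext z; exact Polynomial.deriv _
  rw [h]
  change (Polynomial.derivative^[k] p).eval 0 = _
  rw [← Polynomial.coeff_zero_eq_eval_zero, Polynomial.coeff_iterate_derivative]
  simp [Nat.descFactorial_self]
lemma LM_poly (p : Polynomial ℂ) : bint (fun z => exp (PP p z)) ≤
    2*π*exp ((p.coeff 0).re + (∫ x in unitDisk, gdot (PP p) (PP p) x) / (4*π)) := by
  set g : ℂ → ℂ := fun z => Complex.exp (1 / 2*p.eval z) with hg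
  set p' : Polynomial ℂ := Polynomial.C (1/2)*p with hp'
  have gd : ∀ z, HasDerivAt g (p'.derivative.eval z*g z) z := by
    intro z
    refine (((p.hasDerivAt z).const_mul (1/2)).cexp).congr_deriv ?_
    simp [hp', hg]; ring
  have hgd : Differentiable ℂ g := fun z => (gd z).differentiableAt
  have hgc : ContDiff ℂ ⊤ g := hgd.contDiff
  set β : ℕ → ℂ := fun n => iteratedDeriv n g 0 / n.factorial with hβ
  have hrec : ∀ n : ℕ, ((n:ℂ) + 1)*β (n + 1) = ∑ i ∈ Finset.range (n + 1), ((i:ℂ) + 1)*p'.coeff (i + 1)*β (n - i) := by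
    intro n
    have e1 : iteratedDeriv (n + 1) g 0 = ∑ i ∈ Finset.range (n + 1), (n.choose i : ℂ)*iteratedDeriv i (fun z => p'.derivative.eval z) 0*iteratedDeriv (n - i) g 0 := by
      rw [iteratedDeriv_succ']
      have : deriv g = (fun z => p'.derivative.eval z)*g := by funext z; exact (gd z).deriv
      rw [this, iteratedDeriv_mul (n := n)]
      · exact (Polynomial.contDiff_aeval (𝕜 := ℂ) p'.derivative n).contDiffAt
      · exact (hgc.of_le le_top).contDiffAt
    have hn : ((n + 1).factorial : ℂ) ≠ 0 := by exact_mod_cast Nat.factorial_ne_zero _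
    have hn' : (n.factorial : ℂ) ≠ 0 := by exact_mod_cast Nat.factorial_ne_zero _
    simp only [hβ]
    rw [e1, Finset.sum_div, Finset.mul_sum]
    refine Finset.sum_congr rfl fun i hi => ?_
    have hi' : i ≤ n := by have := Finset.mem_range.1 hi; omega
    rw [iterD, Polynomial.coeff_derivative]
    have hc : (n.choose i : ℂ)*i.factorial*(n - i).factorial = n.factorial := by
      exact_mod_cast Nat.choose_mul_factorial_mul_factorial hi'
    have h3 : ((n - i).factorial : ℂ) ≠ 0 := by exact_mod_cast Nat.factorial_ne_zero _
    have h4 : ((n + 1).factorial : ℂ) = (n + 1)*n.factorial := by rw [Nat.factorial_succ]; push_cast; ring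
    have h5 : ((n:ℂ) + 1) ≠ 0 := by exact_mod_cast Nat.succ_ne_zero n
    rw [h4]
    field_simp
    rw [← hc]; ring
  have hineq : ∀ n : ℕ, ((n:ℝ) + 1)*‖β (n + 1)‖^2 ≤ ∑ i ∈ Finset.range (n + 1), ((i:ℝ) + 1)^2*‖p'.coeff (i + 1)‖^2*‖β (n - i)‖^2 := by
    intro n
    have h1 : ((n:ℝ) + 1)*‖β (n + 1)‖ ≤ ∑ i ∈ Finset.range (n + 1), ((i:ℝ) + 1)*‖p'.coeff (i + 1)‖*‖β (n - i)‖ := by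
      have hh : ‖((n:ℂ) + 1)*β (n + 1)‖ = ((n:ℝ) + 1)*‖β (n + 1)‖ := by
        rw [norm_mul]; congr 1; exact_mod_cast Complex.norm_natCast (n + 1)
      rw [← hh, hrec]
      refine (norm_sum_le _ _).trans (le_of_eq (Finset.sum_congr rfl fun i _ => ?_))
      rw [norm_mul, norm_mul]; congr 2; exact_mod_cast Complex.norm_natCast (i + 1)
    have h3 := sq_sum_le_card_mul_sum_sq (s := Finset.range (n + 1)) (f := fun i : ℕ => ((i:ℝ) + 1)*‖p'.coeff (i + 1)‖*‖β (n - i)‖)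
    have h4 := pow_le_pow_left₀ (by positivity) h1 2
    have hp : (0:ℝ) < n + 1 := by positivity
    simp only [mul_pow, Finset.card_range] at h3 h4
    push_cast at h3
    refine le_of_mul_le_mul_left ?_ hp
    nlinarith
  have bound := LM_seq (fun n => ‖p'.coeff n‖^2) (fun n => ‖β n‖^2) (fun n => by positivity) (fun n => by positivity) hineq
  have hE : ∀ N, ∑ i ∈ Finset.range N, ((i:ℝ) + 1)*‖p'.coeff (i + 1)‖^2 ≤ (∫ x in unitDisk, gdot (PP p) (PP p) x) / (4*π) := by
    intro N
    rw [PP_energy]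
    have hc : ∀ i, ‖p'.coeff i‖^2 = 1/4*‖p.coeff i‖^2 := fun i => by
      rw [hp', Polynomial.coeff_C_mul, norm_mul, mul_pow]; norm_num
    have hpi := pi_pos
    have : π*∑ i ∈ Finset.range p.natDegree, ((i:ℝ) + 1)*‖p.coeff (i + 1)‖^2 / (4*π) = ∑ i ∈ Finset.range p.natDegree, ((i:ℝ) + 1)*‖p'.coeff (i + 1)‖^2 := by
      rw [Finset.mul_sum]
      refine Finset.sum_congr rfl fun i _ => ?_
      rw [hc]; field_simp
    rw [mul_div_assoc, Finset.sum_div, this]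
    refine (Finset.sum_le_sum_of_subset_of_nonneg (Finset.range_mono (le_max_left N p.natDegree)) fun _ _ _ => by positivity).trans (le_of_eq ?_)
    refine (Finset.sum_subset (Finset.range_mono (le_max_right _ _)) fun i _ hi => ?_).symm
    rw [hc, Polynomial.coeff_eq_zero_of_natDegree_lt (by simp at hi; omega)]; simp
  have hb := bpt_cont
  have hs : ∀ z, HasSum (fun n => β n*z^n) (g z) := by
    intro z
    have := Complex.hasSum_taylorSeries_of_entire hgd 0 z
    have e : (fun n => β n*z^n) = fun n => ((n.factorial : ℂ))⁻¹ • (z - 0)^n • iteratedDeriv n g 0 := by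
      funext n
      simp only [hβ, smul_eq_mul, sub_zero]; field_simp
    rw [e]; exact this
  have hsum : Summable fun n => ‖β n‖ := by
    have := (hs 1).summable.norm
    simpa using this
  have hb0 : ‖β 0‖^2 = exp ((p.coeff 0).re) := by
    simp only [hβ, hg, iteratedDeriv_zero, Nat.factorial_zero, Nat.cast_one, div_one, Complex.norm_exp, ← Real.exp_nat_mul,
      ← Polynomial.coeff_zero_eq_eval_zero]
    congr 1
    simp
  have lim : Tendsto (fun N => ∫ θ in 0..(2*π), ‖Sm β (N + 1) (bpt θ)‖^2) atTop (𝓝 (∫ θ in 0..(2*π), ‖g (bpt θ)‖^2)) := by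
    refine intervalIntegral.tendsto_integral_filter_of_dominated_convergence (fun _ => (∑' n, ‖β n‖)^2) ?_ ?_ ?_ ?_
    · refine Eventually.of_forall fun N => Continuous.aestronglyMeasurable ?_
      unfold Sm; fun_prop
    · refine Eventually.of_forall fun N => Eventually.of_forall fun θ _ => ?_
      rw [norm_pow, norm_norm]
      gcongr
      refine (norm_sum_le _ _).trans ?_
      simp only [norm_mul, norm_pow, bpt_norm, one_pow, mul_one]
      exact hsum.sum_le_tsum _ fun _ _ => norm_nonneg _
    · exact continuous_const.intervalIntegrable _ _
    · refine Eventually.of_forall fun θ _ => ?_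
      exact (((hs (bpt θ)).tendsto_sum_nat.comp (tendsto_add_atTop_nat 1)).norm.pow 2)
  have e1 : ∀ z, ‖g z‖^2 = exp (PP p z) := by
    intro z
    simp only [hg, Complex.norm_exp, ← Real.exp_nat_mul, PP]
    congr 1
    simp
  simp only [e1] at lim
  refine le_of_tendsto' lim fun N => ?_
  have e2 : ∫ θ in 0..(2*π), ‖Sm β (N + 1) (bpt θ)‖^2 = 2*π*∑ n ∈ Finset.range (N + 1), ‖β n‖^2 := by
    have h1 : ∀ z : ℂ, ((‖z‖^2 : ℝ) : ℂ) = z*starRingEnd ℂ z := fun z => by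
      rw [Complex.mul_conj, Complex.normSq_eq_norm_sq]
    have := orth_Sm β β (N + 1)
    simp only [← h1] at this
    rw [intervalIntegral.integral_ofReal] at this
    exact_mod_cast this
  rw [e2, exp_add, ← hb0]
  have hpi := pi_pos
  refine mul_le_mul_of_nonneg_left ((bound N).trans ?_) (by positivity)
  gcongr
  exact hE N
end PartG6
section PartG7
open Set Topology
lemma gdot_self (v : ℂ → ℝ) : gdot v v = gradSq v := by funext x; simp only [gdot, gradSq]; ring
lemma den_qU {U : ℂ → ℝ} (hU : ContDiff ℝ 2 U) : Den GG (qU U hU) = ∫ x in unitDisk, gdot U U x := by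
  rw [Den, GG_rep, qU_inner hU (hU.of_le (by norm_num)), tot_qU]; ring
lemma good_ind {P : HH → Prop} (hc : IsClosed {q | P q}) (h : ∀ U (hU : ContDiff ℝ 2 U) (p : Polynomial ℂ),
    (∀ θ, U (bpt θ) = (p.eval (bpt θ)).re) → P (qU U hU)) (q : HH) : P q := by
  have : (univ : Set HH) ⊆ {q | P q} := by
    rw [← Good_dense.closure_eq]
    refine closure_minimal ?_ hc
    rintro q ⟨U, hU, p, hp, rfl⟩
    exact h U hU p hp
  exact this (mem_univ q)
lemma den_cont : Continuous (Den GG) := by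
  have := GG.continuous
  have := iot.continuous
  unfold Den tot; fun_prop
lemma tot_cont : Continuous tot := by unfold tot; fun_prop
lemma GG_symm (p q : HH) : inner ℝ (iot (GG p)) q = inner ℝ p (iot (GG q)) := by
  have h1 := GG.continuous
  have h2 := iot.continuous
  refine good_ind (P := fun p => inner ℝ (iot (GG p)) q = inner ℝ p (iot (GG q))) (isClosed_eq (by fun_prop) (by fun_prop)) ?_ p
  intro U hU _ _
  refine good_ind (P := fun q => inner ℝ (iot (GG (qU U hU))) q = inner ℝ (qU U hU) (iot (GG q))) (isClosed_eq (by fun_prop) (by fun_prop)) ?_ q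
  intro V hV _ _
  rw [real_inner_comm, GG_rep, GG_rep, qU_inner hU (hV.of_le (by norm_num)), qU_inner hV (hU.of_le (by norm_num)), gdot_comm]
  ring
lemma GG_mean (q : HH) : lS (GG q) = 2*π*tot q := by
  have h1 := GG.continuous
  have h2 := lS.continuous
  have h3 := tot_cont
  refine good_ind (P := fun q => lS (GG q) = 2*π*tot q) (isClosed_eq (by fun_prop) (by fun_prop)) ?_ q
  intro U hU _ _
  rw [GG_rep, lS_cbR', tot_qU]
  have := pi_ne_zero
  field_simp
lemma gdot_nn (U : ℂ → ℝ) : 0 ≤ ∫ x in unitDisk, gdot U U x :=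
  integral_nonneg fun x => by rw [gdot_self, gradSq]; positivity
lemma GG_Dnn (q : HH) : 0 ≤ Den GG q := by
  refine good_ind (P := fun q => 0 ≤ Den GG q) (isClosed_le continuous_const den_cont) ?_ q
  intro U hU _ _
  rw [den_qU]; exact gdot_nn U
lemma gdot_quad {U v : ℂ → ℝ} (hU : ContDiff ℝ 1 U) (hv : ContDiff ℝ 1 v) (c d : ℝ) :
    ∫ x in unitDisk, gdot (fun y => c*U y + d*v y) (fun y => c*U y + d*v y) x =
      c^2*(∫ x in unitDisk, gdot U U x) + 2*c*d*(∫ x in unitDisk, gdot U v x) + d^2*∫ x in unitDisk, gdot v v x := by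
  have i1 := (disk_int (gdot_cont hU hU)).const_mul (c^2)
  have i2 := (disk_int (gdot_cont hU hv)).const_mul (2*c*d)
  have i3 := (disk_int (gdot_cont hv hv)).const_mul (d^2)
  rw [← integral_const_mul, ← integral_const_mul, ← integral_const_mul, ← integral_add i1 i2]
  erw [← integral_add (i1.add i2) i3]
  congr 1; funext x
  simp only [gdot, pd_lin hU hv, Pi.add_apply]
  ring
lemma GG_C5 (v : ℂ → ℝ) (hv : ContDiff ℝ 1 v) (q : HH) : inner ℝ q (iot (cbR v hv.continuous))^2 ≤
    inner ℝ q (iot (GG q))*((∫ x in unitDisk, gradSq v x) + (bint v / (2*π))^2) := by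
  have h1 := GG.continuous
  have h2 := iot.continuous
  refine good_ind (P := fun q => inner ℝ q (iot (cbR v hv.continuous))^2 ≤
    inner ℝ q (iot (GG q))*((∫ x in unitDisk, gradSq v x) + (bint v / (2*π))^2)) (isClosed_le (by fun_prop) (by fun_prop)) ?_ q
  intro U hU _ _
  have hU1 := hU.of_le (m := 1) (by norm_num)
  rw [GG_rep, qU_inner hU hv, qU_inner hU hU1, ← gdot_self]
  set a := ∫ x in unitDisk, gdot U U x
  set b := ∫ x in unitDisk, gdot U v x
  set c := ∫ x in unitDisk, gdot v v x
  have hpi := pi_pos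
  have e1 : bint U*bint v / (4*π^2) = (bint U / (2*π))*(bint v / (2*π)) := by field_simp; norm_num
  have e2 : bint U*bint U / (4*π^2) = (bint U / (2*π))^2 := by field_simp; norm_num
  rw [e1, e2]
  set mU := bint U / (2*π)
  set mv := bint v / (2*π)
  have hd := discrim_le_zero (a := c + mv^2) (b := 2*(b + mU*mv)) (c := a + mU^2) fun t => by
    have := gdot_nn (fun y => 1*U y + t*v y)
    rw [gdot_quad hU1 hv] at this
    have : 0 ≤ a + 2*t*b + t^2*c := by linarith
    nlinarith [sq_nonneg (mU + t*mv)]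
  rw [discrim] at hd
  linarith
lemma norm_Mo (c : ℂ) (a b : ℕ) {z : ℂ} (n : ℕ) (hz : ‖z‖ ≤ 1) : |Mo c (a + n) (b + n) z| ≤ ‖c‖*‖z‖^n := by
  refine (Complex.abs_re_le_norm _).trans ?_
  rw [norm_mul, norm_mul, norm_pow, norm_pow, RCLike.norm_conj, pow_add, pow_add]
  have h1 : ‖z‖^a ≤ 1 := pow_le_one₀ (norm_nonneg _) hz
  have h2 : ‖z‖^(b + n) ≤ 1 := pow_le_one₀ (norm_nonneg _) hz
  rw [← pow_add ‖z‖ b n]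
  have h3 : 0 ≤ ‖z‖^n := by positivity
  have h4 : 0 ≤ ‖c‖ := by positivity
  calc ‖c‖*(‖z‖^a*‖z‖^n)*‖z‖^(b + n) ≤ ‖c‖*(1*‖z‖^n)*1 := by gcongr
    _ = _ := by ring
lemma GG_pos (q : HH) (hq : q ≠ 0) : 0 < inner ℝ q (iot (GG q)) := by
  have h0 : 0 ≤ inner ℝ q (iot (GG q)) := by
    have := GG_Dnn q
    rw [Den] at this
    nlinarith [sq_nonneg (tot q)]
  refine lt_of_le_of_ne h0 fun he => hq ?_
  have hz : ∀ c a b, inner ℝ q (iot (cbR (Mo c a b) (Mo_C c a b).continuous)) = 0 := by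
    intro c a b
    have := GG_C5 (Mo c a b) ((Mo_C c a b).of_le (by norm_num)) q
    rw [← he, zero_mul] at this
    exact pow_eq_zero_iff (n := 2) (by norm_num) |>.1 (le_antisymm this (sq_nonneg _))
  have hJS : ∀ c a b, inner ℝ q (JS (cbR (Mo c a b) (Mo_C c a b).continuous)) = 0 := by
    intro c a b
    have hlim : Tendsto (fun n : ℕ => JD (cbR (Mo c (a + n) (b + n)) (Mo_C _ _ _).continuous)) atTop (𝓝 0) := by
      rw [tendsto_zero_iff_norm_tendsto_zero]
      have hsq : Tendsto (fun n : ℕ => ‖JD (cbR (Mo c (a + n) (b + n)) (Mo_C _ _ _).continuous)‖^2) atTop (𝓝 0) := by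
        have e : ∀ n : ℕ, ‖JD (cbR (Mo c (a + n) (b + n)) (Mo_C _ _ _).continuous)‖^2 =
            ∫ x in unitDisk, Mo c (a + n) (b + n) x*Mo c (a + n) (b + n) x := fun n => by
          rw [norm_JD_sq, lD_apply]
          exact integral_νD' (fun x => Mo c (a + n) (b + n) x*Mo c (a + n) (b + n) x)
            (((Mo_C _ _ _).continuous.mul (Mo_C _ _ _).continuous).comp continuous_subtype_val)
        simp only [e]
        have h0 : (0:ℝ) = ∫ x in unitDisk, (0:ℝ) := by simp
        rw [h0]
        have hmd : MeasurableSet unitDisk := measurableSet_ball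
        refine tendsto_integral_of_dominated_convergence (fun _ => ‖c‖*‖c‖) ?_ ?_ ?_ ?_
        · intro n
          exact ((Mo_C _ _ _).continuous.mul (Mo_C _ _ _).continuous).aestronglyMeasurable
        · exact integrable_const _
        · intro n
          refine (ae_restrict_iff' hmd).2 (Eventually.of_forall fun x hx => ?_)
          have hx1 : ‖x‖ ≤ 1 := (mem_ball_zero_iff.1 hx).le
          have hb : |Mo c (a + n) (b + n) x| ≤ ‖c‖ := (norm_Mo c a b n hx1).trans
            (mul_le_of_le_one_right (norm_nonneg _) (pow_le_one₀ (norm_nonneg _) hx1))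
          rw [norm_mul, Real.norm_eq_abs]
          exact mul_le_mul hb hb (abs_nonneg _) (norm_nonneg _)
        · refine (ae_restrict_iff' hmd).2 (Eventually.of_forall fun x hx => ?_)
          have hx1 : ‖x‖ < 1 := mem_ball_zero_iff.1 hx
          have h1 : Tendsto (fun n => Mo c (a + n) (b + n) x) atTop (𝓝 0) := by
            refine squeeze_zero_norm (fun n => norm_Mo c a b n hx1.le) ?_
            simpa using (tendsto_pow_atTop_nhds_zero_of_lt_one (norm_nonneg x) hx1).const_mul ‖c‖
          simpa using h1.mul h1
      have := hsq.sqrt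
      simpa using this
    have hlim2 : Tendsto (fun n : ℕ => inner ℝ q (JD (cbR (Mo c (a + n) (b + n)) (Mo_C _ _ _).continuous))) atTop (𝓝 0) := by
      have := (tendsto_const_nhds (x := q)).inner (𝕜 := ℝ) hlim
      rwa [inner_zero_right] at this
    have heq : ∀ n : ℕ, inner ℝ q (JD (cbR (Mo c (a + n) (b + n)) (Mo_C _ _ _).continuous)) =
        - inner ℝ q (JS (cbR (Mo c a b) (Mo_C c a b).continuous)) := by
      intro n
      have h1 := hz c (a + n) (b + n)
      have h2 : JS (cbR (Mo c (a + n) (b + n)) (Mo_C _ _ _).continuous) = JS (cbR (Mo c a b) (Mo_C c a b).continuous) := by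
        refine JS_congr fun θ => ?_
        change Mo c (a + n) (b + n) (bpt θ) = Mo c a b (bpt θ)
        simp only [Mo]
        have h3 := congrArg (·^n) (bpt_conj θ)
        simp only [mul_pow, one_pow] at h3
        congr 1
        rw [pow_add, pow_add]
        linear_combination (c*bpt θ^a*(starRingEnd ℂ (bpt θ))^b)*h3
      rw [iot, add_apply, inner_add_right, h2] at h1
      linarith
    simp only [heq] at hlim2
    have := tendsto_nhds_unique hlim2 tendsto_const_nhds
    linarith
  have hJD : ∀ c a b, inner ℝ q (JD (cbR (Mo c a b) (Mo_C c a b).continuous)) = 0 := by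
    intro c a b
    have h1 := hz c a b
    rw [iot, add_apply, inner_add_right, hJS] at h1
    linarith
  have aS := sw_zero ((innerSL ℝ q).comp JS) hJS
  have aD := sw_zero ((innerSL ℝ q).comp JD) hJD
  have : inner ℝ q q = 0 := by
    have hcl : IsClosed {p : HH | inner ℝ q p = 0} := isClosed_eq (by fun_prop) continuous_const
    have : closure (range (fun z : CB × CB => JD z.1 + JS z.2)) ⊆ {p : HH | inner ℝ q p = 0} := by
      refine closure_minimal ?_ hcl
      rintro _ ⟨z, rfl⟩
      change inner ℝ q (JD z.1 + JS z.2) = 0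
      rw [inner_add_right]
      have h1 := aS z.2
      have h2 := aD z.1
      change inner ℝ q (JS z.2) = 0 at h1
      change inner ℝ q (JD z.1) = 0 at h2
      rw [h1, h2, add_zero]
    exact this (dense_J q)
  exact inner_self_eq_zero.1 this
lemma bint_PP (p : Polynomial ℂ) : bint (PP p) = 2*π*(p.coeff 0).re := by
  have hb := bpt_cont
  have h1 : bint (PP p) = (∫ θ in 0..(2*π), p.eval (bpt θ)).re := reInt (by fun_prop)
  rw [h1]
  simp only [sm_eval, Sm]
  have e : ∀ n, bpt n = bpt n := fun _ => rfl
  rw [intervalIntegral.integral_finsetSum (fun n _ => (by fun_prop : Continuous _).intervalIntegrable _ _)]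
  have h2 : ∀ n : ℕ, ∫ θ in 0..(2*π), p.coeff n*bpt θ^n = if n = 0 then 2*π*p.coeff 0 else 0 := by
    intro n
    have := orth n 0
    simp only [pow_zero, mul_one] at this
    rw [intervalIntegral.integral_const_mul, this]
    split_ifs with h
    · rw [h]; ring
    · simp
  simp only [h2]
  rw [Finset.sum_ite_eq' , if_pos (by simp)]
  simp
lemma GG_LM (q : HH) : lS (EE (GG q)) ≤ 2*π*exp (tot q + Den GG q / (4*π)) := by
  have h1 := GG.continuous
  have h2 := lS.continuous
  have h3 := tot_cont
  have h4 := den_cont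
  have h5 := EE_cont
  refine good_ind (P := fun q => lS (EE (GG q)) ≤ 2*π*exp (tot q + Den GG q / (4*π))) (isClosed_le (by fun_prop) (by fun_prop)) ?_ q
  intro U hU p hp
  have hU1 := hU.of_le (m := 1) (by norm_num)
  have hP1 := (PP_C p).of_le (m := 1) (by norm_num)
  have e1 : lS (EE (GG (qU U hU))) = bint (fun z => exp (PP p z)) := by
    have : EE (GG (qU U hU)) = cbR (fun z => exp (U z)) (by fun_prop) := by
      ext x; rw [EE_apply, GG_rep]; rfl
    rw [this, lS_cbR']
    exact bint_congr fun θ => by rw [hp]; rfl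
  have hpi := pi_pos
  have e2 : bint U / (2*π) = (p.coeff 0).re := by
    rw [bint_congr (g := PP p) hp, bint_PP]; field_simp
  rw [e1, tot_qU, e2, den_qU]
  refine (LM_poly p).trans ?_
  suffices hs : ∫ x in unitDisk, gdot (PP p) (PP p) x ≤ ∫ x in unitDisk, gdot U U x by
    refine mul_le_mul_of_nonneg_left (exp_le_exp.2 ?_) (by positivity)
    have := div_le_div_of_nonneg_right hs (by positivity : 0 ≤ 4*π)
    linarith
  have g := gdot_quad hP1 (hU1.sub hP1) 1 1
  have e3 : (fun y => 1*PP p y + 1*(U y - PP p y)) = U := by funext y; ring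
  have e4 := green (PP_C p) (hU1.sub hP1)
  simp only [PP_lap, neg_zero, zero_mul, integral_zero, zero_add] at e4
  have e5 : bint (fun x => nderiv (PP p) x*(U x - PP p x)) = 0 := by
    rw [bint_congr (g := fun _ => 0) fun θ => by rw [hp]; simp [PP]]
    simp [bint]
  rw [e5] at e4
  have := gdot_nn (fun y => U y - PP p y)
  simp only [e3] at g
  rw [g]
  have e4' : ∫ x in unitDisk, gdot (PP p) (fun x => U x - PP p x) x = 0 := e4
  rw [e4']
  linarith
lemma sc_pd {U : ℂ → ℝ} (hU : ContDiff ℝ 1 U) (r : ℝ) (w z : ℂ) : pd (fun z => 2*U (r*z)) w z = 2*r*pd U w (r*z) := by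
  have h1 : HasFDerivAt (fun z : ℂ => (r:ℂ)*z) ((r:ℂ) • ContinuousLinearMap.id ℝ ℂ) z :=
    (hasFDerivAt_id z).const_mul (r:ℂ)
  have h2 := (((hU.differentiable one_ne_zero _).hasFDerivAt.comp z h1).const_mul (2:ℝ)).fderiv
  have h3 : pd (fun z => 2*U (r*z)) w z = 2*fderiv ℝ U (r*z) (r*w) := by
    rw [pd]; erw [h2]; rfl
  rw [h3, pd]
  have : (r:ℂ)*w = r • w := by simp
  rw [this, map_smul]; simp; ring
lemma MT_U {U : ℂ → ℝ} (hU : ContDiff ℝ 2 U) : ∫ x in unitDisk, exp (2*U x) ≤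
    2*π*exp (2*(bint U / (2*π)) + 3 / (2*π)*∫ x in unitDisk, gdot U U x) := by
  have hU1 := hU.of_le (m := 1) (by norm_num)
  have hUc := hU.continuous
  have hg := gdot_cont hU1 hU1
  have hb := bpt_cont
  have hpi := pi_pos
  set g : ℝ → ℝ := fun s => s*bint (fun x => gdot U U (s*x)) with hgdef
  have gc : Continuous g := continuous_id.mul (bint_cont hg)
  have gnn : ∀ s, 0 ≤ s → 0 ≤ g s := fun s hs => mul_nonneg hs
    (intervalIntegral.integral_nonneg (by positivity) fun θ _ => by simp only [gdot_self, gradSq]; positivity)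
  set D := ∫ x in unitDisk, gdot U U x with hD
  have hDg : D = ∫ s in (0:ℝ)..1, g s := polar hg
  have key : ∀ r ∈ Icc (0:ℝ) 1, r*bint (fun x => exp (2*U (r*x))) ≤ 2*π*exp (2*(bint U / (2*π)) + 3 / (2*π)*D) := by
    intro r hr
    rcases hr.1.eq_or_lt with h0 | h0
    · rw [← h0, zero_mul]; positivity
    have hV : ContDiff ℝ 2 (fun z : ℂ => 2*U (r*z)) := contDiff_const.mul (hU.comp (contDiff_const.mul contDiff_id))
    have lm := GG_LM (qU _ hV)
    have e1 : lS (EE (GG (qU _ hV))) = bint (fun z => exp (2*U (r*z))) := by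
      have : EE (GG (qU _ hV)) = cbR (fun z => exp (2*U (r*z))) (by fun_prop) := by
        ext x; rw [EE_apply, GG_rep]; rfl
      rw [this, lS_cbR']
    rw [e1, tot_qU, den_qU] at lm
    have e2 : ∫ x in unitDisk, gdot (fun z : ℂ => 2*U (r*z)) (fun z : ℂ => 2*U (r*z)) x = 4*∫ s in (0:ℝ)..r, g s := by
      have : ∀ x, gdot (fun z : ℂ => 2*U (r*z)) (fun z : ℂ => 2*U (r*z)) x = 4*r^2*gdot U U (r*x) := by
        intro x; simp only [gdot, sc_pd hU1]; ring
      simp only [this]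
      rw [integral_const_mul, polar (F := fun x => gdot U U (r*x)) (by fun_prop)]
      have h2 : ∀ s : ℝ, s*bint (fun x => gdot U U (r*(s*x))) = r⁻¹*g (r*s) := by
        intro s
        simp only [hgdef]
        have : ∀ x : ℂ, (((r*s : ℝ) : ℂ))*x = r*(s*x) := fun x => by push_cast; ring
        simp only [this]
        field_simp
      simp only [h2]
      rw [intervalIntegral.integral_const_mul, intervalIntegral.integral_comp_mul_left _ h0.ne']
      simp only [mul_zero, mul_one, smul_eq_mul]
      field_simp
    have e3 : bint (fun z => 2*U (r*z)) ≤ 2*bint U + 2*π*log (1 / r) + ∫ s in r..1, g s := by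
      have pt : ∀ θ : ℝ, 2*U (r*bpt θ) ≤ 2*U (bpt θ) + log (1 / r) + ∫ s in r..1, s*gdot U U (s*bpt θ) := by
        intro θ
        have hd : ∀ s : ℝ, HasDerivAt (fun s : ℝ => U (s*bpt θ)) (pd U (bpt θ) (s*bpt θ)) s := by
          intro s
          have h1 : HasDerivAt (fun s : ℝ => (s:ℂ)*bpt θ) (bpt θ) s := by
            simpa using (Complex.ofRealCLM.hasDerivAt (x := s)).mul_const (bpt θ)
          exact ((hU1.differentiable one_ne_zero _).hasFDerivAt).comp_hasDerivAt s h1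
        have hpc : Continuous fun s : ℝ => pd U (bpt θ) (s*bpt θ) := (pd_cont hU1 _).comp (by fun_prop)
        have ftc := intervalIntegral.integral_eq_sub_of_hasDerivAt (a := r) (b := 1) (fun s _ => hd s) (hpc.intervalIntegrable _ _)
        have hinv : IntervalIntegrable (fun s : ℝ => s⁻¹) volume r 1 := by
          refine ContinuousOn.intervalIntegrable (ContinuousOn.inv₀ continuousOn_id fun s hs => ?_)
          rw [uIcc_of_le hr.2] at hs; exact (h0.trans_le hs.1).ne'
        have hgi : IntervalIntegrable (fun s : ℝ => s*gdot U U (s*bpt θ)) volume r 1 := Continuous.intervalIntegrable (by fun_prop) _ _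
        have mono := intervalIntegral.integral_mono_on hr.2 ((hpc.const_mul (-2)).intervalIntegrable r 1) (hinv.add hgi) fun s hs => by
          have hs0 : 0 < s := h0.trans_le hs.1
          have hn := bpt_norm θ
          have hre : pd U (bpt θ) (s*bpt θ) = (bpt θ).re*pd U 1 (s*bpt θ) + (bpt θ).im*pd U Complex.I (s*bpt θ) := by
            have : bpt θ = (bpt θ).re • (1:ℂ) + (bpt θ).im • Complex.I := by simp
            rw [pd, pd, pd]
            have h9 := congrArg (fderiv ℝ U (s*bpt θ)) this
            rw [map_add, map_smul, map_smul] at h9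
            exact h9
          have hn2 : (bpt θ).re^2 + (bpt θ).im^2 = 1 := by
            have := Complex.sq_norm (bpt θ); rw [hn, Complex.normSq_apply] at this; nlinarith
          change -2*pd U (bpt θ) (s*bpt θ) ≤ s⁻¹ + s*gdot U U (s*bpt θ)
          rw [hre, gdot]
          set A := pd U 1 (s*bpt θ)
          set B := pd U Complex.I (s*bpt θ)
          have h1 : ((bpt θ).re*A + (bpt θ).im*B)^2 ≤ A*A + B*B := by
            nlinarith [sq_nonneg ((bpt θ).re*B - (bpt θ).im*A)]
          set T := (bpt θ).re*A + (bpt θ).im*B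
          have h2 : s⁻¹ + s*T^2 + 2*T = s⁻¹*(1 + s*T)^2 := by field_simp; ring
          have h3 : 0 ≤ s⁻¹*(1 + s*T)^2 := by positivity
          nlinarith
        rw [intervalIntegral.integral_add hinv hgi, integral_inv_of_pos h0 one_pos, intervalIntegral.integral_const_mul, ftc] at mono
        simp only [Complex.ofReal_one, one_mul] at mono
        linarith
      have hc3 : Continuous fun θ : ℝ => ∫ s in r..1, s*gdot U U (s*bpt θ) := by
        refine intervalIntegral.continuous_parametric_intervalIntegral_of_continuous' (f := fun θ s => s*gdot U U (s*bpt θ)) ?_ _ _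
        fun_prop
      have hm := intervalIntegral.integral_mono (a := 0) (b := 2*π) (μ := volume) (by positivity)
        (Continuous.intervalIntegrable (by fun_prop) _ _) (Continuous.intervalIntegrable (by fun_prop) _ _) pt
      have hsw : ∫ θ in 0..(2*π), ∫ s in r..1, s*gdot U U (s*bpt θ) = ∫ s in r..1, g s := by
        have e7 : ∀ s, g s = ∫ θ in 0..(2*π), s*gdot U U (s*bpt θ) := fun s =>
          (intervalIntegral.integral_const_mul _ _).symm
        simp only [e7, intervalIntegral.integral_of_le hr.2, intervalIntegral.integral_of_le two_pi_pos.le]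
        refine integral_integral_swap ?_
        rw [Measure.prod_restrict]
        have hk : IsCompact (Icc (0:ℝ) (2*π) ×ˢ Icc r 1) := isCompact_Icc.prod isCompact_Icc
        refine IntegrableOn.mono_set (t := Icc (0:ℝ) (2*π) ×ˢ Icc r 1) ?_ (prod_mono Ioc_subset_Icc_self Ioc_subset_Icc_self)
        refine ContinuousOn.integrableOn_compact hk (Continuous.continuousOn ?_)
        change Continuous fun z : ℝ × ℝ => z.2*gdot U U (z.2*bpt z.1)
        fun_prop
      rw [intervalIntegral.integral_add (Continuous.intervalIntegrable (by fun_prop) _ _) (hc3.intervalIntegrable _ _),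
        intervalIntegral.integral_add (Continuous.intervalIntegrable (by fun_prop) _ _) (Continuous.intervalIntegrable (by fun_prop) _ _), hsw,
        intervalIntegral.integral_const_mul 2 (fun θ => U (bpt θ))] at hm
      simp only [intervalIntegral.integral_const, sub_zero, smul_eq_mul] at hm
      exact hm
    have e4 : (∫ s in (0:ℝ)..r, g s) + ∫ s in r..1, g s = D := by
      rw [hDg]; exact intervalIntegral.integral_add_adjacent_intervals (gc.intervalIntegrable _ _) (gc.intervalIntegrable _ _)
    have n1 : 0 ≤ ∫ s in (0:ℝ)..r, g s := intervalIntegral.integral_nonneg hr.1 fun s hs => gnn s hs.1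
    have n2 : 0 ≤ ∫ s in r..1, g s := intervalIntegral.integral_nonneg hr.2 fun s hs => gnn s (h0.le.trans hs.1)
    rw [e2] at lm
    have hle : bint (fun z => 2*U (r*z)) / (2*π) + 4*(∫ s in (0:ℝ)..r, g s) / (4*π) ≤
        2*(bint U / (2*π)) + 3 / (2*π)*D + log (1 / r) := by
      have : bint (fun z => 2*U (r*z)) / (2*π) ≤ (2*bint U + 2*π*log (1 / r) + ∫ s in r..1, g s) / (2*π) := by gcongr
      refine (add_le_add_left this _).trans ?_
      rw [← e4]
      have : 2*(bint U / (2*π)) + 3 / (2*π)*((∫ s in (0:ℝ)..r, g s) + ∫ s in r..1, g s) + log (1 / r)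
        - ((2*bint U + 2*π*log (1 / r) + ∫ s in r..1, g s) / (2*π) + 4*(∫ s in (0:ℝ)..r, g s) / (4*π)) =
        ((∫ s in (0:ℝ)..r, g s) / 2 + ∫ s in r..1, g s) / π := by field_simp; ring
      have h6 : 0 ≤ ((∫ s in (0:ℝ)..r, g s) / 2 + ∫ s in r..1, g s) / π := by positivity
      linarith
    calc r*bint (fun x => exp (2*U (r*x))) ≤ r*(2*π*exp (2*(bint U / (2*π)) + 3 / (2*π)*D + log (1 / r))) := by
          refine mul_le_mul_of_nonneg_left (lm.trans ?_) h0.le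
          gcongr
      _ = _ := by
        rw [exp_add _ (log (1 / r)), exp_log (by positivity)]; field_simp
  rw [polar (F := fun x => exp (2*U x)) (by fun_prop)]
  have := intervalIntegral.integral_mono_on (a := 0) (b := 1) (μ := volume) zero_le_one
    ((continuous_id.mul (bint_cont (F := fun x => exp (2*U x)) (by fun_prop))).intervalIntegrable _ _) (continuous_const.intervalIntegrable _ _) key
  simpa using this
lemma GG_MT (q : HH) : lD (EE ((2:ℝ) • GG q)) ≤ 2*π*exp (2*π*Den GG q + 2*tot q) := by
  have h1 := GG.continuous
  have h2 := lD.continuous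
  have h3 := tot_cont
  have h4 := den_cont
  have h5 := EE_cont
  refine good_ind (P := fun q => lD (EE ((2:ℝ) • GG q)) ≤ 2*π*exp (2*π*Den GG q + 2*tot q)) (isClosed_le (by fun_prop) (by fun_prop)) ?_ q
  intro U hU p hp
  have hUc := hU.continuous
  have e1 : lD (EE ((2:ℝ) • GG (qU U hU))) = ∫ x in unitDisk, exp (2*U x) := by
    have : EE ((2:ℝ) • GG (qU U hU)) = cbR (fun z => exp (2*U z)) (by fun_prop) := by
      ext x; rw [EE_apply, GG_rep]; rfl
    rw [this, lD_apply]
    exact integral_νD' (fun z => exp (2*U z)) ((by fun_prop : Continuous fun z => exp (2*U z)).comp continuous_subtype_val)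
  rw [e1, tot_qU, den_qU]
  refine (MT_U hU).trans ?_
  have hpi := pi_pos
  have h6 : 3 / (2*π) ≤ 2*π := by
    have := pi_gt_three
    rw [div_le_iff₀ (by positivity)]; nlinarith
  have h7 := mul_le_mul_of_nonneg_right h6 (gdot_nn U)
  refine mul_le_mul_of_nonneg_left (exp_le_exp.2 (by linarith)) (by positivity)
lemma GG_green : IsGreen GG where
  cpt := GG_cpt
  symm := GG_symm
  pos := GG_pos
  mean := GG_mean
  Dnn := GG_Dnn
  LM := GG_LM
  MT := ⟨2*π, by positivity, GG_MT⟩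
  C5 := GG_C5
end PartG7
section PartR1
open Set Topology
def lk (e : ℝ) (z : ℂ) : ℝ := log (‖z‖^2 + e) / 2
def dk (e : ℝ) (z : ℂ) : ℂ →L[ℝ] ℝ := (‖z‖^2 + e)⁻¹ • innerSL ℝ z
lemma lk_zero (z : ℂ) : lk 0 z = log ‖z‖ := by simp [lk]
lemma lk_abs (z : ℂ) : |lk 0 z| ≤ ‖z‖ + ‖z‖⁻¹ := by
  rw [lk_zero]
  rcases (norm_nonneg z).eq_or_lt with h | h
  · simp [← h]
  · have h1 := log_le_sub_one_of_pos h
    have h2 := log_le_sub_one_of_pos (inv_pos.2 h)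
    rw [log_inv] at h2
    have h3 := inv_pos.2 h
    rw [abs_le]; constructor <;> linarith
lemma lk_diff {e : ℝ} (he : 0 < e) {z : ℂ} (hz : z ≠ 0) : |lk e z - lk 0 z| ≤ √e*‖z‖⁻¹ := by
  have h := norm_pos_iff.2 hz
  have h1 : lk e z - lk 0 z = log (√(1 + e / ‖z‖^2)) := by
    rw [log_sqrt (by positivity), lk, lk, ← sub_div, add_zero, ← log_div (by positivity) (by positivity)]
    congr 2; field_simp
  have h3 : √(1 + e / ‖z‖^2) ≤ 1 + √e*‖z‖⁻¹ := by
    refine sqrt_le_iff.2 ⟨by positivity, ?_⟩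
    have : e / ‖z‖^2 = (√e*‖z‖⁻¹)^2 := by rw [mul_pow, sq_sqrt he.le, inv_pow]; rfl
    rw [this]; nlinarith [show 0 ≤ √e*‖z‖⁻¹ by positivity]
  have h2 : 1 ≤ √(1 + e / ‖z‖^2) := one_le_sqrt.2 (le_add_of_nonneg_right (by positivity))
  rw [h1, abs_of_nonneg (log_nonneg h2)]
  have := log_le_sub_one_of_pos (x := √(1 + e / ‖z‖^2)) (by linarith)
  linarith
lemma dk_diff {e : ℝ} (he : 0 < e) {z : ℂ} (hz : z ≠ 0) :
    ‖dk e z - dk 0 z‖ ≤ e^(1/4:ℝ)*‖z‖^(-(3/2):ℝ) := by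
  have h := norm_pos_iff.2 hz
  have h0 : dk e z - dk 0 z = ((‖z‖^2 + e)⁻¹ - (‖z‖^2)⁻¹) • innerSL ℝ z := by
    rw [dk, dk, add_zero]; ext; simp; ring
  rw [h0, norm_smul, innerSL_apply_norm]
  obtain ⟨q, hq, hq2⟩ : ∃ q > 0, ‖z‖ = q^2 := ⟨√‖z‖, by positivity, (sq_sqrt h.le).symm⟩
  obtain ⟨d, hd, hd4⟩ : ∃ d > 0, e = d^4 := ⟨e^(1/4:ℝ), by positivity, by
    rw [← Real.rpow_natCast, ← Real.rpow_mul he.le]; norm_num⟩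
  have e1 : (d^4)^(1/4:ℝ) = d := by
    rw [← Real.rpow_natCast, ← Real.rpow_mul hd.le]; norm_num
  have e2 : (q^2)^(-(3/2):ℝ) = (q^3)⁻¹ := by
    rw [← Real.rpow_natCast, ← Real.rpow_mul hq.le, ← Real.rpow_natCast q 3, ← Real.rpow_neg hq.le]; norm_num
  rw [hq2, hd4, e1, e2]
  have : ((q^2)^2 + d^4)⁻¹ - ((q^2)^2)⁻¹ = -(d^4 / ((q^4)*(q^4 + d^4))) := by field_simp; ring
  rw [this, norm_neg, Real.norm_of_nonneg (by positivity), ← div_eq_mul_inv, div_mul_eq_mul_div,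
    div_le_div_iff₀ (by positivity) (by positivity)]
  have : d^3*q ≤ q^4 + d^4 := by
    rcases le_total d q with h | h
    · have := mul_le_mul_of_nonneg_right (pow_le_pow_left₀ hd.le h 3) hq.le
      nlinarith [pow_pos hd 4]
    · have := mul_le_mul_of_nonneg_left h (pow_pos hd 3).le
      nlinarith [pow_pos hq 4]
  calc d^4*q^2*q^3 = d*q^4*(d^3*q) := by ring
    _ ≤ d*q^4*(q^4 + d^4) := by gcongr
    _ = _ := by ring
lemma dk_norm {e : ℝ} (he : 0 < e) (z : ℂ) : ‖dk e z‖ ≤ 1 + e⁻¹ := by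
  rw [dk, norm_smul, innerSL_apply_norm, Real.norm_of_nonneg (by positivity), inv_mul_le_iff₀ (by positivity)]
  have : e*e⁻¹ = 1 := by field_simp
  have h2 : 0 < e⁻¹ := by positivity
  nlinarith [sq_nonneg (‖z‖ - 1), norm_nonneg z, mul_nonneg h2.le (sq_nonneg ‖z‖)]
lemma dk_norm0 (z : ℂ) : ‖dk 0 z‖ ≤ ‖z‖⁻¹ := by
  rw [dk, norm_smul, innerSL_apply_norm, Real.norm_of_nonneg (by positivity), add_zero]
  rcases (norm_nonneg z).eq_or_lt with h | h
  · simp [← h]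
  · rw [sq, mul_inv, mul_assoc, inv_mul_cancel₀ h.ne', mul_one]
lemma lk_cont {e : ℝ} (he : 0 < e) : Continuous (lk e) :=
  (Continuous.log (by fun_prop) fun z => by positivity).div_const _
lemma dk_cont {e : ℝ} (he : 0 < e) : Continuous (dk e) :=
  (Continuous.inv₀ (f := fun z : ℂ => ‖z‖^2 + e) (by fun_prop) fun z => by positivity).smul (innerSL ℝ).continuous
lemma lk_deriv {e : ℝ} (he : 0 < e) (z : ℂ) : HasFDerivAt (lk e) (dk e z) z := by
  have h := (((hasStrictFDerivAt_norm_sq z).hasFDerivAt.add_const e).log (by positivity)).mul_const (1/2)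
  have e1 : lk e = fun y => log (‖y‖^2 + e)*(1 / 2) := by funext z; simp only [lk]; ring
  have e2 : dk e z = (1/2:ℝ) • (‖z‖^2 + e)⁻¹ • 2 • (innerSL ℝ) z := by ext; simp [dk]; ring
  rw [e1, e2]; exact h
lemma lk_meas (e : ℝ) : Measurable (lk e) := by unfold lk; fun_prop
lemma dk_meas (e : ℝ) : Measurable (dk e) :=
  ((by fun_prop : Measurable fun z : ℂ => (‖z‖^2 + e)⁻¹)).smul (innerSL ℝ).continuous.measurable
end PartR1
section PartR2
open Set Topology
def We (R e : ℝ) (φ : ℂ → ℝ) (x : ℂ) : ℝ := ∫ t in Metric.ball (0:ℂ) R, φ t*lk e (x - t)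
def Wd (R e : ℝ) (φ : ℂ → ℝ) (x : ℂ) : ℂ →L[ℝ] ℝ := ∫ t in Metric.ball (0:ℂ) R, φ t • dk e (x - t)
variable {φ : ℂ → ℝ} {R M : ℝ}
lemma riesz1 (R : ℝ) (x : ℂ) : IntegrableOn (fun y : ℂ => ‖x - y‖⁻¹) (Metric.ball 0 R) := by
  obtain ⟨C, _, h⟩ := riesz (a := 1) (by norm_num) (by norm_num) R
  simpa only [Real.rpow_neg_one] using (h x).1
lemma int_ball {f : ℂ → ℝ} (hf : Continuous f) (R : ℝ) : IntegrableOn f (Metric.ball 0 R) :=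
  (hf.continuousOn.integrableOn_compact (isCompact_closedBall 0 R)).mono_set Metric.ball_subset_closedBall
lemma lk0_int (R : ℝ) (x : ℂ) : IntegrableOn (fun t => lk 0 (x - t)) (Metric.ball 0 R) := by
  refine ((int_ball (f := fun t => ‖x - t‖) (by fun_prop) R).add (riesz1 R x)).mono'
    ((lk_meas 0).comp (by fun_prop)).aestronglyMeasurable (Eventually.of_forall fun t => lk_abs _)
lemma We0_int (hm : Measurable φ) (hM : ∀ t, |φ t| ≤ M) (x : ℂ) :
    IntegrableOn (fun t => φ t*lk 0 (x - t)) (Metric.ball 0 R) :=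
  (lk0_int R x).bdd_mul (c := M) hm.aestronglyMeasurable (Eventually.of_forall hM)
lemma Wd_int (hm : Measurable φ) (hM : ∀ t, |φ t| ≤ M) {e : ℝ} (he : 0 < e) (x : ℂ) :
    IntegrableOn (fun t => φ t • dk e (x - t)) (Metric.ball 0 R) := by
  refine (integrableOn_const (C := M*(1 + e⁻¹)) measure_ball_lt_top.ne).mono'
    (hm.aestronglyMeasurable.smul ((dk_meas e).comp (by fun_prop)).aestronglyMeasurable)
    (Eventually.of_forall fun t => ?_)
  rw [norm_smul]
  exact mul_le_mul (hM t) (dk_norm he _) (norm_nonneg _) ((abs_nonneg _).trans (hM t))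
lemma Wd0_int (hm : Measurable φ) (hM : ∀ t, |φ t| ≤ M) (x : ℂ) :
    IntegrableOn (fun t => φ t • dk 0 (x - t)) (Metric.ball 0 R) := by
  refine ((riesz1 R x).const_mul M).mono'
    (hm.aestronglyMeasurable.smul ((dk_meas 0).comp (by fun_prop)).aestronglyMeasurable)
    (Eventually.of_forall fun t => ?_)
  rw [norm_smul]
  exact mul_le_mul (hM t) (dk_norm0 _) (norm_nonneg _) ((abs_nonneg _).trans (hM t))
lemma We_deriv (hm : Measurable φ) (hM : ∀ t, |φ t| ≤ M) {e : ℝ} (he : 0 < e) (x : ℂ) :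
    HasFDerivAt (We R e φ) (Wd R e φ x) x := by
  refine hasFDerivAt_integral_of_dominated_of_fderiv_le (bound := fun _ => M*(1 + e⁻¹)) (s := univ)
    (F' := fun x t => φ t • dk e (x - t)) univ_mem ?_ ?_ ?_ ?_ ?_ ?_
  · exact Eventually.of_forall fun x => hm.aestronglyMeasurable.mul ((lk_meas e).comp (by fun_prop)).aestronglyMeasurable
  · exact (int_ball ((lk_cont he).comp (by fun_prop : Continuous fun t => x - t)) R).bdd_mul (c := M) hm.aestronglyMeasurable
      (Eventually.of_forall hM)
  · exact (Wd_int hm hM he x).1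
  · refine Eventually.of_forall fun t x _ => ?_
    rw [norm_smul]
    exact mul_le_mul (hM t) (dk_norm he _) (norm_nonneg _) ((abs_nonneg _).trans (hM t))
  · exact integrableOn_const measure_ball_lt_top.ne
  · refine Eventually.of_forall fun t x _ => ?_
    exact ((lk_deriv he (x - t)).comp x ((hasFDerivAt_id x).sub_const t)).const_mul (φ t)
lemma Wd_cont (hm : Measurable φ) (hM : ∀ t, |φ t| ≤ M) {e : ℝ} (he : 0 < e) : Continuous (Wd R e φ) := by
  refine continuous_of_dominated (bound := fun _ => M*(1 + e⁻¹)) (fun x => (Wd_int hm hM he x).1) ?_ ?_ ?_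
  · refine fun x => Eventually.of_forall fun t => ?_
    rw [norm_smul]
    exact mul_le_mul (hM t) (dk_norm he _) (norm_nonneg _) ((abs_nonneg _).trans (hM t))
  · exact integrableOn_const measure_ball_lt_top.ne
  · exact Eventually.of_forall fun t => ((dk_cont he).comp (by fun_prop : Continuous fun x : ℂ => x - t)).const_smul (φ t)
lemma ae_ne_ball (x : ℂ) : ∀ᵐ t ∂(volume.restrict (Metric.ball (0:ℂ) R)), x - t ≠ 0 := by
  have h0 : ∀ᵐ t : ℂ ∂(volume.restrict (Metric.ball (0:ℂ) R)), t ≠ x := Measure.ae_ne _ _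
  filter_upwards [h0] with t ht
  exact sub_ne_zero.2 ht.symm
lemma We_lim (hm : Measurable φ) (hM : ∀ t, |φ t| ≤ M) (x : ℂ) :
    Tendsto (fun n => We R (en n) φ x) atTop (𝓝 (We R 0 φ x)) := by
  refine tendsto_integral_of_dominated_convergence (fun t => M*(‖x - t‖ + 2*‖x - t‖⁻¹)) ?_ ?_ ?_ ?_
  · exact fun n => hm.aestronglyMeasurable.mul ((lk_meas _).comp (by fun_prop)).aestronglyMeasurable
  · exact ((int_ball (f := fun t => ‖x - t‖) (by fun_prop) R).add ((riesz1 R x).const_mul 2)).const_mul M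
  · intro n
    filter_upwards [ae_ne_ball x] with t ht
    rw [norm_mul]
    refine mul_le_mul (hM t) ?_ (norm_nonneg _) ((abs_nonneg _).trans (hM t))
    have h1 := lk_diff (en_pos n) ht
    have h2 := lk_abs (x - t)
    have h3 : √(en n) ≤ 1 := by
      rw [sqrt_le_one]; unfold en; rw [div_le_one (by positivity)]; simp
    have h4 := mul_le_mul_of_nonneg_right h3 (inv_nonneg.2 (norm_nonneg (x - t)))
    have h5 := abs_sub_abs_le_abs_sub (lk (en n) (x - t)) (lk 0 (x - t))
    rw [Real.norm_eq_abs]; linarith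
  · filter_upwards [ae_ne_ball x] with t ht
    refine Tendsto.const_mul _ ?_
    have : ContinuousAt (fun e => lk e (x - t)) 0 := by
      have := norm_pos_iff.2 ht
      exact (ContinuousAt.log (by fun_prop) (by positivity)).div_const _
    exact this.tendsto.comp en_tendsto
lemma Wd_unif (hm : Measurable φ) (hM : ∀ t, |φ t| ≤ M) :
    TendstoUniformly (fun n => Wd R (en n) φ) (Wd R 0 φ) atTop := by
  obtain ⟨C, hC, hr⟩ := riesz (a := 3/2) (by norm_num) (by norm_num) R
  have hM0 : 0 ≤ M := (abs_nonneg _).trans (hM 0)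
  rw [Metric.tendstoUniformly_iff]
  intro ε hε
  have h1 : Tendsto (fun n => M*C*en n^(1/4:ℝ)) atTop (𝓝 0) := by
    have := en_tendsto.rpow_const (p := 1/4) (Or.inr (by norm_num))
    rw [Real.zero_rpow (by norm_num)] at this
    simpa using this.const_mul (M*C)
  filter_upwards [h1.eventually (gt_mem_nhds hε)] with n hn x
  refine lt_of_le_of_lt ?_ hn
  rw [dist_comm, dist_eq_norm, Wd, Wd, ← integral_sub (Wd_int hm hM (en_pos n) x) (Wd0_int hm hM x)]
  have hb : ∀ᵐ t ∂(volume.restrict (Metric.ball (0:ℂ) R)), ‖φ t • dk (en n) (x - t) - φ t • dk 0 (x - t)‖ ≤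
      M*en n^(1/4:ℝ)*‖x - t‖^(-(3/2):ℝ) := by
    filter_upwards [ae_ne_ball x] with t ht
    have : φ t • dk (en n) (x - t) - φ t • dk 0 (x - t) = φ t • (dk (en n) (x - t) - dk 0 (x - t)) := by
      ext; simp [mul_sub]
    rw [this, norm_smul, mul_assoc]
    exact mul_le_mul (hM t) (dk_diff (en_pos n) ht) (norm_nonneg _) hM0
  refine (norm_integral_le_of_norm_le ((hr x).1.const_mul _) hb).trans ?_
  rw [integral_const_mul]
  have := mul_le_mul_of_nonneg_left (hr x).2 (mul_nonneg hM0 (rpow_nonneg (en_pos n).le (1/4)))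
  linarith
lemma W0_deriv (hm : Measurable φ) (hM : ∀ t, |φ t| ≤ M) (x : ℂ) : HasFDerivAt (We R 0 φ) (Wd R 0 φ x) x :=
  hasFDerivAt_of_tendstoUniformly (Wd_unif hm hM) (fun n x => We_deriv hm hM (en_pos n) x) (We_lim hm hM) x
lemma W0_C1 (hm : Measurable φ) (hM : ∀ t, |φ t| ≤ M) : ContDiff ℝ 1 (We R 0 φ) := by
  refine contDiff_one_iff_hasFDerivAt.2 ⟨Wd R 0 φ, ?_, W0_deriv hm hM⟩
  exact (Wd_unif hm hM).continuous (Frequently.of_forall fun n => Wd_cont hm hM (en_pos n))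
lemma C_of_pd {n : ℕ} {f : ℂ → ℝ} (hf : ContDiff ℝ 1 f) (h1 : ContDiff ℝ n (pd f 1)) (h2 : ContDiff ℝ n (pd f Complex.I)) :
    ContDiff ℝ (n + 1) f := by
  refine (contDiff_succ_iff_hasFDerivAt (n := n)).2 ⟨fderiv ℝ f, ?_, fun x => (hf.differentiable (by norm_num) x).hasFDerivAt⟩
  have : fderiv ℝ f = fun x => pd f 1 x • Complex.reCLM + pd f Complex.I x • Complex.imCLM := by
    funext x; ext w
    have : w = (w.re:ℝ) • (1:ℂ) + (w.im:ℝ) • Complex.I := by simp [Complex.re_add_im]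
    conv_lhs => rw [this, map_add, map_smul, map_smul]
    simp [pd]; ring
  rw [this]
  exact (h1.smul contDiff_const).add (h2.smul contDiff_const)
lemma W0_C2 {C : NNReal} (hL : LipschitzWith C φ) (hM : ∀ t, |φ t| ≤ M) (h0 : ∀ t, R ≤ ‖t‖ → φ t = 0) :
    ContDiff ℝ 2 (We (R + 1) 0 φ) := by
  have hm := hL.continuous.measurable
  have h1 := W0_C1 (R := R + 1) hm hM
  have key : ∀ w : ℂ, pd (We (R + 1) 0 φ) w = We (R + 1) 0 (fun t => lineDeriv ℝ φ t w) := by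
    intro w; funext x
    have hfull : ∀ x, We (R + 1) 0 φ x = ∫ t, φ t*lk 0 (x - t) := by
      intro x
      refine setIntegral_eq_integral_of_forall_compl_eq_zero fun t ht => ?_
      rw [mem_ball_zero_iff, not_lt] at ht
      rw [h0 t (by linarith), zero_mul]
    have hg : Integrable ((Metric.ball (0:ℂ) (R+1)).indicator fun t => lk 0 (x - t)) :=
      (integrable_indicator_iff measurableSet_ball).2 (lk0_int _ x)
    have t1 := hL.integral_inv_smul_sub_mul_tendsto_integral_lineDeriv_mul hg w (μ := volume)
    have e1 : ∫ t, lineDeriv ℝ φ t w*(Metric.ball (0:ℂ) (R+1)).indicator (fun t => lk 0 (x - t)) t =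
        We (R + 1) 0 (fun t => lineDeriv ℝ φ t w) x := by
      rw [We, ← integral_indicator measurableSet_ball]
      congr 1; funext t; by_cases h : t ∈ Metric.ball (0:ℂ) (R+1) <;> simp [h]
    rw [e1] at t1
    have hd := (h1.differentiable (by norm_num) x).hasFDerivAt.hasLineDerivAt w
    have t2 := (hasDerivAt_iff_tendsto_slope.1 hd).mono_left (nhdsWithin_mono 0 (s := Ioi 0) (fun t (ht : 0 < t) => ht.ne'))
    refine tendsto_nhds_unique t2 (t1.congr' ?_)
    have hs : ∀ᶠ t : ℝ in 𝓝[>] 0, t*‖w‖ < 1 := by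
      have : Tendsto (fun t : ℝ => t*‖w‖) (𝓝[>] 0) (𝓝 (0*‖w‖)) :=
        (tendsto_id.mul_const _).mono_left nhdsWithin_le_nhds
      exact this.eventually (gt_mem_nhds (by simp))
    filter_upwards [hs, self_mem_nhdsWithin] with t ht (ht0 : 0 < t)
    have i1 : Integrable fun s => φ s*lk 0 (x - s) := by
      rw [← integrableOn_iff_integrable_of_support_subset (s := Metric.ball (0:ℂ) (R+1))]
      · exact We0_int hm hM x
      · intro s hs
        rw [mem_ball_zero_iff]; by_contra h
        exact hs (by simp [h0 s (by linarith)])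
    have i2 : Integrable fun s => φ (s + t • w)*lk 0 (x - s) := by
      rw [← integrableOn_iff_integrable_of_support_subset (s := Metric.ball (0:ℂ) (R+1))]
      · exact We0_int (φ := fun s => φ (s + t • w)) (hm.comp (by fun_prop)) (fun s => hM _) x
      · intro s hs
        rw [mem_ball_zero_iff]; by_contra h
        refine hs ?_
        have n1 : ‖t • w‖ < 1 := by rwa [norm_smul, Real.norm_of_nonneg ht0.le]
        have n2 := norm_sub_le (s + t • w) (t • w)
        rw [add_sub_cancel_right] at n2
        simp only [h0 (s + t • w) (by linarith), zero_mul]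
    have sh : We (R + 1) 0 φ (x + t • w) = ∫ s, φ (s + t • w)*lk 0 (x - s) := by
      rw [hfull, ← integral_add_right_eq_self _ (t • w)]
      congr 1; funext s; congr 2; ring
    simp only [slope_def_field, zero_smul, add_zero, sub_zero]
    rw [sh, hfull x, ← integral_sub i2 i1, div_eq_inv_mul, ← integral_const_mul]
    congr 1; funext s
    by_cases h : s ∈ Metric.ball (0:ℂ) (R+1)
    · simp only [h, indicator_of_mem, smul_eq_mul]; ring
    · simp only [h, indicator_of_notMem, not_false_eq_true, mul_zero]
      rw [mem_ball_zero_iff, not_lt] at h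
      have n1 : ‖t • w‖ < 1 := by rwa [norm_smul, Real.norm_of_nonneg ht0.le]
      have n2 := norm_sub_le (s + t • w) (t • w)
      rw [add_sub_cancel_right] at n2
      rw [h0 (s + t • w) (by linarith), h0 s (by linarith)]; simp
  have hC : ∀ w : ℂ, ContDiff ℝ 1 (pd (We (R + 1) 0 φ) w) := by
    intro w
    rw [key]
    exact W0_C1 (measurable_lineDeriv hL.continuous) (fun t => norm_lineDeriv_le_of_lipschitz ℝ hL)
  exact_mod_cast C_of_pd (n := 1) h1 (hC 1) (hC Complex.I)
end PartR2
section PartR3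
open Set Topology
open scoped ContDiff
def EC (η : ℝ → ℝ) : Prop := ContDiff ℝ ∞ η ∧ (∀ s, 1 < s → η s = 0) ∧ ∃ c, ∀ s < 0, η s = c
lemma EC_deriv {η : ℝ → ℝ} (h : EC η) : EC (deriv η) := by
  obtain ⟨h1, h2, c, h3⟩ := h
  refine ⟨?_, fun s hs => ?_, 0, fun s hs => ?_⟩
  · exact (contDiff_infty_iff_deriv.1 h1).2
  · have : η =ᶠ[𝓝 s] fun _ => 0 := by filter_upwards [lt_mem_nhds hs] with t ht using h2 t ht
    rw [this.deriv_eq]; simp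
  · have : η =ᶠ[𝓝 s] fun _ => c := by filter_upwards [gt_mem_nhds hs] with t ht using h3 t ht
    rw [this.deriv_eq]; simp
lemma EC_bdd {η : ℝ → ℝ} (h : EC η) : ∃ C, 0 ≤ C ∧ ∀ s, |η s| ≤ C := by
  obtain ⟨h1, h2, c, h3⟩ := h
  obtain ⟨C, hC⟩ := (isCompact_Icc (a := (0:ℝ)) (b := 1)).exists_bound_of_continuousOn h1.continuous.continuousOn
  have hC0 : 0 ≤ C := (norm_nonneg _).trans (hC 0 (by simp))
  refine ⟨C + |c|, by positivity, fun s => ?_⟩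
  rcases lt_or_ge s 0 with h | h
  · rw [h3 s h]; linarith
  rcases lt_or_ge 1 s with h' | h'
  · rw [h2 s h']; simp; positivity
  · exact (hC s ⟨h, h'⟩).trans (by linarith [abs_nonneg c])
lemma EC_pow {η : ℝ → ℝ} (h : EC η) {C : ℝ} (hC : ∀ s, |η s| ≤ C) (k m : ℕ) (z : ℂ) :
    ‖z‖^k * |η ((k + m)*(‖z‖^2 - 1))| ≤ exp 1*C := by
  have hC0 : 0 ≤ C := (abs_nonneg _).trans (hC 0)
  by_cases h1 : 1 < (k + m)*(‖z‖^2 - 1)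
  · rw [h.2.1 _ h1]; simp; positivity
  push Not at h1
  refine mul_le_mul ?_ (hC _) (abs_nonneg _) (exp_pos _).le
  rcases le_total ‖z‖ 1 with hz | hz
  · exact (pow_le_one₀ (norm_nonneg z) hz).trans (one_le_exp zero_le_one)
  · have e1 : ‖z‖ ≤ exp (‖z‖^2 - 1) := by
      have := add_one_le_exp (‖z‖^2 - 1)
      nlinarith
    calc ‖z‖^k ≤ exp (‖z‖^2 - 1)^k := by gcongr
      _ = exp (k*(‖z‖^2 - 1)) := by rw [← exp_nat_mul]
      _ ≤ _ := exp_le_exp.2 (by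
        have : 0 ≤ (m:ℝ)*(‖z‖^2 - 1) := mul_nonneg (by positivity) (by nlinarith)
        linarith)
lemma EC_pow' {η : ℝ → ℝ} (h : EC η) {C : ℝ} (hC : ∀ s, |η s| ≤ C) (k m : ℕ) (z : ℂ) :
    (k + m : ℝ)*(‖z‖^k * |η ((k + m)*(‖z‖^2 - 1))|)*‖z‖ ≤ (k + m)*(exp 1*C)*2 := by
  have hC0 : 0 ≤ C := (abs_nonneg _).trans (hC 0)
  have h0 : (0:ℝ) ≤ k + m := by positivity
  by_cases h1 : 1 < (k + m)*(‖z‖^2 - 1)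
  · rw [h.2.1 _ h1]; simp; positivity
  rcases h0.eq_or_lt with h2 | h2
  · rw [← h2]; simp
  refine mul_le_mul (mul_le_mul_of_nonneg_left (EC_pow h hC k m z) h0) ?_ (norm_nonneg _) (by positivity)
  have : (1:ℝ) ≤ k + m := by
    have : 0 < k + m := by exact_mod_cast h2
    exact_mod_cast this
  by_contra hz
  push Not at hz h1
  have : 3 ≤ ‖z‖^2 - 1 := by nlinarith
  nlinarith
def Tz (η : ℝ → ℝ) (m : ℕ) (b : ℕ → ℂ) (k : ℕ) (z : ℂ) : ℂ :=
  b k*z^k*(η ((k + m)*(‖z‖^2 - 1)) : ℝ)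
lemma Tz_norm {η : ℝ → ℝ} (m : ℕ) (b : ℕ → ℂ) (k : ℕ) (z : ℂ) :
    ‖Tz η m b k z‖ = ‖b k‖*(‖z‖^k * |η ((k + m)*(‖z‖^2 - 1))|) := by
  rw [Tz, norm_mul, norm_mul, norm_pow, Complex.norm_real, Real.norm_eq_abs, mul_assoc]
def Gz (z : ℂ) : ℂ →L[ℝ] ℂ := Complex.ofRealCLM.comp ((2:ℝ) • innerSL ℝ z)
lemma Tz_deriv {η : ℝ → ℝ} (h : EC η) (m : ℕ) (b : ℕ → ℂ) (k : ℕ) (z : ℂ) :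
    HasFDerivAt (Tz η m b k) ((k*b k*z^(k - 1)*(η ((k + m)*(‖z‖^2 - 1)) : ℝ)) • ContinuousLinearMap.id ℝ ℂ
      + (Tz (deriv η) m (fun k => (k + m)*b k) k z) • Gz z) z := by
  have h1 : HasFDerivAt (fun z : ℂ => b k*z^k) ((b k*(k*z^(k - 1))) • ContinuousLinearMap.id ℝ ℂ) z := by
    refine (((hasDerivAt_pow k z).const_mul (b k)).hasFDerivAt.restrictScalars ℝ).congr_fderiv ?_
    ext; simp; ring
  have h2 : HasFDerivAt (fun z : ℂ => ((k + m : ℝ))*(‖z‖^2 - 1)) ((k + m : ℝ) • (2:ℝ) • innerSL ℝ z) z :=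
    (((hasStrictFDerivAt_norm_sq z).hasFDerivAt).sub_const 1).const_mul _ |>.congr_fderiv (by
      ext; simp; ring_nf; tauto)
  have h3 : HasDerivAt η (deriv η ((k + m)*(‖z‖^2 - 1))) ((k + m)*(‖z‖^2 - 1)) :=
    (h.1.differentiable (by norm_num) _).hasDerivAt
  have h4 := h3.comp_hasFDerivAt z h2
  have h5 := Complex.ofRealCLM.hasFDerivAt.comp z h4
  have h6 := h1.mul h5
  refine HasFDerivAt.congr_fderiv (f := Tz η m b k) h6 ?_
  ext w
  simp [Tz, Gz]; ring
lemma PS (j : ℕ) : ∀ (η : ℝ → ℝ) (m : ℕ) (b : ℕ → ℂ), EC η → Summable (fun k : ℕ => ((k:ℝ) + 1)^j*‖b k‖) →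
    ContDiff ℝ j (fun z => ∑' k, Tz η m b k z) := by
  induction j with
  | zero =>
    intro η m b h hb
    obtain ⟨C, _, hC⟩ := EC_bdd h
    rw [Nat.cast_zero, contDiff_zero]
    refine continuous_tsum (u := fun k => ‖b k‖*(exp 1*C)) (fun k => ?_) ?_ fun k z => ?_
    · have := h.1.continuous
      unfold Tz; fun_prop
    · simpa using hb.mul_right (exp 1*C)
    · rw [Tz_norm]
      exact mul_le_mul_of_nonneg_left (EC_pow h hC k m z) (norm_nonneg _)
  | succ j ih =>
    intro η m b h hb
    obtain ⟨C, hC0, hC⟩ := EC_bdd h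
    obtain ⟨C', hC0', hC'⟩ := EC_bdd (EC_deriv h)
    have s0 : Summable (fun k : ℕ => ((k:ℝ) + 1)*‖b k‖) := by
      refine Summable.of_nonneg_of_le (fun k => by positivity) (fun k => ?_) hb
      gcongr
      exact le_self_pow₀ (by linarith [(Nat.cast_nonneg k : (0:ℝ) ≤ k)]) (by omega)
    have sb : Summable (fun k => ‖b k‖) := by
      refine Summable.of_nonneg_of_le (fun k => by positivity) (fun k => ?_) s0
      exact le_mul_of_one_le_left (norm_nonneg _) (by linarith [(Nat.cast_nonneg k : (0:ℝ) ≤ k)])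
    let b1 : ℕ → ℂ := fun k => (k + 1)*b (k + 1)
    let b2 : ℕ → ℂ := fun k => (k + m)*b k
    have nb2 : ∀ k, ‖b2 k‖ = (k + m)*‖b k‖ := fun k => by
      simp only [b2, norm_mul]; congr 1
      have : ((k:ℂ) + m) = ((k + m : ℕ) : ℂ) := by push_cast; rfl
      rw [this, Complex.norm_natCast]; push_cast; rfl
    have le2 : ∀ k : ℕ, (k + m : ℝ) ≤ (m + 1)*(k + 1) := fun k => by nlinarith [(Nat.cast_nonneg k : (0:ℝ) ≤ k), (Nat.cast_nonneg m : (0:ℝ) ≤ m)]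
    let α : ℕ → ℂ → ℂ := fun k z => k*b k*z^(k - 1)*(η ((k + m)*(‖z‖^2 - 1)) : ℝ)
    have α0 : ∀ z, α 0 z = 0 := fun z => by simp [α]
    have αs : ∀ k z, α (k + 1) z = Tz η (m + 1) b1 k z := fun k z => by
      simp only [α, Tz, b1, Nat.add_sub_cancel]; push_cast; ring_nf
    have αn : ∀ k z, ‖α k z‖ ≤ (k + 1)*‖b k‖*(exp 1*C) := by
      intro k z
      cases k with
      | zero => rw [α0]; simp; positivity
      | succ k =>
        rw [αs, Tz_norm]
        refine mul_le_mul ?_ (EC_pow h hC k (m + 1) z |>.trans_eq' (by push_cast; ring_nf)) (by positivity) (by positivity)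
        simp only [b1, norm_mul]
        gcongr
        refine (norm_add_le _ _).trans ?_
        rw [Complex.norm_natCast]; push_cast; simp
    have βn : ∀ k z, ‖Tz (deriv η) m b2 k z • Gz z‖ ≤ (k + 1)*‖b k‖*((m + 1)*(exp 1*C')*4) := by
      intro k z
      have g : ‖Gz z‖ ≤ 2*‖z‖ := by
        refine ContinuousLinearMap.opNorm_le_bound _ (by positivity) fun w => ?_
        simp only [Gz, ContinuousLinearMap.comp_apply, Complex.ofRealCLM_apply, Complex.norm_real]
        rw [smul_apply, norm_smul, innerSL_apply_apply, mul_assoc]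
        simpa using norm_inner_le_norm (𝕜 := ℝ) z w
      rw [norm_smul, Tz_norm, nb2]
      have e := EC_pow' (EC_deriv h) hC' k m z
      have e3 := mul_le_mul_of_nonneg_right (le2 k) (show 0 ≤ ‖b k‖*(exp 1*C') by positivity)
      calc _ ≤ (k + m)*‖b k‖*(‖z‖^k * |deriv η ((k + m)*(‖z‖^2 - 1))|)*(2*‖z‖) := by gcongr
        _ = 2*‖b k‖*((k + m : ℝ)*(‖z‖^k * |deriv η ((k + m)*(‖z‖^2 - 1))|)*‖z‖) := by ring
        _ ≤ 2*‖b k‖*((k + m)*(exp 1*C')*2) := by gcongr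
        _ ≤ _ := by linarith
    have sα : ∀ z, Summable fun k => α k z := fun z =>
      Summable.of_norm_bounded (s0.mul_right (exp 1*C)) (fun k => αn k z)
    have sβ : ∀ z, Summable fun k => Tz (deriv η) m b2 k z := fun z => by
      refine Summable.of_norm_bounded (g := fun k : ℕ => (k + 1)*‖b k‖*((m + 1)*(exp 1*C'))) (s0.mul_right _) (fun k => ?_)
      rw [Tz_norm, nb2]
      calc _ ≤ (m + 1)*(k + 1)*‖b k‖*(exp 1*C') := by
            refine mul_le_mul (mul_le_mul_of_nonneg_right (le2 k) (norm_nonneg _)) ?_ (by positivity) (by positivity)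
            · exact EC_pow (EC_deriv h) hC' k m z
        _ = _ := by ring
    rw [Nat.cast_succ]
    refine (contDiff_succ_iff_hasFDerivAt (n := j)).2
      ⟨fun z => (∑' k, Tz η (m + 1) b1 k z) • ContinuousLinearMap.id ℝ ℂ + (∑' k, Tz (deriv η) m b2 k z) • Gz z, ?_, ?_⟩
    · have c1 := ih η (m + 1) b1 h (by
        refine Summable.of_nonneg_of_le (fun k => by positivity) (fun k => ?_) ((summable_nat_add_iff 1).2 hb)
        simp only [b1, norm_mul]
        have : ‖(k:ℂ) + 1‖ ≤ k + 1 := (norm_add_le _ _).trans (by rw [Complex.norm_natCast]; simp)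
        push_cast
        calc _ ≤ ((k:ℝ) + 1)^j*(((k:ℝ) + 1)*‖b (k + 1)‖) := by gcongr
          _ = ((k:ℝ) + 1)^(j + 1)*‖b (k + 1)‖ := by ring
          _ ≤ _ := by gcongr; linarith)
      have c2 := ih (deriv η) m b2 (EC_deriv h) (by
        refine Summable.of_nonneg_of_le (fun k => by positivity) (fun k => ?_) (hb.mul_left ((m:ℝ) + 1))
        rw [nb2]
        calc _ ≤ ((k:ℝ) + 1)^j*((m + 1)*(k + 1)*‖b k‖) := by gcongr; exact le2 k
          _ = _ := by ring)
      have c3 : ContDiff ℝ j Gz := by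
        have : Gz = fun z => ((ContinuousLinearMap.compL ℝ ℂ ℝ ℂ Complex.ofRealCLM).comp ((2:ℝ) • (innerSL ℝ : ℂ →L[ℝ] ℂ →L[ℝ] ℝ))) z := by
          funext z; rfl
        rw [this]
        exact ContinuousLinearMap.contDiff _
      exact (c1.smul contDiff_const).add (c2.smul c3)
    · intro z
      have := hasFDerivAt_tsum (u := fun k : ℕ => (k + 1)*‖b k‖*(exp 1*C) + (k + 1)*‖b k‖*((m + 1)*(exp 1*C')*4))
        (f := Tz η m b) (x₀ := 0)
        (f' := fun k z => α k z • ContinuousLinearMap.id ℝ ℂ + (Tz (deriv η) m b2 k z) • Gz z)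
        ((s0.mul_right _).add (s0.mul_right _)) (fun k z => Tz_deriv h m b k z) (fun k z => ?_) ?_ z
      · refine this.congr_fderiv ?_
        rw [((sα z).smul_const _).tsum_add ((sβ z).smul_const _), (sα z).tsum_smul_const, (sβ z).tsum_smul_const,
          (sα z).tsum_eq_zero_add, α0, zero_add]
        simp only [αs]
      · refine (norm_add_le _ _).trans (add_le_add ?_ (βn k z))
        rw [norm_smul]
        exact (mul_le_of_le_one_right (norm_nonneg _) (ContinuousLinearMap.norm_id_le)).trans (αn k z)
      · refine Summable.of_norm_bounded (sb.mul_right (exp 1*C)) (fun k => ?_)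
        rw [Tz_norm]
        exact mul_le_mul_of_nonneg_left (EC_pow h hC k m 0) (norm_nonneg _)
lemma HS_ext {j : ℕ} {a : ℕ → ℂ} (ha : Summable (fun k : ℕ => ((k:ℝ) + 1)^j*‖a k‖)) :
    ∃ U : ℂ → ℝ, ContDiff ℝ j U ∧ ∀ z : ℂ, ‖z‖ ≤ 1 → U z = (∑' k, a k*z^k).re := by
  let η : ℝ → ℝ := fun s => smoothTransition (1 - s)
  have h : EC η := ⟨smoothTransition.contDiff.comp (contDiff_const.sub contDiff_id),
    fun s hs => smoothTransition.zero_of_nonpos (by linarith), 1,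
    fun s hs => smoothTransition.one_of_one_le (by linarith)⟩
  refine ⟨fun z => (∑' k, Tz η 0 a k z).re, Complex.reCLM.contDiff.comp (PS j η 0 a h ha), fun z hz => ?_⟩
  change (∑' k, Tz η 0 a k z).re = _
  congr 2; funext k
  have : η ((k + (0:ℕ))*(‖z‖^2 - 1)) = 1 := smoothTransition.one_of_one_le (by
    have : (k + (0:ℕ))*(‖z‖^2 - 1) ≤ 0 := mul_nonpos_of_nonneg_of_nonpos (by positivity) (by nlinarith [norm_nonneg z])
    linarith)
  rw [Tz, this]; simp
end PartR3
section PartR4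
open Set Topology
variable {Ω : Type*} [MeasurableSpace Ω] {μ : Measure Ω} [IsFiniteMeasure μ]
lemma lk_lim {A : Ω → ℂ} {B g : Ω → ℝ} {M : ℝ} (hA : Measurable A) (hB : Integrable B μ) (hg : AEStronglyMeasurable g μ)
    (hM : ∀ᵐ ω ∂μ, |g ω| ≤ M) (h : ∀ᵐ ω ∂μ, A ω ≠ 0 ∧ ‖A ω‖ ≤ 2 ∧ ‖A ω‖⁻¹ ≤ B ω) :
    Tendsto (fun n => ∫ ω, lk (en n) (A ω)*g ω ∂μ) atTop (𝓝 (∫ ω, lk 0 (A ω)*g ω ∂μ)) ∧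
      Integrable (fun ω => lk 0 (A ω)*g ω) μ := by
  have i1 : Integrable (fun ω => (2 + 2*B ω)*M) μ := ((integrable_const 2).add (hB.const_mul 2)).mul_const M
  constructor
  · refine tendsto_integral_of_dominated_convergence (fun ω => (2 + 2*B ω)*M) ?_ i1 ?_ ?_
    · exact fun n => ((lk_meas _).comp hA).aestronglyMeasurable.mul hg
    · intro n
      filter_upwards [h, hM] with ω ⟨h1, h2, h3⟩ h4
      have e1 := lk_diff (en_pos n) h1
      have e2 := lk_abs (A ω)
      have e3 : √(en n) ≤ 1 := by
        refine sqrt_le_one.2 ?_; unfold en; rw [div_le_one (by positivity)]; linarith [(Nat.cast_nonneg n : (0:ℝ) ≤ n)]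
      have e4 : 0 ≤ ‖A ω‖⁻¹ := by positivity
      have e5 : |lk (en n) (A ω)| ≤ |lk (en n) (A ω) - lk 0 (A ω)| + |lk 0 (A ω)| := by
        simpa using abs_add_le (lk (en n) (A ω) - lk 0 (A ω)) (lk 0 (A ω))
      rw [norm_mul, Real.norm_eq_abs, Real.norm_eq_abs]
      refine mul_le_mul ?_ h4 (abs_nonneg _) (by linarith)
      nlinarith
    · filter_upwards [h] with ω ⟨h1, _, _⟩
      refine Tendsto.mul_const _ ?_
      rw [tendsto_iff_norm_sub_tendsto_zero]
      refine squeeze_zero (fun _ => norm_nonneg _) (fun n => lk_diff (en_pos n) h1) ?_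
      have := (continuous_sqrt.tendsto 0).comp en_tendsto
      rw [sqrt_zero] at this
      simpa using this.mul_const (‖A ω‖⁻¹)
  · refine i1.mono' (((lk_meas _).comp hA).aestronglyMeasurable.mul hg) ?_
    filter_upwards [h, hM] with ω ⟨h1, h2, h3⟩ h4
    have e2 := lk_abs (A ω)
    have e4 : 0 ≤ ‖A ω‖⁻¹ := by positivity
    rw [norm_mul, Real.norm_eq_abs, Real.norm_eq_abs]
    exact mul_le_mul (by linarith) h4 (abs_nonneg _) (by linarith)
lemma logser {Y : Ω → ℂ} {g : Ω → ℝ} {M ρ : ℝ} (hY : AEStronglyMeasurable Y μ) (hg : AEStronglyMeasurable g μ)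
    (hM : ∀ᵐ ω ∂μ, |g ω| ≤ M) (hρ : 0 ≤ ρ) (hρ1 : ρ < 1) {x : ℂ} (h : ∀ᵐ ω ∂μ, ‖x‖*‖Y ω‖ ≤ ρ) :
    ∫ ω, lk 0 (1 - starRingEnd ℂ x*Y ω)*g ω ∂μ =
      -(∑' k : ℕ, (∫ ω, starRingEnd ℂ (Y ω)^k*g ω ∂μ) / k*x^k).re := by
  let f : ℕ → Ω → ℂ := fun k ω => (x*starRingEnd ℂ (Y ω))^k / k*g ω
  have hc : AEStronglyMeasurable (fun ω => starRingEnd ℂ (Y ω)) μ := Complex.continuous_conj.comp_aestronglyMeasurable hY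
  have hg' : AEStronglyMeasurable (fun ω => (g ω : ℂ)) μ := Complex.continuous_ofReal.comp_aestronglyMeasurable hg
  have fb : ∀ k, ∀ᵐ ω ∂μ, ‖f k ω‖ ≤ ρ^k*M := by
    intro k
    filter_upwards [h, hM] with ω h1 h2
    simp only [f, norm_mul, norm_div, norm_pow, RCLike.norm_conj, Complex.norm_natCast, Complex.norm_real]
    refine mul_le_mul ?_ h2 (norm_nonneg _) (by positivity)
    rcases Nat.eq_zero_or_pos k with rfl | hk
    · simp
    · have : (1:ℝ) ≤ k := by exact_mod_cast hk
      exact (div_le_self (by positivity) this).trans (by gcongr)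
  have fi : ∀ k, Integrable (f k) μ := fun k =>
    (integrable_const (ρ^k*M)).mono' (by
      have := (((hc.const_mul x).pow k).mul_const (k:ℂ)⁻¹).mul hg'
      exact this) (fb k)
  have hs := hasSum_integral_of_summable_integral_norm fi (by
    refine Summable.of_nonneg_of_le (fun k => integral_nonneg fun _ => norm_nonneg _)
      (fun k => (integral_mono_ae (fi k).norm (integrable_const (ρ^k*M)) (fb k)))
      (?_ : Summable fun k => ∫ _, ρ^k*M ∂μ)
    simp only [integral_const, smul_eq_mul]
    exact ((summable_geometric_of_lt_one hρ hρ1).mul_right M).mul_left _)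
  have e1 : ∀ᵐ ω ∂μ, (∑' k, f k ω) = -Complex.log (1 - x*starRingEnd ℂ (Y ω))*g ω := by
    filter_upwards [h] with ω h1
    exact ((Complex.hasSum_taylorSeries_neg_log (by rw [norm_mul, RCLike.norm_conj]; linarith)).mul_right _).tsum_eq
  have e2 : ∀ k, ∫ ω, f k ω ∂μ = (∫ ω, starRingEnd ℂ (Y ω)^k*g ω ∂μ) / k*x^k := fun k => by
    rw [div_mul_eq_mul_div, mul_div_assoc, ← integral_mul_const]
    congr 1; funext ω; simp only [f]; ring
  simp only [e2] at hs
  rw [hs.tsum_eq]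
  have i2 : Integrable (fun ω => ∑' k, f k ω) μ := by
    refine (integrable_const (∑' k, ρ^k*M)).mono' ?_ ?_
    · refine (AEStronglyMeasurable.congr ?_ (Filter.EventuallyEq.symm e1))
      exact ((Complex.measurable_log.comp_aemeasurable ((aemeasurable_const.sub
        (hc.aemeasurable.const_mul x)))).neg.mul hg'.aemeasurable).aestronglyMeasurable
    · filter_upwards [ae_all_iff.2 fb] with ω h1
      have s := (summable_geometric_of_lt_one hρ hρ1).mul_right M
      exact (tsum_of_norm_bounded s.hasSum h1)
  have := Complex.reCLM.integral_comp_comm i2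
  simp only [Complex.reCLM_apply] at this
  rw [← this, ← integral_neg]
  refine integral_congr_ae ?_
  filter_upwards [e1] with ω h1
  rw [h1, neg_mul, Complex.neg_re, neg_neg, Complex.re_mul_ofReal, Complex.log_re, lk_zero]
  congr 2
  rw [← RCLike.norm_conj]; simp
lemma Nf_lk (e : ℝ) (x y : ℂ) : Nf e x y = -(1 / (2*π))*(lk e (x - y) + lk e (1 - starRingEnd ℂ x*y)) := by
  simp only [Nf, lk, Complex.normSq_eq_norm_sq]; field_simp; ring
lemma conj_ge {x y : ℂ} (hx : ‖x‖ ≤ 1) (hy : ‖y‖ ≤ 1) : ‖x - y‖ ≤ ‖1 - starRingEnd ℂ x*y‖ := by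
  have := normSq_ge ⟨x, by simpa using hx⟩ ⟨y, by simpa using hy⟩
  simp only [Complex.normSq_eq_norm_sq] at this
  exact abs_le_of_sq_le_sq' this (norm_nonneg _) |>.2
lemma conj_le {x y : ℂ} (hx : ‖x‖ ≤ 1) (hy : ‖y‖ ≤ 1) : ‖1 - starRingEnd ℂ x*y‖ ≤ 2 := by
  refine (norm_sub_le _ _).trans ?_
  rw [norm_mul, RCLike.norm_conj, norm_one]
  nlinarith [norm_nonneg x, norm_nonneg y]
lemma BB_norm (x : BB) : ‖(x:ℂ)‖ ≤ 1 := mem_closedBall_zero_iff.1 x.2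
lemma fr_meas (F : CB) : Measurable fun y => F (retr y) := (F.continuous.comp retr_cont).measurable
lemma oD (F : CB) (x : BB) : opk κ0 (JD F) x = -(1 / (2*π)) *
    (We 1 0 (fun y => F (retr y)) x + ∫ y in unitDisk, lk 0 (1 - starRingEnd ℂ (x:ℂ)*y)*F (retr y)) ∧
    IntegrableOn (fun y => lk 0 (1 - starRingEnd ℂ (x:ℂ)*y)*F (retr y)) unitDisk := by
  have hm := fr_meas F
  have hB : IntegrableOn (fun y : ℂ => ‖(x:ℂ) - y‖⁻¹) unitDisk := riesz1 1 x
  have hx := BB_norm x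
  have hM : ∀ᵐ y ∂(volume.restrict unitDisk), |F (retr y)| ≤ ‖F‖ := Eventually.of_forall fun y => cb_abs_le F _
  have hne : ∀ᵐ y ∂(volume.restrict unitDisk), (x:ℂ) - y ≠ 0 ∧ ‖y‖ ≤ 1 := by
    filter_upwards [ae_ne_ball (R := 1) (x:ℂ), ae_restrict_mem (measurableSet_ball : MeasurableSet unitDisk)] with y h1 h2
    exact ⟨h1, (by simpa [unitDisk] using h2 : ‖y‖ < 1).le⟩
  have l1 := lk_lim (μ := volume.restrict unitDisk) (A := fun y => (x:ℂ) - y) (by fun_prop) hB hm.aestronglyMeasurable hM (by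
    filter_upwards [hne] with y ⟨h1, h2⟩
    exact ⟨h1, (norm_sub_le _ _).trans (by linarith), le_rfl⟩)
  have l2 := lk_lim (μ := volume.restrict unitDisk) (A := fun y => 1 - starRingEnd ℂ (x:ℂ)*y) (by fun_prop) hB hm.aestronglyMeasurable hM (by
    filter_upwards [hne] with y ⟨h1, h2⟩
    have h3 := norm_pos_iff.2 h1
    have h4 := conj_ge hx h2
    exact ⟨norm_pos_iff.1 (h3.trans_le h4), conj_le hx h2, inv_anti₀ h3 h4⟩)
  refine ⟨?_, l2.2⟩
  refine tendsto_nhds_unique (T_lim (JD F) x) ?_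
  have e : We 1 0 (fun y => F (retr y)) x = ∫ y in unitDisk, lk 0 ((x:ℂ) - y)*F (retr y) := by
    simp only [We, mul_comm (F _)]; rfl
  rw [e]
  refine ((l1.1.add l2.1).const_mul (-(1 / (2*π)))).congr fun n => ?_
  have c1 : Continuous fun y => lk (en n) ((x:ℂ) - y)*F (retr y) :=
    ((lk_cont (en_pos n)).comp (by fun_prop)).mul (F.continuous.comp retr_cont)
  have c2 : Continuous fun y => lk (en n) (1 - starRingEnd ℂ (x:ℂ)*y)*F (retr y) :=
    ((lk_cont (en_pos n)).comp (by fun_prop)).mul (F.continuous.comp retr_cont)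
  rw [← integral_add (μ := volume.restrict unitDisk) (int_ball c1 1) (int_ball c2 1), ← integral_const_mul, real_inner_comm, κn_eq, inner_JD_iot, lD_apply,
    integral_νD _ (ContinuousMap.continuous _).aestronglyMeasurable]
  refine setIntegral_congr_fun measurableSet_ball fun y hy => ?_
  have hy : ‖y‖ < 1 := mem_ball_zero_iff.1 hy
  rw [ContinuousMap.mul_apply, cbR_apply, retr_val hy.le, Nf_lk]; ring
lemma bp_abs {x : ℂ} (θ : ℝ) : ‖1 - starRingEnd ℂ x*bpt θ‖ = ‖x - bpt θ‖ := by
  have : x - bpt θ = -(bpt θ*starRingEnd ℂ (1 - starRingEnd ℂ x*bpt θ)) := by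
    have := bpt_conj θ
    simp only [map_sub, map_one, map_mul, Complex.conj_conj]
    linear_combination (-x)*this
  rw [this, norm_neg, norm_mul, bpt_norm, one_mul, RCLike.norm_conj]
def ck (g : CB) (k : ℕ) : ℂ := ∫ θ in 0..(2*π), starRingEnd ℂ (bpt θ)^k*g (bptB θ)
lemma oS (g : CB) {x : BB} (hx : ‖(x:ℂ)‖ < 1) : opk κ0 (JS g) x = ((1 / π : ℝ)*∑' k : ℕ, ck g k / k*(x:ℂ)^k).re := by
  have h0 : (0:ℝ) ≤ 2*π := by positivity
  have hge : ∀ θ, 1 - ‖(x:ℂ)‖ ≤ ‖1 - starRingEnd ℂ (x:ℂ)*bpt θ‖ := fun θ => by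
    have := norm_sub_norm_le 1 (starRingEnd ℂ (x:ℂ)*bpt θ)
    rwa [norm_mul, RCLike.norm_conj, bpt_norm, mul_one, norm_one] at this
  have hc : Continuous fun θ => g (bptB θ) := g.continuous.comp bptB_cont
  have hb := bpt_cont
  have hM : ∀ᵐ θ ∂(volume.restrict (Ioc 0 (2*π))), |g (bptB θ)| ≤ ‖g‖ := Eventually.of_forall fun y => cb_abs_le g _
  have l1 := (lk_lim (μ := volume.restrict (Ioc 0 (2*π))) (A := fun θ => 1 - starRingEnd ℂ (x:ℂ)*bpt θ) (B := fun _ => (1 - ‖(x:ℂ)‖)⁻¹)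
    (by fun_prop) (integrable_const _) hc.aestronglyMeasurable hM (Eventually.of_forall fun θ => by
      have := hge θ
      exact ⟨norm_pos_iff.1 (by linarith), conj_le hx.le (bpt_norm θ).le, inv_anti₀ (by linarith) this⟩)).1
  rw [logser hb.aestronglyMeasurable hc.aestronglyMeasurable hM (norm_nonneg _) hx (Eventually.of_forall fun θ => by rw [bpt_norm, mul_one])] at l1
  refine tendsto_nhds_unique (T_lim (JS g) x) ?_
  have e : ((1 / π : ℝ)*∑' k : ℕ, ck g k / k*(x:ℂ)^k).re = -(1 / π) *
      -(∑' k : ℕ, (∫ θ in Ioc 0 (2*π), starRingEnd ℂ (bpt θ)^k*g (bptB θ)) / k*(x:ℂ)^k).re := by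
    rw [Complex.re_ofReal_mul, neg_mul_neg]
    simp only [ck, intervalIntegral.integral_of_le h0]
  rw [e]
  refine (l1.const_mul (-(1 / π))).congr fun n => ?_
  rw [← integral_const_mul, real_inner_comm, κn_eq, inner_JS_iot, lS_apply,
    integral_νS _ (ContinuousMap.continuous _).aestronglyMeasurable, intervalIntegral.integral_of_le h0]
  refine integral_congr_ae (Eventually.of_forall fun θ => ?_)
  have e2 : lk (en n) ((x:ℂ) - bpt θ) = lk (en n) (1 - starRingEnd ℂ (x:ℂ)*bpt θ) := by simp only [lk, bp_abs]
  change _ = g (bptB θ)*Nf (en n) x (bpt θ)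
  rw [Nf_lk, e2]; field_simp; ring
end PartR4
section PartR5
open Set Topology
def cf (p : ℝ → ℝ) (k : ℕ) : ℂ := ∫ θ in 0..(2*π), starRingEnd ℂ (bpt θ)^k*p θ
lemma bptc_cont : Continuous fun θ => starRingEnd ℂ (bpt θ) := Complex.continuous_conj.comp bpt_cont
lemma Sm_norm (a : ℕ → ℂ) (N : ℕ) : ∫ θ in 0..(2*π), ‖Sm a N (bpt θ)‖^2 = 2*π*∑ k ∈ Finset.range N, ‖a k‖^2 := by
  have h := orth_Sm a a N
  simp only [Complex.mul_conj, Complex.normSq_eq_norm_sq] at h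
  rw [intervalIntegral.integral_ofReal] at h
  exact_mod_cast h
lemma Sm_cont (a : ℕ → ℂ) (N : ℕ) : Continuous fun θ => Sm a N (bpt θ) := by
  have := bpt_cont
  unfold Sm; fun_prop
lemma bessel {p : ℝ → ℝ} (hp : Continuous p) (N : ℕ) :
    ∑ k ∈ Finset.range N, ‖cf p k‖^2 ≤ 2*π*∫ θ in 0..(2*π), p θ^2 := by
  have hc := bptc_cont
  have hS := Sm_cont (cf p) N
  have h1 : ∫ θ in 0..(2*π), (p θ*starRingEnd ℂ (Sm (cf p) N (bpt θ))) = ((∑ k ∈ Finset.range N, ‖cf p k‖^2 : ℝ) : ℂ) := by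
    have e : ∀ θ, p θ*starRingEnd ℂ (Sm (cf p) N (bpt θ)) = ∑ k ∈ Finset.range N, starRingEnd ℂ (cf p k)*(starRingEnd ℂ (bpt θ)^k*p θ) := by
      intro θ
      simp only [Sm, map_sum, map_mul, map_pow, Finset.mul_sum]
      exact Finset.sum_congr rfl fun k _ => by ring
    simp only [e]
    rw [intervalIntegral.integral_finsetSum fun k _ => Continuous.intervalIntegrable (by fun_prop) _ _]
    push_cast
    refine Finset.sum_congr rfl fun k _ => ?_
    rw [intervalIntegral.integral_const_mul, mul_comm]
    exact Complex.mul_conj' _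
  have h1' : ∫ θ in 0..(2*π), (p θ*starRingEnd ℂ (Sm (cf p) N (bpt θ))).re = ∑ k ∈ Finset.range N, ‖cf p k‖^2 := by
    rw [reInt (by fun_prop), h1, Complex.ofReal_re]
  have h2 := Sm_norm (cf p) N
  set σ := ∑ k ∈ Finset.range N, ‖cf p k‖^2
  have h3 : 0 ≤ ∫ θ in 0..(2*π), (p θ^2 - (1 / π)*(p θ*starRingEnd ℂ (Sm (cf p) N (bpt θ))).re + (1 / (2*π))^2*‖Sm (cf p) N (bpt θ)‖^2) := by
    refine intervalIntegral.integral_nonneg (by positivity) fun θ _ => ?_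
    set z := Sm (cf p) N (bpt θ)
    have e : p θ^2 - (1 / π)*(p θ*starRingEnd ℂ z).re + (1 / (2*π))^2*‖z‖^2 = (p θ - 1 / (2*π)*z.re)^2 + (1 / (2*π)*z.im)^2 := by
      rw [← Complex.normSq_eq_norm_sq, Complex.normSq_apply, Complex.re_ofReal_mul, Complex.conj_re]; field_simp; ring
    rw [e]; positivity
  rw [intervalIntegral.integral_add (Continuous.intervalIntegrable (by fun_prop) _ _) (Continuous.intervalIntegrable (by fun_prop) _ _),
    intervalIntegral.integral_sub (Continuous.intervalIntegrable (by fun_prop) _ _) (Continuous.intervalIntegrable (by fun_prop) _ _),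
    intervalIntegral.integral_const_mul, intervalIntegral.integral_const_mul, h1', h2] at h3
  have e : (1 / (2*π))^2*(2*π*σ) = 1 / (2*π)*σ := by field_simp
  have e2 : 1 / π*σ = 2*(1 / (2*π)*σ) := by field_simp
  rw [e, e2] at h3
  have h4 : 1 / (2*π)*σ ≤ ∫ θ in 0..(2*π), p θ^2 := by linarith
  calc σ = 2*π*(1 / (2*π)*σ) := by field_simp
    _ ≤ _ := by gcongr
lemma cf_l2 {p : ℝ → ℝ} (hp : Continuous p) : Summable fun k => ‖cf p k‖^2 :=
  summable_of_sum_range_le (fun _ => by positivity) (bessel hp)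
lemma amgm {a : ℕ → ℂ} {j : ℕ} (h : Summable fun k : ℕ => ((k:ℝ)^(j + 1)*‖a k‖)^2) : Summable fun k : ℕ => ((k:ℝ) + 1)^j*‖a k‖ := by
  have hs : Summable fun k : ℕ => (1:ℝ) / (k:ℝ)^2 := summable_one_div_nat_pow.2 (by norm_num)
  refine (summable_nat_add_iff 1).1 ?_
  have s := ((summable_nat_add_iff 1).2 (hs.add h)).mul_left (2^j : ℝ)
  refine Summable.of_nonneg_of_le (fun k => by positivity) (fun k => ?_) s
  set x : ℝ := ((k + 1 : ℕ) : ℝ)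
  have hx : 1 ≤ x := by simp [x]
  have h1 : (x + 1)^j ≤ 2^j*x^j := by rw [← mul_pow]; gcongr; linarith
  have h2 : x^j*‖a (k + 1)‖ ≤ 1 / x^2 + (x^(j + 1)*‖a (k + 1)‖)^2 := by
    have e : x^j*‖a (k + 1)‖ = (1 / x)*(x^(j + 1)*‖a (k + 1)‖) := by rw [pow_succ]; field_simp
    rw [e]
    have e3 : 1 / x^2 = (1 / x)^2 := by rw [div_pow, one_pow]
    rw [e3]
    nlinarith [sq_nonneg ((1 / x) - (x^(j + 1)*‖a (k + 1)‖)), sq_nonneg (1 / x), sq_nonneg (x^(j + 1)*‖a (k + 1)‖)]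
  calc (x + 1)^j*‖a (k + 1)‖ ≤ 2^j*x^j*‖a (k + 1)‖ := by gcongr
    _ = 2^j*(x^j*‖a (k + 1)‖) := by ring
    _ ≤ _ := by gcongr
lemma ck_div (c : ℕ → ℂ) (j : ℕ) (k : ℕ) : (k:ℝ)^(j + 1)*‖c k / k‖ = (k:ℝ)^(j + 1) / k*‖c k‖ := by
  rw [norm_div, Complex.norm_natCast]; ring
lemma ck_sum (g : CB) : Summable fun k : ℕ => ((k:ℝ)^(0 + 1)*‖ck g k / k‖)^2 := by
  refine Summable.of_nonneg_of_le (fun k => by positivity) (fun k => ?_) (cf_l2 (g.continuous.comp bptB_cont))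
  rw [ck_div]; gcongr
  refine mul_le_of_le_one_left (norm_nonneg _) ?_
  rw [zero_add, pow_one]; exact div_self_le_one _
lemma oS' (g : CB) (x : BB) : opk κ0 (JS g) x = (1 / π)*(∑' k : ℕ, ck g k / k*(x:ℂ)^k).re := by
  obtain ⟨U, hU, hU'⟩ := HS_ext (amgm (ck_sum g))
  rw [← hU' x (BB_norm x)]
  have : (fun x => opk κ0 (JS g) x) = fun x : BB => (1 / π)*U x :=
    Continuous.ext_on BB_dense (opk κ0 (JS g)).continuous (continuous_const.mul (hU.continuous.comp continuous_subtype_val)) fun x hx => by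
      rw [oS g hx, hU' x (BB_norm x), Complex.re_ofReal_mul]
  exact congrFun this x
end PartR5
section PartR6
open Set Topology
def DB (p : ℝ → ℝ) : Prop := Continuous p ∧ (∀ θ, p (θ + 2*π) = p θ) ∧
  ∃ C, ∀ t, ∫ θ in 0..(2*π), (p (θ + t) - p θ)^2 ≤ C*t^2
lemma bpt_add (s t : ℝ) : bpt (s + t) = bpt s*bpt t := by
  simp only [bpt]; push_cast; rw [add_mul, Complex.exp_add]
lemma cf_shift {p : ℝ → ℝ} (hp : Continuous p) (hper : ∀ θ, p (θ + 2*π) = p θ) (t : ℝ) (k : ℕ) :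
    cf (fun θ => p (θ + t) - p θ) k = (bpt t^k - 1)*cf p k := by
  have hc := bptc_cont
  have e1 : cf (fun θ => p (θ + t)) k = bpt t^k*cf p k := by
    let q : ℝ → ℂ := fun θ => starRingEnd ℂ (bpt θ)^k*p θ
    have hq : Function.Periodic q (2*π) := fun θ => by simp only [q, bpt_per, hper]
    have h1 := hq.intervalIntegral_add_eq t 0
    rw [zero_add] at h1
    rw [cf, cf, ← h1, ← intervalIntegral.integral_const_mul]
    have h2 := intervalIntegral.integral_comp_add_right (a := 0) (b := 2*π) (fun θ => bpt t^k*q θ) t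
    rw [zero_add, add_comm (2*π)] at h2
    rw [← h2]
    congr 1; funext θ
    simp only [q]
    rw [bpt_add, map_mul, mul_pow, ← mul_assoc, ← mul_assoc, mul_comm (bpt t^k), mul_assoc (starRingEnd ℂ (bpt θ)^k), ← mul_pow, bpt_conj]
    simp
  rw [sub_mul, one_mul, ← e1, cf, cf, cf, ← intervalIntegral.integral_sub]
  · congr 1; funext θ; push_cast; ring
  all_goals exact Continuous.intervalIntegrable (by fun_prop) _ _
lemma DB_sum {p : ℝ → ℝ} (h : DB p) : Summable fun k : ℕ => ((k:ℝ)*‖cf p k‖)^2 := by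
  obtain ⟨hp, hper, C, hC⟩ := h
  refine summable_of_sum_range_le (c := 2*π*C) (fun _ => by positivity) fun N => ?_
  have ht : Tendsto (fun t : ℝ => ∑ k ∈ Finset.range N, (‖(t⁻¹ : ℝ) • (bpt t^k - 1)‖*‖cf p k‖)^2) (𝓝[≠] 0)
      (𝓝 (∑ k ∈ Finset.range N, ((k:ℝ)*‖cf p k‖)^2)) := by
    refine tendsto_finsetSum _ fun k _ => Tendsto.pow (Tendsto.mul_const _ ?_) 2
    have hd : HasDerivAt (fun t => bpt t^k) (k*bpt 0^(k - 1)*(Complex.I*bpt 0)) 0 := (bpt_hasDerivAt 0).pow k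
    have h1 := (hasDerivAt_iff_tendsto_slope_zero.1 hd).norm
    have b0 : bpt 0 = 1 := by simp [bpt]
    simpa [b0] using h1
  refine le_of_tendsto ht ?_
  filter_upwards [self_mem_nhdsWithin] with t ht
  have ht : t ≠ 0 := ht
  have b := bessel (p := fun θ => p (θ + t) - p θ) (by fun_prop) N
  simp only [cf_shift hp hper, norm_mul] at b
  have e : ∑ k ∈ Finset.range N, (‖(t⁻¹ : ℝ) • (bpt t^k - 1)‖*‖cf p k‖)^2 = (t⁻¹)^2*∑ k ∈ Finset.range N, (‖bpt t^k - 1‖*‖cf p k‖)^2 := by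
    rw [Finset.mul_sum]
    refine Finset.sum_congr rfl fun k _ => ?_
    rw [norm_smul, mul_assoc, mul_pow, Real.norm_eq_abs, sq_abs]
  rw [e]
  calc _ ≤ (t⁻¹)^2*(2*π*(C*t^2)) := by
        gcongr; exact b.trans (by gcongr; exact hC t)
    _ = _ := by field_simp
lemma ser_cont {b : ℕ → ℂ} (hb : Summable fun k => ‖b k‖) : Continuous fun θ => ∑' k, b k*bpt θ^k := by
  have := bpt_cont
  refine continuous_tsum (fun k => by fun_prop) hb fun k θ => ?_
  rw [norm_mul, norm_pow, bpt_norm, one_pow, mul_one]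
lemma ser_sum {b : ℕ → ℂ} (hb : Summable fun k => ‖b k‖) (θ : ℝ) : Summable fun k => b k*bpt θ^k :=
  Summable.of_norm_bounded hb fun k => by rw [norm_mul, norm_pow, bpt_norm, one_pow, mul_one]
lemma parseval {b : ℕ → ℂ} (hb : Summable fun k => ‖b k‖) (h2 : Summable fun k => ‖b k‖^2) :
    ∫ θ in 0..(2*π), (∑' k, b k*bpt θ^k).re^2 ≤ 2*π*∑' k, ‖b k‖^2 := by
  have ht : Tendsto (fun N => ∫ θ in 0..(2*π), (Sm b N (bpt θ)).re^2) atTop (𝓝 (∫ θ in 0..(2*π), (∑' k, b k*bpt θ^k).re^2)) := by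
    refine intervalIntegral.tendsto_integral_filter_of_dominated_convergence (fun _ => (∑' k, ‖b k‖)^2) ?_ ?_ ?_ ?_
    · refine Eventually.of_forall fun N => Continuous.aestronglyMeasurable ?_
      have := Sm_cont b N
      fun_prop
    · refine Eventually.of_forall fun N => Eventually.of_forall fun θ _ => ?_
      rw [norm_pow, Real.norm_eq_abs]
      gcongr
      refine (Complex.abs_re_le_norm _).trans ((norm_sum_le _ _).trans ?_)
      simp only [norm_mul, norm_pow, bpt_norm, one_pow, mul_one]
      exact hb.sum_le_tsum _ fun _ _ => norm_nonneg _
    · simp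
    · refine Eventually.of_forall fun θ _ => ?_
      exact ((Complex.continuous_re.tendsto _).comp (ser_sum hb θ).hasSum.tendsto_sum_nat).pow 2
  refine le_of_tendsto ht (Eventually.of_forall fun N => ?_)
  have h3 : ∫ θ in 0..(2*π), (Sm b N (bpt θ)).re^2 ≤ ∫ θ in 0..(2*π), ‖Sm b N (bpt θ)‖^2 := by
    have := Sm_cont b N
    refine intervalIntegral.integral_mono (by positivity) (Continuous.intervalIntegrable (by fun_prop) _ _)
      (Continuous.intervalIntegrable (by fun_prop) _ _) fun θ => ?_
    rw [← sq_abs]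
    exact pow_le_pow_left₀ (abs_nonneg _) (Complex.abs_re_le_norm _) 2
  rw [Sm_norm] at h3
  refine h3.trans ?_
  gcongr
  exact h2.sum_le_tsum _ fun _ _ => by positivity
lemma bpt_lip (k : ℕ) (t : ℝ) : ‖bpt t^k - 1‖ ≤ k * |t| := by
  have e : bpt t^k = bpt (k*t) := by
    simp only [bpt]; rw [← Complex.exp_nat_mul]; push_cast; ring_nf
  rw [e]
  have := norm_image_sub_le_of_norm_deriv_le_segment' (f := bpt) (C := 1) (a := 0) (b := |k*t|)
    (fun x _ => (bpt_hasDerivAt x).hasDerivWithinAt) (fun x _ => by simp [bpt_norm]) |k*t| (right_mem_Icc.2 (abs_nonneg _))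
  have b0 : bpt 0 = 1 := by simp [bpt]
  rw [b0, sub_zero, one_mul, abs_mul, Nat.abs_cast] at this
  refine le_trans (le_of_eq ?_) this
  rcases abs_choice t with h | h
  · rw [h]
  · rw [h]
    have : bpt (k*-t) = starRingEnd ℂ (bpt (k*t)) := by
      simp only [bpt, ← Complex.exp_conj]; simp
    rw [this, ← RCLike.norm_conj (bpt (k*t) - 1)]; simp
lemma DB_ser {a : ℕ → ℂ} (ha : Summable fun k => ‖a k‖) (h2 : Summable fun k : ℕ => ((k:ℝ)*‖a k‖)^2) :
    DB fun θ => (∑' k, a k*bpt θ^k).re := by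
  refine ⟨Complex.continuous_re.comp (ser_cont ha), fun θ => by simp only [bpt_per], 2*π*∑' k : ℕ, ((k:ℝ)*‖a k‖)^2, fun t => ?_⟩
  let b : ℕ → ℂ := fun k => a k*(bpt t^k - 1)
  have b1 : ∀ k, ‖b k‖^2 ≤ ((k:ℝ)*‖a k‖)^2*t^2 := fun k => by
    have := bpt_lip k t
    simp only [b, norm_mul]
    rw [← sq_abs t, ← mul_pow]
    gcongr ?_^2
    calc _ ≤ ‖a k‖*(k * |t|) := by gcongr
      _ = _ := by ring
  have s2 : Summable fun k => ‖b k‖^2 := Summable.of_nonneg_of_le (fun k => by positivity) b1 (h2.mul_right _)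
  have s1 : Summable fun k => ‖b k‖ := by
    refine Summable.of_nonneg_of_le (fun k => by positivity) (fun k => ?_) (ha.mul_right 2)
    simp only [b, norm_mul]; gcongr
    refine (norm_sub_le _ _).trans ?_
    rw [norm_pow, bpt_norm]; norm_num
  have e : ∀ θ, (∑' k, a k*bpt (θ + t)^k).re - (∑' k, a k*bpt θ^k).re = (∑' k, b k*bpt θ^k).re := fun θ => by
    rw [← Complex.sub_re, ← (ser_sum ha _).tsum_sub (ser_sum ha _)]
    congr 2; funext k; simp only [b]; rw [bpt_add]; ring
  simp only [e]
  refine (parseval s1 s2).trans ?_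
  rw [mul_assoc (2*π), ← tsum_mul_right]
  exact mul_le_mul_of_nonneg_left (s2.tsum_le_tsum b1 (h2.mul_right _)) (by positivity)
def LD (P q : ℝ → ℝ) : Prop := (∃ M, ∀ θ, |q θ| ≤ M) ∧ ∃ L, ∀ θ t, |q (θ + t) - q θ| ≤ L*(|t| + |P (θ + t) - P θ|)
variable {P q r : ℝ → ℝ}
lemma LD_DB (hP : DB P) (hq : Continuous q) (hper : ∀ θ, q (θ + 2*π) = q θ) (h : LD P q) : DB q := by
  obtain ⟨hPc, _, C, hC⟩ := hP
  obtain ⟨_, L, hL⟩ := h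
  refine ⟨hq, hper, 2*L^2*(2*π + C), fun t => ?_⟩
  calc _ ≤ ∫ θ in 0..(2*π), 2*L^2*(t^2 + (P (θ + t) - P θ)^2) := by
        refine intervalIntegral.integral_mono (by positivity) (Continuous.intervalIntegrable (by fun_prop) _ _)
          (Continuous.intervalIntegrable (by fun_prop) _ _) fun θ => ?_
        have h1 := pow_le_pow_left₀ (abs_nonneg _) (hL θ t) 2
        rw [sq_abs, mul_pow] at h1
        refine h1.trans ?_
        rw [mul_comm 2, mul_assoc]
        gcongr
        rw [← sq_abs t, ← sq_abs (P (θ + t) - P θ)]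
        nlinarith [sq_nonneg (|t| - |P (θ + t) - P θ|)]
    _ = 2*L^2*(2*π*t^2 + ∫ θ in 0..(2*π), (P (θ + t) - P θ)^2) := by
        rw [intervalIntegral.integral_const_mul, intervalIntegral.integral_add (by simp) (Continuous.intervalIntegrable (by fun_prop) _ _)]
        simp
    _ ≤ 2*L^2*(2*π*t^2 + C*t^2) := by gcongr; exact hC t
    _ = _ := by ring
lemma LD_add (hq : LD P q) (hr : LD P r) : LD P fun θ => q θ + r θ := by
  obtain ⟨⟨M, hM⟩, L, hL⟩ := hq
  obtain ⟨⟨M', hM'⟩, L', hL'⟩ := hr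
  refine ⟨⟨M + M', fun θ => (abs_add_le _ _).trans (add_le_add (hM θ) (hM' θ))⟩, L + L', fun θ t => ?_⟩
  rw [add_mul, add_sub_add_comm]
  exact (abs_add_le _ _).trans (add_le_add (hL θ t) (hL' θ t))
lemma LD_mul (hq : LD P q) (hr : LD P r) : LD P fun θ => q θ*r θ := by
  obtain ⟨⟨M, hM⟩, L, hL⟩ := hq
  obtain ⟨⟨M', hM'⟩, L', hL'⟩ := hr
  have m0 := (abs_nonneg _).trans (hM 0)
  refine ⟨⟨M*M', fun θ => ?_⟩, M*L' + L*M', fun θ t => ?_⟩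
  · rw [abs_mul]; exact mul_le_mul (hM θ) (hM' θ) (abs_nonneg _) m0
  have e : q (θ + t)*r (θ + t) - q θ*r θ = q (θ + t)*(r (θ + t) - r θ) + (q (θ + t) - q θ)*r θ := by ring
  rw [e]
  refine (abs_add_le _ _).trans ?_
  rw [abs_mul, abs_mul]
  calc _ ≤ M*(L'*(|t| + |P (θ + t) - P θ|)) + L*(|t| + |P (θ + t) - P θ|)*M' := by
        refine add_le_add (mul_le_mul (hM _) (hL' θ t) (abs_nonneg _) m0)
          (mul_le_mul (hL θ t) (hM' θ) (abs_nonneg _) ((abs_nonneg _).trans (hL θ t)))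
    _ = _ := by ring
lemma LD_self (h : DB P) : LD P P := by
  have hb : ∃ M, ∀ θ, |P θ| ≤ M := by
    obtain ⟨M, hM⟩ := (isCompact_Icc (a := (0:ℝ)) (b := 2*π)).exists_bound_of_continuousOn h.1.continuousOn
    refine ⟨M, fun θ => ?_⟩
    obtain ⟨y, hy, e⟩ := Function.Periodic.exists_mem_Ico₀ (f := P) h.2.1 (by positivity) θ
    rw [e]; exact hM y ⟨hy.1, hy.2.le⟩
  exact ⟨hb, 1, fun θ t => by rw [one_mul]; linarith [abs_nonneg t]⟩
lemma LD_C1 (hq : ContDiff ℝ 1 q) (hper : ∀ θ, q (θ + 2*π) = q θ) : LD P q := by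
  have bd : ∀ f : ℝ → ℝ, Continuous f → (∀ θ, f (θ + 2*π) = f θ) → ∃ M, ∀ θ, |f θ| ≤ M := fun f hf hp => by
    obtain ⟨M, hM⟩ := (isCompact_Icc (a := (0:ℝ)) (b := 2*π)).exists_bound_of_continuousOn hf.continuousOn
    refine ⟨M, fun θ => ?_⟩
    obtain ⟨y, hy, e⟩ := Function.Periodic.exists_mem_Ico₀ (f := f) hp (by positivity) θ
    rw [e]; exact hM y ⟨hy.1, hy.2.le⟩
  obtain ⟨M, hM⟩ := bd (deriv q) (hq.continuous_deriv le_rfl) fun θ => by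
    rw [← deriv_comp_add_const]; congr 1; funext x; exact hper x
  refine ⟨bd q hq.continuous hper, M, fun θ t => ?_⟩
  have := convex_univ.norm_image_sub_le_of_norm_deriv_le (f := q) (fun x _ => hq.differentiable (by norm_num) x) (fun x _ => hM x) (mem_univ θ) (mem_univ (θ + t))
  rw [add_sub_cancel_left] at this
  refine this.trans ?_
  rw [Real.norm_eq_abs]
  exact mul_le_mul_of_nonneg_left (by linarith [abs_nonneg (P (θ + t) - P θ)]) ((abs_nonneg _).trans (hM 0))
lemma LD_const (c : ℝ) : LD P fun _ => c := LD_C1 contDiff_const fun _ => rfl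
lemma LD_exp (hq : LD P q) : LD P fun θ => exp (q θ) := by
  obtain ⟨⟨M, hM⟩, L, hL⟩ := hq
  have m : ∀ θ, exp (q θ) ≤ exp M := fun θ => exp_le_exp.2 ((le_abs_self _).trans (hM θ))
  refine ⟨⟨exp M, fun θ => by rw [abs_of_pos (exp_pos _)]; exact m θ⟩, exp M*L, fun θ t => ?_⟩
  have := (convex_Iic M).norm_image_sub_le_of_norm_deriv_le (f := exp) (fun x _ => differentiable_exp x) (C := exp M)
    (fun x hx => by rw [Real.deriv_exp, Real.norm_eq_abs, abs_of_pos (exp_pos _)]; exact exp_le_exp.2 hx)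
    ((le_abs_self _).trans (hM θ) : q θ ∈ Iic M) ((le_abs_self _).trans (hM (θ + t)) : q (θ + t) ∈ Iic M)
  refine this.trans ?_
  rw [mul_assoc]; gcongr; exact hL θ t
lemma cf_deriv {p p' : ℝ → ℝ} (hp : ∀ θ, HasDerivAt p (p' θ) θ) (hc : Continuous p') (hper : ∀ θ, p (θ + 2*π) = p θ) (k : ℕ) :
    cf p' k = Complex.I*k*cf p k := by
  have hcc := bptc_cont
  have hpc : Continuous p := continuous_iff_continuousAt.2 fun θ => (hp θ).continuousAt
  have d : ∀ θ, HasDerivAt (fun θ => starRingEnd ℂ (bpt θ)^k) (-(Complex.I*k)*starRingEnd ℂ (bpt θ)^k) θ := fun θ => by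
    have h1 : HasDerivAt (fun θ => starRingEnd ℂ (bpt θ)) (-Complex.I*starRingEnd ℂ (bpt θ)) θ := by
      have := (Complex.conjCLE.toContinuousLinearMap.hasFDerivAt).comp_hasDerivAt θ (bpt_hasDerivAt θ)
      exact this.congr_deriv (by simp)
    have := h1.pow k
    refine this.congr_deriv ?_
    cases k with
    | zero => simp
    | succ k => rw [pow_succ]; simp only [Nat.add_sub_cancel]; ring
  have := intervalIntegral.integral_mul_deriv_eq_deriv_mul (a := 0) (b := 2*π) (u := fun θ => starRingEnd ℂ (bpt θ)^k)
    (v := fun θ => (p θ : ℂ)) (v' := fun θ => (p' θ : ℂ)) (fun θ _ => d θ) (fun θ _ => (hp θ).ofReal_comp)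
    (Continuous.intervalIntegrable (by fun_prop) _ _) (Continuous.intervalIntegrable (by fun_prop) _ _)
  rw [cf, this, cf, ← intervalIntegral.integral_const_mul]
  have e1 := hper 0
  have e2 := bpt_per 0
  rw [zero_add] at e1 e2
  rw [e1, e2, sub_self, zero_sub, ← intervalIntegral.integral_neg]
  congr 1; funext θ; ring
end PartR6
section PartR7
open Set Topology
def cu (r : ℝ) : ℝ := max 0 (min 1 (4 - 2*r))
def im (t : ℂ) : ℝ := (max 1 ‖t‖)⁻¹
def ρf (t : ℂ) : ℂ := (im t^2 : ℝ) • t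
def wf (t : ℂ) : ℝ := im t^4*cu ‖t‖
def φf (F : CB) (t : ℂ) : ℝ := F (retr (ρf t))*wf t
lemma cu_mem (r : ℝ) : 0 ≤ cu r ∧ cu r ≤ 1 := ⟨le_max_left _ _, max_le zero_le_one (min_le_left _ _)⟩
lemma im_mem (t : ℂ) : 0 < im t ∧ im t ≤ 1 ∧ im t*‖t‖ ≤ 1 := by
  have h : 1 ≤ max 1 ‖t‖ := le_max_left _ _
  refine ⟨by unfold im; positivity, inv_le_one_of_one_le₀ h, ?_⟩
  rw [im, inv_mul_le_iff₀ (by positivity), mul_one]; exact le_max_right _ _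
lemma im_diff (t s : ℂ) : |im t - im s| ≤ im t*im s*‖t - s‖ := by
  have h1 : 1 ≤ max 1 ‖t‖ := le_max_left _ _
  have h2 : 1 ≤ max 1 ‖s‖ := le_max_left _ _
  have e : im t - im s = im t*im s*(max 1 ‖s‖ - max 1 ‖t‖) := by
    simp only [im]; field_simp
  rw [e, abs_mul, abs_of_pos (mul_pos (im_mem t).1 (im_mem s).1)]
  refine mul_le_mul_of_nonneg_left ?_ (mul_pos (im_mem t).1 (im_mem s).1).le
  refine (abs_max_sub_max_le_max _ _ _ _).trans (max_le (by simp) ?_)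
  rw [norm_sub_rev]; exact abs_norm_sub_norm_le _ _
lemma ρ_lip (t s : ℂ) : ‖ρf t - ρf s‖ ≤ 3*‖t - s‖ := by
  have e : ρf t - ρf s = (im t^2 : ℝ) • (t - s) + ((im t - im s)*(im t + im s) : ℝ) • s := by
    simp only [ρf, smul_sub]; rw [show (im t - im s)*(im t + im s) = im t^2 - im s^2 by ring, sub_smul]; abel
  rw [e]
  refine (norm_add_le _ _).trans ?_
  obtain ⟨a1, a2, a3⟩ := im_mem t
  obtain ⟨b1, b2, b3⟩ := im_mem s
  have d := im_diff t s
  rw [norm_smul, norm_smul, Real.norm_eq_abs, Real.norm_eq_abs, abs_mul, abs_of_pos (by positivity), abs_of_pos (by positivity : 0 < im t + im s)]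
  have h1 : im t^2*‖t - s‖ ≤ 1*‖t - s‖ := by gcongr; nlinarith
  have h2 : |im t - im s| * (im t + im s)*‖s‖ ≤ 2*‖t - s‖ := by
    calc _ ≤ im t*im s*‖t - s‖*(im t + im s)*‖s‖ := by gcongr
      _ = (im t*(im t + im s))*(im s*‖s‖)*‖t - s‖ := by ring
      _ ≤ 2*1*‖t - s‖ := by gcongr; nlinarith
      _ = _ := by ring
  linarith
lemma cu_lip (a b : ℝ) : |cu a - cu b| ≤ 2 * |a - b| := by
  unfold cu
  refine (abs_max_sub_max_le_max _ _ _ _).trans (max_le (by simp) ?_)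
  refine (abs_min_sub_min_le_max _ _ _ _).trans (max_le (by simp) ?_)
  rw [show 4 - 2*a - (4 - 2*b) = 2*(b - a) by ring, abs_mul, abs_sub_comm a]; simp
lemma wf_mem (t : ℂ) : 0 ≤ wf t ∧ wf t ≤ 1 := by
  obtain ⟨a1, a2, a3⟩ := im_mem t
  obtain ⟨b1, b2⟩ := cu_mem ‖t‖
  exact ⟨by unfold wf; positivity, mul_le_one₀ (pow_le_one₀ a1.le a2) b1 b2⟩
lemma wf_lip (t s : ℂ) : |wf t - wf s| ≤ 6*‖t - s‖ := by
  obtain ⟨a1, a2, a3⟩ := im_mem t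
  obtain ⟨b1, b2, b3⟩ := im_mem s
  obtain ⟨c1, c2⟩ := cu_mem ‖t‖
  have d : |im t - im s| ≤ ‖t - s‖ := (im_diff t s).trans (mul_le_of_le_one_left (norm_nonneg _) (mul_le_one₀ a2 b1.le b2))
  have l : |cu ‖t‖ - cu ‖s‖| ≤ 2*‖t - s‖ := (cu_lip _ _).trans (by gcongr; exact abs_norm_sub_norm_le _ _)
  have e : wf t - wf s = (im t - im s)*((im t + im s)*(im t^2 + im s^2)*cu ‖t‖) + im s^4*(cu ‖t‖ - cu ‖s‖) := by
    simp only [wf]; ring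
  rw [e]
  refine (abs_add_le _ _).trans ?_
  rw [abs_mul, abs_mul (im s^4), abs_of_nonneg (by positivity : 0 ≤ (im t + im s)*(im t^2 + im s^2)*cu ‖t‖), abs_of_pos (by positivity : 0 < im s^4)]
  have h1 : (im t + im s)*(im t^2 + im s^2)*cu ‖t‖ ≤ 2*2*1 := by
    gcongr
    · linarith
    · nlinarith
  have h2 : im s^4 ≤ 1 := pow_le_one₀ b1.le b2
  calc _ ≤ ‖t - s‖*(2*2*1) + 1*(2*‖t - s‖) := by gcongr
    _ = _ := by ring
lemma ρ_norm (t : ℂ) : ‖ρf t‖ ≤ 1 := by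
  obtain ⟨a1, a2, a3⟩ := im_mem t
  rw [ρf, norm_smul, Real.norm_of_nonneg (by positivity)]; nlinarith
lemma φf_bdd (F : CB) (t : ℂ) : |φf F t| ≤ ‖F‖ := by
  obtain ⟨a1, a2⟩ := wf_mem t
  rw [φf, abs_mul, abs_of_nonneg a1]
  exact (mul_le_of_le_one_right (abs_nonneg _) a2).trans (cb_abs_le F _)
lemma lip_cont {E : Type*} [NormedAddCommGroup E] {f : ℂ → E} {C : ℝ} (h : ∀ t s, ‖f t - f s‖ ≤ C*‖t - s‖) : Continuous f :=
  (LipschitzWith.of_dist_le' (K := C) fun t s => by simpa [dist_eq_norm] using h t s).continuous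
lemma φf_cont (F : CB) : Continuous (φf F) :=
  (F.continuous.comp (retr_cont.comp (lip_cont ρ_lip))).mul (lip_cont (C := 6) wf_lip)
lemma φf_lip {F : CB} {C : ℝ} (hF : ∀ x y : BB, |F x - F y| ≤ C*‖(x:ℂ) - y‖) : ∃ C', LipschitzWith C' (φf F) := by
  refine ⟨_, LipschitzWith.of_dist_le' (K := ‖F‖*6 + C*3) fun t s => ?_⟩
  rw [dist_eq_norm, dist_eq_norm, Real.norm_eq_abs]
  obtain ⟨a1, a2⟩ := wf_mem s
  have hC : 0 ≤ C := by
    have := hF ⟨1, by simp⟩ ⟨0, by simp⟩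
    simp only [sub_zero, norm_one, mul_one] at this
    exact (abs_nonneg _).trans this
  have e : φf F t - φf F s = F (retr (ρf t))*(wf t - wf s) + (F (retr (ρf t)) - F (retr (ρf s)))*wf s := by simp only [φf]; ring
  rw [e]
  refine (abs_add_le _ _).trans ?_
  rw [abs_mul, abs_mul, abs_of_nonneg a1]
  have h1 := hF (retr (ρf t)) (retr (ρf s))
  rw [retr_val (ρ_norm t), retr_val (ρ_norm s)] at h1
  calc _ ≤ ‖F‖*(6*‖t - s‖) + C*(3*‖t - s‖)*1 := by
        gcongr
        · exact cb_abs_le F _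
        · exact wf_lip t s
        · exact h1.trans (by gcongr; exact ρ_lip t s)
    _ = _ := by ring
lemma inv_cov (g : ℂ → ℝ) : ∫ y in {y : ℂ | 1 / 2 < ‖y‖ ∧ ‖y‖ < 1}, g y =
    ∫ t in {t : ℂ | 1 < ‖t‖ ∧ ‖t‖ < 2}, (‖t‖^4)⁻¹*g (starRingEnd ℂ t)⁻¹ := by
  set A := {t : ℂ | 1 < ‖t‖ ∧ ‖t‖ < 2}
  have hA : MeasurableSet A := (isOpen_lt continuous_const continuous_norm).inter (isOpen_lt continuous_norm continuous_const) |>.measurableSet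
  have h0 : ∀ t ∈ A, t ≠ 0 := fun t ht => norm_pos_iff.1 (by have := ht.1; linarith)
  let f' : ℂ → ℂ →L[ℝ] ℂ := fun t => Complex.conjCLE.toContinuousLinearMap.comp ((ContinuousLinearMap.mul ℝ ℂ) (-(t^2)⁻¹))
  have hd : ∀ t ∈ A, HasFDerivWithinAt (fun t : ℂ => (starRingEnd ℂ t)⁻¹) (f' t) A t := by
    intro t ht
    have h1 := (Complex.conjCLE.toContinuousLinearMap.hasFDerivAt).comp t ((hasDerivAt_inv (h0 t ht)).hasFDerivAt.restrictScalars ℝ)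
    have e1 : (fun t : ℂ => (starRingEnd ℂ t)⁻¹) = Complex.conjCLE.toContinuousLinearMap ∘ fun t => t⁻¹ := by
      funext t; simp
    have e2 : f' t = Complex.conjCLE.toContinuousLinearMap.comp ((ContinuousLinearMap.toSpanSingleton ℂ (-(t^2)⁻¹)).restrictScalars ℝ) := by
      ext z; simp [f', mul_comm]
    rw [e1, e2]
    exact h1.hasFDerivWithinAt
  have hdet : ∀ t, |(f' t).det| = (‖t‖^4)⁻¹ := by
    intro t
    have e : ((f' t : ℂ →L[ℝ] ℂ) : ℂ →ₗ[ℝ] ℂ) = Complex.conjAe.toLinearMap ∘ₗ (LinearMap.mul ℝ ℂ (-(t^2)⁻¹)) := by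
      ext z; simp [f']
    rw [ContinuousLinearMap.det, e, LinearMap.det_comp, Complex.det_conjAe]
    have := Algebra.norm_complex_apply (-(t^2)⁻¹)
    rw [Algebra.norm_apply] at this
    change |-1*LinearMap.det ((Algebra.lmul ℝ ℂ) (-(t^2)⁻¹))| = _
    rw [this, Complex.normSq_eq_norm_sq]
    simp; ring
  have himg : (fun t : ℂ => (starRingEnd ℂ t)⁻¹) '' A = {y : ℂ | 1 / 2 < ‖y‖ ∧ ‖y‖ < 1} := by
    ext y
    constructor
    · rintro ⟨t, ⟨h1, h2⟩, rfl⟩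
      constructor
      · rw [norm_inv, RCLike.norm_conj, one_div]; exact inv_strictAnti₀ (by linarith) h2
      · rw [norm_inv, RCLike.norm_conj]; exact inv_lt_one_of_one_lt₀ h1
    · rintro ⟨h1, h2⟩
      refine ⟨(starRingEnd ℂ y)⁻¹, ⟨?_, ?_⟩, by simp⟩
      · rw [norm_inv, RCLike.norm_conj]; exact one_lt_inv₀ (by linarith) |>.2 h2
      · rw [norm_inv, RCLike.norm_conj, inv_lt_comm₀ (by linarith) (by norm_num)]; linarith
  rw [← himg, integral_image_eq_integral_abs_det_fderiv_smul volume hA hd ?_]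
  · simp only [hdet, smul_eq_mul]
  · intro a _ b _ hab
    exact (starRingEnd ℂ).injective (by simpa using hab)
end PartR7
section PartR8
open Set Topology
def An : Set ℂ := {t : ℂ | 1 < ‖t‖ ∧ ‖t‖ < 2}
def Bn : Set ℂ := {y : ℂ | 1 / 2 < ‖y‖ ∧ ‖y‖ < 1}
lemma An_meas : MeasurableSet An := (isOpen_lt continuous_const continuous_norm).inter (isOpen_lt continuous_norm continuous_const) |>.measurableSet
lemma Bn_meas : MeasurableSet Bn := (isOpen_lt continuous_const continuous_norm).inter (isOpen_lt continuous_norm continuous_const) |>.measurableSet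
lemma mUD : MeasurableSet unitDisk := measurableSet_ball
def ψn (y : ℂ) : ℝ := Bn.indicator (fun y => cu ‖y‖⁻¹) y
lemma cu_cont : Continuous cu := by unfold cu; fun_prop
lemma ψn_meas : Measurable ψn := (cu_cont.measurable.comp measurable_norm.inv).indicator Bn_meas
lemma ψn_mem (y : ℂ) : 0 ≤ ψn y ∧ ψn y ≤ 1 := by
  unfold ψn indicator; split_ifs
  · exact cu_mem _
  · simp
lemma φf_zero (F : CB) {t : ℂ} (h : 2 ≤ ‖t‖) : φf F t = 0 := by
  have : cu ‖t‖ = 0 := max_eq_left ((min_le_right _ _).trans (by linarith))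
  simp [φf, wf, this]
lemma φf_in (F : CB) {t : ℂ} (h : ‖t‖ ≤ 1) : φf F t = F (retr t) := by
  have h1 : im t = 1 := by simp [im, max_eq_left h]
  have h2 : cu ‖t‖ = 1 := by rw [cu, min_eq_left (by linarith)]; simp
  simp [φf, wf, ρf, h1, h2]
lemma φf_out (F : CB) {t : ℂ} (h : 1 < ‖t‖) : φf F t = (‖t‖^4)⁻¹*(F (retr (starRingEnd ℂ t)⁻¹)*cu ‖t‖) := by
  have h1 : im t = ‖t‖⁻¹ := by simp [im, max_eq_right h.le]
  have h2 : ρf t = (starRingEnd ℂ t)⁻¹ := by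
    have h0 : t ≠ 0 := norm_pos_iff.1 (by linarith)
    rw [ρf, h1, Complex.inv_def, Complex.conj_conj, Complex.normSq_conj, Complex.normSq_eq_norm_sq, Complex.real_smul, inv_pow, mul_comm]
  rw [φf, wf, h1, h2]; ring
lemma ker_inv {x t : ℂ} (hx : ‖x‖ ≤ 1) (ht : 1 < ‖t‖) :
    lk 0 (1 - starRingEnd ℂ x*(starRingEnd ℂ t)⁻¹) = lk 0 (x - t) - lk 0 (0 - t) := by
  have h0 : t ≠ 0 := norm_pos_iff.1 (by linarith)
  have h1 : ‖x - t‖ ≠ 0 := norm_ne_zero_iff.2 (sub_ne_zero.2 fun h => by rw [h] at hx; linarith)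
  have h2 : ‖t‖ ≠ 0 := by positivity
  have e : 1 - starRingEnd ℂ x*(starRingEnd ℂ t)⁻¹ = starRingEnd ℂ ((t - x) / t) := by
    rw [map_div₀, map_sub, sub_div, div_self (by simpa using h0)]; rfl
  rw [lk_zero, lk_zero, lk_zero, e, RCLike.norm_conj, norm_div, zero_sub, norm_neg, norm_sub_rev, Real.log_div h1 h2]
lemma tail_C2 (F : CB) : ∃ V : ℂ → ℝ, ContDiff ℝ 2 V ∧ ∀ x : BB,
    ∫ y in unitDisk, lk 0 (1 - starRingEnd ℂ (x:ℂ)*y)*(F (retr y)*(1 - ψn y)) = V x := by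
  set g : ℂ → ℝ := fun y => F (retr y)*(1 - ψn y)
  have hgm : Measurable g := (fr_meas F).mul (measurable_const.sub ψn_meas)
  have hgM : ∀ y, |g y| ≤ ‖F‖ := fun y => by
    obtain ⟨h1, h2⟩ := ψn_mem y
    rw [abs_mul, abs_of_nonneg (by linarith : 0 ≤ 1 - ψn y)]
    exact (mul_le_of_le_one_right (abs_nonneg _) (by linarith)).trans (cb_abs_le F _)
  set μ := (volume : Measure ℂ).restrict (Metric.closedBall 0 (2/3)) with hμ
  have : IsFiniteMeasure μ := ⟨by rw [hμ, Measure.restrict_apply_univ]; exact measure_closedBall_lt_top⟩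
  set m : ℕ → ℂ := fun k => (∫ y, starRingEnd ℂ y^k*g y ∂μ) / k
  have hmem : ∀ᵐ y ∂μ, ‖y‖ ≤ 2/3 := by
    filter_upwards [ae_restrict_mem measurableSet_closedBall] with y hy
    exact mem_closedBall_zero_iff.1 hy
  have hm : ∀ k, ‖m k‖ ≤ (μ.real univ*‖F‖)*(2/3)^k := by
    intro k
    have h1 : ‖∫ y, starRingEnd ℂ y^k*g y ∂μ‖ ≤ (2/3)^k*‖F‖*μ.real univ := by
      refine norm_integral_le_of_norm_le_const ?_
      filter_upwards [hmem] with y hy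
      rw [norm_mul, norm_pow, RCLike.norm_conj, Complex.norm_real]
      exact mul_le_mul (by gcongr) (hgM y) (norm_nonneg _) (by positivity)
    simp only [m, norm_div, Complex.norm_natCast]
    rcases Nat.eq_zero_or_pos k with rfl | hk
    · simp; positivity
    · have : (1:ℝ) ≤ k := by exact_mod_cast hk
      exact (div_le_self (norm_nonneg _) this).trans (h1.trans (by linarith))
  have hs : Summable fun k : ℕ => ((k:ℝ) + 1)^2*‖m k‖ := by
    have s1 := summable_pow_mul_geometric_of_norm_lt_one 2 (r := (2/3:ℝ)) (by norm_num)
    have s2 := ((summable_nat_add_iff 1).2 s1).mul_left (μ.real univ*‖F‖*(3/2))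
    refine Summable.of_nonneg_of_le (fun _ => by positivity) (fun k => ?_) s2
    calc _ ≤ ((k:ℝ) + 1)^2*((μ.real univ*‖F‖)*(2/3)^k) := by gcongr; exact hm k
      _ = _ := by push_cast; rw [pow_succ]; ring
  obtain ⟨V, hV, hV'⟩ := HS_ext hs
  refine ⟨fun z => -V z, hV.neg, fun x => ?_⟩
  have hx := BB_norm x
  change _ = -V x
  rw [hV' x hx, ← logser (μ := μ) (Y := fun y => y) aestronglyMeasurable_id hgm.aestronglyMeasurable (Eventually.of_forall hgM)
    (ρ := 2/3) (by norm_num) (by norm_num) (by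
      filter_upwards [hmem] with y hy
      nlinarith [norm_nonneg y])]
  refine setIntegral_eq_of_subset_of_forall_sdiff_eq_zero mUD (Metric.closedBall_subset_ball (by norm_num)) fun y hy => ?_
  have h1 : ‖y‖ < 1 := mem_ball_zero_iff.1 hy.1
  have h2 : 2/3 < ‖y‖ := not_le.1 fun h => hy.2 (mem_closedBall_zero_iff.2 h)
  have h3 : y ∈ Bn := ⟨by linarith, h1⟩
  have h4 : ‖y‖⁻¹ ≤ 3/2 := by rw [inv_le_comm₀ (by linarith) (by norm_num)]; linarith
  have h5 : ψn y = 1 := by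
    rw [ψn, indicator_of_mem h3, cu, min_eq_left (by linarith)]; simp
  simp [h5]
lemma D_form (F : CB) : ∃ T : ℂ → ℝ, ContDiff ℝ 2 T ∧ ∀ x : BB,
    opk κ0 (JD F) x = -(1 / (2*π))*We 3 0 (φf F) x + T x := by
  obtain ⟨V, hV, hV'⟩ := tail_C2 F
  have hfm := (φf_cont F).measurable
  refine ⟨fun z => -(1 / (2*π))*(V z - ∫ t in An, φf F t*lk 0 (0 - t)), by fun_prop, fun x => ?_⟩
  have hx := BB_norm x
  obtain ⟨o1, o2⟩ := oD F x
  have iA : ∀ x : ℂ, IntegrableOn (fun t => φf F t*lk 0 (x - t)) An := fun x =>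
    (We0_int (R := 3) hfm (φf_bdd F) x).mono_set fun t ht => mem_ball_zero_iff.2 (by have := ht.2; linarith)
  rw [o1]
  have e1 : ∫ y in unitDisk, lk 0 (1 - starRingEnd ℂ (x:ℂ)*y)*F (retr y) = V x +
      ∫ t in An, (φf F t*lk 0 (x - t) - φf F t*lk 0 (0 - t)) := by
    have i2 : IntegrableOn (fun y => lk 0 (1 - starRingEnd ℂ (x:ℂ)*y)*F (retr y)*ψn y) unitDisk :=
      Integrable.mul_bdd (c := 1) o2 ψn_meas.aestronglyMeasurable (Eventually.of_forall fun y => by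
        rw [Real.norm_eq_abs, abs_of_nonneg (ψn_mem y).1]; exact (ψn_mem y).2)
    have e2 : ∫ y in unitDisk, lk 0 (1 - starRingEnd ℂ (x:ℂ)*y)*F (retr y)*ψn y =
        ∫ t in An, (φf F t*lk 0 (x - t) - φf F t*lk 0 (0 - t)) := by
      have : (fun y => lk 0 (1 - starRingEnd ℂ (x:ℂ)*y)*F (retr y)*ψn y) =
          Bn.indicator fun y => lk 0 (1 - starRingEnd ℂ (x:ℂ)*y)*F (retr y)*cu ‖y‖⁻¹ := by
        funext y; unfold ψn indicator; split_ifs <;> simp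
      rw [this, setIntegral_indicator Bn_meas, show unitDisk ∩ Bn = Bn from inter_eq_right.2 fun y hy => mem_ball_zero_iff.2 hy.2]
      refine (inv_cov _).trans (setIntegral_congr_fun An_meas fun t ht => ?_)
      beta_reduce
      rw [ker_inv hx ht.1, norm_inv, RCLike.norm_conj, inv_inv, φf_out F ht.1]; ring
    rw [← hV' x, ← e2, ← integral_add (μ := volume.restrict unitDisk) ?_ i2]
    · refine integral_congr_ae (Eventually.of_forall fun y => ?_)
      beta_reduce; ring
    · refine (o2.sub i2).congr (Eventually.of_forall fun y => ?_)
      simp only [Pi.sub_apply]; ring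
  have e3 : We 3 0 (φf F) x = We 1 0 (fun y => F (retr y)) x + ∫ t in An, φf F t*lk 0 (x - t) := by
    have i3 := We0_int (R := 3) hfm (φf_bdd F) (x:ℂ)
    have hu : (Metric.ball (0:ℂ) 3) = unitDisk ∪ (Metric.ball (0:ℂ) 3 \ unitDisk) :=
      (union_sdiff_cancel (Metric.ball_subset_ball (by norm_num))).symm
    rw [We, hu, setIntegral_union disjoint_sdiff_right (measurableSet_ball.diff mUD) (i3.mono_set (Metric.ball_subset_ball (by norm_num))) (i3.mono_set sdiff_subset)]
    congr 1
    · exact setIntegral_congr_fun mUD fun y hy => by beta_reduce; rw [φf_in F (mem_ball_zero_iff.1 hy).le]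
    · rw [show (∫ t in An, φf F t*lk 0 (x - t)) = ∫ t in (An ∪ Metric.sphere 0 1), φf F t*lk 0 (x - t) from
        (setIntegral_congr_set (union_ae_eq_left_of_ae_eq_empty (ae_eq_empty.2 (Measure.addHaar_sphere _ _ _)))).symm]
      refine setIntegral_eq_of_subset_of_forall_sdiff_eq_zero (measurableSet_ball.diff mUD) ?_ ?_
      · rintro t (ht | ht)
        · exact ⟨mem_ball_zero_iff.2 (by have := ht.2; linarith), fun h => by have := mem_ball_zero_iff.1 h; have := ht.1; linarith⟩
        · have := mem_sphere_zero_iff_norm.1 ht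
          exact ⟨mem_ball_zero_iff.2 (by linarith), fun h => by have := mem_ball_zero_iff.1 h; linarith⟩
      · rintro t ⟨⟨_, h1⟩, h2⟩
        rw [φf_zero F, zero_mul]
        by_contra h
        push Not at h
        have h3 : 1 ≤ ‖t‖ := not_lt.1 fun h => h1 (mem_ball_zero_iff.2 h)
        rcases h3.eq_or_lt with h4 | h4
        · exact h2 (Or.inr (mem_sphere_zero_iff_norm.2 h4.symm))
        · exact h2 (Or.inl ⟨h4, h⟩)
  rw [e1, e3, integral_sub (iA x) (iA 0)]
  ring
lemma D_C1 (F : CB) : ∃ T : ℂ → ℝ, ContDiff ℝ 1 T ∧ ∀ x : BB, opk κ0 (JD F) x = T x := by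
  obtain ⟨T, h1, h2⟩ := D_form F
  exact ⟨_, (contDiff_const.mul (W0_C1 (φf_cont F).measurable (φf_bdd F))).add (h1.of_le (by norm_num)), h2⟩
lemma D_C2 {F : CB} {C : ℝ} (hF : ∀ x y : BB, |F x - F y| ≤ C*‖(x:ℂ) - y‖) : ∃ T : ℂ → ℝ, ContDiff ℝ 2 T ∧ ∀ x : BB, opk κ0 (JD F) x = T x := by
  obtain ⟨T, h1, h2⟩ := D_form F
  obtain ⟨C', hC⟩ := φf_lip hF
  have := W0_C2 (R := 2) hC (φf_bdd F) fun t ht => φf_zero F ht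
  norm_num at this
  exact ⟨_, (contDiff_const.mul this).add h1, h2⟩
end PartR8
section PartR9
open Set Topology
lemma C1_lip {V : ℂ → ℝ} (hV : ContDiff ℝ 1 V) : ∃ C, 0 ≤ C ∧ ∀ x y : BB, |V x - V y| ≤ C*‖(x:ℂ) - y‖ := by
  obtain ⟨C, hC⟩ := (isCompact_closedBall (0:ℂ) 1).exists_bound_of_continuousOn (hV.continuous_fderiv (by norm_num)).continuousOn
  refine ⟨C, (norm_nonneg _).trans (hC 0 (by simp)), fun x y => ?_⟩
  exact (convex_closedBall (0:ℂ) 1).norm_image_sub_le_of_norm_fderiv_le (fun z _ => hV.differentiable (by norm_num) z) hC y.2 x.2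
lemma bpt_C : ContDiff ℝ 2 bpt := by
  unfold bpt
  exact (Complex.ofRealCLM.contDiff.mul contDiff_const).cexp
lemma deriv_per {f : ℝ → ℝ} (h : ∀ θ, f (θ + 2*π) = f θ) (θ : ℝ) : deriv f (θ + 2*π) = deriv f θ := by
  rw [← deriv_comp_add_const f (2*π) θ, funext h]
lemma deriv_C1 {f : ℝ → ℝ} (h : ContDiff ℝ 2 f) : ContDiff ℝ 1 (deriv f) :=
  ((contDiff_succ_iff_deriv (n := 1)).1 h).2.2
lemma ser_deriv {a : ℕ → ℂ} (ha : Summable fun k => ‖a k‖) (h1 : Summable fun k : ℕ => (k:ℝ)*‖a k‖) (θ : ℝ) :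
    HasDerivAt (fun θ => (∑' k, a k*bpt θ^k).re) ((∑' k : ℕ, Complex.I*(k*a k)*bpt θ^k).re) θ := by
  have := hasDerivAt_tsum (𝕜 := ℝ) (g := fun k θ => a k*bpt θ^k) (g' := fun (k : ℕ) θ => Complex.I*(k*a k)*bpt θ^k) (y₀ := 0) h1
    (fun k θ => by
      refine (((bpt_hasDerivAt θ).pow k).const_mul (a k)).congr_deriv ?_
      rcases k with _ | k
      · simp
      · rw [Nat.add_sub_cancel, pow_succ]; ring)
    (fun k θ => by simp [bpt_norm]) (ser_sum ha 0) θ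
  exact (Complex.reCLM.hasFDerivAt.comp_hasDerivAt θ this)
lemma boot {u f g w H : CB} {b α c L : ℝ} (hu : ∀ x, u x = opk κ0 (JD f) x + opk κ0 (JS g) x + c)
    (hf : ∀ x, f x = α + w x*exp (u x)) (hw : ∀ x y : BB, |w x - w y| ≤ L*‖(x:ℂ) - y‖)
    (hg : ∀ x, g x = b + H x*exp (1 / 2*u x)) (hH : ContDiff ℝ 2 fun θ => H (bptB θ)) :
    ∃ U : ℂ → ℝ, ContDiff ℝ 2 U ∧ ∀ x : BB, u x = U x := by
  have per : ∀ (q : CB) θ, q (bptB (θ + 2*π)) = q (bptB θ) := fun q θ => by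
    congr 1; exact Subtype.ext (bpt_per θ)
  have perC : ∀ (q : ℂ → ℝ) θ, q (bpt (θ + 2*π)) = q (bpt θ) := fun q θ => by rw [bpt_per]
  set c' : ℕ → ℂ := ck g
  set a : ℕ → ℂ := fun k => c' k / k
  have a0 : Summable fun k => ‖a k‖ := (amgm (ck_sum g)).congr fun k => by rw [pow_zero, one_mul]
  have key : ∀ j : ℕ, Summable (fun k : ℕ => ((k:ℝ)^(j+1)*‖c' k‖)^2) → Summable fun k : ℕ => ((k:ℝ)^(j + 1 + 1)*‖a k‖)^2 := by
    intro j h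
    refine h.congr fun k => ?_
    rw [ck_div]
    rcases k with _ | k
    · simp
    · rw [pow_succ _ (j+1)]; field_simp
  have uS : ∀ x : BB, u x = opk κ0 (JD f) x + (1 / π)*(∑' k : ℕ, a k*(x:ℂ)^k).re + c := fun x => by rw [hu, oS']
  -- first step
  obtain ⟨T, hT, hT'⟩ := D_C1 f
  have P1 : DB fun θ => (∑' k, a k*bpt θ^k).re := DB_ser a0 ((ck_sum g).congr fun k => by rw [zero_add, pow_one])
  have uc : ∀ q : CB, Continuous fun θ => q (bptB θ) := fun q => q.continuous.comp bptB_cont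
  have hb := bpt_C
  have lu : LD (fun θ => (∑' k, a k*bpt θ^k).re) fun θ => u (bptB θ) := by
    have : (fun θ => u (bptB θ)) = fun θ => T (bpt θ) + (1 / π)*(∑' k, a k*bpt θ^k).re + c := by
      funext θ; rw [uS, hT']; rfl
    rw [this]
    exact LD_add (LD_add (LD_C1 (hT.comp (hb.of_le (by norm_num))) (perC T)) (LD_mul (LD_const _) (LD_self P1))) (LD_const _)
  have eg : (fun θ => g (bptB θ)) = fun θ => b + H (bptB θ)*exp (1 / 2*u (bptB θ)) := funext fun θ => hg _
  have dg : DB fun θ => g (bptB θ) := by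
    refine LD_DB P1 (uc g) (per g) ?_
    rw [eg]
    exact LD_add (LD_const _) (LD_mul (LD_C1 (hH.of_le (by norm_num)) (per H)) (LD_exp (LD_mul (LD_const _) lu)))
  have s1 : Summable fun k : ℕ => ((k:ℝ)^(0 + 1)*‖c' k‖)^2 := (DB_sum dg).congr fun k => by rw [zero_add, pow_one]; rfl
  obtain ⟨U1, hU1, hU1'⟩ := HS_ext (amgm (key 0 s1))
  set V : ℂ → ℝ := fun z => T z + (1 / π)*U1 z + c
  have hV : ContDiff ℝ 1 V := (hT.add (contDiff_const.mul hU1)).add contDiff_const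
  have uV : ∀ x : BB, u x = V x := fun x => by rw [uS, hT']; simp only [V]; rw [hU1' x (BB_norm x)]
  obtain ⟨C, hC0, hC⟩ := C1_lip hV.exp
  have hf' : ∀ x y : BB, |f x - f y| ≤ (‖w‖*C + L*‖EE u‖)*‖(x:ℂ) - y‖ := by
    intro x y
    have e : f x - f y = w x*(exp (V x) - exp (V y)) + (w x - w y)*EE u y := by
      rw [hf, hf, EE_apply, uV, uV]; ring
    rw [e]
    refine (abs_add_le _ _).trans ?_
    rw [abs_mul, abs_mul]
    have h1 := hC x y
    have h2 := cb_abs_le w x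
    have h3 := cb_abs_le (EE u) y
    have h4 := hw x y
    calc _ ≤ ‖w‖*(C*‖(x:ℂ) - y‖) + (L*‖(x:ℂ) - y‖)*‖EE u‖ := by
          gcongr
          exact (abs_nonneg _).trans h4
      _ = _ := by ring
  -- second step
  obtain ⟨T2, hT2, hT2'⟩ := D_C2 hf'
  have c0 : Summable fun k => ‖c' k‖ := by simpa using amgm s1
  have lea : ∀ k : ℕ, (k:ℝ)*‖a k‖ ≤ ‖c' k‖ := fun k => by
    have := ck_div c' 0 k
    simp only [zero_add, pow_one] at this
    rw [this]; exact mul_le_of_le_one_left (norm_nonneg _) (div_self_le_one _)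
  have a1 : Summable fun k : ℕ => (k:ℝ)*‖a k‖ := Summable.of_nonneg_of_le (fun _ => by positivity) lea c0
  have nI : ∀ k : ℕ, ‖Complex.I*(k*a k)‖ = k*‖a k‖ := fun k => by simp
  set P : ℝ → ℝ := fun θ => (∑' k : ℕ, Complex.I*(k*a k)*bpt θ^k).re
  have P2 : DB P := by
    refine DB_ser (by simpa only [nI] using a1) ?_
    refine Summable.of_nonneg_of_le (fun _ => by positivity) (fun k => ?_) s1
    rw [nI, zero_add, pow_one]; gcongr; exact lea k
  have hT2b : ContDiff ℝ 2 fun θ => T2 (bpt θ) := hT2.comp hb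
  have du : ∀ θ, HasDerivAt (fun θ => u (bptB θ)) (deriv (fun θ => T2 (bpt θ)) θ + (1 / π)*P θ) θ := by
    intro θ
    have : (fun θ => u (bptB θ)) = fun θ => T2 (bpt θ) + (1 / π)*(∑' k, a k*bpt θ^k).re + c := by
      funext θ; rw [uS, hT2']; rfl
    rw [this]
    exact ((hT2b.differentiable (by norm_num) θ).hasDerivAt.add ((ser_deriv a0 a1 θ).const_mul _)).add_const _
  set u' : ℝ → ℝ := fun θ => deriv (fun θ => T2 (bpt θ)) θ + (1 / π)*P θ
  have lu' : LD P u' := LD_add (LD_C1 (deriv_C1 hT2b) (deriv_per (perC T2))) (LD_mul (LD_const _) (LD_self P2))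
  have cu' : Continuous u' := (deriv_C1 hT2b).continuous.add (continuous_const.mul P2.1)
  have uC1 : ContDiff ℝ 1 fun θ => u (bptB θ) := by
    refine contDiff_one_iff_deriv.2 ⟨fun θ => (du θ).differentiableAt, ?_⟩
    rwa [show deriv (fun θ => u (bptB θ)) = u' from funext fun θ => (du θ).deriv]
  set g' : ℝ → ℝ := fun θ => deriv (fun θ => H (bptB θ)) θ*exp (1 / 2*u (bptB θ)) + H (bptB θ)*(exp (1 / 2*u (bptB θ))*(1 / 2*u' θ))
  have lE : LD P fun θ => exp (1 / 2*u (bptB θ)) := LD_exp (LD_mul (LD_const _) (LD_C1 uC1 (per u)))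
  have lg' : LD P g' := LD_add (LD_mul (LD_C1 (deriv_C1 hH) (deriv_per (per H))) lE)
    (LD_mul (LD_C1 (hH.of_le (by norm_num)) (per H)) (LD_mul lE (LD_mul (LD_const _) lu')))
  have dg' : ∀ θ, HasDerivAt (fun θ => g (bptB θ)) (g' θ) θ := fun θ => by
    rw [eg]
    exact ((hH.differentiable (by norm_num) θ).hasDerivAt.mul ((du θ).const_mul (1/2)).exp).const_add b
  have cg' : Continuous g' := by
    have h1 := uc u
    have h2 := uc H
    have h3 := (deriv_C1 hH).continuous
    exact (h3.mul (continuous_const.mul h1).rexp).add (h2.mul ((continuous_const.mul h1).rexp.mul (continuous_const.mul cu')))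
  have pg' : ∀ θ, g' (θ + 2*π) = g' θ := fun θ => by
    rw [← (dg' _).deriv, ← (dg' _).deriv]; exact deriv_per (per g) θ
  have s2 : Summable fun k : ℕ => ((k:ℝ)^(1 + 1)*‖c' k‖)^2 := (DB_sum (LD_DB P2 cg' pg' lg')).congr fun k => by
    rw [cf_deriv dg' cg' (per g), norm_mul, norm_mul, Complex.norm_I, Complex.norm_natCast, one_mul, ← mul_assoc, ← pow_two]; rfl
  obtain ⟨U2, hU2, hU2'⟩ := HS_ext (amgm (key 1 s2))
  refine ⟨fun z => T2 z + (1 / π)*U2 z + c, (hT2.add (contDiff_const.mul hU2)).add contDiff_const, fun x => ?_⟩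
  beta_reduce
  rw [uS, hT2', hU2' x (BB_norm x)]
end PartR9
section PartT1
open Set Topology
lemma JD_zero {a : CB} (h : JD a = 0) {y : ℂ} (hy : y ∈ unitDisk) : a (retr y) = 0 := by
  have h1 := norm_JD_sq a
  rw [h, norm_zero, lD_apply, integral_νD _ (a*a).continuous.aestronglyMeasurable] at h1
  have hc : Continuous fun y => (a*a) (retr y) := (a*a).continuous.comp retr_cont
  have h2 := (setIntegral_eq_zero_iff_of_nonneg_ae (μ := volume) (Eventually.of_forall fun y => mul_self_nonneg (a (retr y))) (int_ball hc 1)).1 (h1.symm.trans (zero_pow two_ne_zero))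
  exact mul_self_eq_zero.1 (Measure.eqOn_open_of_ae_eq h2 Metric.isOpen_ball hc.continuousOn continuousOn_const hy)
lemma JS_zero {a : CB} (h : JS a = 0) (θ : ℝ) : a (bptB θ) = 0 := by
  have h1 := norm_JS_sq a
  rw [h, norm_zero, lS_apply, integral_νS _ (a*a).continuous.aestronglyMeasurable] at h1
  have hc : Continuous fun y => (a*a) (bptB y) := (a*a).continuous.comp bptB_cont
  have hp : Function.Periodic (fun y => (a*a) (bptB y)) (2*π) := fun θ => by
    beta_reduce; congr 1; exact Subtype.ext (bpt_per θ)
  have := hp.intervalIntegral_add_eq 0 (θ - π)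
  rw [zero_add] at this
  have pp := pi_pos
  rw [this, intervalIntegral.integral_of_le (by linarith), integral_Ioc_eq_integral_Ioo] at h1
  have h2 := (setIntegral_eq_zero_iff_of_nonneg_ae (μ := volume) (Eventually.of_forall fun y => mul_self_nonneg (a (bptB y)))
    ((hc.integrableOn_Icc (a := θ - π) (b := θ - π + 2*π)).mono_set Ioo_subset_Icc_self)).1 (h1.symm.trans (zero_pow two_ne_zero))
  exact mul_self_eq_zero.1 (Measure.eqOn_open_of_ae_eq h2 isOpen_Ioo hc.continuousOn continuousOn_const (mem_Ioo.2 ⟨by linarith, by linarith⟩ : θ ∈ Ioo (θ - π) (θ - π + 2*π)))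
lemma J_zero {a b : CB} (h : JD a + JS b = 0) : JD a = 0 ∧ JS b = 0 := by
  have h1 : inner ℝ (JD a) (JD a + JS b) = (0:ℝ) := by rw [h, inner_zero_right]
  have h2 : inner ℝ (JS b) (JD a + JS b) = (0:ℝ) := by rw [h, inner_zero_right]
  rw [inner_add_right, inner_JD_JS, add_zero] at h1
  rw [inner_add_right, inner_JS_JD, zero_add] at h2
  exact ⟨inner_self_eq_zero.1 h1, inner_self_eq_zero.1 h2⟩
lemma sol {K h u : CB} {ε L : ℝ} (hu : u = GG (FF K h ε u)) (hK : ∀ x y : BB, |K x - K y| ≤ L*‖(x:ℂ) - y‖)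
    (hh : ContDiff ℝ 2 fun θ => h (bptB θ)) : ∃ U : ℂ → ℝ, ContDiff ℝ 2 U ∧ (∀ x : BB, u x = U x) ∧
      (∀ y ∈ unitDisk, -lap U y = (1 + ε)⁻¹*(ε - (ε - 2*K (retr y))*exp (U y))) ∧
      ∀ θ, nderiv U (bpt θ) = (1 + ε)⁻¹*(2*(h (bptB θ)*exp (1 / 2*U (bpt θ))) - 2) := by
  set q := FF K h ε u with hq
  set f : CB := (1 + ε)⁻¹ • (ε • 1 - cK K ε*EE u) with hf
  set g0 : CB := (1 + ε)⁻¹ • ((2:ℝ) • (h*EE ((1/2:ℝ) • u)) - (2:ℝ) • 1) with hg0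
  set s : ℝ := lS u / (4*π^2)
  have hqe : q = JD f + JS (g0 + s • 1) := rfl
  set t := tot q*(2*π)⁻¹
  have fa : ∀ x, f x = (1 + ε)⁻¹*(ε - (ε - 2*K x)*exp (u x)) := fun x => by
    rw [hf, ← EE_apply]; simp [cK]
  have ga : ∀ x, g0 x = (1 + ε)⁻¹*(2*(h x*exp (1 / 2*u x)) - 2) := fun x => by
    have : EE ((1/2:ℝ) • u) x = exp (1 / 2*u x) := by rw [EE_apply]; rfl
    rw [hg0, ← this]; simp
  clear_value f g0
  obtain ⟨U, hU, hU'⟩ := boot (u := u) (f := f) (g := g0 + (s - t) • 1) (w := (-(1 + ε)⁻¹) • (ε • 1 - (2:ℝ) • K)) (H := ((1 + ε)⁻¹*2) • h)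
    (b := (1 + ε)⁻¹*(-2) + s - t) (α := (1 + ε)⁻¹*ε) (c := tot q) (L := |(1 + ε)⁻¹*2| * L)
    (fun x => by
      have e3 : opk κ0 q = opk κ0 (JD f) + opk κ0 (JS (g0 + (s - t) • 1)) + t • opk κ0 (JS 1) := by
        rw [← map_smul, ← map_smul, ← map_add, ← map_add, add_assoc, ← map_add JS, add_assoc, ← add_smul, sub_add_cancel, ← hqe]
      conv_lhs => rw [hu, GG_apply, e3]
      simp only [ContinuousMap.add_apply, ContinuousMap.smul_apply, ContinuousMap.sub_apply, ContinuousMap.one_apply, smul_eq_mul]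
      simp only [t]; ring)
    (fun x => by
      rw [fa]
      simp only [ContinuousMap.smul_apply, ContinuousMap.sub_apply, ContinuousMap.one_apply, smul_eq_mul]; ring)
    (fun x y => by
      simp only [ContinuousMap.smul_apply, ContinuousMap.sub_apply, ContinuousMap.one_apply, smul_eq_mul]
      rw [show -(1 + ε)⁻¹*(ε*1 - 2*K x) - -(1 + ε)⁻¹*(ε*1 - 2*K y) = ((1 + ε)⁻¹*2)*(K x - K y) by ring, abs_mul, mul_assoc]
      exact mul_le_mul_of_nonneg_left (hK x y) (abs_nonneg _))
    (fun x => by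
      simp only [ContinuousMap.add_apply, ContinuousMap.smul_apply, ContinuousMap.one_apply, smul_eq_mul]
      rw [ga]; ring)
    (contDiff_const.mul hh)
  have ucb : u = cbR U hU.continuous := by ext x; exact hU' x
  have e1 : q - qU U hU = 0 := by
    by_contra hne
    have := GG_green.pos _ hne
    rw [map_sub, GG_rep hU, ← hu, ← ucb, sub_self, map_zero, inner_zero_right] at this
    exact lt_irrefl _ this
  have e2 : JD (f - cbR (fun x => -lap U x) (lap_cont hU).neg) + JS (g0 - cbR (nderiv U) (nderiv_cont (hU.of_le (by norm_num)))) = 0 := by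
    rw [← e1, hqe, qU, map_sub, map_sub, map_add, map_smul JS, show s = bint U / (4*π^2) by simp only [s]; rw [ucb, lS_cbR]]; abel
  obtain ⟨z1, z2⟩ := J_zero e2
  refine ⟨U, hU, hU', fun y hy => ?_, fun θ => ?_⟩
  · have := JD_zero z1 hy
    have e := retr_val (mem_ball_zero_iff.1 hy).le
    rw [ContinuousMap.sub_apply, cbR_apply, fa, hU', e] at this
    linarith
  · have := JS_zero z2 θ
    rw [ContinuousMap.sub_apply, cbR_apply, ga, hU'] at this
    change _ - nderiv U (bpt θ) = 0 at this
    exact (sub_eq_zero.1 this).symm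
end PartT1
section PartT2
open Set Topology
lemma exlog {τ : ℝ} (hτ : 0 < τ) : ∃ l : ℝ → ℝ, ContDiff ℝ 1 l ∧ (∀ s, HasDerivAt l ((max s τ)⁻¹) s) ∧
    ∀ s, τ ≤ s → l s = log s := by
  have hc : Continuous fun s : ℝ => (max s τ)⁻¹ :=
    (continuous_id.max continuous_const).inv₀ fun s => (lt_of_lt_of_le hτ (le_max_right _ _)).ne'
  have hd : ∀ s, HasDerivAt (fun s => log τ + ∫ t in τ..s, (max t τ)⁻¹) ((max s τ)⁻¹) s := fun s =>
    (intervalIntegral.integral_hasDerivAt_right (hc.intervalIntegrable _ _)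
      (hc.stronglyMeasurableAtFilter _ _) hc.continuousAt).const_add _
  refine ⟨_, contDiff_one_iff_deriv.2 ⟨fun s => (hd s).differentiableAt, ?_⟩, hd, fun s hs => ?_⟩
  · rw [funext fun s => (hd s).deriv]; exact hc
  · have : ∫ t in τ..s, (max t τ)⁻¹ = ∫ t in τ..s, t⁻¹ := by
      refine intervalIntegral.integral_congr fun t ht => ?_
      rw [uIcc_of_le hs] at ht
      rw [max_eq_left ht.1]
    rw [this, integral_inv_of_pos hτ (hτ.trans_le hs), log_div (hτ.trans_le hs).ne' hτ.ne']; ring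
def XL (a : ℂ) : ℂ →L[ℝ] ℝ := a.re • Complex.reCLM + a.im • Complex.imCLM
lemma XL_apply (a x : ℂ) : XL a x = a.re*x.re + a.im*x.im := by
  simp [XL]
lemma XL_norm {a x : ℂ} (ha : ‖a‖ = 1) : ‖x - a‖^2 = ‖x‖^2 + 1 - 2*XL a x := by
  have h1 : a.re*a.re + a.im*a.im = 1 := by
    have := Complex.sq_norm a; rw [ha, Complex.normSq_apply] at this; linarith
  rw [Complex.sq_norm, Complex.sq_norm, Complex.normSq_apply, Complex.normSq_apply, XL_apply,
    Complex.sub_re, Complex.sub_im]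
  linear_combination h1
lemma XL_le {a : ℂ} (ha : ‖a‖ = 1) (x : BB) : ‖(x:ℂ) - a‖^2 ≤ 2*(1 - XL a x) ∧ -1 ≤ XL a x ∧ XL a x ≤ 1 := by
  have h := XL_norm (x := x) ha
  have hx : ‖(x:ℂ)‖ ≤ 1 := BB_norm x
  have h2 : ‖(x:ℂ)‖^2 ≤ 1 := by nlinarith [norm_nonneg (x:ℂ)]
  have h4 : ‖(x:ℂ) - a‖ ≤ ‖(x:ℂ)‖ + 1 := by have := norm_sub_le (x:ℂ) a; rwa [ha] at this
  refine ⟨by linarith, ?_, by nlinarith [sq_nonneg ‖(x:ℂ) - a‖]⟩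
  nlinarith [norm_nonneg ((x:ℂ) - a), norm_nonneg (x:ℂ)]
lemma bubble (θ0 : ℝ) {s : ℝ} (hs : 0 < s) (h2 : s ≤ 1) : ∃ (q : ℂ → ℝ) (hq : ContDiff ℝ 1 q),
    (∀ x : BB, q x = log (1 + s^2 - XL (bpt θ0) x)) ∧
    (∫ x in unitDisk, gradSq q x) ≤ (1 + s^2)*lS (EE (-cbR q hq.continuous)) ∧
    lD (EE (-cbR q hq.continuous)*EE (-cbR q hq.continuous)) ≤ (1 + s^2)*lS (EE (-cbR q hq.continuous)) ∧
    2 / (3*s) ≤ lS (EE (-cbR q hq.continuous)) := by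
  have hτ : 0 < s^2 := by positivity
  obtain ⟨l, l1, l2, l3⟩ := exlog hτ
  set a := bpt θ0 with ha
  have an : ‖a‖ = 1 := bpt_norm _
  have an2 : a.re^2 + a.im^2 = 1 := by
    have := Complex.sq_norm a; rw [an, Complex.normSq_apply] at this; linarith
  have hq : ContDiff ℝ 1 fun x : ℂ => l (1 + s^2 - XL a x) := l1.comp (contDiff_const.sub (XL a).contDiff)
  set q : ℂ → ℝ := fun x : ℂ => l (1 + s^2 - XL a x) with hqd
  have hX2 : ContDiff ℝ 2 fun x : ℂ => XL a x := (XL a).contDiff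
  have pX : ∀ w x, pd (fun x : ℂ => XL a x) w x = XL a w := fun w x => by
    rw [pd]; erw [(XL a).hasFDerivAt.fderiv]
  have pq : ∀ w x, pd q w x = -(max (1 + s^2 - XL a x) (s^2))⁻¹*XL a w := fun w x => by
    have := (l2 (1 + s^2 - XL a x)).comp_hasFDerivAt x ((XL a).hasFDerivAt.const_sub (1 + s^2))
    rw [pd]; erw [this.fderiv]; simp
  have hlow : ∀ x : BB, s^2 ≤ 1 + s^2 - XL a x := fun x => by linarith [(XL_le an x).2.2]
  have qv : ∀ x : BB, q x = log (1 + s^2 - XL a x) := fun x => l3 _ (hlow x)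
  have qe : ∀ x : BB, exp (-q x) = (1 + s^2 - XL a x)⁻¹ := fun x => by
    rw [qv, exp_neg, exp_log (hτ.trans_le (hlow x))]
  have he : ContDiff ℝ 1 fun x => exp (-q x) := hq.neg.exp
  have pe : ∀ w x, pd (fun x => exp (-q x)) w x = -exp (-q x)*pd q w x := fun w x => by
    have := ((hq.differentiable one_ne_zero x).hasFDerivAt.neg).exp
    rw [pd]; erw [this.fderiv]; simp [pd]
  have gr : ∀ x : BB, gradSq q x = ((1 + s^2 - XL a x)⁻¹)^2 := fun x => by
    rw [gradSq, pq, pq, max_eq_left (hlow x), XL_apply a 1, XL_apply a Complex.I]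
    simp only [Complex.one_re, Complex.one_im, Complex.I_re, Complex.I_im]
    linear_combination ((1 + s^2 - XL a x)⁻¹)^2*an2
  have gd : ∀ x : BB, gdot (fun x : ℂ => XL a x) (fun x => exp (-q x)) x = ((1 + s^2 - XL a x)⁻¹)^2 := fun x => by
    rw [gdot, pX, pX, pe, pe, pq, pq, max_eq_left (hlow x), qe, XL_apply a 1, XL_apply a Complex.I]
    simp only [Complex.one_re, Complex.one_im, Complex.I_re, Complex.I_im]
    linear_combination ((1 + s^2 - XL a x)⁻¹)^2*an2
  have lapX : ∀ x, lap (fun x : ℂ => XL a x) x = 0 := fun x => by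
    simp only [lap]
    rw [funext fun y => pX 1 y, funext fun y => pX Complex.I y]; simp
  have ndX : ∀ x, nderiv (fun x : ℂ => XL a x) x = XL a x := fun x => by
    rw [nderiv, pX, pX, XL_apply, XL_apply, XL_apply]; simp; ring
  have g1 := green hX2 he
  have Ef : EE (-cbR q hq.continuous) = cbR (fun x => exp (-q x)) he.continuous := by
    ext x; rw [EE_apply]; rfl
  have LS : lS (EE (-cbR q hq.continuous)) = bint fun x => exp (-q x) := by rw [Ef, lS_cbR]
  have mem : ∀ x ∈ unitDisk, ‖x‖ ≤ 1 := fun x hx => (mem_ball_zero_iff.1 hx).le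
  have main : (∫ x in unitDisk, gdot (fun x : ℂ => XL a x) (fun x => exp (-q x)) x)
      ≤ (1 + s^2)*lS (EE (-cbR q hq.continuous)) := by
    rw [g1, LS, ← bint_const_mul]
    simp only [lapX, neg_zero, zero_mul, integral_zero, zero_add, ndX]
    rw [← lS_cbR _ (by fun_prop : Continuous fun x => XL a x*exp (-q x)), ← lS_cbR _ (by fun_prop : Continuous fun x => (1 + s^2)*exp (-q x))]
    refine lS_mono fun x => ?_
    rw [cbR_apply, cbR_apply]
    exact mul_le_mul_of_nonneg_right (by linarith [hlow x]) (exp_pos _).le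
  refine ⟨q, hq, qv, ?_, ?_, ?_⟩
  · refine le_of_eq_of_le (setIntegral_congr_fun Metric.isOpen_ball.measurableSet fun x hx => ?_) main
    rw [← retr_val (mem x hx), gr, gd]
  · refine le_of_eq_of_le ?_ main
    rw [lD_apply, integral_νD _ (cb_int _ _).aestronglyMeasurable]
    refine setIntegral_congr_fun Metric.isOpen_ball.measurableSet fun x hx => ?_
    have g := gd (retr x)
    rw [retr_val (mem x hx)] at g
    have e := qe (retr x)
    rw [retr_val (mem x hx)] at e
    rw [g, ContinuousMap.mul_apply, Ef, cbR_apply, retr_val (mem x hx), e]; ring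
  · rw [LS, bint]
    have cF : Continuous fun θ => exp (-q (bpt θ)) := he.continuous.comp bpt_cont
    have per : Function.Periodic (fun θ => exp (-q (bpt θ))) (2*π) := fun θ => by beta_reduce; rw [bpt_per]
    have := per.intervalIntegral_add_eq 0 θ0
    rw [zero_add] at this
    rw [this]
    rw [← intervalIntegral.integral_add_adjacent_intervals (b := θ0 + s) (cF.intervalIntegrable _ _) (cF.intervalIntegrable _ _)]
    have i2 : 0 ≤ ∫ θ in (θ0 + s)..(θ0 + 2*π), exp (-q (bpt θ)) :=
      intervalIntegral.integral_nonneg (by linarith [pi_gt_three]) fun _ _ => (exp_pos _).le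
    have i1 : ∫ θ in θ0..(θ0 + s), 2 / (3*s^2) ≤ ∫ θ in θ0..(θ0 + s), exp (-q (bpt θ)) := by
      refine intervalIntegral.integral_mono_on (by linarith) (by simp) (cF.intervalIntegrable _ _) fun θ hθ => ?_
      have e := qe (bptB θ)
      change exp (-q (bpt θ)) = (1 + s^2 - XL a (bpt θ))⁻¹ at e
      have hl := hlow (bptB θ)
      change s^2 ≤ 1 + s^2 - XL a (bpt θ) at hl
      rw [e, ← one_div, div_le_div_iff₀ (by positivity) (hτ.trans_le hl)]
      have hX : XL a (bpt θ) = cos (θ - θ0) := by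
        rw [XL_apply, ha, bpt_eq, bpt_eq, cos_sub]; simp [-Complex.ofReal_cos, -Complex.ofReal_sin]; ring
      have := one_sub_sq_div_two_le_cos (x := θ - θ0)
      rw [hX]
      nlinarith [hθ.1, hθ.2]
    rw [intervalIntegral.integral_const] at i1
    have : (θ0 + s - θ0) • (2 / (3*s^2)) = 2 / (3*s) := by
      rw [smul_eq_mul]; field_simp; ring
    linarith
lemma conc (w : CB) (θ0 : ℝ) {η : ℝ} (hη : 0 < η) : ∃ C, 0 ≤ C ∧ ∀ x : BB,
    |w x - w (bptB θ0)| ≤ η + C*(1 - XL (bpt θ0) x)^2 := by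
  obtain ⟨d, d0, hd⟩ := Metric.continuousAt_iff.1 w.continuous.continuousAt η hη
  refine ⟨2*‖w‖*(4 / d^4), by positivity, fun x => ?_⟩
  by_cases hx : dist x (bptB θ0) < d
  · have := (hd hx).le
    rw [Real.dist_eq] at this
    have : 0 ≤ 2*‖w‖*(4 / d^4)*(1 - XL (bpt θ0) x)^2 := by positivity
    linarith
  · push Not at hx
    have h1 := XL_le (bpt_norm θ0) x
    rw [Subtype.dist_eq, dist_eq_norm] at hx
    change d ≤ ‖(x:ℂ) - bpt θ0‖ at hx
    have h2 : d^2 / 2 ≤ 1 - XL (bpt θ0) x := by nlinarith [h1.1]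
    have h3 : 1 ≤ 4 / d^4*(1 - XL (bpt θ0) x)^2 := by
      have : (d^2 / 2)^2 ≤ (1 - XL (bpt θ0) x)^2 := pow_le_pow_left₀ (by positivity) h2 2
      rw [div_mul_eq_mul_div, le_div_iff₀ (by positivity)]; linarith
    have h4 := abs_sub (w x) (w (bptB θ0))
    have := cb_abs_le w x
    have := cb_abs_le w (bptB θ0)
    have : 2*‖w‖*1 ≤ 2*‖w‖*(4 / d^4*(1 - XL (bpt θ0) x)^2) := mul_le_mul_of_nonneg_left h3 (by positivity)
    linarith
lemma lD_one : lD 1 = π := by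
  rw [lD_apply]; simp [νD_univ]
lemma bub_J (K h : CB) (θ0 : ℝ) {A η C1 C2 : ℝ} (hA : 0 < A) (hη : 0 < η)
    (c1 : ∀ x : BB, |K x - K (bptB θ0)| ≤ η + C1*(1 - XL (bpt θ0) x)^2) (hC1 : 0 ≤ C1)
    (c2 : ∀ x : BB, |h x - h (bptB θ0)| ≤ η + C2*(1 - XL (bpt θ0) x)^2) (hC2 : 0 ≤ C2)
    {β : ℝ} (hβ : 0 < β) (hβ1 : β ≤ 1) (hk : K (bptB θ0) ≤ 0) {s : ℝ} (hs : 0 < s) (hs1 : s ≤ 1) :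
    ∃ (v : ℂ → ℝ) (hv : ContDiff ℝ 1 v), ∃ Λ : ℝ, 2 / (3*s) ≤ Λ ∧ lS (EE ((1/2:ℝ) • cbR v hv.continuous)) = A*Λ ∧
    Jv K h β v (cbR v hv.continuous) ≤
      ((1 + s^2)*(2*(1 + β) + A^2*(β - 2*K (bptB θ0) + 2*η)) - 4*A*(h (bptB θ0) - η) + 4*η)*Λ
      + (8*π*(log A - log η) + (2 * |log A| + 4)*π + 2*A^2*C1*π + 16*A*C2*π) := by
  obtain ⟨q, hq, q1, q2, q3, q4⟩ := bubble θ0 hs hs1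
  have hv : ContDiff ℝ 1 fun x => 2*log A - 2*q x := contDiff_const.sub (contDiff_const.mul hq)
  set E := EE (-cbR q hq.continuous) with hE
  have Ex : ∀ x, E x = (1 + s^2 - XL (bpt θ0) x)⁻¹ := fun x => by
    have := (XL_le (bpt_norm θ0) x).2.2
    rw [hE, EE_apply, ContinuousMap.neg_apply, cbR_apply, q1, exp_neg, exp_log (by linarith [sq_nonneg s, pow_pos hs 2])]
  have qE : ∀ x : BB, q x = -log (E x) := fun x => by rw [hE, EE_apply, log_exp]; simp [cbR_apply]
  have E0 : ∀ x, 0 < E x := fun x => by rw [hE, EE_apply]; exact exp_pos _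
  have EX : ∀ x : BB, 0 ≤ 1 - XL (bpt θ0) x ∧ 1 - XL (bpt θ0) x ≤ 2 ∧ (1 - XL (bpt θ0) x)*E x ≤ 1 := fun x => by
    have := XL_le (bpt_norm θ0) x
    refine ⟨by linarith, by linarith, ?_⟩
    rw [Ex, ← div_eq_mul_inv]
    exact (div_le_one (by linarith [pow_pos hs 2])).2 (by linarith [pow_pos hs 2])
  set Λ := lS E
  have Λ0 : 0 < Λ := lt_of_lt_of_le (by positivity) q4
  set w : CB := cbR _ hv.continuous with hw
  have wx : ∀ x, w x = 2*log A + 2*log (E x) := fun x => by rw [hw, cbR_apply, qE]; ring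
  have e1 : EE ((1/2:ℝ) • w) = A • E := by
    ext x
    rw [EE_apply, ContinuousMap.smul_apply, ContinuousMap.smul_apply, smul_eq_mul, smul_eq_mul, wx, ← mul_add, ← mul_assoc,
      show (1/2:ℝ)*2 = 1 by norm_num, one_mul, exp_add, exp_log hA, exp_log (E0 x)]
  have e2 : EE w = A^2 • (E*E) := by
    rw [← EE_half_mul, e1, smul_mul_smul_comm, sq]
  refine ⟨_, hv, Λ, q4, ?_, ?_⟩
  · rw [e1, map_smul, smul_eq_mul]
  have b1 : (∫ x in unitDisk, gradSq (fun x => 2*log A - 2*q x) x) ≤ 4*((1 + s^2)*Λ) := by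
    refine le_of_eq_of_le ?_ (mul_le_mul_of_nonneg_left q2 (by norm_num))
    rw [← integral_const_mul]
    congr 1; ext x
    have : ∀ w, pd (fun x => 2*log A - 2*q x) w x = -(2*pd q w x) := fun w => by
      have := ((hq.differentiable one_ne_zero x).hasFDerivAt.const_mul 2).const_sub (2*log A)
      rw [pd]; erw [this.fderiv]; simp [pd]
    rw [gradSq, this, this, gradSq]; ring
  have b2 : lS w ≤ (2*log A - 2*log η)*(2*π) + 2*η*Λ := by
    have : lS w ≤ lS ((2*log A - 2*log η) • (1 : CB) + (2*η) • E) := by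
      refine lS_mono fun x => ?_
      have := log_le_sub_one_of_pos (mul_pos hη (E0 x))
      rw [log_mul hη.ne' (E0 x).ne'] at this
      rw [wx, ContinuousMap.add_apply, ContinuousMap.smul_apply, ContinuousMap.smul_apply, smul_eq_mul, smul_eq_mul, ContinuousMap.one_apply]
      linarith
    rwa [map_add, map_smul, map_smul, lS_one, smul_eq_mul, smul_eq_mul] at this
  have b3 : -((2 * |log A| + 4)*π) ≤ lD w := by
    have : lD (-(2 * |log A| + 4) • (1 : CB)) ≤ lD w := by
      refine lD_mono fun x => ?_
      have h1 := XL_le (bpt_norm θ0) x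
      have h2 : 0 < 1 + s^2 - XL (bpt θ0) x := by linarith [pow_pos hs 2]
      have := log_le_sub_one_of_pos h2
      rw [wx, ContinuousMap.smul_apply, smul_eq_mul, ContinuousMap.one_apply, Ex, log_inv]
      linarith [neg_abs_le (log A), pow_le_one₀ (n := 2) hs.le hs1]
    rw [map_smul, lD_one, smul_eq_mul] at this; linarith
  have b4 : lD (cK K β*EE w) ≤ A^2*(β - 2*K (bptB θ0) + 2*η)*((1 + s^2)*Λ) + 2*A^2*C1*π := by
    have : lD (cK K β*EE w) ≤ lD ((A^2*(β - 2*K (bptB θ0) + 2*η)) • (E*E) + (2*A^2*C1) • (1 : CB)) := by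
      refine lD_mono fun x => ?_
      rw [e2]
      simp only [cK, ContinuousMap.add_apply, ContinuousMap.sub_apply, ContinuousMap.smul_apply, smul_eq_mul, ContinuousMap.one_apply, ContinuousMap.mul_apply]
      have h1 := (abs_le.1 (c1 x)).1
      obtain ⟨h2, h3, h4⟩ := EX x
      have h5 : ((1 - XL (bpt θ0) x)*E x)^2 ≤ 1 := pow_le_one₀ (mul_nonneg h2 (E0 x).le) h4
      have h6 : (β*1 - 2*K x)*(E x*E x) ≤ (β - 2*K (bptB θ0) + 2*η + 2*(C1*(1 - XL (bpt θ0) x)^2))*(E x*E x) :=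
        mul_le_mul_of_nonneg_right (by linarith) (by have := E0 x; positivity)
      have h7 := mul_le_mul_of_nonneg_left h6 (sq_nonneg A)
      have h8 := mul_le_mul_of_nonneg_left h5 (by positivity : 0 ≤ 2*A^2*C1)
      linarith
    rw [map_add, map_smul, map_smul, lD_one, smul_eq_mul, smul_eq_mul] at this
    have h1 := mul_le_mul_of_nonneg_left q3 (by have : 0 ≤ β - 2*K (bptB θ0) + 2*η := by linarith
                                                positivity : 0 ≤ A^2*(β - 2*K (bptB θ0) + 2*η))
    linarith
  have b5 : A*(h (bptB θ0) - η)*Λ - 4*A*C2*π ≤ lS (h*EE ((1/2:ℝ) • w)) := by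
    have : lS ((A*(h (bptB θ0) - η)) • E - (2*A*C2) • (1 : CB)) ≤ lS (h*EE ((1/2:ℝ) • w)) := by
      refine lS_mono fun x => ?_
      rw [e1]
      simp only [ContinuousMap.sub_apply, ContinuousMap.smul_apply, smul_eq_mul, ContinuousMap.one_apply, ContinuousMap.mul_apply]
      have h1 := (abs_le.1 (c2 x)).1
      obtain ⟨h2, h3, h4⟩ := EX x
      have h5 : (1 - XL (bpt θ0) x)^2*E x ≤ 2 := by nlinarith [E0 x]
      have h6 := mul_le_mul_of_nonneg_left h1 (mul_pos hA (E0 x)).le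
      have h8 := mul_le_mul_of_nonneg_left h5 (by positivity : 0 ≤ A*C2)
      linarith
    rw [map_sub, map_smul, map_smul, lS_one, smul_eq_mul, smul_eq_mul] at this
    linarith
  have b1' := mul_le_mul_of_nonneg_left b1 (by positivity : 0 ≤ (1 + β) / 2)
  have b3' : -β*lD w ≤ (2 * |log A| + 4)*π := by
    have : 0 ≤ (2 * |log A| + 4)*π := by positivity
    nlinarith
  rw [Jv]
  linarith
lemma bub_ex (K h : CB) (θ0 : ℝ) (hk : K (bptB θ0) < 0) (hh : √(-K (bptB θ0)) < h (bptB θ0)) :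
    ∃ δ > 0, ∀ β, 0 < β → β ≤ δ → ∃ (v : ℂ → ℝ) (hv : ContDiff ℝ 1 v),
      Jv K h β v (cbR v hv.continuous) < -(8*π*‖h‖) ∧ 2*π < lS (EE ((1/2:ℝ) • cbR v hv.continuous)) := by
  set H := h (bptB θ0) with hH
  obtain ⟨k, hkd⟩ : ∃ k, k = -K (bptB θ0) := ⟨_, rfl⟩
  rw [← hkd] at hh
  have k0 : 0 < k := by linarith
  have H0 : 0 < H := lt_of_le_of_lt (sqrt_nonneg _) hh
  have hH2 : k < H^2 := (sqrt_lt' H0).1 hh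
  obtain ⟨A, hAd⟩ : ∃ A, A = H / k := ⟨_, rfl⟩
  have A0 : 0 < A := by rw [hAd]; positivity
  obtain ⟨c, hc⟩ : ∃ c, c = H^2 / k - 1 := ⟨_, rfl⟩
  have c0 : 0 < c := by rw [hc, sub_pos, one_lt_div k0]; exact hH2
  have key : 2 + 2*k*A^2 - 4*A*H = -2*c := by rw [hAd, hc]; field_simp; ring
  obtain ⟨η, η0, η1, η2⟩ : ∃ η : ℝ, 0 < η ∧ η ≤ 1 ∧ η*(2*A^2 + 4*A + 4) ≤ c / 4 := by
    refine ⟨min 1 (c / 4 / (2*A^2 + 4*A + 4)), by positivity, min_le_left _ _, ?_⟩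
    exact (mul_le_mul_of_nonneg_right (min_le_right _ _) (by positivity)).trans (div_mul_cancel₀ _ (by positivity)).le
  obtain ⟨C1, hC1, c1⟩ := conc K θ0 η0
  obtain ⟨C2, hC2, c2⟩ := conc h θ0 η0
  refine ⟨min 1 (c / 4 / (2 + A^2)), by positivity, fun β hβ hβδ => ?_⟩
  have β1 : β ≤ 1 := hβδ.trans (min_le_left _ _)
  have β2 : β*(2 + A^2) ≤ c / 4 :=
    (mul_le_mul_of_nonneg_right (hβδ.trans (min_le_right _ _)) (by positivity)).trans (div_mul_cancel₀ _ (by positivity)).le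
  set C0 := 8*π*(log A - log η) + (2 * |log A| + 4)*π + 2*A^2*C1*π + 16*A*C2*π with hC0
  obtain ⟨M1, hM1⟩ : ∃ M, M = 4 + A^2*(3 + 2*k) := ⟨_, rfl⟩
  have M10 : 0 < M1 := by rw [hM1]; positivity
  obtain ⟨M2, hM2⟩ : ∃ M, M = (|C0| + 8*π*‖h‖ + 1) / c + (2*π + 1) / A := ⟨_, rfl⟩
  have M20 : 0 < M2 := by rw [hM2]; positivity
  obtain ⟨s, hs⟩ : ∃ s, s = (1 + 4*M1 / c + 2*M2)⁻¹ := ⟨_, rfl⟩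
  have s0 : 0 < s := by rw [hs]; positivity
  have sm : s*(1 + 4*M1 / c + 2*M2) = 1 := by rw [hs]; exact inv_mul_cancel₀ (by positivity)
  have p1 : 0 < 4*M1 / c := by positivity
  have s1 : s ≤ 1 := by linarith [mul_pos s0 p1, mul_pos s0 M20]
  have s2 : s*M1 ≤ c / 4 := by
    have e : s*(4*M1 / c) ≤ 1 := by linarith [mul_pos s0 M20]
    rw [← mul_div_assoc, div_le_one c0] at e; linarith
  have s3 : M2 ≤ 2 / (3*s) := by
    rw [le_div_iff₀ (by positivity)]; linarith [mul_pos s0 p1, mul_pos s0 M20]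
  obtain ⟨v, hv, Λ, v1, v2, v3⟩ := bub_J K h θ0 A0 η0 c1 hC1 c2 hC2 hβ β1 hk.le s0 s1
  have Λ0 : 0 < Λ := lt_of_lt_of_le M20 (s3.trans v1)
  have Λ1 : M2 ≤ Λ := s3.trans v1
  refine ⟨v, hv, lt_of_le_of_lt v3 ?_, ?_⟩
  · have hB : (1 + s^2)*(2*(1 + β) + A^2*(β - 2*K (bptB θ0) + 2*η)) - 4*A*(H - η) + 4*η ≤ -c := by
      rw [show K (bptB θ0) = -k by rw [hkd, neg_neg]]
      have t1 : 2*(1 + β) + A^2*(β - 2*-k + 2*η) ≤ M1 := by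
        rw [hM1]; linarith [mul_le_mul_of_nonneg_left (by linarith : β - 2*-k + 2*η ≤ 3 + 2*k) (sq_nonneg A)]
      have t2 : s^2*(2*(1 + β) + A^2*(β - 2*-k + 2*η)) ≤ s*M1 :=
        (mul_le_mul_of_nonneg_left t1 (sq_nonneg s)).trans (mul_le_mul_of_nonneg_right (pow_le_of_le_one s0.le s1 two_ne_zero) M10.le)
      linarith
    have h1 := mul_le_mul_of_nonneg_right hB Λ0.le
    have h2 : |C0| + 8*π*‖h‖ + 1 ≤ c*Λ := by
      have : (|C0| + 8*π*‖h‖ + 1) / c ≤ Λ := by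
        have : 0 < (2*π + 1) / A := by positivity
        linarith
      rw [div_le_iff₀ c0] at this; linarith
    linarith [le_abs_self C0]
  · rw [v2]
    have : (2*π + 1) / A ≤ Λ := by
      have : 0 < (|C0| + 8*π*‖h‖ + 1) / c := by positivity
      linarith
    rw [div_le_iff₀ A0] at this; linarith
end PartT2
section PartT3
open Set Topology
lemma const_ex (K h : CB) {β : ℝ} (hβ1 : β ≤ 1) : ∃ (v : ℂ → ℝ) (hv : ContDiff ℝ 1 v),
    Jv K h β v (cbR v hv.continuous) < -(8*π*‖h‖) ∧ lS (EE ((1/2:ℝ) • cbR v hv.continuous)) < 2*π := by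
  obtain ⟨C, hC⟩ : ∃ C, C = 1 + ‖cK K β‖ + 16*‖h‖ := ⟨_, rfl⟩
  have C0 : 0 < C := by rw [hC]; positivity
  have hv : ContDiff ℝ 1 fun _ : ℂ => -C := contDiff_const
  set w := cbR _ hv.continuous with hw
  have ew : w = (-C) • (1 : CB) := by
    ext x; rw [hw, cbR_apply, ContinuousMap.smul_apply, ContinuousMap.one_apply, smul_eq_mul, mul_one]
  have e1 : ∀ x, EE w x ≤ 1 := fun x => by rw [EE_apply, hw, cbR_apply, exp_le_one_iff]; linarith
  have e2 : EE ((1/2:ℝ) • w) = exp (1/2*-C) • (1 : CB) := by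
    ext x; rw [EE_apply, ContinuousMap.smul_apply, ContinuousMap.smul_apply, ContinuousMap.one_apply, smul_eq_mul, smul_eq_mul, mul_one, hw, cbR_apply]
  have e3 : exp (1/2*-C) < 1 := by rw [exp_lt_one_iff]; linarith
  refine ⟨_, hv, ?_, ?_⟩
  · have g : ∀ x, gradSq (fun _ : ℂ => -C) x = 0 := fun x => by simp [gradSq, pd]
    have b1 : lD (cK K β*EE w) ≤ ‖cK K β‖*π := by
      have : lD (cK K β*EE w) ≤ lD (‖cK K β‖ • (1 : CB)) := by
        refine lD_mono fun x => ?_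
        rw [ContinuousMap.mul_apply, ContinuousMap.smul_apply, smul_eq_mul, ContinuousMap.one_apply]
        have : 0 ≤ EE w x := by rw [EE_apply]; exact (exp_pos _).le
        exact (mul_le_mul_of_nonneg_right (le_of_abs_le (cb_abs_le _ x)) this).trans (mul_le_mul_of_nonneg_left (e1 x) (norm_nonneg _))
      rwa [map_smul, lD_one, smul_eq_mul] at this
    have b2 : -‖h‖*(2*π) ≤ lS (h*EE ((1/2:ℝ) • w)) := by
      have : lS ((-‖h‖) • (1 : CB)) ≤ lS (h*EE ((1/2:ℝ) • w)) := by
        refine lS_mono fun x => ?_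
        rw [e2, ContinuousMap.mul_apply, ContinuousMap.smul_apply, ContinuousMap.smul_apply, smul_eq_mul, smul_eq_mul, ContinuousMap.one_apply, mul_one, mul_one]
        have h1 := neg_le_of_abs_le (cb_abs_le h x)
        have h2 := exp_pos (1/2*-C)
        nlinarith [norm_nonneg h]
      rwa [map_smul, lS_one, smul_eq_mul] at this
    rw [Jv, integral_congr_ae (Eventually.of_forall g), integral_zero, mul_zero, zero_add]
    have e4 : lS w = -C*(2*π) := by rw [ew, map_smul, lS_one, smul_eq_mul]
    have e5 : lD w = -C*π := by rw [ew, map_smul, lD_one, smul_eq_mul]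
    change 2*lS w - β*lD w + lD (cK K β*EE w) - 4*lS (h*EE ((1/2:ℝ) • w)) < _
    rw [e4, e5]
    have h3 : β*(C*π) ≤ 1*(C*π) := mul_le_mul_of_nonneg_right hβ1 (by positivity)
    have h4 : C*π = π + ‖cK K β‖*π + 16*‖h‖*π := by rw [hC]; ring
    have h5 : 0 ≤ ‖cK K β‖*π := by positivity
    have h6 : 0 ≤ ‖h‖*π := by positivity
    linarith [pi_pos]
  · rw [e2, map_smul, lS_one, smul_eq_mul]
    nlinarith [pi_pos]
lemma h_ext {h : ℂ → ℝ} (hh : Continuous fun θ => h (bpt θ)) : ∃ H : CB, ∀ θ, H (bptB θ) = h (bpt θ) := by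
  have per : Function.Periodic (fun θ => h (bpt θ)) (2*π) := fun θ => by beta_reduce; rw [bpt_per]
  have c1 : Continuous per.lift := continuous_coinduced_dom.2 hh
  let f : C(Circle, ℝ) := ⟨fun z => per.lift (AddCircle.homeomorphCircle'.symm z), c1.comp AddCircle.homeomorphCircle'.symm.continuous⟩
  let e : Circle → BB := fun z => ⟨z, by simp [Circle.norm_coe]⟩
  have ec : Continuous e := Continuous.subtype_mk (by fun_prop) _
  have he : IsClosedEmbedding e := ec.isClosedEmbedding fun x y hxy => Circle.ext (congrArg (fun t : BB => (t : ℂ)) hxy)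
  obtain ⟨g, hg⟩ := ContinuousMap.exists_extension he f
  refine ⟨g, fun θ => ?_⟩
  have := DFunLike.congr_fun hg (Circle.exp θ)
  have e1 : e (Circle.exp θ) = bptB θ := Subtype.ext (by change ((Circle.exp θ : Circle) : ℂ) = _; rw [Circle.coe_exp]; rfl)
  have e2 : AddCircle.homeomorphCircle'.symm (Circle.exp θ) = (θ : AddCircle (2*π)) := by
    rw [Homeomorph.symm_apply_eq]; rfl
  change g (e _) = per.lift (AddCircle.homeomorphCircle'.symm (Circle.exp θ)) at this
  rw [e1, e2] at this
  exact this
lemma lD_int (f : CB) : lD f = ∫ x in unitDisk, f (retr x) := by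
  rw [lD_apply, integral_νD _ (cb_int _ _).aestronglyMeasurable]
lemma lS_int (f : CB) : lS f = ∫ θ in 0..(2*π), f (bptB θ) := by
  rw [lS_apply, integral_νS _ (cb_int _ _).aestronglyMeasurable]
lemma one_eps (K h : ℂ → ℝ) (hK : ContDiff ℝ 2 K) (hh : ContDiff ℝ 2 (fun θ => h (bpt θ))) (Hb : CB)
    (hHb : ∀ θ, Hb (bptB θ) = h (bpt θ)) {ε : ℝ} (hε : 0 < ε) {u : CB}
    (hu : u = GG (FF (cbR K hK.continuous) Hb ε u))
    (hidx : ∀ v1 v2 : ℂ → ℝ, ContDiff ℝ 1 v1 → ContDiff ℝ 1 v2 → ∃ x y : ℝ, x^2 + y^2 = 1 ∧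
      ∀ w : CB, (∀ z : BB, w z = x*v1 z + y*v2 z) →
        0 ≤ (1 + ε)*(∫ z in unitDisk, gradSq (fun z => x*v1 z + y*v2 z) z)
          + lD (cK (cbR K hK.continuous) ε*EE u*(w*w)) - lS (Hb*EE ((1/2:ℝ) • u)*(w*w))) :
    ∃ U, IsPerturbedSolution K h ε U ∧ IndexLe K h ε U 1 := by
  obtain ⟨L, L0, hL⟩ := C1_lip (hK.of_le (by norm_num : (1 : WithTop ℕ∞) ≤ 2))
  obtain ⟨U, U2, Ue, U3, U4⟩ := sol hu (fun x y => hL x y) (by simpa only [hHb] using hh)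
  have h1 : (1 + ε) ≠ 0 := by positivity
  refine ⟨U, ⟨U2, fun x hx => ?_, fun x hx => ?_⟩, fun E hE hE1 hE2 => ?_⟩
  · rw [U3 x hx, cbR_apply, retr_val (mem_ball_zero_iff.1 hx).le, Ktil, Keps]
    field_simp; ring
  · have hx1 : ‖x‖ = 1 := mem_sphere_zero_iff_norm.1 hx
    have hb : x = bpt x.arg := by
      have := Complex.norm_mul_exp_arg_mul_I x
      rw [hx1, Complex.ofReal_one, one_mul] at this; exact this.symm
    rw [hb, U4, hHb, htil, heps, show 1 / 2*U (bpt x.arg) = U (bpt x.arg) / 2 by ring]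
    field_simp; ring
  · by_contra hcon
    push Not at hcon
    have : Nontrivial E := Module.nontrivial_of_finrank_pos (R := ℝ) (by omega)
    obtain ⟨a, ha⟩ := exists_ne (0 : E)
    obtain ⟨b, hab⟩ := exists_linearIndependent_pair_of_one_lt_finrank hcon ha
    obtain ⟨x, y, hxy, hw⟩ := hidx a b (hE1 _ a.2) (hE1 _ b.2)
    have hne : x • a + y • b ≠ 0 := fun h0 => by
      have := LinearIndependent.pair_iff.1 hab x y h0
      rw [this.1, this.2] at hxy; norm_num at hxy
    have e0 : ((x • a + y • b : E) : ℂ → ℝ) = fun z => x*(a : ℂ → ℝ) z + y*(b : ℂ → ℝ) z := by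
      ext z; rfl
    have hQ := hE2 _ (x • a + y • b).2 (fun h => hne (Subtype.ext h))
    rw [e0] at hQ
    set v : ℂ → ℝ := fun z => x*(a : ℂ → ℝ) z + y*(b : ℂ → ℝ) z with hv
    have vc : Continuous v := (continuous_const.mul (hE1 _ a.2).continuous).add (continuous_const.mul (hE1 _ b.2).continuous)
    have := hw (cbR v vc) fun z => rfl
    have eD : lD (cK (cbR K hK.continuous) ε*EE u*(cbR v vc*cbR v vc)) =
        ((1 + ε)*-2)*∫ x in unitDisk, Keps K ε x*exp (U x)*v x^2 := by
      rw [lD_int, ← integral_const_mul]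
      refine setIntegral_congr_fun (show MeasurableSet (Metric.ball (0:ℂ) 1) from Metric.isOpen_ball.measurableSet) fun z hz => ?_
      have hz1 := retr_val (mem_ball_zero_iff.1 hz).le
      simp only [ContinuousMap.mul_apply, EE_apply, cK, ContinuousMap.sub_apply, ContinuousMap.smul_apply, ContinuousMap.one_apply,
        cbR_apply, smul_eq_mul, Ue, hz1, Keps]
      field_simp; ring
    have eS : lS (Hb*EE ((1/2:ℝ) • u)*(cbR v vc*cbR v vc)) =
        (1 + ε)*bint (fun x => heps h ε x*exp (U x / 2)*v x^2) := by
      rw [lS_int, bint, ← intervalIntegral.integral_const_mul]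
      congr 1; ext θ
      have : ((bptB θ : BB) : ℂ) = bpt θ := rfl
      simp only [ContinuousMap.mul_apply, EE_apply, ContinuousMap.smul_apply, cbR_apply, smul_eq_mul, Ue, this, hHb, heps]
      rw [show 1 / 2*U (bpt θ) = U (bpt θ) / 2 by ring]
      field_simp
    rw [eD, eS] at this
    rw [Qform] at hQ
    have h2 := mul_neg_of_pos_of_neg (by positivity : 0 < 1 + ε) hQ
    linarith
end PartT3

/-- Theorem 3.1: solutions of the perturbed problems with ε_n → 0⁺ and Morse index ≤ 1. -/
theorem perturbed_solutions_pos_eps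
    (K h : ℂ → ℝ)
    (hK : ContDiff ℝ 2 K)
    (hKneg : ∀ x ∈ closedUnitDisk, K x < 0)
    (hh : ContDiff ℝ 2 (fun θ => h (bpt θ)))
    (hx0 : ∃ x₀ ∈ unitCircle, Real.sqrt (-K x₀) < h x₀) :
    ∃ (εs : ℕ → ℝ) (us : ℕ → ℂ → ℝ),
      Tendsto εs atTop (nhds 0) ∧ (∀ n, 0 < εs n) ∧
      ∀ n, IsPerturbedSolution K h (εs n) (us n) ∧ IndexLe K h (εs n) (us n) 1 := by
  obtain ⟨x0, hx, hlt⟩ := hx0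
  have hb : x0 = bpt x0.arg := by
    have := Complex.norm_mul_exp_arg_mul_I x0
    rw [mem_sphere_zero_iff_norm.1 hx, Complex.ofReal_one, one_mul] at this; exact this.symm
  obtain ⟨Hb, hHb⟩ := h_ext hh.continuous
  set Kb := cbR K hK.continuous with hKb
  have Kn : ∀ x : BB, Kb x < 0 := fun x => hKneg x x.2
  rw [hb, ← hHb] at hlt
  obtain ⟨δ, δ0, hδ⟩ := bub_ex Kb Hb x0.arg (Kn _) hlt
  have key : ∀ n : ℕ, ∃ ε : ℝ, 0 < ε ∧ ε ≤ 1 / ((n : ℝ) + 1) ∧ ∃ U, IsPerturbedSolution K h ε U ∧ IndexLe K h ε U 1 := by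
    intro n
    set β := min δ (1 / ((n : ℝ) + 1)) with hβ
    have β0 : 0 < β := lt_min δ0 (by positivity)
    have β1 : β ≤ 1 / ((n : ℝ) + 1) := min_le_right _ _
    have β2 : β ≤ 1 := β1.trans (by rw [div_le_one (by positivity)]; linarith [(Nat.cast_nonneg n : (0:ℝ) ≤ n)])
    obtain ⟨va, hva, ja, la⟩ := const_ex Kb Hb β2
    obtain ⟨vb, hvb, jb, lb⟩ := hδ β β0 (min_le_left _ _)
    obtain ⟨ε, hε, u, hu, hidx⟩ := abstract_main Kb Hb GG_green (fun x => (Kn x).le) (half_pos β0) (half_lt_self β0) va vb hva hvb ja jb la lb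
    have ε0 : 0 < ε := (half_pos β0).trans_le hε.1
    exact ⟨ε, ε0, hε.2.trans β1, one_eps K h hK hh Hb hHb ε0 hu hidx⟩
  choose εs h1 h2 us h3 using key
  exact ⟨εs, us, squeeze_zero (fun n => (h1 n).le) h2 tendsto_one_div_add_atTop_nhds_zero_nat, h1, h3⟩

end
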